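/- Let A be a commutative Noetherian ring of Krull dimension zero and let R = A[[x_1,...,x_n]] be a formal power series ring over A. Then for every ideal I of R and every integer i ≥ 0, the set of associated primes Ass_R H^i_I(R) is finite. -/

import Mathlib

section
namespace LCF

/-- Associated primes in the classical sense. -/
def AP (R : Type*) [CommRing R] (M : Type*) [AddCommGroup M] [Module R M] : Set (Ideal R) :=
  {P | P.IsPrime ∧ ∃ x : M, ∀ r, r ∈ P ↔ r • x = 0}

theorem associatedPrimes_eq_AP (R : Type*) [CommRing R] [IsNoetherianRing R] (M : Type*)
    [AddCommGroup M] [Module R M] : associatedPrimes R M = AP R M := by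
  ext P
  rw [AssociatedPrimes.mem_iff, isAssociatedPrime_iff]
  constructor
  · rintro ⟨h, x, rfl⟩
    exact ⟨h, x, fun r => by rw [Submodule.mem_colon_singleton, Submodule.mem_bot]⟩
  · rintro ⟨h, x, hx⟩
    exact ⟨h, x, by ext r; rw [hx, Submodule.mem_colon_singleton, Submodule.mem_bot]⟩

section
variable {R : Type*} [CommRing R] {M N : Type*} [AddCommGroup M] [Module R M]
  [AddCommGroup N] [Module R N]

theorem AP_mono_of_injective (f : M →ₗ[R] N) (hf : Function.Injective f) : AP R M ⊆ AP R N := by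
  rintro P ⟨h, x, hx⟩
  exact ⟨h, f x, fun r => by rw [hx, ← map_smul, map_eq_zero_iff f hf]⟩

theorem AP_congr (e : M ≃ₗ[R] N) : AP R M = AP R N :=
  Set.Subset.antisymm (AP_mono_of_injective e.toLinearMap e.injective)
    (AP_mono_of_injective e.symm.toLinearMap e.symm.injective)

theorem prime_of_finite_inf {ι : Type*} [Finite ι] (P : Ideal R) [hP : P.IsPrime] (J : ι → Ideal R)
    (h : ∀ r, r ∈ P ↔ ∀ i, r ∈ J i) : ∃ i, P = J i := by
  classical
  cases nonempty_fintype ι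
  have : P = Finset.univ.inf J := by
    ext r; rw [h]; simp [Submodule.mem_finsetInf]
  have h2 : Finset.univ.inf J ≤ P := this.ge
  obtain ⟨i, -, hi⟩ := (Ideal.IsPrime.inf_le' hP).1 h2
  exact ⟨i, le_antisymm (fun r hr => (h r).1 hr i) hi⟩

/-- Associated primes of a finite product. -/
theorem AP_pi_subset {ι : Type*} [Finite ι] (M : ι → Type*) [∀ i, AddCommGroup (M i)]
    [∀ i, Module R (M i)] : AP R (∀ i, M i) ⊆ ⋃ i, AP R (M i) := by
  rintro P ⟨h, x, hx⟩
  obtain ⟨i, hi⟩ := prime_of_finite_inf P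
    (fun i => LinearMap.ker (LinearMap.toSpanSingleton R (M i) (x i))) (fun r => by
      rw [hx]; simp [funext_iff])
  refine Set.mem_iUnion.2 ⟨i, h, x i, fun r => ?_⟩
  rw [hi]; simp

theorem AP_finite_pi {ι : Type*} [Finite ι] (M : ι → Type*) [∀ i, AddCommGroup (M i)]
    [∀ i, Module R (M i)] (h : ∀ i, (AP R (M i)).Finite) : (AP R (∀ i, M i)).Finite :=
  (Set.finite_iUnion h).subset (AP_pi_subset M)

theorem AP_subset_of_submodule (K : Submodule R M) :
    AP R M ⊆ AP R K ∪ AP R (M ⧸ K) := by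
  rintro P ⟨h, x, hx⟩
  by_cases hk : ∃ s, s ∉ P ∧ s • x ∈ K
  · obtain ⟨s, hs, hsx⟩ := hk
    left
    refine ⟨h, ⟨s • x, hsx⟩, fun r => ?_⟩
    rw [Subtype.ext_iff]
    simp only [SetLike.mk_smul_mk, ZeroMemClass.coe_zero]
    rw [smul_smul, ← hx]
    constructor
    · intro hr; exact P.mul_mem_right _ hr
    · intro hr; exact (h.mem_or_mem hr).resolve_right hs
  · right
    push Not at hk
    refine ⟨h, K.mkQ x, fun r => ?_⟩
    rw [← map_smul, Submodule.mkQ_apply, Submodule.Quotient.mk_eq_zero]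
    constructor
    · intro hr; rw [(hx r).1 hr]; exact K.zero_mem
    · intro hr; by_contra hc; exact hk r hc hr

theorem AP_finite_of_fg [IsNoetherianRing R] [Module.Finite R M] : (AP R M).Finite := by
  rw [← associatedPrimes_eq_AP]
  exact associatedPrimes.finite R M

theorem AP_nonempty [IsNoetherianRing R] [Nontrivial M] : (AP R M).Nonempty := by
  rw [← associatedPrimes_eq_AP]
  exact associatedPrimes.nonempty R M
end

section
variable {T R : Type*} [CommRing T] [CommRing R] [Algebra T R] {M : Type*} [AddCommGroup M]
  [Module R M] [Module T M] [IsScalarTower T R M]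

theorem AP_comap {P : Ideal R} (h : P ∈ AP R M) : P.comap (algebraMap T R) ∈ AP T M := by
  obtain ⟨h, x, hx⟩ := h
  refine ⟨h.comap _, x, fun r => ?_⟩
  rw [Ideal.mem_comap, hx, algebraMap_smul]

/-- If the contraction map on primes is injective, finiteness passes up. -/
theorem AP_finite_up (hT : (AP T M).Finite)
    (hinj : ∀ P Q : Ideal R, P.IsPrime → Q.IsPrime →
      P.comap (algebraMap T R) = Q.comap (algebraMap T R) → P = Q) : (AP R M).Finite := by
  refine Set.Finite.of_finite_image (f := fun P => P.comap (algebraMap T R))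
    (hT.subset ?_) ?_
  · rintro _ ⟨P, hP, rfl⟩; exact AP_comap hP
  · intro P hP Q hQ h; exact hinj P Q hP.1 hQ.1 h

theorem AP_finite_down [IsNoetherianRing R] (hR : (AP R M).Finite) : (AP T M).Finite := by
  refine (hR.image (fun P => P.comap (algebraMap T R))).subset ?_
  rintro P ⟨hP, m, hm⟩
  let ann : M → Ideal R := fun y => LinearMap.ker (LinearMap.toSpanSingleton R M y)
  have hann : ∀ y r, r ∈ ann y ↔ r • y = 0 := fun y r => by simp [ann]
  let S : Set (Ideal R) := {I | ∃ y : M, I = ann y ∧ ∀ t : T, t ∈ P ↔ t • y = 0}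
  have hne : S.Nonempty := ⟨_, m, rfl, hm⟩
  obtain ⟨I, ⟨y, rfl, hy⟩, hmax⟩ := set_has_maximal_iff_noetherian.2
    (inferInstance : IsNoetherian R R) S hne
  have hmax' : ∀ z : M, (∀ t : T, t ∈ P ↔ t • z = 0) → ann y ≤ ann z → ann z = ann y := by
    intro z hz hle
    by_contra hne
    exact hmax _ ⟨z, rfl, hz⟩ (lt_of_le_of_ne hle (Ne.symm hne))
  refine ⟨ann y, ⟨⟨?_, ?_⟩, y, hann y⟩, ?_⟩
  · rw [Ne, Ideal.eq_top_iff_one, hann, one_smul]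
    rintro rfl
    exact hP.ne_top ((Ideal.eq_top_iff_one _).2 ((hy 1).2 (smul_zero _)))
  · intro a b hab
    by_contra! hcon
    obtain ⟨ha, hb⟩ := hcon
    rw [hann] at hab
    by_cases hz : ∀ t : T, t ∈ P ↔ t • (b • y) = 0
    · have := hmax' (b • y) hz (fun r hr => by
        rw [hann] at hr ⊢; rw [smul_comm, hr, smul_zero])
      apply ha
      rw [← this, hann, smul_smul, hab]
    · push Not at hz
      obtain ⟨t, ht⟩ := hz
      rcases ht with ⟨ht1, ht2⟩ | ⟨ht1, ht2⟩
      · apply ht2; rw [smul_comm, (hy t).1 ht1, smul_zero]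
      · have := hmax' (t • y) (fun s => by
          rw [smul_smul, ← hy]
          exact ⟨fun h => P.mul_mem_right _ h, fun h => (hP.mem_or_mem h).resolve_right ht1⟩)
          (fun r hr => by rw [hann] at hr ⊢; rw [smul_comm, hr, smul_zero])
        apply hb
        rw [← this, hann, smul_comm, ht2]
  · ext t
    simp only [Ideal.mem_comap]
    rw [hann, hy, algebraMap_smul]

end

end LCF
end

section
namespace LCF

/-! ### Cohomology of sequences of modules -/
section Cx
variable {R : Type*} [Ring R] {C : ℕ → Type*} [∀ i, AddCommGroup (C i)] [∀ i, Module R (C i)]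

/-- coboundaries -/
def Bd (d : ∀ i, C i →ₗ[R] C (i + 1)) : ∀ i, Submodule R (C i)
  | 0 => ⊥
  | (i + 1) => LinearMap.range (d i)

/-- cohomology -/
abbrev Coh (d : ∀ i, C i →ₗ[R] C (i + 1)) (i : ℕ) : Type _ :=
  (LinearMap.ker (d i)) ⧸ ((Bd d i).comap (LinearMap.ker (d i)).subtype)

/-- class of a cocycle -/
def cls (d : ∀ i, C i →ₗ[R] C (i + 1)) (i : ℕ) : LinearMap.ker (d i) →ₗ[R] Coh d i :=
  Submodule.mkQ _

theorem cls_surj (d : ∀ i, C i →ₗ[R] C (i + 1)) (i : ℕ) : Function.Surjective (cls d i) :=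
  Submodule.mkQ_surjective _

theorem cls_eq_zero {d : ∀ i, C i →ₗ[R] C (i + 1)} {i : ℕ} {z : LinearMap.ker (d i)} :
    cls d i z = 0 ↔ (z : C i) ∈ Bd d i := by
  rw [cls, Submodule.mkQ_apply, Submodule.Quotient.mk_eq_zero]; rfl

variable {C' : ℕ → Type*} [∀ i, AddCommGroup (C' i)] {d : ∀ i, C i →ₗ[R] C (i + 1)}

theorem Bd_map {S : Type*} [Ring S] [∀ i, Module S (C' i)] {d' : ∀ i, C' i →ₗ[S] C' (i + 1)}
    (φ : ∀ i, C i →+ C' i) (hφ : ∀ i x, φ (i + 1) (d i x) = d' i (φ i x)) (i : ℕ) (x : C i)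
    (hx : x ∈ Bd d i) : φ i x ∈ Bd d' i := by
  cases i with
  | zero => rw [Bd, Submodule.mem_bot] at hx; subst hx; rw [map_zero]; exact zero_mem _
  | succ i => obtain ⟨y, rfl⟩ := hx; exact ⟨φ i y, (hφ i y).symm⟩

variable [∀ i, Module R (C' i)] {d' : ∀ i, C' i →ₗ[R] C' (i + 1)}

/-- induced map on cohomology -/
def mapCoh (φ : ∀ i, C i →ₗ[R] C' i) (hφ : ∀ i x, φ (i + 1) (d i x) = d' i (φ i x)) (i : ℕ) :
    Coh d i →ₗ[R] Coh d' i :=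
  Submodule.mapQ _ _ ((φ i).restrict (p := LinearMap.ker (d i)) (q := LinearMap.ker (d' i))
    (fun x hx => by rw [LinearMap.mem_ker] at hx ⊢; rw [← hφ, hx, map_zero]))
    (fun x hx => Bd_map (fun i => (φ i).toAddMonoidHom) hφ i x.1 hx)

theorem mapCoh_cls (φ : ∀ i, C i →ₗ[R] C' i) (hφ : ∀ i x, φ (i + 1) (d i x) = d' i (φ i x)) (i : ℕ)
    (z : LinearMap.ker (d i)) (w : LinearMap.ker (d' i)) (h : φ i z = w) :
    mapCoh φ hφ i (cls d i z) = cls d' i w := by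
  have : w = ⟨φ i z, by rw [h]; exact w.2⟩ := Subtype.ext h.symm
  rw [this]; rfl

theorem mapCoh_bij (φ : ∀ i, C i →ₗ[R] C' i) (hφ : ∀ i x, φ (i + 1) (d i x) = d' i (φ i x))
    (hb : ∀ i, Function.Bijective (φ i)) (i : ℕ) : Function.Bijective (mapCoh φ hφ i) := by
  constructor
  · rw [injective_iff_map_eq_zero]
    intro a
    obtain ⟨z, rfl⟩ := cls_surj _ _ a
    have hz : d' i (φ i z) = 0 := by rw [← hφ, LinearMap.mem_ker.1 z.2, map_zero]
    rw [mapCoh_cls φ hφ i z ⟨φ i z, hz⟩ rfl, cls_eq_zero, cls_eq_zero]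
    intro h
    cases i with
    | zero =>
      rw [Bd, Submodule.mem_bot] at h ⊢
      exact (hb 0).1 (by rw [map_zero]; exact h)
    | succ i =>
      obtain ⟨y, hy⟩ := h
      obtain ⟨x, rfl⟩ := (hb i).2 y
      rw [← hφ] at hy
      exact ⟨x, (hb _).1 hy⟩
  · intro a
    obtain ⟨w, rfl⟩ := cls_surj _ _ a
    obtain ⟨x, hx⟩ := (hb i).2 w
    have hz : d i x = 0 := (hb (i+1)).1 (by rw [hφ, hx, map_zero]; exact w.2)
    exact ⟨cls d i ⟨x, hz⟩, mapCoh_cls φ hφ i ⟨x, hz⟩ w hx⟩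

end Cx

/-! ### Čech complexes of presheaves on the simplex -/
section Cech
variable {ι : Type*} [DecidableEq ι]

/-- image of a multi-index -/
abbrev img {i : ℕ} (α : Fin i → ι) : Finset ι := Finset.univ.image α

theorem img_sub {i : ℕ} (α : Fin (i+1) → ι) (j : Fin (i+1)) : img (α ∘ j.succAbove) ⊆ img α := by
  intro a ha
  simp only [img, Finset.mem_image, Finset.mem_univ, true_and, Function.comp] at ha ⊢
  obtain ⟨k, hk⟩ := ha
  exact ⟨_, hk⟩

variable {R : Type*} [Ring R] (L : Finset ι → Type*) [∀ U, AddCommGroup (L U)]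

/-- unordered cochains -/
abbrev Ch (i : ℕ) : Type _ := ∀ α : Fin i → ι, L (img α)

variable {L} [∀ U, Module R (L U)]

/-- functoriality of a system of restriction maps -/
structure IsPsh (res : ∀ U V, U ⊆ V → L U →ₗ[R] L V) : Prop where
  refl : ∀ U x, res U U subset_rfl x = x
  comp : ∀ U V W (h : U ⊆ V) (h' : V ⊆ W) x, res V W h' (res U V h x) = res U W (h.trans h') x

/-- Čech differential -/
def dd (res : ∀ U V, U ⊆ V → L U →ₗ[R] L V) (i : ℕ) : Ch L i →ₗ[R] Ch L (i + 1) :=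
  LinearMap.pi fun α => ∑ j : Fin (i+1), ((-1 : ℤ) ^ (j : ℕ)) •
    (res _ _ (img_sub α j)).comp (LinearMap.proj (α ∘ j.succAbove))

theorem dd_apply (res : ∀ U V, U ⊆ V → L U →ₗ[R] L V) (i : ℕ) (s : Ch L i) (α : Fin (i+1) → ι) :
    dd res i s α = ∑ j : Fin (i+1), ((-1 : ℤ) ^ (j : ℕ)) •
      res _ _ (img_sub α j) (s (α ∘ j.succAbove)) := by
  simp [dd, LinearMap.pi_apply, LinearMap.sum_apply]

theorem res_congr (res : ∀ U V, U ⊆ V → L U →ₗ[R] L V) {i : ℕ} (s : Ch L i) {α β : Fin i → ι}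
    (h : α = β) (V : Finset ι) (hα : img α ⊆ V) (hβ : img β ⊆ V) :
    res _ V hα (s α) = res _ V hβ (s β) := by
  subst h; rfl

theorem dd_dd {res : ∀ U V, U ⊆ V → L U →ₗ[R] L V} (hres : IsPsh res) (i : ℕ) (s : Ch L i) :
    dd res (i+1) (dd res i s) = 0 := by
  funext α
  rw [dd_apply]
  simp only [dd_apply, map_sum, map_zsmul, hres.comp, Finset.smul_sum, Pi.zero_apply, smul_smul]
  rw [← Fintype.sum_prod_type' (f := fun (j : Fin (i+1+1)) (k : Fin (i+1)) => ((-1 : ℤ) ^ (j : ℕ) * (-1) ^ (k : ℕ)) •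
      res _ (img α) ((img_sub (α ∘ j.succAbove) k).trans (img_sub α j))
        (s ((α ∘ j.succAbove) ∘ k.succAbove)))]
  refine Finset.sum_involution
    (fun p _ => (p.1.succAbove p.2, p.2.predAbove p.1)) ?_ ?_ ?_ ?_
  · rintro ⟨j, k⟩ -
    have h1 : (α ∘ (j.succAbove k).succAbove) ∘ (k.predAbove j).succAbove =
        (α ∘ j.succAbove) ∘ k.succAbove := by
      funext l
      simp [Function.comp, Fin.succAbove_succAbove_succAbove_predAbove]
    rw [res_congr res s h1 (img α) _ ((img_sub (α ∘ j.succAbove) k).trans (img_sub α j))]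
    rw [← add_smul]
    have := Fin.neg_one_pow_succAbove_add_predAbove (R := ℤ) j k
    simp only
    rw [← pow_add, ← pow_add, this]; simp
  · rintro ⟨j, k⟩ - _ h
    simp only [Prod.mk.injEq] at h
    exact Fin.succAbove_ne j k h.1
  · intro _ _; simp
  · rintro ⟨j, k⟩ -
    simp [Fin.succAbove_succAbove_predAbove, Fin.predAbove_predAbove_succAbove]

section maps
variable {S : Type*} [Ring S] {L' : Finset ι → Type*} [∀ U, AddCommGroup (L' U)]
  [∀ U, Module S (L' U)]

/-- natural additive maps commute with the differential -/
theorem dd_nat {res : ∀ U V, U ⊆ V → L U →ₗ[R] L V} {res' : ∀ U V, U ⊆ V → L' U →ₗ[S] L' V}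
    (φ : ∀ U, L U →+ L' U) (hφ : ∀ U V h x, φ V (res U V h x) = res' U V h (φ U x)) (i : ℕ)
    (s : Ch L i) :
    (fun α => φ _ (dd res i s α)) = dd res' i (fun α => φ _ (s α)) := by
  funext α
  simp only [dd_apply, map_sum, map_zsmul, hφ]
end maps

theorem dd_homotopy {res : ∀ U V, U ⊆ V → L U →ₗ[R] L V} (hres : IsPsh res) (a : ι)
    (ha : ∀ U V h, V = insert a U → Function.Bijective (res U V h)) (i : ℕ) (s : Ch L i)
    (hs : dd res i s = 0) : s ∈ Bd (dd res) i := by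
  cases i with
  | zero =>
    rw [Bd, Submodule.mem_bot]
    funext α
    have h1 := congrFun hs (fun _ => a)
    rw [dd_apply, Fin.sum_univ_succ] at h1
    simp only [Finset.univ_eq_empty, Finset.sum_empty, add_zero, Fin.val_zero,
      pow_zero, one_smul, Pi.zero_apply] at h1
    rw [res_congr res s (Subsingleton.elim _ α) _ _ (by intro x hx; simp [img] at hx)] at h1
    refine (ha _ _ _ ?_).1 (h1.trans (map_zero _).symm)
    ext x; simp [img, eq_comm]
  | succ i =>
    have hc : ∀ {k : ℕ} (β : Fin k → ι),
        img (Fin.cons a β : Fin (k+1) → ι) = insert a (img β) := by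
      intro k β
      ext x; simp [img, Fin.exists_fin_succ, eq_comm]
    have hc' : ∀ {k : ℕ} (β : Fin k → ι), img β ⊆ img (Fin.cons a β : Fin (k+1) → ι) := by
      intro k β; rw [hc]; exact Finset.subset_insert _ _
    have hex : ∀ β : Fin i → ι, ∃ y : L (img β),
        res _ _ (hc' β) y = s (Fin.cons a β : Fin (i+1) → ι) := fun β => (ha _ _ _ (hc β)).2 _
    choose t ht using hex
    refine ⟨t, ?_⟩
    funext α
    refine (ha _ _ (hc' α) (hc α)).1 ?_
    have h1 := congrFun hs (Fin.cons a α : Fin (i+1+1) → ι)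
    rw [dd_apply, Fin.sum_univ_succ] at h1
    have e0 : (Fin.cons a α : Fin (i+1+1) → ι) ∘ (0 : Fin (i+1+1)).succAbove = α := by
      funext k; simp
    have e1 : ∀ j : Fin (i+1), (Fin.cons a α : Fin (i+1+1) → ι) ∘ j.succ.succAbove =
        (Fin.cons a (α ∘ j.succAbove) : Fin (i+1) → ι) := by
      intro j; funext k
      refine Fin.cases ?_ (fun k => ?_) k <;> simp
    rw [res_congr res s e0 _ _ (hc' α)] at h1
    have e2 : ∀ j : Fin (i+1), res _ _ (img_sub (Fin.cons a α : Fin (i+1+1) → ι) j.succ)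
        (s ((Fin.cons a α : Fin (i+1+1) → ι) ∘ j.succ.succAbove)) =
        res _ _ (hc' α) (res _ _ (img_sub α j) (t (α ∘ j.succAbove))) := by
      intro j
      have e3 : img (Fin.cons a (α ∘ j.succAbove) : Fin (i+1) → ι) ⊆
          img (Fin.cons a α : Fin (i+1+1) → ι) := by rw [← e1]; exact img_sub _ _
      rw [res_congr res s (e1 j) _ _ e3, ← ht, hres.comp, hres.comp]
    simp only [e2, Fin.val_zero, pow_zero, one_smul, Fin.val_succ, pow_succ, mul_neg, mul_one,
      neg_smul, Finset.sum_neg_distrib, Pi.zero_apply] at h1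
    rw [dd_apply, map_sum]
    simp only [map_zsmul]
    exact (sub_eq_zero.1 (by rw [sub_eq_add_neg]; exact h1)).symm
end Cech
end LCF
end

section
namespace LCF

theorem AP_Coh_iff {R : Type*} [CommRing R] {C : ℕ → Type*} [∀ i, AddCommGroup (C i)]
    [∀ i, Module R (C i)] (d : ∀ i, C i →ₗ[R] C (i + 1)) (i : ℕ) (P : Ideal R) :
    P ∈ AP R (Coh d i) ↔ P.IsPrime ∧ ∃ z : C i, d i z = 0 ∧ ∀ r, r ∈ P ↔ r • z ∈ Bd d i := by
  constructor
  · rintro ⟨h, x, hx⟩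
    obtain ⟨z, rfl⟩ := cls_surj _ _ x
    refine ⟨h, z, z.2, fun r => ?_⟩
    rw [hx, ← map_smul, cls_eq_zero]; rfl
  · rintro ⟨h, z, hz, hr⟩
    refine ⟨h, cls d i ⟨z, hz⟩, fun r => ?_⟩
    rw [hr, ← map_smul, cls_eq_zero]; rfl

section Model
variable {ι : Type*} [DecidableEq ι] {R : Type*} [CommRing R]

/-- product of the `f j`, `j ∈ U` -/
def gp (f : ι → R) (U : Finset ι) : R := ∏ j ∈ U, f j

omit [DecidableEq ι] in
theorem gp_dvd (f : ι → R) {U V : Finset ι} (h : U ⊆ V) : gp f U ∣ gp f V :=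
  Finset.prod_dvd_prod_of_subset _ _ _ h

variable {M : Type*} [AddCommGroup M] [Module R M] {L : Finset ι → Type*}
  [∀ U, AddCommGroup (L U)] [∀ U, Module R (L U)]

/-- A Čech system of localizations of `M`. -/
structure Model (f : ι → R) (l : ∀ U, M →ₗ[R] L U) (res : ∀ U V, U ⊆ V → L U →ₗ[R] L V) :
    Prop where
  loc : ∀ U, IsLocalizedModule (.powers (gp f U)) (l U)
  comm : ∀ U V h m, res U V h (l U m) = l V m

theorem unit_of_dvd {a b : R} (h : a ∣ b) {N : Type*} [AddCommGroup N] [Module R N]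
    (hb : IsUnit (algebraMap R (Module.End R N) b)) : IsUnit (algebraMap R (Module.End R N) a) := by
  obtain ⟨c, rfl⟩ := h
  rw [map_mul] at hb
  have hc : Commute (algebraMap R (Module.End R N) a) (algebraMap R (Module.End R N) c) :=
    Algebra.commutes _ _
  exact (hc.isUnit_mul_iff.1 hb).1

theorem unit_powers {a b : R} (h : a ∣ b) {N : Type*} [AddCommGroup N] [Module R N]
    (l : M →ₗ[R] N) [IsLocalizedModule (.powers b) l] (x : Submonoid.powers a) :
    IsUnit (algebraMap R (Module.End R N) x) := by
  obtain ⟨_, k, rfl⟩ := x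
  exact unit_of_dvd (pow_dvd_pow_of_dvd h k)
    (IsLocalizedModule.map_units l (⟨b ^ k, k, rfl⟩ : Submonoid.powers b))

/-- restriction maps for given localizations -/
noncomputable def resOf (f : ι → R) (l : ∀ U, M →ₗ[R] L U)
    [∀ U, IsLocalizedModule (.powers (gp f U)) (l U)] (U V : Finset ι) (h : U ⊆ V) :
    L U →ₗ[R] L V :=
  IsLocalizedModule.lift (.powers (gp f U)) (l U) (l V) (unit_powers (gp_dvd f h) (l V))

omit [DecidableEq ι] in
theorem resOf_model (f : ι → R) (l : ∀ U, M →ₗ[R] L U)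
    [hl : ∀ U, IsLocalizedModule (.powers (gp f U)) (l U)] : Model f l (resOf f l) where
  loc := hl
  comm U V h m := IsLocalizedModule.lift_apply _ _ _ _ _

omit [DecidableEq ι] in
theorem Model.ext_lin {f : ι → R} {l : ∀ U, M →ₗ[R] L U} {res : ∀ U V, U ⊆ V → L U →ₗ[R] L V}
    (hM : Model f l res) {M' : Type*} [AddCommGroup M'] [Module R M']
    {L' : Finset ι → Type*} [∀ U, AddCommGroup (L' U)]
    [∀ U, Module R (L' U)] {l' : ∀ U, M' →ₗ[R] L' U} {res' : ∀ U V, U ⊆ V → L' U →ₗ[R] L' V}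
    (hM' : Model f l' res') {U V : Finset ι} (h : U ⊆ V) (p q : L U →ₗ[R] L' V)
    (hpq : ∀ m, p (l U m) = q (l U m)) : p = q := by
  haveI := hM.loc
  haveI := hM'.loc
  exact IsLocalizedModule.ext (.powers (gp f U)) (l U) (unit_powers (gp_dvd f h) (l' V))
    (LinearMap.ext hpq)

omit [DecidableEq ι] in
theorem Model.isPsh {f : ι → R} {l : ∀ U, M →ₗ[R] L U} {res : ∀ U V, U ⊆ V → L U →ₗ[R] L V}
    (hM : Model f l res) : IsPsh res where
  refl U x := LinearMap.congr_fun (hM.ext_lin hM subset_rfl (res U U subset_rfl) LinearMap.id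
    (fun m => hM.comm _ _ _ _)) x
  comp U V W h h' x := LinearMap.congr_fun (hM.ext_lin hM (h.trans h')
    ((res V W h').comp (res U V h)) (res U W (h.trans h'))
    (fun m => by simp [hM.comm])) x

section map
variable {M' : Type*} [AddCommGroup M'] [Module R M']
    {L' : Finset ι → Type*} [∀ U, AddCommGroup (L' U)]
    [∀ U, Module R (L' U)] 
variable {f : ι → R} {l : ∀ U, M →ₗ[R] L U} {res : ∀ U V, U ⊆ V → L U →ₗ[R] L V}
    {l' : ∀ U, M' →ₗ[R] L' U} {res' : ∀ U V, U ⊆ V → L' U →ₗ[R] L' V}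

/-- functoriality of localizations -/
noncomputable def mapU (hM : Model f l res) (hM' : Model f l' res') (φ : M →ₗ[R] M')
    (U : Finset ι) : L U →ₗ[R] L' U :=
  haveI := hM.loc
  haveI := hM'.loc
  IsLocalizedModule.map (.powers (gp f U)) (l U) (l' U) φ

omit [DecidableEq ι] in
theorem mapU_l (hM : Model f l res) (hM' : Model f l' res') (φ : M →ₗ[R] M') (U : Finset ι) (m) :
    mapU hM hM' φ U (l U m) = l' U (φ m) := by
  haveI := hM.loc
  haveI := hM'.loc
  exact IsLocalizedModule.map_apply _ _ _ _ _

omit [DecidableEq ι] in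
theorem mapU_nat (hM : Model f l res) (hM' : Model f l' res') (φ : M →ₗ[R] M') (U V : Finset ι)
    (h : U ⊆ V) (x) : mapU hM hM' φ V (res U V h x) = res' U V h (mapU hM hM' φ U x) :=
  LinearMap.congr_fun (hM.ext_lin hM' h ((mapU hM hM' φ V).comp (res U V h))
    ((res' U V h).comp (mapU hM hM' φ U)) (fun m => by simp [mapU_l, hM.comm, hM'.comm])) x

/-- functoriality of Čech cochains -/
noncomputable def chMap (hM : Model f l res) (hM' : Model f l' res') (φ : M →ₗ[R] M') (i : ℕ) :
    Ch L i →ₗ[R] Ch L' i :=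
  LinearMap.pi fun α => (mapU hM hM' φ _).comp (LinearMap.proj α)

theorem chMap_dd (hM : Model f l res) (hM' : Model f l' res') (φ : M →ₗ[R] M') (i : ℕ) (x) :
    chMap hM hM' φ (i+1) (dd res i x) = dd res' i (chMap hM hM' φ i x) :=
  dd_nat (res := res) (res' := res') (fun U => (mapU hM hM' φ U).toAddMonoidHom)
    (mapU_nat hM hM' φ) i x

/-- functoriality of Čech cohomology -/
noncomputable def cohMap (hM : Model f l res) (hM' : Model f l' res') (φ : M →ₗ[R] M') (i : ℕ) :
    Coh (dd res) i →ₗ[R] Coh (dd res') i :=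
  mapCoh (chMap hM hM' φ) (chMap_dd hM hM' φ) i

theorem chMap_bij (hM : Model f l res) (hM' : Model f l' res') (φ : M →ₗ[R] M')
    (h : Function.Bijective φ) (i : ℕ) : Function.Bijective (chMap hM hM' φ i) := by
  haveI := hM.loc
  haveI := hM'.loc
  constructor
  · intro x y hxy
    funext α
    exact IsLocalizedModule.map_injective _ _ _ _ h.1 (congrFun hxy α)
  · intro y
    have := fun α => IsLocalizedModule.map_surjective (.powers (gp f (img α))) (l (img α))
      (l' (img α)) φ h.2 (y α)
    choose x hx using this
    exact ⟨x, funext hx⟩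

/-- Čech cohomology is independent of the model -/
noncomputable def cohEquiv (hM : Model f l res) (hM' : Model f l' res') (e : M ≃ₗ[R] M') (i : ℕ) :
    Coh (dd res) i ≃ₗ[R] Coh (dd res') i :=
  LinearEquiv.ofBijective (cohMap hM hM' e.toLinearMap i)
    (mapCoh_bij _ (chMap_dd hM hM' _) (chMap_bij hM hM' _ e.bijective) i)

theorem chMap_comp {M'' : Type*} [AddCommGroup M''] [Module R M'']
    {L'' : Finset ι → Type*} [∀ U, AddCommGroup (L'' U)] [∀ U, Module R (L'' U)]
    {l'' : ∀ U, M'' →ₗ[R] L'' U} {res'' : ∀ U V, U ⊆ V → L'' U →ₗ[R] L'' V}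
    (hM : Model f l res) (hM' : Model f l' res') (hM'' : Model f l'' res'')
    (φ : M →ₗ[R] M') (ψ : M' →ₗ[R] M'') (i : ℕ) (x) :
    chMap hM' hM'' ψ i (chMap hM hM' φ i x) = chMap hM hM'' (ψ ∘ₗ φ) i x := by
  funext α
  exact LinearMap.congr_fun (hM.ext_lin hM'' subset_rfl
    ((mapU hM' hM'' ψ _).comp (mapU hM hM' φ _)) (mapU hM hM'' (ψ ∘ₗ φ) (img α))
    (fun m => by simp [mapU_l])) (x α)

theorem chMap_id (hM : Model f l res) (i : ℕ) (x) : chMap hM hM LinearMap.id i x = x := by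
  funext α
  exact LinearMap.congr_fun (hM.ext_lin hM subset_rfl (mapU hM hM LinearMap.id (img α))
    LinearMap.id (fun m => by simp [mapU_l])) (x α)

theorem chMap_sum {J : Type*} (s : Finset J) (hM : Model f l res) (hM' : Model f l' res')
    (φ : J → M →ₗ[R] M') (i : ℕ) (x) :
    chMap hM hM' (∑ j ∈ s, φ j) i x = ∑ j ∈ s, chMap hM hM' (φ j) i x := by
  funext α
  rw [Finset.sum_apply]
  exact (LinearMap.congr_fun (hM.ext_lin hM' subset_rfl (mapU hM hM' (∑ j ∈ s, φ j) (img α))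
    (∑ j ∈ s, mapU hM hM' (φ j) (img α)) (fun m => by simp [mapU_l, LinearMap.sum_apply])) (x α)).trans
      (by rw [LinearMap.sum_apply]; rfl)

end map

/-- Retracts: if the identity of `M` factors additively through finitely many `M' j`, then the
associated primes of the Čech cohomology of `M` are among those of the `M' j`. -/
theorem AP_finite_of_retract {J : Type*} [Fintype J] {M' : J → Type*} [∀ j, AddCommGroup (M' j)]
    [∀ j, Module R (M' j)] {L' : J → Finset ι → Type*} [∀ j U, AddCommGroup (L' j U)]
    [∀ j U, Module R (L' j U)] {f : ι → R} {l : ∀ U, M →ₗ[R] L U}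
    {res : ∀ U V, U ⊆ V → L U →ₗ[R] L V}
    {l' : ∀ j U, M' j →ₗ[R] L' j U} {res' : ∀ j U V, U ⊆ V → L' j U →ₗ[R] L' j V}
    (hM : Model f l res) (hM' : ∀ j, Model f (l' j) (res' j))
    (φ : ∀ j, M →ₗ[R] M' j) (ψ : ∀ j, M' j →ₗ[R] M) (h : ∀ m, ∑ j, ψ j (φ j m) = m) (i : ℕ)
    (hfin : ∀ j, (AP R (Coh (dd (res' j)) i)).Finite) : (AP R (Coh (dd res) i)).Finite := by
  refine (AP_finite_pi _ hfin).subset (AP_mono_of_injective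
    (LinearMap.pi fun j => cohMap hM (hM' j) (φ j) i) ?_)
  rw [injective_iff_map_eq_zero]
  intro a ha
  obtain ⟨z, rfl⟩ := cls_surj _ _ a
  rw [cls_eq_zero]
  have hid : ∑ j, (ψ j) ∘ₗ (φ j) = LinearMap.id := by
    ext m; simp [LinearMap.sum_apply, h]
  rw [← chMap_id hM i z.1, ← hid, chMap_sum]
  refine Submodule.sum_mem _ fun j _ => ?_
  rw [← chMap_comp hM (hM' j) hM]
  have h1 := congrFun ha j
  have hz : dd (res' j) i (chMap hM (hM' j) (φ j) i z) = 0 := by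
    rw [← chMap_dd, LinearMap.mem_ker.1 z.2, map_zero]
  simp only [LinearMap.pi_apply, Pi.zero_apply] at h1
  rw [cohMap, mapCoh_cls _ _ _ z ⟨_, hz⟩ rfl, cls_eq_zero] at h1
  exact Bd_map (fun i => (chMap (hM' j) hM (ψ j) i).toAddMonoidHom)
    (fun i x => chMap_dd (hM' j) hM (ψ j) i x) i _ h1

end Model

section canonical
variable {ι : Type*} [DecidableEq ι] {R : Type*} [CommRing R] 

/-- canonical restriction maps -/
noncomputable abbrev cres (f : ι → R) (M : Type*) [AddCommGroup M] [Module R M] (U V : Finset ι)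
    (h : U ⊆ V) : LocalizedModule (.powers (gp f U)) M →ₗ[R] LocalizedModule (.powers (gp f V)) M :=
  resOf f (fun U => LocalizedModule.mkLinearMap (.powers (gp f U)) M) U V h

omit [DecidableEq ι] in
theorem cmodel (f : ι → R) (M : Type*) [AddCommGroup M] [Module R M] :
    Model f (fun U => LocalizedModule.mkLinearMap (.powers (gp f U)) M) (cres f M) :=
  resOf_model f _

/-- Čech cohomology -/
abbrev HC (f : ι → R) (M : Type*) [AddCommGroup M] [Module R M] (i : ℕ) :=
  Coh (dd (cres f M)) i

end canonical

section restrict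
variable {ι : Type*} [DecidableEq ι] {T R : Type*} [CommRing T] [CommRing R] [Algebra T R]
variable {M : Type*} [AddCommGroup M] [Module R M] [Module T M] [IsScalarTower T R M]
   {L : Finset ι → Type*}
  [∀ U, AddCommGroup (L U)] [∀ U, Module R (L U)] [∀ U, Module T (L U)]
  [∀ U, IsScalarTower T R (L U)]

omit [DecidableEq ι] in
theorem Model.restrict {f : ι → T} {l : ∀ U, M →ₗ[R] L U} {res : ∀ U V, U ⊆ V → L U →ₗ[R] L V}
    (hM : Model (fun j => algebraMap T R (f j)) l res) :
    Model f (fun U => (l U).restrictScalars T) (fun U V h => (res U V h).restrictScalars T) where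
  loc U := by
    haveI : IsLocalizedModule (.powers (algebraMap T R (gp f U))) (l U) := by
      have := hM.loc U
      rwa [gp, ← map_prod] at this
    exact IsLocalizedModule.restrictScalars_powers _ _
  comm := hM.comm

theorem AP_restrict (res : ∀ U V, U ⊆ V → L U →ₗ[R] L V) (i : ℕ) :
    AP T (Coh (dd (fun U V h => (res U V h).restrictScalars T)) i) = AP T (Coh (dd res) i) := by
  have hd : ∀ i (x : Ch L i), dd (fun U V h => (res U V h).restrictScalars T) i x = dd res i x := by
    intro i x; funext α; simp only [dd_apply]; rfl
  have hB : ∀ x : Ch L i, x ∈ Bd (dd (fun U V h => (res U V h).restrictScalars T)) i ↔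
      x ∈ Bd (dd res) i := by
    intro x
    cases i with
    | zero => rfl
    | succ i =>
      constructor
      · rintro ⟨y, rfl⟩; exact ⟨y, (hd _ _).symm⟩
      · rintro ⟨y, rfl⟩; exact ⟨y, (hd _ _)⟩
  ext P
  rw [AP_Coh_iff]
  constructor
  · rintro ⟨h, z, hz, hr⟩
    refine ⟨h, cls (dd res) i ⟨z, (hd _ _).symm.trans hz⟩, fun r => ?_⟩
    rw [hr, hB, ← algebraMap_smul R r (cls (dd res) i _), ← map_smul, cls_eq_zero]
    rw [← algebraMap_smul R r z]; rfl
  · rintro ⟨h, x, hx⟩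
    obtain ⟨z, rfl⟩ := cls_surj _ _ x
    refine ⟨h, z, (hd _ _).trans z.2, fun r => ?_⟩
    rw [hx, hB, ← algebraMap_smul R r (cls (dd res) i _), ← map_smul, cls_eq_zero,
      ← algebraMap_smul R r z.1]; rfl

end restrict
end LCF
end

section
namespace LCF
section
variable {R : Type*} [CommRing R] {J : Type*} [AddCommGroup J] [Module R J]

/-- elements killed by a power of `f` -/
def Gam (f : R) (J : Type*) [AddCommGroup J] [Module R J] : Submodule R J where
  carrier := {x | ∃ k : ℕ, f ^ k • x = 0}
  zero_mem' := ⟨0, by simp⟩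
  add_mem' := by
    rintro x y ⟨k, hk⟩ ⟨l, hl⟩
    refine ⟨k + l, ?_⟩
    rw [smul_add, pow_add, mul_smul, mul_smul, hl, smul_zero, add_zero, smul_comm, hk, smul_zero]
  smul_mem' := by
    rintro r x ⟨k, hk⟩
    exact ⟨k, by rw [smul_comm, hk, smul_zero]⟩

theorem mem_Gam {f : R} {x : J} : x ∈ Gam f J ↔ ∃ k : ℕ, f ^ k • x = 0 := Iff.rfl

theorem Gam_baer [IsNoetherianRing R] (hJ : Module.Baer R J) (f : R) : Module.Baer R (Gam f J) := by
  intro I g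
  classical
  obtain ⟨k, hk⟩ : ∃ k : ℕ, ∀ x : I, f ^ k • g x = 0 := by
    obtain ⟨s, hs⟩ := (isNoetherian_def.1 (inferInstance : IsNoetherian R I)) ⊤
    have h1 : ∀ x : I, ∃ k : ℕ, f ^ k • g x = 0 := fun x => by
      obtain ⟨k, hk⟩ := (g x).2
      exact ⟨k, Subtype.ext (by simpa using hk)⟩
    choose k hk using h1
    refine ⟨∑ x ∈ s, k x, fun x => ?_⟩
    have hx : x ∈ Submodule.span R (s : Set I) := by rw [hs]; trivial
    induction hx using Submodule.span_induction with
    | mem x h =>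
      rw [← Finset.add_sum_erase _ _ h, add_comm, pow_add, mul_smul, hk, smul_zero]
    | zero => simp
    | add x y _ _ h1 h2 => rw [map_add, smul_add, h1, h2, add_zero]
    | smul r x _ h1 => rw [map_smul, smul_comm, h1, smul_zero]
  obtain ⟨c, hc⟩ := Ideal.exists_pow_inf_eq_pow_smul (Ideal.span {f}) (M := R) (I : Submodule R R)
  have hAR : ∀ x, x ∈ I → (f ^ (c + k)) ∣ x → ∃ y ∈ I, x = f ^ k * y := by
    intro x hx ⟨a, ha⟩
    have h1 : x ∈ (Ideal.span {f} ^ (c+k) • ⊤ ⊓ I : Submodule R R) := by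
      refine ⟨?_, hx⟩
      rw [ha, Ideal.span_singleton_pow]
      exact Submodule.smul_mem_smul (Ideal.mem_span_singleton_self _) trivial
    rw [hc _ (by omega), Nat.add_sub_cancel_left, Ideal.span_singleton_pow,
      Submodule.ideal_span_singleton_smul] at h1
    obtain ⟨y, hy, hxy⟩ := h1
    exact ⟨y, hy.2, hxy.symm⟩
  let φ : I →ₗ[R] (R ⧸ Ideal.span {f ^ (c + k)}) :=
    (Submodule.mkQ (Ideal.span {f ^ (c + k)})).comp I.subtype
  have hφ : LinearMap.ker φ ≤ LinearMap.ker ((Gam f J).subtype.comp g) := by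
    intro x hx
    have hx' : (x : R) ∈ Ideal.span {f ^ (c + k)} := by
      have : Submodule.Quotient.mk (p := Ideal.span {f ^ (c + k)}) (x : R) = 0 := hx
      rwa [Submodule.Quotient.mk_eq_zero] at this
    obtain ⟨y, hy, hxy⟩ := hAR x x.2 (Ideal.mem_span_singleton.1 hx')
    have : x = f ^ k • (⟨y, hy⟩ : I) := Subtype.ext hxy
    rw [LinearMap.mem_ker, LinearMap.comp_apply, this, map_smul, hk]; rfl
  obtain ⟨h, hh⟩ := hJ.extension_property ((LinearMap.ker φ).liftQ φ le_rfl)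
    (by rw [← LinearMap.ker_eq_bot]; exact Submodule.ker_liftQ_eq_bot _ _ _ le_rfl)
    ((LinearMap.ker φ).liftQ ((Gam f J).subtype.comp g) hφ)
  have hmem : ∀ x : R, h (Submodule.Quotient.mk x) ∈ Gam f J := by
    intro x
    refine ⟨c + k, ?_⟩
    rw [← map_smul, ← Submodule.Quotient.mk_smul, (Submodule.Quotient.mk_eq_zero _).2, map_zero]
    exact Ideal.mem_span_singleton.2 ⟨x, rfl⟩
  refine ⟨(h.comp (Submodule.mkQ _)).codRestrict _ hmem, fun x hx => Subtype.ext ?_⟩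
  exact LinearMap.congr_fun hh (Submodule.Quotient.mk ⟨x, hx⟩)

/-- split off the torsion part -/
theorem Gam_split [IsNoetherianRing R] (hJ : Module.Baer R J) (f : R) :
    ∃ p : J →ₗ[R] Gam f J, (∀ x : Gam f J, p x = x) ∧ Module.Baer R (LinearMap.ker p) ∧
      Function.Bijective (fun x : LinearMap.ker p => f • x) := by
  obtain ⟨p, hp⟩ := (Gam_baer hJ f).extension_property (Gam f J).subtype
    Subtype.val_injective LinearMap.id
  have hp' : ∀ x : Gam f J, p x = x := fun x => LinearMap.congr_fun hp x
  have hinj : ∀ x : LinearMap.ker p, f • x = 0 → x = 0 := by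
    rintro ⟨x, hx⟩ h
    have h1 : f • x = 0 := congrArg Subtype.val h
    have h2 : p x = (⟨x, 1, by simpa using h1⟩ : Gam f J) := hp' ⟨x, 1, by simpa using h1⟩
    rw [LinearMap.mem_ker.1 hx] at h2
    exact Subtype.ext (congrArg Subtype.val h2).symm
  have hq : ∀ x : J, x - (p x : J) ∈ LinearMap.ker p := fun x => by
    rw [LinearMap.mem_ker, map_sub, hp', sub_self]
  let q : J →ₗ[R] LinearMap.ker p := (LinearMap.id - (Gam f J).subtype.comp p).codRestrict _ hq
  have hqq : ∀ x : LinearMap.ker p, q x = x := fun x => Subtype.ext (by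
    change (x : J) - (p x : J) = x
    rw [LinearMap.mem_ker.1 x.2]; simp)
  have hB : Module.Baer R (LinearMap.ker p) := by
    intro I g
    obtain ⟨h, hh⟩ := hJ I ((LinearMap.ker p).subtype.comp g)
    exact ⟨q.comp h, fun x hx => by
      rw [LinearMap.comp_apply, hh x hx]; exact hqq _⟩
  refine ⟨p, hp', hB, ?_, ?_⟩
  · intro x y hxy
    exact sub_eq_zero.1 (hinj _ (by rw [smul_sub]; exact sub_eq_zero.2 hxy))
  · intro x
    let φ : R →ₗ[R] R := LinearMap.mulLeft R f
    have hφ : LinearMap.ker φ ≤ LinearMap.ker (LinearMap.toSpanSingleton R _ x) := by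
      intro a ha
      have ha : f * a = 0 := ha
      refine hinj _ ?_
      rw [LinearMap.toSpanSingleton_apply, smul_smul, ha, zero_smul]
    obtain ⟨h, hh⟩ := hB.extension_property ((LinearMap.ker φ).liftQ φ le_rfl)
      (by rw [← LinearMap.ker_eq_bot]; exact Submodule.ker_liftQ_eq_bot _ _ _ le_rfl)
      ((LinearMap.ker φ).liftQ (LinearMap.toSpanSingleton R _ x) hφ)
    have h1 : h (f * 1) = (1 : R) • x := LinearMap.congr_fun hh (Submodule.Quotient.mk 1)
    refine ⟨h 1, ?_⟩
    rw [one_smul] at h1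
    exact (map_smul h f 1).symm.trans h1

end

section
variable {ι : Type*} [DecidableEq ι] {R : Type*} [CommRing R]

theorem loc_bij_of_bij {J N N' : Type*} [AddCommGroup J] [Module R J] [AddCommGroup N] [Module R N]
    [AddCommGroup N'] [Module R N'] (g f : R) (l : J →ₗ[R] N) (l' : J →ₗ[R] N')
    [IsLocalizedModule (.powers g) l] [IsLocalizedModule (.powers (f * g)) l']
    (hf : Function.Bijective (fun x : J => f • x)) (r : N →ₗ[R] N') (hr : ∀ m, r (l m) = l' m) :
    Function.Bijective r := by
  have hfu : IsUnit (algebraMap R (Module.End R J) f) := (Module.End.isUnit_iff _).2 hf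
  have hfk : ∀ k, Function.Bijective (fun x : J => f ^ k • x) := fun k => by
    have := (Module.End.isUnit_iff _).1 (hfu.pow k)
    rw [← map_pow] at this; exact this
  have hu : ∀ k, Function.Injective (fun x : N' => (f * g) ^ k • x) := fun k =>
    ((Module.End.isUnit_iff _).1 (IsLocalizedModule.map_units l'
      (⟨_, k, rfl⟩ : Submonoid.powers (f * g)))).1
  have hu' : ∀ k, Function.Bijective (fun x : N => g ^ k • x) := fun k =>
    ((Module.End.isUnit_iff _).1 (IsLocalizedModule.map_units l
      (⟨_, k, rfl⟩ : Submonoid.powers g)))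
  constructor
  · rw [injective_iff_map_eq_zero]
    intro a ha
    obtain ⟨⟨m, ⟨_, k, rfl⟩⟩, hm⟩ := IsLocalizedModule.surj (.powers g) l a
    have hm : g ^ k • a = l m := hm
    have h1 : l' m = 0 := by rw [← hr, ← hm, map_smul, ha, smul_zero]
    obtain ⟨⟨_, j, rfl⟩, hj⟩ := (IsLocalizedModule.eq_zero_iff (.powers (f*g)) l').1 h1
    have hj : (f * g) ^ j • m = 0 := hj
    rw [mul_pow, mul_smul] at hj
    have h2 : g ^ j • m = 0 := (hfk j).1 (by simpa using hj)
    have h3 : l m = 0 := (IsLocalizedModule.eq_zero_iff (.powers g) l).2 ⟨⟨_, j, rfl⟩, h2⟩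
    exact (hu' k).1 (by simp [hm, h3])
  · intro b
    obtain ⟨⟨m, ⟨_, k, rfl⟩⟩, hm⟩ := IsLocalizedModule.surj (.powers (f*g)) l' b
    have hm : (f * g) ^ k • b = l' m := hm
    obtain ⟨m', hm'⟩ := (hfk k).2 m
    obtain ⟨a, ha⟩ := (hu' k).2 (l m')
    refine ⟨a, hu k ?_⟩
    simp only at ha hm' ⊢
    rw [hm, mul_pow, mul_smul, ← map_smul, ha, hr, ← map_smul, hm']

theorem chMap_Bd {J J' : Type*} [AddCommGroup J] [Module R J] [AddCommGroup J'] [Module R J']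
    (f : ι → R) (φ : J →ₗ[R] J') (i : ℕ)
    (s : Ch (fun U => LocalizedModule (.powers (gp f U)) J) i) (hs : s ∈ Bd (dd (cres f J)) i) :
    chMap (cmodel f J) (cmodel f J') φ i s ∈ Bd (dd (cres f J')) i := by
  cases i with
  | zero =>
    have h0 : s = 0 := hs
    rw [h0, map_zero]; exact zero_mem _
  | succ i =>
    obtain ⟨y, hy⟩ := hs
    exact ⟨chMap (cmodel f J) (cmodel f J') φ i y, by rw [← chMap_dd, hy]⟩

/-- vanishing of Čech cohomology of injective modules -/
theorem inj_vanish [IsNoetherianRing R] (f : ι → R) (T : Finset ι) : ∀ (J : Type*) [AddCommGroup J]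
    [Module R J], Module.Baer R J → (∀ j ∉ T, ∀ x : J, ∃ k : ℕ, f j ^ k • x = 0) → ∀ (i : ℕ)
    (s : Ch (fun U => LocalizedModule (.powers (gp f U)) J) (i + 1)), dd (cres f J) (i + 1) s = 0 →
    s ∈ Bd (dd (cres f J)) (i + 1) := by
  induction T using Finset.induction_on with
  | empty =>
    intro J _ _ _ hT i s _
    convert Submodule.zero_mem _
    funext α
    have : α 0 ∈ img α := by simp [img]
    obtain ⟨c, hc⟩ : f (α 0) ∣ gp f (img α) := Finset.dvd_prod_of_mem _ this
    induction hs : s α using LocalizedModule.induction_on with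
    | h m t =>
    obtain ⟨k, hk⟩ := hT (α 0) (by simp) m
    rw [Pi.zero_apply, ← LocalizedModule.zero_mk t, LocalizedModule.mk_eq]
    refine ⟨⟨_, k, rfl⟩, ?_⟩
    have h0 : (gp f (img α)) ^ k • m = 0 := by
      rw [hc, mul_pow, mul_comm, mul_smul, hk, smul_zero]
    simp only [Submonoid.smul_def, smul_zero]
    rw [smul_comm, h0, smul_zero]
  | insert a T _ ih =>
    intro J _ _ hJ hT i s hs
    obtain ⟨p, hp, hB, hbij⟩ := Gam_split hJ (f a)
    have hq : ∀ x : J, x - (p x : J) ∈ LinearMap.ker p := fun x => by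
      rw [LinearMap.mem_ker, map_sub, hp, sub_self]
    let q : J →ₗ[R] LinearMap.ker p :=
      (LinearMap.id - (Gam (f a) J).subtype.comp p).codRestrict _ hq
    have hid : (Gam (f a) J).subtype.comp p + (LinearMap.ker p).subtype.comp q = LinearMap.id := by
      ext x; change (p x : J) + (x - (p x : J)) = x; simp
    have hsum : s = chMap (cmodel f J) (cmodel f J) ((Gam (f a) J).subtype.comp p) (i+1) s +
        chMap (cmodel f J) (cmodel f J) ((LinearMap.ker p).subtype.comp q) (i+1) s := by
      have := chMap_sum (Finset.univ : Finset (Fin 2)) (cmodel f J) (cmodel f J)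
        ![(Gam (f a) J).subtype.comp p, (LinearMap.ker p).subtype.comp q] (i+1) s
      simp only [Fin.sum_univ_two, Matrix.cons_val_zero, Matrix.cons_val_one] at this
      rw [hid, chMap_id] at this
      exact this
    rw [hsum]
    refine Submodule.add_mem _ ?_ ?_
    · rw [← chMap_comp (cmodel f J) (cmodel f _) (cmodel f J)]
      refine chMap_Bd f _ _ _ ?_
      refine ih _ (Gam_baer hJ _) ?_ _ _ (by rw [← chMap_dd, hs, map_zero])
      intro j hj x
      by_cases hja : j = a
      · subst hja
        obtain ⟨k, hk⟩ := x.2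
        exact ⟨k, Subtype.ext hk⟩
      · obtain ⟨k, hk⟩ := hT j (by simp [hj, hja]) x.1
        exact ⟨k, Subtype.ext hk⟩
    · rw [← chMap_comp (cmodel f J) (cmodel f _) (cmodel f J)]
      refine chMap_Bd f _ _ _ ?_
      refine dd_homotopy (cmodel f _).isPsh a ?_ _ _ (by rw [← chMap_dd, hs, map_zero])
      intro U V h hV
      by_cases haU : a ∈ U
      · have : V = U := by rw [hV, Finset.insert_eq_of_mem haU]
        subst this
        rw [show (cres f (LinearMap.ker p) V V h) = LinearMap.id from
          LinearMap.ext fun x => (cmodel f _).isPsh.refl V x]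
        exact Function.bijective_id
      · have e : f a * gp f U = gp f V := by rw [hV, gp, gp, Finset.prod_insert haU]
        haveI : IsLocalizedModule (.powers (f a * gp f U))
          (LocalizedModule.mkLinearMap (.powers (gp f V)) (LinearMap.ker p)) := by
          rw [e]; infer_instance
        exact loc_bij_of_bij (gp f U) (f a) (LocalizedModule.mkLinearMap _ _)
          (LocalizedModule.mkLinearMap (.powers (gp f V)) (LinearMap.ker p)) hbij _
          ((cmodel f _).comm U V h)
end
end LCF
end

section
namespace LCF
open CategoryTheory Limits Opposite

universe u
variable {R : Type u} [CommRing R]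

/-- Hom into `Y` applied to a resolution -/
noncomputable abbrev KK {X : ModuleCat.{u} R} (P : ProjectiveResolution X) (Y : ModuleCat.{u} R) :
    ChainComplex (ModuleCat.{u} R)ᵒᵖ ℕ :=
  ((((linearYoneda R (ModuleCat.{u} R)).obj Y).rightOp).mapHomologicalComplex _).obj P.complex

/-- the inclusion of cocycles -/
noncomputable abbrev jj {X : ModuleCat.{u} R} (P : ProjectiveResolution X) (Y : ModuleCat.{u} R) (n : ℕ)
   (w : ((KK P Y).opcycles n).unop) : P.complex.X n ⟶ Y := ((KK P Y).pOpcycles n).unop w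

/-- the class map -/
noncomputable abbrev qq {X : ModuleCat.{u} R} (P : ProjectiveResolution X) (Y : ModuleCat.{u} R) (n : ℕ)
   (w : ((KK P Y).opcycles n).unop) : (((Ext R (ModuleCat.{u} R) n).obj (op X)).obj Y) :=
  (P.isoLeftDerivedObj (((linearYoneda R (ModuleCat.{u} R)).obj Y).rightOp) n).hom.unop
    (((KK P Y).homologyι n).unop w)

/-- the cocycle `c` represents the class `e` -/
def Rep {X : ModuleCat.{u} R} (P : ProjectiveResolution X) (Y : ModuleCat.{u} R) (n : ℕ)
    (c : P.complex.X n ⟶ Y) (e : (((Ext R (ModuleCat.{u} R) n).obj (op X)).obj Y)) : Prop :=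
  ∃ w, jj P Y n w = c ∧ qq P Y n w = e

variable {X : ModuleCat.{u} R} (P : ProjectiveResolution X) (Y : ModuleCat.{u} R) (n : ℕ)

theorem rep_smul (r : R) {c e} (h : Rep P Y n c e) : Rep P Y n (r • c) (r • e) := by
  obtain ⟨w, rfl, rfl⟩ := h
  refine ⟨r • w, ?_, ?_⟩
  · exact map_smul ((KK P Y).pOpcycles n).unop.hom r w
  · let κ : ((KK P Y).homology n).unop →ₗ[R] (((Ext R (ModuleCat.{u} R) n).obj (op X)).obj Y) :=
      (P.isoLeftDerivedObj (((linearYoneda R (ModuleCat.{u} R)).obj Y).rightOp) n).hom.unop.hom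
    let ν := ((KK P Y).homologyι n).unop.hom
    change κ (ν (r • w)) = r • κ (ν w)
    rw [map_smul, map_smul]

theorem rep_cocycle {c e} (h : Rep P Y n c e) : P.complex.d (n+1) n ≫ c = 0 := by
  obtain ⟨w, rfl, rfl⟩ := h
  have h1 := congrArg Quiver.Hom.unop ((KK P Y).d_pOpcycles (n+1) n)
  have h2 := LinearMap.congr_fun (congrArg ModuleCat.Hom.hom h1) w
  exact h2

theorem rep_exists (e) : ∃ c, Rep P Y n c e := by
  have h1 : Epi ((KK P Y).homologyι n).unop := inferInstance
  rw [ModuleCat.epi_iff_surjective] at h1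
  have h2 : Epi (P.isoLeftDerivedObj (((linearYoneda R (ModuleCat.{u} R)).obj Y).rightOp) n).hom.unop :=
    inferInstance
  rw [ModuleCat.epi_iff_surjective] at h2
  obtain ⟨a, ha⟩ := h2 e
  obtain ⟨w, hw⟩ := h1 a
  exact ⟨_, w, rfl, by simp only [qq]; rw [hw]; exact ha⟩

theorem rep_of_cocycle (c : P.complex.X n ⟶ Y) (hc : P.complex.d (n+1) n ≫ c = 0) :
    ∃ e, Rep P Y n c e := by
  have h1 := (ShortComplex.exact_of_g_is_cokernel (ShortComplex.mk _ _ ((KK P Y).d_pOpcycles (n+1) n))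
    ((KK P Y).opcyclesIsCokernel (n+1) n (by simp))).unop
  rw [ShortComplex.moduleCat_exact_iff] at h1
  obtain ⟨w, hw⟩ := h1 c hc
  exact ⟨_, w, hw, rfl⟩

theorem rep_zero_iff {c e} (h : Rep P Y n c e) : e = 0 ↔
    ∃ b : P.complex.X ((ComplexShape.down ℕ).next n) ⟶ Y, c = P.complex.d n _ ≫ b := by
  obtain ⟨w, rfl, rfl⟩ := h
  have h1 := (ShortComplex.exact_of_f_is_kernel (ShortComplex.mk _ _
    ((KK P Y).homologyι_comp_fromOpcycles n ((ComplexShape.down ℕ).next n)))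
    ((KK P Y).homologyIsKernel n _ rfl)).unop
  rw [ShortComplex.moduleCat_exact_iff] at h1
  have h2 : Mono (P.isoLeftDerivedObj (((linearYoneda R (ModuleCat.{u} R)).obj Y).rightOp) n).hom.unop :=
    inferInstance
  rw [ModuleCat.mono_iff_injective] at h2
  have h3 : Mono ((KK P Y).pOpcycles n).unop := inferInstance
  rw [ModuleCat.mono_iff_injective] at h3
  have h4 : ∀ b : P.complex.X ((ComplexShape.down ℕ).next n) ⟶ Y,
      ((KK P Y).pOpcycles n).unop (((KK P Y).fromOpcycles n _).unop b) = P.complex.d n _ ≫ b := by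
    intro b
    have h1 := congrArg Quiver.Hom.unop ((KK P Y).p_fromOpcycles n ((ComplexShape.down ℕ).next n))
    exact LinearMap.congr_fun (congrArg ModuleCat.Hom.hom h1) b
  constructor
  · intro h
    have h5 : ((KK P Y).homologyι n).unop w = 0 := h2 (h.trans
      (map_zero (P.isoLeftDerivedObj (((linearYoneda R (ModuleCat.{u} R)).obj Y).rightOp) n).hom.unop.hom).symm)
    obtain ⟨b, hb⟩ := h1 w h5
    refine ⟨b, ?_⟩
    refine Eq.trans ?_ (h4 b)
    exact congrArg ((KK P Y).pOpcycles n).unop hb.symm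
  · rintro ⟨b, hb⟩
    have h5 : w = ((KK P Y).fromOpcycles n _).unop b := h3 (hb.trans (h4 b).symm)
    have h6 := congrArg Quiver.Hom.unop
      ((KK P Y).homologyι_comp_fromOpcycles n ((ComplexShape.down ℕ).next n))
    have h7 : ((KK P Y).homologyι n).unop (((KK P Y).fromOpcycles n _).unop b) = 0 :=
      LinearMap.congr_fun (congrArg ModuleCat.Hom.hom h6) b
    rw [h5]
    refine Eq.trans (congrArg
      (P.isoLeftDerivedObj (((linearYoneda R (ModuleCat.{u} R)).obj Y).rightOp) n).hom.unop.hom h7) ?_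
    exact map_zero (P.isoLeftDerivedObj (((linearYoneda R (ModuleCat.{u} R)).obj Y).rightOp) n).hom.unop.hom

theorem rep_map {X' : ModuleCat.{u} R} (P' : ProjectiveResolution X') (f : X' ⟶ X)
    (φ : P'.complex ⟶ P.complex) (comm : φ.f 0 ≫ P.π.f 0 = P'.π.f 0 ≫ f) {c e}
    (h : Rep P Y n c e) :
    Rep P' Y n (φ.f n ≫ c) (((Ext R (ModuleCat.{u} R) n).map f.op).app Y e) := by
  obtain ⟨w, rfl, rfl⟩ := h
  let F := ((linearYoneda R (ModuleCat.{u} R)).obj Y).rightOp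
  let φ' := (F.mapHomologicalComplex (ComplexShape.down ℕ)).map φ
  refine ⟨(HomologicalComplex.opcyclesMap φ' n).unop w, ?_, ?_⟩
  · have h1 := congrArg Quiver.Hom.unop (HomologicalComplex.p_opcyclesMap φ' n)
    exact LinearMap.congr_fun (congrArg ModuleCat.Hom.hom h1) w
  · have h1 := congrArg Quiver.Hom.unop (HomologicalComplex.homologyι_naturality φ' n)
    have h1' := LinearMap.congr_fun (congrArg ModuleCat.Hom.hom h1) w
    have h2 := congrArg Quiver.Hom.unop
      (ProjectiveResolution.isoLeftDerivedObj_hom_naturality f P' P φ comm F n)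
    have h2' := LinearMap.congr_fun (congrArg ModuleCat.Hom.hom h2) (((KK P Y).homologyι n).unop w)
    refine Eq.trans ?_ h2'.symm
    exact congrArg (P'.isoLeftDerivedObj F n).hom.unop h1'.symm
end LCF
end

section
namespace LCF
open CategoryTheory Limits Opposite

universe u
variable {R : Type u} [CommRing R]

/-- the modules `R/I^t` -/
abbrev XX (I : Ideal R) (t : ℕ) : ModuleCat.{u} R := ModuleCat.of R (R ⧸ I ^ t)

/-- the projection `R/I^t' → R/I^t` -/
def pr (I : Ideal R) {t t' : ℕ} (h : t ≤ t') : XX I t' ⟶ XX I t :=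
  ModuleCat.ofHom <| Submodule.mapQ _ _ LinearMap.id (Ideal.pow_le_pow_right h)

/-- chosen resolutions -/
noncomputable abbrev PP (I : Ideal R) (t : ℕ) : ProjectiveResolution (XX I t) :=
  projectiveResolution _

/-- chosen lifts -/
noncomputable abbrev LL (I : Ideal R) {t t' : ℕ} (h : t ≤ t') : (PP I t').complex ⟶ (PP I t).complex :=
  ProjectiveResolution.lift (pr I h) (PP I t') (PP I t)

theorem lc_desc (I : Ideal R) (n : ℕ) (M : ModuleCat.{u} R) (x : (localCohomology I n).obj M) :
    ∃ (t : ℕ) (c : (PP I t).complex.X n ⟶ M), (PP I t).complex.d (n+1) n ≫ c = 0 ∧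
      ∀ r : R, r • x = 0 ↔ ∃ (t' : ℕ) (h : t ≤ t')
        (b : (PP I t').complex.X ((ComplexShape.down ℕ).next n) ⟶ M),
        r • ((LL I h).f n ≫ c) = (PP I t').complex.d n _ ≫ b := by
  let D := localCohomology.diagram (localCohomology.idealPowersDiagram I) n
  haveI : HasColimit D := localCohomology.hasColimitDiagram.{u, 0} _ n
  have hcol := isColimitOfPreserves ((evaluation _ _).obj M) (colimit.isColimit D)
  haveI : IsFiltered (ℕᵒᵖ)ᵒᵖ := inferInstance
  haveI : PreservesFilteredColimitsOfSize.{0, 0} (forget (ModuleCat.{u} R)) :=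
    preservesFilteredColimitsOfSize_shrink.{0, u, 0, u} _
  have hex := Concrete.isColimit_exists_rep _ hcol x
  obtain ⟨j, e, he⟩ := hex
  obtain ⟨j⟩ := j
  obtain ⟨t⟩ := j
  obtain ⟨c, hc⟩ := rep_exists (PP I t) M n e
  refine ⟨t, c, rep_cocycle _ _ _ hc, fun r => ?_⟩
  have hz := Concrete.isColimit_rep_eq_iff_exists _ hcol (i := op (op t)) (j := op (op t)) (r • e) 0
  have e1 : r • x = (((evaluation _ _).obj M).mapCocone (colimit.cocone D)).ι.app (op (op t)) (r • e) := by
    rw [← he]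
    exact (map_smul ((((evaluation _ _).obj M).mapCocone (colimit.cocone D)).ι.app (op (op t))).hom
      r e).symm
  have e2 : (((evaluation _ _).obj M).mapCocone (colimit.cocone D)).ι.app (op (op t)) (0 : ((D ⋙ (evaluation _ _).obj M).obj (op (op t)))) = 0 :=
    map_zero ((((evaluation _ _).obj M).mapCocone (colimit.cocone D)).ι.app (op (op t))).hom
  have hc' := rep_smul _ _ _ r hc
  have key : ∀ (t' : ℕ) (h : t ≤ t') (g : op (op t) ⟶ op (op t')), (D ⋙ (evaluation _ _).obj M).map g (r • e) = 0 ↔ 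
      ∃ (b : (PP I t').complex.X ((ComplexShape.down ℕ).next n) ⟶ M),
        r • ((LL I h).f n ≫ c) = (PP I t').complex.d n _ ≫ b := by
    intro t' h g
    have h1 := rep_map (PP I t) M n (PP I t') (pr I h) (LL I h)
      (ProjectiveResolution.lift_commutes_zero _ _ _) hc'
    have h2 := rep_zero_iff _ _ _ h1
    rw [Linear.comp_smul] at h2
    exact h2
  refine Iff.trans ⟨fun h => e1.symm.trans (h.trans e2.symm), fun h => e1.trans (Eq.trans h e2)⟩
    (hz.trans ?_)
  constructor
  · rintro ⟨⟨⟨t'⟩⟩, g, g', h⟩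
    have hle : t ≤ t' := leOfHom g.unop.unop
    have h0 : (D ⋙ (evaluation _ _).obj M).map g' 0 = 0 :=
      map_zero ((D ⋙ (evaluation _ _).obj M).map g').hom
    exact ⟨t', hle, (key t' hle g).1 (h.trans h0)⟩
  · rintro ⟨t', hle, hb⟩
    refine ⟨op (op t'), (homOfLE hle).op.op, (homOfLE hle).op.op, ?_⟩
    refine ((key t' hle _).2 hb).trans ?_
    exact (map_zero ((D ⋙ (evaluation _ _).obj M).map (homOfLE hle).op.op).hom).symm
end LCF
end

section
namespace LCF
open CategoryTheory Limits Opposite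

universe u
variable {R : Type u} [CommRing R]

/-- the predicate `S` on `R` is the annihilator of a class in `H^n_I(M)` -/
def DD (I : Ideal R) (n : ℕ) (M : ModuleCat.{u} R) (S : R → Prop) : Prop :=
  ∃ (t : ℕ) (c : (PP I t).complex.X n ⟶ M), (PP I t).complex.d (n+1) n ≫ c = 0 ∧
      ∀ r : R, S r ↔ ∃ (t' : ℕ) (h : t ≤ t')
        (b : (PP I t').complex.X ((ComplexShape.down ℕ).next n) ⟶ M),
        r • ((LL I h).f n ≫ c) = (PP I t').complex.d n _ ≫ b

variable {I : Ideal R}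

/-- the augmentation -/
noncomputable def pi0 {X : ModuleCat.{u} R} (P : ProjectiveResolution X) : P.complex.X 0 ⟶ X := P.π.f 0

instance pi0_epi {X : ModuleCat.{u} R} (P : ProjectiveResolution X) : Epi (pi0 P) :=
  inferInstanceAs (Epi (P.π.f 0))

theorem d_pi0 {X : ModuleCat.{u} R} (P : ProjectiveResolution X) : P.complex.d 1 0 ≫ pi0 P = 0 :=
  P.complex_d_comp_π_f_zero

theorem factor0 {X : ModuleCat.{u} R} (P : ProjectiveResolution X) {M : ModuleCat.{u} R}
    (c : P.complex.X 0 ⟶ M) (hc : P.complex.d 1 0 ≫ c = 0) : ∃ m : X ⟶ M, c = pi0 P ≫ m := by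
  have hx := P.exact₀
  haveI : Epi (ShortComplex.mk _ _ P.complex_d_comp_π_f_zero).g := inferInstanceAs (Epi (P.π.f 0))
  exact ⟨hx.desc c hc, (hx.g_desc c hc).symm⟩

theorem factorInj {X : ModuleCat.{u} R} (P : ProjectiveResolution X) {J : ModuleCat.{u} R} [Injective J]
    {n : ℕ} (c : P.complex.X (n+1) ⟶ J) (hc : P.complex.d (n+2) (n+1) ≫ c = 0) :
    ∃ b, c = P.complex.d (n+1) n ≫ b := by
  have := P.exact_succ n
  exact ⟨this.descToInjective c hc, (this.comp_descToInjective c hc).symm⟩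

theorem XX_hom_ext {t : ℕ} {M : ModuleCat.{u} R} {a b : XX I t ⟶ M}
    (h : a (Submodule.Quotient.mk 1) = b (Submodule.Quotient.mk 1)) : a = b := by
  ext
  exact h

theorem XX_hom_mk {t : ℕ} {M : ModuleCat.{u} R} (y : M) (hy : ∀ a ∈ I ^ t, a • y = 0) :
    ∃ a : XX I t ⟶ M, a (Submodule.Quotient.mk 1) = y := by
  refine ⟨ModuleCat.ofHom (Submodule.liftQ _ (LinearMap.toSpanSingleton R M y) fun a ha => ?_), ?_⟩
  · exact hy a ha
  · change (1 : R) • y = y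
    simp

theorem XX_hom_kill {t : ℕ} {M : ModuleCat.{u} R} (m : XX I t ⟶ M) (a : R) (ha : a ∈ I ^ t) :
    a • m (Submodule.Quotient.mk 1) = 0 := by
  have h1 : a • (Submodule.Quotient.mk 1 : R ⧸ I ^ t) = 0 := by
    rw [← Submodule.Quotient.mk_smul, Submodule.Quotient.mk_eq_zero]
    simpa using ha
  have := map_smul m.hom a (Submodule.Quotient.mk 1)
  exact this.symm.trans ((congrArg m.hom h1).trans (map_zero _))

theorem LL0 {t t' : ℕ} (h : t ≤ t') : (LL I h).f 0 ≫ pi0 (PP I t) = pi0 (PP I t') ≫ pr I h :=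
  ProjectiveResolution.lift_commutes_zero _ _ _

theorem LL0m {t t' : ℕ} (h : t ≤ t') {M : ModuleCat.{u} R} (m : XX I t ⟶ M) :
   (LL I h).f 0 ≫ pi0 (PP I t) ≫ m = pi0 (PP I t') ≫ pr I h ≫ m := by
  have := congrArg (fun z => z ≫ m) (LL0 (I := I) h)
  simpa only [Category.assoc] using this

theorem DD_zero {M : ModuleCat.{u} R} {S : R → Prop} (h : DD I 0 M S) :
    ∃ (y : M) (t : ℕ), (∀ a ∈ I ^ t, a • y = 0) ∧ ∀ r, S r ↔ r • y = 0 := by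
  obtain ⟨t, c, hc, hS⟩ := h
  obtain ⟨m, rfl⟩ := factor0 (PP I t) c hc
  refine ⟨m (Submodule.Quotient.mk 1), t, XX_hom_kill m, fun r => ?_⟩
  rw [hS]
  have hd : ∀ t', (PP I t').complex.d 0 ((ComplexShape.down ℕ).next 0) = 0 := fun t' =>
    (PP I t').complex.shape _ _ (by simp)
  have key : ∀ (t' : ℕ) (h : t ≤ t'), r • ((LL I h).f 0 ≫ pi0 (PP I t) ≫ m) =
      0 ↔ r • m (Submodule.Quotient.mk 1) = 0 := by
    intro t' h
    rw [LL0m, ← Linear.comp_smul]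
    constructor
    · intro h0
      have h1 : r • (pr I h ≫ m) = 0 := by
        rw [← cancel_epi (pi0 (PP I t')), h0, comp_zero]
      exact LinearMap.congr_fun (congrArg ModuleCat.Hom.hom h1) (Submodule.Quotient.mk 1)
    · intro h0
      have h1 : r • (pr I h ≫ m) = 0 := XX_hom_ext h0
      rw [h1, comp_zero]
  constructor
  · rintro ⟨t', h, b, hb⟩
    rw [hd, zero_comp] at hb
    exact (key t' h).1 hb
  · intro h
    refine ⟨t, le_rfl, 0, ?_⟩
    rw [comp_zero]
    exact (key t le_rfl).2 h

variable {M J M' : ModuleCat.{u} R} {i : M ⟶ J} {π : J ⟶ M'} [Mono i] [Epi π] [Injective J]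
  (w : i ≫ π = 0) (hex : (ShortComplex.mk i π w).Exact)

include hex in
theorem liftM {A : ModuleCat.{u} R} (g : A ⟶ J) (hg : g ≫ π = 0) : ∃ e : A ⟶ M, e ≫ i = g := by
  haveI : Mono (ShortComplex.mk i π w).f := ‹_›
  exact ⟨hex.lift g hg, hex.lift_f g hg⟩

theorem DD_split {S : R → Prop} {n : ℕ} (h : DD I (n+1) M S) :
    ∃ (t : ℕ) (c : (PP I t).complex.X (n+1) ⟶ M) (b : (PP I t).complex.X n ⟶ J),
      c ≫ i = (PP I t).complex.d (n+1) n ≫ b ∧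
      ∀ r : R, S r ↔ ∃ (t' : ℕ) (h : t ≤ t')
        (b : (PP I t').complex.X n ⟶ M),
        r • ((LL I h).f (n+1) ≫ c) = (PP I t').complex.d (n+1) n ≫ b := by
  obtain ⟨t, c, hc, hS⟩ := h
  obtain ⟨b, hb⟩ := factorInj (PP I t) (c ≫ i) (by rw [← Category.assoc, hc, zero_comp])
  have hn : (ComplexShape.down ℕ).next (n+1) = n := (ComplexShape.down ℕ).next_eq' (by simp)
  rw [hn] at hS
  exact ⟨t, c, b, hb, hS⟩

include hex in
theorem DD_one {S : R → Prop} (h : DD I 1 M S) :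
    ∃ (y' : M') (t : ℕ), (∀ a ∈ I ^ t, a • y' = 0) ∧
      ∀ r, S r ↔ ∃ (y : J) (t : ℕ), (∀ a ∈ I ^ t, a • y = 0) ∧ r • y' = π y := by
  obtain ⟨t, c, b, hb, hS⟩ := DD_split (J := J) (i := i) h
  obtain ⟨m', hm'⟩ := factor0 (PP I t) (b ≫ π) (by
    rw [← Category.assoc, ← hb, Category.assoc, w, comp_zero])
  refine ⟨m' (Submodule.Quotient.mk 1), t, XX_hom_kill m', fun r => ?_⟩
  rw [hS]
  constructor
  · rintro ⟨t', h, e, he⟩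
    obtain ⟨m, hm⟩ := factor0 (PP I t') (r • ((LL I h).f 0 ≫ b) - e ≫ i) (by
      rw [Preadditive.comp_sub, Linear.comp_smul, ← Category.assoc, ← (LL I h).comm, Category.assoc,
        ← hb, ← Category.assoc, ← Category.assoc, ← he, Linear.smul_comp, sub_self])
    refine ⟨m (Submodule.Quotient.mk 1), t', XX_hom_kill m, ?_⟩
    have h1 : r • (pr I h ≫ m') = m ≫ π := by
      rw [← cancel_epi (pi0 (PP I t')), Linear.comp_smul, ← LL0m, ← hm', ← Category.assoc, ← Category.assoc, ← hm,
        Preadditive.sub_comp, Category.assoc e, w, comp_zero, sub_zero, Linear.smul_comp,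
        Category.assoc]
    exact LinearMap.congr_fun (congrArg ModuleCat.Hom.hom h1) (Submodule.Quotient.mk 1)
  · rintro ⟨y, t₀, hy, hry⟩
    let t' := max t t₀
    have h : t ≤ t' := le_max_left _ _
    obtain ⟨m, hm⟩ := XX_hom_mk (I := I) (t := t') y
      (fun a ha => hy a (Ideal.pow_le_pow_right (le_max_right _ _) ha))
    have h1 : r • (pr I h ≫ m') = m ≫ π := by
      refine XX_hom_ext ?_
      exact Eq.trans hry (congrArg π hm.symm)
    obtain ⟨e, he⟩ := liftM w hex (r • ((LL I h).f 0 ≫ b) - pi0 (PP I t') ≫ m) (by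
      rw [Preadditive.sub_comp, Linear.smul_comp, Category.assoc, hm', LL0m, ← Linear.comp_smul, h1,
        Category.assoc, sub_self])
    refine ⟨t', h, e, ?_⟩
    rw [← cancel_mono i, Category.assoc, he, Preadditive.comp_sub, Linear.comp_smul,
      ← Category.assoc, ← (LL I h).comm, Category.assoc, ← hb, Linear.smul_comp, Category.assoc,
      ← Category.assoc ((PP I t').complex.d 1 0)]
    rw [d_pi0, zero_comp, sub_zero]

include hex in
theorem DD_succ {S : R → Prop} {n : ℕ} (h : DD I (n+2) M S) : DD I (n+1) M' S := by
  obtain ⟨t, c, b, hb, hS⟩ := DD_split (J := J) (i := i) h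
  have hn : (ComplexShape.down ℕ).next (n+1) = n := (ComplexShape.down ℕ).next_eq' (by simp)
  refine ⟨t, b ≫ π, ?_, ?_⟩
  · rw [← Category.assoc, ← hb, Category.assoc, w, comp_zero]
  rw [hn]
  intro r
  rw [hS]
  constructor
  · rintro ⟨t', h, e, he⟩
    obtain ⟨m, hm⟩ := factorInj (PP I t') (r • ((LL I h).f (n+1) ≫ b) - e ≫ i) (by
      rw [Preadditive.comp_sub, Linear.comp_smul, ← Category.assoc, ← (LL I h).comm, Category.assoc,
        ← hb, ← Category.assoc, ← Category.assoc, ← he, Linear.smul_comp, sub_self])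
    refine ⟨t', h, m ≫ π, ?_⟩
    rw [← Category.assoc, ← Category.assoc, ← hm, Preadditive.sub_comp, Category.assoc e, w, comp_zero, sub_zero,
      Linear.smul_comp, Category.assoc]
  · rintro ⟨t', h, e', he'⟩
    haveI : Projective ((PP I t').complex.X n) := (PP I t').projective n
    obtain ⟨e0, rfl⟩ : ∃ e0, e' = e0 ≫ π := ⟨Projective.factorThru e' π, by simp⟩
    obtain ⟨e, he⟩ := liftM w hex (r • ((LL I h).f (n+1) ≫ b) - (PP I t').complex.d (n+1) n ≫ e0) (by
      rw [Preadditive.sub_comp, Linear.smul_comp, Category.assoc, he', Category.assoc, sub_self])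
    refine ⟨t', h, e, ?_⟩
    rw [← cancel_mono i, Category.assoc, he, Preadditive.comp_sub, Linear.comp_smul,
      ← Category.assoc, ← (LL I h).comm, Category.assoc, ← hb, Linear.smul_comp, Category.assoc,
      ← Category.assoc ((PP I t').complex.d _ _)]
    simp
end LCF
end

section
namespace LCF
open CategoryTheory Limits Opposite

universe u
section cech
variable {ι : Type*} [DecidableEq ι] {R : Type*} [CommRing R] (f : ι → R)

/-- degree zero cochain of an element -/
noncomputable def c0 {M : Type*} [AddCommGroup M] [Module R M] (m : M) :
    Ch (fun U => LocalizedModule (.powers (gp f U)) M) 0 :=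
  fun α => LocalizedModule.mkLinearMap (.powers (gp f (img α))) M m

theorem c0_smul {M : Type*} [AddCommGroup M] [Module R M] (r : R) (m : M) :
    c0 f (r • m) = r • c0 f m := by
  funext α; exact map_smul _ _ _

theorem c0_bij {M : Type*} [AddCommGroup M] [Module R M] :
    Function.Bijective (c0 f : M → _) := by
  have hg : ∀ α : Fin 0 → ι, gp f (img α) = 1 := by
    intro α; simp [gp, img]
  constructor
  · intro a b h
    have h1 := congrFun h Fin.elim0
    have h2 := (IsLocalizedModule.eq_iff_exists (.powers (gp f (img (Fin.elim0 : Fin 0 → ι))))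
      (LocalizedModule.mkLinearMap _ M)).1 h1
    obtain ⟨⟨_, k, rfl⟩, hc⟩ := h2
    simpa [hg, Submonoid.smul_def] using hc
  · intro s
    obtain ⟨⟨m, ⟨_, k, rfl⟩⟩, hm⟩ := IsLocalizedModule.surj (.powers (gp f (img (Fin.elim0 : Fin 0 → ι))))
      (LocalizedModule.mkLinearMap _ M) (s Fin.elim0)
    refine ⟨m, ?_⟩
    funext α
    obtain rfl : α = Fin.elim0 := Subsingleton.elim _ _
    rw [c0, ← hm]
    simp [hg, Submonoid.smul_def]

theorem c0_chMap {M N : Type*} [AddCommGroup M] [Module R M] [AddCommGroup N] [Module R N]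
    (φ : M →ₗ[R] N) (m : M) : chMap (cmodel f M) (cmodel f N) φ 0 (c0 f m) = c0 f (φ m) := by
  funext α
  exact mapU_l (cmodel f M) (cmodel f N) φ _ _

theorem c0_cocycle [Finite ι] {M : Type*} [AddCommGroup M] [Module R M] (I : Ideal R)
    (hI : I = Ideal.span (Set.range f)) (m : M) :
    dd (cres f M) 0 (c0 f m) = 0 ↔ ∃ t, ∀ a ∈ I ^ t, a • m = 0 := by
  have h1 : dd (cres f M) 0 (c0 f m) = 0 ↔ ∀ j : ι, ∃ k : ℕ, f j ^ k • m = 0 := by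
    have key : ∀ α : Fin 1 → ι, dd (cres f M) 0 (c0 f m) α = 0 ↔ ∃ k : ℕ, f (α 0) ^ k • m = 0 := by
      intro α
      rw [dd_apply, Fin.sum_univ_succ]
      simp only [Finset.univ_eq_empty, Finset.sum_empty, add_zero, Fin.val_zero,
        pow_zero, one_smul, c0]
      rw [(cmodel f M).comm, IsLocalizedModule.eq_zero_iff (.powers (gp f (img α)))]
      have hg : gp f (img α) = f (α 0) := by simp [gp, img]
      rw [hg]
      constructor
      · rintro ⟨⟨_, k, rfl⟩, hk⟩; exact ⟨k, hk⟩
      · rintro ⟨k, hk⟩; exact ⟨⟨_, k, rfl⟩, hk⟩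
    constructor
    · intro h j
      exact (key (fun _ => j)).1 (congrFun h _)
    · intro h
      funext α
      exact (key α).2 (h _)
  rw [h1]
  constructor
  · intro h
    have h2 : I ≤ Ideal.radical (LinearMap.ker (LinearMap.toSpanSingleton R M m)) := by
      rw [hI, Ideal.span_le]
      rintro _ ⟨j, rfl⟩
      obtain ⟨k, hk⟩ := h j
      exact ⟨k, by simpa using hk⟩
    have hfg : I.FG := by rw [hI]; exact Submodule.fg_span (Set.finite_range f)
    obtain ⟨t, ht⟩ := Ideal.exists_pow_le_of_le_radical_of_fg h2 hfg
    exact ⟨t, fun a ha => by simpa using ht ha⟩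
  · rintro ⟨t, ht⟩ j
    refine ⟨t, ht _ (Ideal.pow_mem_pow ?_ t)⟩
    rw [hI]; exact Ideal.subset_span ⟨j, rfl⟩

variable {M J M' : Type*} [AddCommGroup M] [Module R M] [AddCommGroup J] [Module R J]
  [AddCommGroup M'] [Module R M'] (i : M →ₗ[R] J) (π : J →ₗ[R] M') (hi : Function.Injective i)
  (hπ : Function.Surjective π) (hex : Function.Exact i π)

theorem ch_inj (hi : Function.Injective i) (n : ℕ) :
    Function.Injective (chMap (cmodel f M) (cmodel f J) i n) := by
  intro x y hxy
  funext α
  exact IsLocalizedModule.map_injective _ _ _ _ hi (congrFun hxy α)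

theorem ch_surj (hπ : Function.Surjective π) (n : ℕ) :
    Function.Surjective (chMap (cmodel f J) (cmodel f M') π n) := by
  intro y
  have := fun α => IsLocalizedModule.map_surjective (.powers (gp f (img α)))
    (LocalizedModule.mkLinearMap (.powers (gp f (img α))) J)
    (LocalizedModule.mkLinearMap (.powers (gp f (img α))) M') π hπ (y α)
  choose x hx using this
  exact ⟨x, funext hx⟩

theorem ch_exact (hex : Function.Exact i π) (n : ℕ) :
    Function.Exact (chMap (cmodel f M) (cmodel f J) i n) (chMap (cmodel f J) (cmodel f M') π n) := by
  have key := fun α : Fin n → ι => IsLocalizedModule.map_exact (.powers (gp f (img α)))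
    (LocalizedModule.mkLinearMap (.powers (gp f (img α))) M)
    (LocalizedModule.mkLinearMap (.powers (gp f (img α))) J)
    (LocalizedModule.mkLinearMap (.powers (gp f (img α))) M') i π hex
  intro y
  constructor
  · intro hy
    have := fun α => (key α (y α)).1 (congrFun hy α)
    choose x hx using this
    exact ⟨x, funext hx⟩
  · rintro ⟨x, rfl⟩
    funext α
    exact (key α _).2 ⟨x α, rfl⟩

include hi hπ hex in
theorem ch_snake (n : ℕ) (y' : Ch (fun U => LocalizedModule (.powers (gp f U)) M') n)
    (hy' : dd (cres f M') n y' = 0) :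
    ∃ z : Ch (fun U => LocalizedModule (.powers (gp f U)) M) (n+1), dd (cres f M) (n+1) z = 0 ∧
      ∀ r : R, r • z ∈ Bd (dd (cres f M)) (n+1) ↔
        ∃ s : Ch (fun U => LocalizedModule (.powers (gp f U)) J) n, dd (cres f J) n s = 0 ∧
          chMap (cmodel f J) (cmodel f M') π n s = r • y' := by
  obtain ⟨s0, rfl⟩ := ch_surj f π hπ n y'
  rw [← chMap_dd] at hy'
  obtain ⟨z, hz⟩ := (ch_exact f i π hex (n+1) _).1 hy'
  refine ⟨z, ?_, fun r => ?_⟩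
  · apply ch_inj f i hi
    rw [chMap_dd, hz, dd_dd (cmodel f J).isPsh, map_zero]
  constructor
  · rintro ⟨w, hw⟩
    refine ⟨r • s0 - chMap (cmodel f M) (cmodel f J) i n w, ?_, ?_⟩
    · rw [map_sub, map_smul, ← chMap_dd, hw, map_smul, hz, sub_self]
    · rw [map_sub, map_smul, (ch_exact f i π hex n _).2 ⟨w, rfl⟩, sub_zero]
  · rintro ⟨s, hs, hs'⟩
    obtain ⟨w, hw⟩ := (ch_exact f i π hex n (r • s0 - s)).1 (by rw [map_sub, map_smul, hs', sub_self])
    refine ⟨w, ch_inj f i hi _ ?_⟩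
    rw [chMap_dd, hw, map_sub, map_smul, hs, sub_zero, map_smul, hz]
end cech

variable {R : Type u} [CommRing R] [IsNoetherianRing R] {ι : Type} [Finite ι] [DecidableEq ι]

theorem DD_cech [Fintype ι] (f : ι → R) (I : Ideal R) (hI : I = Ideal.span (Set.range f)) (n : ℕ) :
    ∀ (M : ModuleCat.{u} R) (S : R → Prop), DD I n M S →
    ∃ z : Ch (fun U => LocalizedModule (.powers (gp f U)) M) n, dd (cres f M) n z = 0 ∧
      ∀ r, S r ↔ r • z ∈ Bd (dd (cres f M)) n := by
  have seq : ∀ M : ModuleCat.{u} R, 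
      Function.Injective (Injective.ι M) ∧ Function.Surjective (cokernel.π (Injective.ι M)) ∧
      Function.Exact (Injective.ι M) (cokernel.π (Injective.ι M)) ∧
      (ShortComplex.mk _ _ (cokernel.condition (Injective.ι M))).Exact ∧
      Module.Baer R ↑(Injective.under M : ModuleCat.{u} R) := by
    intro M
    have hx : (ShortComplex.mk _ _ (cokernel.condition (Injective.ι M))).Exact :=
      ShortComplex.exact_cokernel _
    refine ⟨(ModuleCat.mono_iff_injective _).1 inferInstance,
      (ModuleCat.epi_iff_surjective _).1 inferInstance,
      (ShortComplex.ShortExact.moduleCat_exact_iff_function_exact _).1 hx, hx, ?_⟩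
    haveI : Module.Injective R ↑(Injective.under M : ModuleCat.{u} R) := by
      haveI : Injective (Injective.under M) := inferInstance
      exact Module.injective_module_of_injective_object (inj := this) _ _
    exact Module.Baer.of_injective inferInstance
  induction n with
  | zero =>
    intro M S h
    obtain ⟨y, t, hy, hS⟩ := DD_zero h
    refine ⟨c0 f y, (c0_cocycle f I hI y).2 ⟨t, hy⟩, fun r => ?_⟩
    rw [hS, Bd, Submodule.mem_bot, ← c0_smul]
    constructor
    · intro h; rw [h]; simpa using c0_smul f (0 : R) (0 : M)
    · intro h; apply (c0_bij f).1; rw [h]; symm; simpa using c0_smul f (0 : R) (0 : M)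
  | succ n ih =>
    intro M S h
    obtain ⟨hi, hπ, hex, hx, hB⟩ := seq M
    cases n with
    | zero =>
      obtain ⟨y', t, hy', hS⟩ := DD_one _ hx h
      obtain ⟨z, hz, hr⟩ := ch_snake f _ _ hi hπ hex 0 (c0 f y') ((c0_cocycle f I hI y').2 ⟨t, hy'⟩)
      refine ⟨z, hz, fun r => ?_⟩
      rw [hr, hS]
      constructor
      · rintro ⟨y, t, hy, hry⟩
        refine ⟨c0 f y, (c0_cocycle f I hI y).2 ⟨t, hy⟩, ?_⟩
        rw [c0_chMap, ← c0_smul, hry]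
      · rintro ⟨s, hs, hs'⟩
        obtain ⟨y, rfl⟩ := (c0_bij f).2 s
        obtain ⟨t, ht⟩ := (c0_cocycle f I hI y).1 hs
        refine ⟨y, t, ht, (c0_bij f).1 ?_⟩
        rw [c0_smul, ← hs', c0_chMap]
    | succ n =>
      obtain ⟨y', hy', hS⟩ := ih _ S (DD_succ _ hx h)
      obtain ⟨z, hz, hr⟩ := ch_snake f _ _ hi hπ hex (n+1) y' hy'
      refine ⟨z, hz, fun r => ?_⟩
      rw [hr, hS]
      constructor
      · rintro ⟨u', hu'⟩
        obtain ⟨u, rfl⟩ := ch_surj f _ hπ _ u'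
        refine ⟨dd (cres f ↑(Injective.under M : ModuleCat.{u} R)) n u, dd_dd (cmodel f _).isPsh _ _, ?_⟩
        rw [chMap_dd, hu']
      · rintro ⟨s, hs, hs'⟩
        rw [← hs']
        apply chMap_Bd
        exact inj_vanish f Finset.univ _ hB (fun j hj => absurd (Finset.mem_univ j) hj) n s hs

theorem AP_lc [Fintype ι] (f : ι → R) (n : ℕ) (M : ModuleCat.{u} R) :
    AP R ((localCohomology (Ideal.span (Set.range f)) n).obj M) ⊆ AP R (HC f M n) := by
  rintro P ⟨hP, x, hx⟩
  obtain ⟨t, c, hc, h⟩ := lc_desc _ n M x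
  obtain ⟨z, hz, hr⟩ := DD_cech f _ rfl n M (fun r => r • x = 0) ⟨t, c, hc, h⟩
  rw [AP_Coh_iff]
  exact ⟨hP, z, hz, fun r => (hx r).trans (hr r)⟩
end LCF
end

section
namespace LCF

/-- restriction of scalars along an endomorphism -/
def Fr {T : Type*} [CommRing T] (_φ : T →+* T) (X : Type*) := X

section
variable {T : Type*} [CommRing T] (φ : T →+* T)

instance {X : Type*} [h : AddCommGroup X] : AddCommGroup (Fr φ X) := h

instance {X : Type*} [AddCommGroup X] [Module T X] : Module T (Fr φ X) :=
  (Module.compHom X φ : Module T X)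

theorem Fr_smul {X : Type*} [AddCommGroup X] [Module T X] (r : T) (x : X) :
    (r • (show Fr φ X from x) : Fr φ X) = (φ r • x : X) := rfl

/-- functoriality of `Fr` -/
def Fr.map {X Y : Type*} [AddCommGroup X] [Module T X] [AddCommGroup Y] [Module T Y]
    (h : X →ₗ[T] Y) : Fr φ X →ₗ[T] Fr φ Y where
  toFun := h
  map_add' := h.map_add
  map_smul' r x := h.map_smul (φ r) x

theorem dvd_phi {p N : ℕ} (hN : (p : T) ^ N = 0) {g h c : T} (hc : h = g ^ p + p * c) (a m : ℕ)
    (ha : N + a ≤ m + 1) : g ^ (p * a) ∣ h ^ m := by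
  rw [hc, pow_mul]
  refine (Commute.all _ _).pow_dvd_add_pow_of_pow_eq_zero_right ha ?_
  rw [mul_pow, hN, zero_mul]

theorem dvd_phi' {p N : ℕ} (hN : (p : T) ^ N = 0) {g h c : T} (hc : h = g ^ p + p * c) :
    h ∣ g ^ (p * (N + 1)) := by
  have : g ^ p = h + (p * (-c)) := by rw [hc]; ring
  rw [pow_mul, this]
  conv_lhs => rw [← pow_one h]
  refine (Commute.all _ _).pow_dvd_add_pow_of_pow_eq_zero_right (n := N) (m := 1) (by omega) ?_
  rw [mul_pow, hN, zero_mul]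

theorem isUnit_smul_of_dvd_pow {X : Type*} [AddCommGroup X] [Module T X] {a b : T} {k : ℕ}
    (h : a ∣ b ^ k) (hb : IsUnit (algebraMap T (Module.End T X) b)) :
    IsUnit (algebraMap T (Module.End T X) a) :=
  unit_of_dvd h (by rw [map_pow]; exact hb.pow k)

theorem loc_surj {g : T} {X Y : Type*} [AddCommGroup X] [Module T X] [AddCommGroup Y] [Module T Y]
    (l : X →ₗ[T] Y) [hl : IsLocalizedModule (.powers g) l] (y : Y) :
    ∃ (k : ℕ) (x : X), g ^ k • y = l x := by
  obtain ⟨⟨x, s⟩, hx⟩ := hl.surj y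
  obtain ⟨k, hks⟩ := s.2
  replace hks : g ^ k = (s : T) := hks
  exact ⟨k, x, by rw [hks]; exact hx⟩

theorem loc_eq {g : T} {X Y : Type*} [AddCommGroup X] [Module T X] [AddCommGroup Y] [Module T Y]
    (l : X →ₗ[T] Y) [hl : IsLocalizedModule (.powers g) l] {x₁ x₂ : X} (h : l x₁ = l x₂) :
    ∃ (k : ℕ), g ^ k • x₁ = g ^ k • x₂ := by
  obtain ⟨s, hk⟩ := hl.exists_of_eq h
  obtain ⟨k, hks⟩ := s.2
  replace hks : g ^ k = (s : T) := hks
  exact ⟨k, by rw [hks]; exact hk⟩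

/-- localizing `Fr φ` -/
theorem Fr_loc {p N : ℕ} (hp : 2 ≤ p) (hN : (p : T) ^ N = 0) {g c : T} (hc : φ g = g ^ p + p * c)
    {X Y : Type*} [AddCommGroup X] [Module T X] [AddCommGroup Y] [Module T Y]
    (l : X →ₗ[T] Y) [hl : IsLocalizedModule (.powers g) l] :
    IsLocalizedModule (.powers g) (Fr.map φ l) where
  map_units := by
    rintro ⟨_, k, rfl⟩
    have h1 : IsUnit (algebraMap T (Module.End T Y) g) := hl.map_units ⟨g, 1, pow_one g⟩
    have h2 : IsUnit (algebraMap T (Module.End T Y) (φ (g ^ k))) := by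
      rw [map_pow, map_pow]
      exact (isUnit_smul_of_dvd_pow (dvd_phi' hN hc) h1).pow k
    rw [Module.End.isUnit_iff] at h2 ⊢
    exact h2
  surj := by
    intro y
    obtain ⟨k, x, hx⟩ := loc_surj l (g := g) y
    obtain ⟨d, hd⟩ := dvd_phi hN hc k (N + k) (by omega)
    obtain ⟨e, he⟩ : g ^ k ∣ g ^ (p * k) := pow_dvd_pow _ (by nlinarith)
    refine ⟨⟨((e * d) • x : X), ⟨g ^ (N + k), N + k, rfl⟩⟩, ?_⟩
    rw [Submonoid.smul_def]
    change φ (g ^ (N + k)) • (show Y from y) = l ((e * d) • x)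
    have aux : ∀ y : Y, g ^ k • y = l x → (g ^ k * e * d) • y = (e * d) • l x := by
      intro y h
      rw [← h, smul_smul]; congr 1; ring
    rw [map_pow, hd, he, map_smul]
    exact aux y hx
  exists_of_eq := by
    intro x₁ x₂ h
    obtain ⟨k, hk⟩ := loc_eq l (g := g) h
    obtain ⟨d, hd⟩ := dvd_phi hN hc k (N + k) (by omega)
    obtain ⟨e, he⟩ : g ^ k ∣ g ^ (p * k) := pow_dvd_pow _ (by nlinarith)
    refine ⟨⟨g ^ (N + k), N + k, rfl⟩, ?_⟩
    rw [Submonoid.smul_def, Submonoid.smul_def]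
    change φ (g ^ (N + k)) • (show X from x₁) = φ (g ^ (N + k)) • (show X from x₂)
    rw [map_pow, hd, he, mul_assoc, mul_comm, mul_smul, mul_smul _ _ (show X from x₂)]
    exact congrArg _ hk

end

section main
variable {T : Type*} [CommRing T] [IsNoetherianRing T] (φ : T →+* T) {p N : ℕ} (hp : 2 ≤ p)
  (hN : (p : T) ^ N = 0) (hφ : ∀ t, ∃ c, φ t = t ^ p + p * c)
  {J : Type*} [Fintype J] (x : J → T) (κ : J → T →+ T) (hκ : ∀ a s t, κ a (φ s * t) = s * κ a t)
  (hdec : ∀ t, t = ∑ a, x a * φ (κ a t))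

include hp hN hφ hκ hdec

theorem AP_frob {ι : Type*} [DecidableEq ι] [Finite ι] (f : ι → T) (i : ℕ) :
    (AP T (HC f T i)).Finite := by
  classical
  have hM := cmodel f T
  let L : Finset ι → Type _ := fun U => LocalizedModule (.powers (gp f U)) T
  let l : ∀ U, T →ₗ[T] L U := fun U => LocalizedModule.mkLinearMap (.powers (gp f U)) T
  change Model f l (cres f T) at hM
  have hM' : Model f (M := Fr φ T) (L := fun U => Fr φ (L U)) (fun U => Fr.map φ (l U))
      (fun U V h => Fr.map φ (cres f T U V h)) := by
    constructor
    · intro U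
      haveI := hM.loc U
      obtain ⟨c, hc⟩ := hφ (gp f U)
      exact Fr_loc φ hp hN hc (l U)
    · exact hM.comm
  let φl : T →ₗ[T] Fr φ T := 
    { toFun := φ, map_add' := map_add φ, map_smul' := fun r t => map_mul φ r t }
  let κl : J → Fr φ T →ₗ[T] T := fun a =>
    { toFun := κ a, map_add' := map_add (κ a), map_smul' := fun r t => hκ a r t }
  let xl : J → Fr φ T →ₗ[T] Fr φ T := fun a => Fr.map φ (LinearMap.mulLeft T (x a))
  have hid : ∑ a, xl a ∘ₗ φl ∘ₗ κl a = LinearMap.id := by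
    refine LinearMap.ext fun t => ?_
    rw [LinearMap.sum_apply]
    exact (hdec t).symm
  -- cochain level
  let K : J → ∀ i, Ch L i → Ch L i := fun a i z => chMap hM' hM (κl a) i z
  let Φ : ∀ i, Ch L i → Ch L i := fun i z => chMap hM hM' φl i z
  have hd' : ∀ i (z : Ch L i), dd (fun U V h => Fr.map φ (cres f T U V h)) i z =
      dd (cres f T) i z := by
    intro i z
    exact (dd_nat (res := cres f T) (res' := fun U V h => Fr.map φ (cres f T U V h))
      (fun U => (AddMonoidHom.id (L U) : L U →+ Fr φ (L U))) (fun U V h x => rfl) i z).symm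
  have hBd' : ∀ i (z : Ch L i), z ∈ Bd (dd (fun U V h => Fr.map φ (cres f T U V h))) i ↔
      z ∈ Bd (dd (cres f T)) i := by
    intro i z
    cases i with
    | zero => rfl
    | succ i =>
      constructor
      · rintro ⟨y, rfl⟩; exact ⟨y, (hd' _ _).symm⟩
      · rintro ⟨y, rfl⟩; exact ⟨y, hd' _ _⟩
  have hKd : ∀ a i z, K a (i+1) (dd (cres f T) i z) = dd (cres f T) i (K a i z) := by
    intro a i z
    rw [← hd']
    exact chMap_dd hM' hM (κl a) i z
  have hKB : ∀ a z, z ∈ Bd (dd (cres f T)) i → K a i z ∈ Bd (dd (cres f T)) i := by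
    intro a z hz
    exact Bd_map (fun i => (chMap hM' hM (κl a) i).toAddMonoidHom)
      (fun i x => chMap_dd hM' hM (κl a) i x) i _ ((hBd' _ _).2 hz)
  have hΦB : ∀ z, z ∈ Bd (dd (cres f T)) i → Φ i z ∈ Bd (dd (cres f T)) i := by
    intro z hz
    exact (hBd' _ _).1 (Bd_map (fun i => (chMap hM hM' φl i).toAddMonoidHom)
      (fun i x => chMap_dd hM hM' φl i x) i _ hz)
  have hKφ : ∀ a (r : T) (z : Ch L i), K a i (φ r • z) = r • K a i z := by
    intro a r z
    exact (chMap hM' hM (κl a) i).map_smul r z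
  have hX : ∀ a (z : Ch L i), (chMap hM' hM' (xl a) i z : Ch L i) = x a • z := by
    intro a z
    funext α
    exact LinearMap.congr_fun (hM'.ext_lin hM' subset_rfl (mapU hM' hM' (xl a) (img α))
      (Fr.map φ (LinearMap.lsmul T _ (x a))) (fun m => by
        rw [mapU_l]
        exact (l (img α)).map_smul (x a) m)) (z α)
  have hD : ∀ z : Ch L i, z = ∑ a, x a • Φ i (K a i z) := by
    intro z
    have h1 := chMap_id hM' i z
    rw [← hid] at h1
    refine h1.symm.trans ((chMap_sum Finset.univ hM' hM' _ i z).trans ?_)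
    refine Finset.sum_congr rfl fun a _ => ?_
    rw [← hX]
    refine (chMap_comp hM' hM' hM' (φl ∘ₗ κl a) (xl a) i z).symm.trans ?_
    exact congrArg (chMap hM' hM' (xl a) i) (chMap_comp hM' hM hM' (κl a) φl i z).symm
  -- the root
  let G : ℕ → Submodule T (Ch L i) := fun k =>
    { carrier := {z | ∀ α, ∃ t : T, gp f (img α) ^ k • z α = l _ t}
      zero_mem' := fun α => ⟨0, by simp⟩
      add_mem' := fun {y z} hy hz α => by
        obtain ⟨s, hs⟩ := hy α
        obtain ⟨t, ht⟩ := hz α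
        exact ⟨s + t, by rw [Pi.add_apply, smul_add, hs, ht, map_add]⟩
      smul_mem' := fun r z hz α => by
        obtain ⟨t, ht⟩ := hz α
        exact ⟨r • t, by rw [Pi.smul_apply, smul_comm, ht, map_smul]⟩ }
  have hGK : ∀ k a z, z ∈ G k → K a i z ∈ G (N + (k + 1) / 2) := by
    intro k a z hz α
    obtain ⟨t, ht⟩ := hz α
    obtain ⟨c, hc⟩ := hφ (gp f (img α))
    obtain ⟨d, hd⟩ := dvd_phi hN hc ((k + 1) / 2) (N + (k + 1) / 2) (by omega)
    obtain ⟨e, he⟩ : gp f (img α) ^ k ∣ gp f (img α) ^ (p * ((k + 1) / 2)) :=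
      pow_dvd_pow _ (by have : 2 * ((k + 1) / 2) ≤ p * ((k + 1) / 2) := Nat.mul_le_mul_right _ hp
                        omega)
    refine ⟨κ a ((e * d) * t), ?_⟩
    have h2 := (mapU hM' hM (κl a) (img α)).map_smul (gp f (img α) ^ (N + (k + 1) / 2)) (z α)
    refine h2.symm.trans ?_
    have h3 : (gp f (img α) ^ (N + (k + 1) / 2) • (show Fr φ (L (img α)) from z α) :
        Fr φ (L (img α))) = (Fr.map φ (l (img α))) ((e * d) * t : T) := by
      change φ (gp f (img α) ^ (N + (k + 1) / 2)) • z α = l _ ((e * d) • t)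
      rw [map_pow, hd, he, map_smul, ← ht, smul_smul]
      congr 1; ring
    refine (congrArg _ h3).trans ?_
    exact mapU_l hM' hM (κl a) (img α) _
  have hGall : ∀ z : Ch L i, ∃ k, z ∈ G k := by
    intro z
    have h1 : ∀ α, ∃ k, ∃ t : T, gp f (img α) ^ k • z α = l _ t := by
      intro α
      obtain ⟨⟨t, ⟨_, k, rfl⟩⟩, ht⟩ := (hM.loc (img α)).surj (z α)
      exact ⟨k, t, ht⟩
    choose k t ht using h1
    cases nonempty_fintype ι
    refine ⟨∑ α, k α, fun α => ?_⟩
    obtain ⟨d, hd⟩ := pow_dvd_pow (gp f (img α)) (Finset.single_le_sum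
      (f := k) (fun _ _ => Nat.zero_le _) (Finset.mem_univ α))
    exact ⟨d • t α, by rw [hd, mul_comm, mul_smul, ht, map_smul]⟩
  have hGN : ∀ k, IsNoetherian T (G k) := by
    intro k
    cases nonempty_fintype ι
    let e : G k →ₗ[T] (∀ α : Fin i → ι, LinearMap.range (l (img α))) :=
      LinearMap.pi fun α => LinearMap.codRestrict _
        ((LinearMap.lsmul T _ (gp f (img α) ^ k)) ∘ₗ (LinearMap.proj α) ∘ₗ (G k).subtype)
        (fun z => by obtain ⟨t, ht⟩ := z.2 α; exact ⟨t, ht.symm⟩)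
    refine isNoetherian_of_injective e ?_
    intro y z hyz
    refine Subtype.ext (funext fun α => ?_)
    have h1 : gp f (img α) ^ k • (y : Ch L i) α = gp f (img α) ^ k • (z : Ch L i) α :=
      congrArg Subtype.val (congrFun hyz α)
    exact ((Module.End.isUnit_iff _).1 ((hM.loc (img α)).map_units ⟨_, k, rfl⟩)).1 h1
  -- finiteness
  haveI := hGN (2 * N + 1)
  refine (AP_finite_of_fg (R := T)
    (M := G (2 * N + 1) ⧸ (Bd (dd (cres f T)) i).comap (G (2 * N + 1)).subtype)).subset ?_
  intro P hP
  rw [AP_Coh_iff] at hP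
  obtain ⟨hPr, z, -, hz⟩ := hP
  have key : ∀ k, ∀ z ∈ G k, (∀ r, r ∈ P ↔ r • z ∈ Bd (dd (cres f T)) i) →
      ∃ z ∈ G (2 * N + 1), (∀ r, r ∈ P ↔ r • z ∈ Bd (dd (cres f T)) i) := by
    intro k
    induction k using Nat.strong_induction_on with
    | _ k ih =>
    intro z hzk hz
    by_cases hk : k ≤ 2 * N + 1
    · refine ⟨z, fun α => ?_, hz⟩
      obtain ⟨t, ht⟩ := hzk α
      refine ⟨gp f (img α) ^ (2 * N + 1 - k) • t, ?_⟩
      rw [map_smul, ← ht, smul_smul, ← pow_add, Nat.sub_add_cancel hk]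
    · have hpP : (p : T) ∈ P := hPr.mem_of_pow_mem N (by rw [hN]; exact P.zero_mem)
      have hφP : ∀ r, φ r ∈ P ↔ r ∈ P := by
        intro r
        obtain ⟨c, hc⟩ := hφ r
        rw [hc, Ideal.add_mem_iff_left _ (P.mul_mem_right _ hpP)]
        exact ⟨hPr.mem_of_pow_mem p, fun h => P.pow_mem_of_mem h p (by omega)⟩
      obtain ⟨a, ha⟩ := prime_of_finite_inf P
        (fun a => (Bd (dd (cres f T)) i).comap (LinearMap.toSpanSingleton T (Ch L i) (K a i z)))
        (fun r => by
          simp only [Submodule.mem_comap, LinearMap.toSpanSingleton_apply]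
          constructor
          · intro hr a
            rw [← hKφ]
            exact hKB a _ ((hz _).1 ((hφP r).2 hr))
          · intro h
            rw [← hφP, hz, hD (φ r • z)]
            refine Submodule.sum_mem _ fun a _ => Submodule.smul_mem _ _ (hΦB _ ?_)
            rw [hKφ]; exact h a)
      exact ih (N + (k + 1) / 2) (by omega) (K a i z) (hGK k a z hzk) (fun r => by
        rw [ha]; simp only [Submodule.mem_comap, LinearMap.toSpanSingleton_apply])
  obtain ⟨k, hk⟩ := hGall z
  obtain ⟨y, hy, hyP⟩ := key k z hk hz
  refine ⟨hPr, Submodule.Quotient.mk ⟨y, hy⟩, fun r => ?_⟩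
  rw [hyP, ← Submodule.Quotient.mk_smul, Submodule.Quotient.mk_eq_zero]
  rfl

end main
end LCF
end

section
namespace LCF
open MvPowerSeries

section
variable {B : Type*} [CommRing B] {n : ℕ} (p : ℕ) [hp : Fact p.Prime] (σ : B ≃+* B)

/-- lift of Frobenius on power series -/
noncomputable def phiF : MvPowerSeries (Fin n) B →+* MvPowerSeries (Fin n) B :=
  ((expand p hp.out.ne_zero : MvPowerSeries (Fin n) B →ₐ[B] _) : _ →+* _).comp
    (MvPowerSeries.map (σ : B →+* B))

/-- exponent attached to a digit vector -/
noncomputable def dig (b : Fin n → Fin p) : Fin n →₀ ℕ :=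
  Finsupp.equivFunOnFinite.symm fun i => (b i : ℕ)

/-- digits of an exponent -/
def digOf (γ : Fin n →₀ ℕ) : Fin n → Fin p := fun i => ⟨γ i % p, Nat.mod_lt _ hp.out.pos⟩

/-- quotient of an exponent -/
noncomputable def quo (γ : Fin n →₀ ℕ) : Fin n →₀ ℕ :=
  Finsupp.equivFunOnFinite.symm fun i => γ i / p

theorem quo_dig (γ : Fin n →₀ ℕ) : p • quo p γ + dig p (digOf p γ) = γ := by
  ext i
  simpa [quo, dig, digOf] using Nat.div_add_mod (γ i) p

theorem digOf_add (β : Fin n →₀ ℕ) (b : Fin n → Fin p) : digOf p (p • β + dig p b) = b := by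
  funext i
  ext
  simp [digOf, dig, Nat.mod_eq_of_lt]

theorem quo_add (β : Fin n →₀ ℕ) (b : Fin n → Fin p) : quo p (p • β + dig p b) = β := by
  ext i
  have h := hp.out.pos
  change (p * β i + (b i : ℕ)) / p = β i
  rw [Nat.mul_add_div h, Nat.div_eq_of_lt (b i).2, add_zero]

theorem coeff_x_phi (γ : Fin n →₀ ℕ) (b : Fin n → Fin p) (s : MvPowerSeries (Fin n) B) :
    coeff γ (monomial (dig p b) 1 * phiF p σ s) =
      if digOf p γ = b then σ (coeff (quo p γ) s) else 0 := by
  rw [coeff_monomial_mul, one_mul]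
  split_ifs with h1 h2 h2
  · have : γ - dig p b = p • quo p γ := by
      conv_lhs => rw [← quo_dig p γ, h2]
      rw [add_tsub_cancel_right]
    rw [this]
    change coeff (p • quo p γ) (expand p hp.out.ne_zero _) = _
    rw [coeff_expand_smul, coeff_map]; rfl
  · obtain ⟨i, hi⟩ : ∃ i, ¬ p ∣ (γ - dig p b) i := by
      by_contra! hc
      apply h2
      funext i
      ext
      have h3 := hc i
      have h4 : (b i : ℕ) ≤ γ i := h1 i
      have h5 : (γ - dig p b) i = γ i - b i := rfl
      rw [h5, ← Nat.modEq_iff_dvd' h4] at h3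
      exact Eq.trans (show γ i % p = b i % p from h3.symm) (Nat.mod_eq_of_lt (b i).2)
    exact coeff_expand_of_not_dvd p hp.out.ne_zero _ hi
  · exfalso
    apply h1
    rw [← quo_dig p γ, h2]
    exact le_add_self
  · rfl

/-- the components -/
noncomputable def kap (a : Fin n → Fin p) : MvPowerSeries (Fin n) B →+ MvPowerSeries (Fin n) B where
  toFun t := fun β => σ.symm (coeff (p • β + dig p a) t)
  map_zero' := by
    funext β
    exact (congrArg σ.symm (map_zero (coeff (p • β + dig p a)))).trans (map_zero σ.symm)
  map_add' s t := by
    funext β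
    exact (congrArg σ.symm (map_add (coeff (p • β + dig p a)) s t)).trans (map_add σ.symm _ _)

theorem coeff_kap (a : Fin n → Fin p) (t : MvPowerSeries (Fin n) B) (β) :
    coeff β (kap p σ a t) = σ.symm (coeff (p • β + dig p a) t) := rfl

theorem kap_x_phi (a b : Fin n → Fin p) (s : MvPowerSeries (Fin n) B) :
    kap p σ a (monomial (dig p b) 1 * phiF p σ s) = if a = b then s else 0 := by
  ext β
  rw [coeff_kap, coeff_x_phi, digOf_add, quo_add]
  split_ifs <;> simp

theorem dec_phi (t : MvPowerSeries (Fin n) B) :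
    t = ∑ a, monomial (dig p a) 1 * phiF p σ (kap p σ a t) := by
  ext γ
  rw [map_sum]
  simp_rw [coeff_x_phi]
  rw [Finset.sum_ite_eq, if_pos (Finset.mem_univ _), coeff_kap, quo_dig, σ.apply_symm_apply]

theorem kap_phi_mul (a : Fin n → Fin p) (s t : MvPowerSeries (Fin n) B) :
    kap p σ a (phiF p σ s * t) = s * kap p σ a t := by
  conv_lhs => rw [dec_phi p σ t]
  rw [Finset.mul_sum, map_sum]
  have : ∀ b, phiF p σ s * (monomial (dig p b) 1 * phiF p σ (kap p σ b t)) =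
      monomial (dig p b) 1 * phiF p σ (s * kap p σ b t) := by
    intro b; rw [map_mul]; ring
  simp_rw [this, kap_x_phi]
  simp

theorem phiF_lift {N : ℕ} (hN : (p : B) ^ N = 0) (hσ : ∀ b, ∃ c, σ b = b ^ p + p * c)
    (t : MvPowerSeries (Fin n) B) : ∃ c, phiF p σ t = t ^ p + p * c := by
  cases subsingleton_or_nontrivial B
  · exact ⟨0, by ext; exact Subsingleton.elim _ _⟩
  have hnu : (p : B) ∈ nonunits B := by
    intro h
    have := h.pow N
    rw [hN] at this
    exact not_isUnit_zero this
  haveI : CharP (B ⧸ Ideal.span {(p : B)}) p := CharP.quotient B p hnu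
  haveI : ExpChar (B ⧸ Ideal.span {(p : B)}) p := ExpChar.prime hp.out
  let π := Ideal.Quotient.mk (Ideal.span {(p : B)})
  have h1 : MvPowerSeries.map π (phiF p σ t) = MvPowerSeries.map π (t ^ p) := by
    have h2 : π.comp (σ : B →+* B) = (frobenius _ p).comp π := by
      ext b
      obtain ⟨c, hc⟩ := hσ b
      have h3 : π (p : B) = 0 := Ideal.Quotient.eq_zero_iff_mem.2 (Ideal.mem_span_singleton_self _)
      simp only [RingHom.comp_apply, RingHom.coe_coe, hc, map_add, map_mul, h3, zero_mul, add_zero,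
        map_pow, frobenius_def]
    change MvPowerSeries.map π (expand p hp.out.ne_zero (MvPowerSeries.map (σ : B →+* B) t)) = _
    rw [map_expand, ← RingHom.comp_apply (MvPowerSeries.map π), ← MvPowerSeries.map_comp, h2,
      MvPowerSeries.map_comp, RingHom.comp_apply, ← map_expand, map_frobenius_expand, map_pow]
  have h2 : ∀ γ, ∃ c, coeff γ (phiF p σ t - t ^ p) = p * c := by
    intro γ
    have h3 : π (coeff γ (phiF p σ t - t ^ p)) = 0 := by
      rw [← coeff_map, map_sub, h1, sub_self, map_zero]
    obtain ⟨c, hc⟩ := Ideal.mem_span_singleton.1 (Ideal.Quotient.eq_zero_iff_mem.1 h3)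
    exact ⟨c, hc⟩
  choose c hc using h2
  let c' : MvPowerSeries (Fin n) B := fun γ => c γ
  refine ⟨c', ?_⟩
  rw [← sub_eq_iff_eq_add']
  ext γ
  rw [hc]
  have : (p : MvPowerSeries (Fin n) B) = MvPowerSeries.C (p : B) := by simp
  rw [this]
  exact (coeff_C_mul γ c' (p : B)).symm

theorem AP_frob_series [IsNoetherianRing B] {N : ℕ} (hN : (p : B) ^ N = 0)
    (hσ : ∀ b, ∃ c, σ b = b ^ p + p * c) {ι : Type*} [DecidableEq ι] [Finite ι]
    (f : ι → MvPowerSeries (Fin n) B) (i : ℕ) :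
    (AP (MvPowerSeries (Fin n) B) (HC f (MvPowerSeries (Fin n) B) i)).Finite :=
  AP_frob (phiF p σ) hp.out.two_le (N := N)
    (by
      have : (p : MvPowerSeries (Fin n) B) = MvPowerSeries.C (p : B) := by simp
      rw [this, ← map_pow, hN, map_zero])
    (phiF_lift p σ hN hσ) (fun a => monomial (dig p a) 1) (kap p σ) (kap_phi_mul p σ)
    (dec_phi p σ) f i
end
end LCF
end

section
namespace LCF

section rk
universe u1 u2 u3
variable {Z : Type u1} [CommRing Z] {M : Type u2} [AddCommGroup M] [Module Z M]
  {M' : Type u3} [AddCommGroup M'] [Module Z M']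

/-- rank of a submodule as an extended natural number -/
noncomputable def rk (W : Submodule Z M) : ℕ∞ := (Module.rank Z W).toENat

theorem rk_mono {W W' : Submodule Z M} (h : W ≤ W') : rk W ≤ rk W' :=
  Cardinal.toENat.monotone' (Submodule.rank_mono h)

theorem le_rk_of_li [Nontrivial Z] {W : Submodule Z M} {κ : Type*} [Fintype κ] (v : κ → M) (hv : ∀ i, v i ∈ W)
    (hli : LinearIndependent Z v) : (Fintype.card κ : ℕ∞) ≤ rk W := by
  have h1 : LinearIndependent Z (fun i => (⟨v i, hv i⟩ : W)) :=
    LinearIndependent.of_comp W.subtype hli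
  have h2 := h1.cardinal_lift_le_rank
  have h3 := Cardinal.toENat.monotone' h2
  simpa [rk] using h3

theorem exists_li_of_le_rk [Nontrivial Z] {W : Submodule Z M} {n : ℕ} (h : (n : ℕ∞) ≤ rk W) :
    ∃ v : Fin n → M, (∀ i, v i ∈ W) ∧ LinearIndependent Z v := by
  have h1 : (n : Cardinal) ≤ Module.rank Z W := by
    rw [rk] at h
    simpa using h
  obtain ⟨v, hv⟩ := natCast_le_rank_iff.1 h1
  exact ⟨fun i => (v i : M), fun i => (v i).2, hv.map' W.subtype (Submodule.ker_subtype W)⟩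

theorem rk_span_le [Nontrivial Z] [IsDomain Z] {W : Submodule Z M} {κ : Type*} [Fintype κ] (v : κ → M)
    (h : W ≤ Submodule.span Z (Set.range v)) : rk W ≤ Fintype.card κ := by
  refine (rk_mono h).trans ?_
  have h1 := rank_span_le (R := Z) (Set.range v)
  have h2 : Cardinal.mk (Set.range v) ≤ (Fintype.card κ : Cardinal) := by
    have h := Cardinal.mk_range_le_lift (f := v)
    rw [Cardinal.mk_fintype κ, Cardinal.lift_natCast] at h
    exact Cardinal.lift_le.1 (h.trans_eq (Cardinal.lift_natCast _).symm)
  have h3 := Cardinal.toENat.monotone' (h1.trans h2)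
  simpa [rk] using h3

theorem rk_map_add_ker [IsDomain Z] (W : Submodule Z M) (g : M →ₗ[Z] M') :
    rk (W.map g) + rk (W ⊓ LinearMap.ker g) = rk W := by
  let g' := g.domRestrict W
  have h1 := rank_quotient_add_rank_of_isDomain (LinearMap.ker g')
  have h2 : Module.rank Z (LinearMap.ker g') = Module.rank Z (W ⊓ LinearMap.ker g : Submodule Z M) := by
    refine LinearEquiv.rank_eq (LinearEquiv.ofBijective
      ((W.subtype.comp (LinearMap.ker g').subtype).codRestrict _ ?_) ⟨?_, ?_⟩)
    · rintro ⟨⟨x, hx⟩, hk⟩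
      exact ⟨hx, hk⟩
    · intro a b hab
      have := congrArg Subtype.val hab
      exact Subtype.ext (Subtype.ext this)
    · rintro ⟨x, hx, hk⟩
      exact ⟨⟨⟨x, hx⟩, hk⟩, rfl⟩
  have h3 : Cardinal.lift.{u3} (Module.rank Z (W ⧸ LinearMap.ker g')) = Cardinal.lift.{u2} (Module.rank Z (W.map g)) := by
    have e : (W ⧸ LinearMap.ker g') ≃ₗ[Z] W.map g :=
      g'.quotKerEquivRange.trans (LinearEquiv.ofEq _ _ (by
        rw [LinearMap.range_domRestrict]))
    exact e.lift_rank_eq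
  have h4 := congrArg Cardinal.toENat h3
  rw [Cardinal.toENat_lift, Cardinal.toENat_lift] at h4
  rw [rk, rk, rk, ← h4, ← h2, ← h1, map_add]

theorem rk_map_le [IsDomain Z] (W : Submodule Z M) (g : M →ₗ[Z] M') : rk (W.map g) ≤ rk W := by
  rw [← rk_map_add_ker W g]; exact le_self_add

theorem rk_map_inj [IsDomain Z] (W : Submodule Z M) (g : M →ₗ[Z] M')
    (hg : ∀ x ∈ W, g x = 0 → x = 0) : rk (W.map g) = rk W := by
  have : W ⊓ LinearMap.ker g = ⊥ := by
    rw [eq_bot_iff]; rintro x ⟨h1, h2⟩; exact hg x h1 h2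
  rw [← rk_map_add_ker W g, this]
  have : rk (⊥ : Submodule Z M) = 0 := by simp [rk]
  rw [this, add_zero]

/-- a maximal independent family controls everything up to torsion -/
theorem exists_max_li [IsDomain Z] {W : Submodule Z M} {p : ℕ} (h : rk W = p) :
    ∃ v : Fin p → M, (∀ i, v i ∈ W) ∧ ∀ w ∈ W, ∃ c : Z, c ≠ 0 ∧ c • w ∈ Submodule.span Z (Set.range v) := by
  obtain ⟨v, hv, hli⟩ := exists_li_of_le_rk h.ge
  refine ⟨v, hv, fun w hw => ?_⟩
  by_contra! hc
  have : LinearIndependent Z (Fin.cons w v : Fin (p + 1) → M) := by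
    rw [Fintype.linearIndependent_iff]
    intro a ha
    rw [Fin.sum_univ_succ] at ha
    simp only [Fin.cons_zero, Fin.cons_succ] at ha
    have h0 : a 0 = 0 := by
      by_contra h0
      refine hc (a 0) h0 ?_
      rw [eq_neg_of_add_eq_zero_left ha]
      exact Submodule.neg_mem _ (Submodule.sum_mem _ fun i _ => Submodule.smul_mem _ _
        (Submodule.subset_span ⟨i, rfl⟩))
    rw [h0, zero_smul, zero_add] at ha
    intro i
    refine Fin.cases h0 (fun j => ?_) i
    exact Fintype.linearIndependent_iff.1 hli _ ha j
  have h2 := le_rk_of_li (W := W) _ (by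
    intro i; refine Fin.cases ?_ ?_ i
    · exact hw
    · exact hv) this
  rw [h, Fintype.card_fin] at h2
  exact absurd (Nat.cast_le.1 h2) (by omega)

theorem rk_pi_le [IsDomain Z] {W : Submodule Z M'} {p : ℕ} (U : Submodule Z M)
    (g : Fin p → M →ₗ[Z] M') (hg : ∀ i, ∀ x ∈ U, g i x ∈ W) (hinj : ∀ x ∈ U, (∀ i, g i x = 0) → x = 0) :
    rk U ≤ p * rk W := by
  induction p generalizing U with
  | zero =>
    have : U = ⊥ := by rw [eq_bot_iff]; intro x hx; exact hinj x hx (fun i => i.elim0)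
    subst this
    simp [rk]
  | succ p ih =>
    rw [← rk_map_add_ker U (g 0)]
    have h1 : rk (U.map (g 0)) ≤ rk W := rk_mono (by rintro _ ⟨x, hx, rfl⟩; exact hg 0 x hx)
    have h2 := ih (U ⊓ LinearMap.ker (g 0)) (fun i => g i.succ) (fun i x hx => hg _ x hx.1)
      (fun x hx h => hinj x hx.1 (fun i => by
        refine Fin.cases ?_ ?_ i
        · exact hx.2
        · exact h))
    calc _ ≤ rk W + p * rk W := add_le_add h1 h2
      _ = _ := by push_cast; rw [add_mul, one_mul, add_comm]

end rk
end LCF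
end

section
namespace LCF
open MvPolynomial

section weyl
variable {Z : Type*} [CommRing Z] {A : Type*} [Ring A] [Algebra Z A] {J : Type*}

theorem exists_aeval_comm (y : J → A) (hy : ∀ i j, y i * y j = y j * y i) :
    ∃ E : MvPolynomial J Z →ₐ[Z] A, ∀ j, E (X j) = y j := by
  letI := Algebra.adjoinCommRingOfComm Z (s := Set.range y) (by
    rintro _ ⟨i, rfl⟩ _ ⟨j, rfl⟩; exact hy i j)
  let g : MvPolynomial J Z →ₐ[Z] Algebra.adjoin Z (Set.range y) :=
    MvPolynomial.aeval fun j => ⟨y j, Algebra.subset_adjoin ⟨j, rfl⟩⟩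
  refine ⟨(Algebra.adjoin Z (Set.range y)).val.comp g, fun j => ?_⟩
  have : g (X j) = ⟨y j, Algebra.subset_adjoin ⟨j, rfl⟩⟩ := MvPolynomial.aeval_X _ _
  rw [AlgHom.comp_apply, this]; rfl

variable [DecidableEq J]

theorem ad_eq (E : MvPolynomial J Z →ₐ[Z] A) (i : J) (d : A) (e : Z)
    (h : ∀ j, d * E (X j) = E (X j) * d + (if i = j then algebraMap Z A e else 0)) (g : MvPolynomial J Z) :
    d * E g = E g * d + e • E (pderiv i g) := by
  induction g using MvPolynomial.induction_on with
  | C c =>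
    rw [← MvPolynomial.algebraMap_eq, AlgHom.commutes, MvPolynomial.algebraMap_eq, pderiv_C, map_zero, smul_zero, add_zero]
    exact (Algebra.commutes c d).symm
  | add p q hp hq => rw [map_add, mul_add, hp, hq, map_add, map_add, smul_add]; noncomm_ring
  | mul_X p j hp =>
    rw [map_mul, ← mul_assoc, hp, add_mul, mul_assoc, h j, Derivation.leibniz, pderiv_X, map_add,
      smul_eq_mul, smul_eq_mul, map_mul, map_mul]
    by_cases hij : i = j
    · subst hij
      rw [if_pos rfl, Pi.single_eq_same, map_one, Algebra.algebraMap_eq_smul_one, mul_add, mul_smul_comm, smul_add]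
      rw [smul_mul_assoc, ← map_mul E _ (X i), ← map_mul E (X i), mul_comm (X i)]
      noncomm_ring
    · rw [if_neg hij, Pi.single_eq_of_ne (Ne.symm hij), map_zero, mul_zero, zero_add, add_zero,
        smul_mul_assoc, ← map_mul E _ (X j), ← map_mul E (X j), mul_comm (X j)]
      noncomm_ring

/-- normally ordered operator attached to a polynomial in `y, ∂`. -/
noncomputable def Psi (E F : MvPolynomial J Z →ₐ[Z] A) : MvPolynomial (J ⊕ J) Z →ₗ[Z] A :=
  (MvPolynomial.basisMonomials (J ⊕ J) Z).constr Z fun m =>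
    E (monomial (m.comapDomain Sum.inl Sum.inl_injective.injOn) 1) *
    F (monomial (m.comapDomain Sum.inr Sum.inr_injective.injOn) 1)

omit [DecidableEq J] in
theorem Psi_monomial (E F : MvPolynomial J Z →ₐ[Z] A) (m : J ⊕ J →₀ ℕ) (c : Z) :
    Psi E F (monomial m c) = c • (E (monomial (m.comapDomain Sum.inl Sum.inl_injective.injOn) 1) *
    F (monomial (m.comapDomain Sum.inr Sum.inr_injective.injOn) 1)) := by
  have : monomial m c = c • (MvPolynomial.basisMonomials (J ⊕ J) Z) m := by
    rw [coe_basisMonomials, smul_monomial]; simp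
  rw [this, map_smul, Psi, Module.Basis.constr_basis]

theorem comap_sub_inl (m : J ⊕ J →₀ ℕ) (i : J) :
    (m - Finsupp.single (Sum.inl i) 1).comapDomain Sum.inl Sum.inl_injective.injOn =
    m.comapDomain Sum.inl Sum.inl_injective.injOn - Finsupp.single i 1 := by
  ext j; simp [Finsupp.single_apply]

theorem comap_sub_inr (m : J ⊕ J →₀ ℕ) (i : J) :
    (m - Finsupp.single (Sum.inr i) 1).comapDomain Sum.inr Sum.inr_injective.injOn =
    m.comapDomain Sum.inr Sum.inr_injective.injOn - Finsupp.single i 1 := by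
  ext j; simp [Finsupp.single_apply]

theorem comap_sub_inl' (m : J ⊕ J →₀ ℕ) (i : J) :
    (m - Finsupp.single (Sum.inl i) 1).comapDomain Sum.inr Sum.inr_injective.injOn =
    m.comapDomain Sum.inr Sum.inr_injective.injOn := by
  ext j; simp [Finsupp.single_apply]

theorem comap_sub_inr' (m : J ⊕ J →₀ ℕ) (i : J) :
    (m - Finsupp.single (Sum.inr i) 1).comapDomain Sum.inl Sum.inl_injective.injOn =
    m.comapDomain Sum.inl Sum.inl_injective.injOn := by
  ext j; simp [Finsupp.single_apply]

theorem ad_Psi_l (E F : MvPolynomial J Z →ₐ[Z] A)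
    (hEF : ∀ i j, F (X i) * E (X j) = E (X j) * F (X i) + (if i = j then algebraMap Z A 1 else 0))
    (i : J) (P : MvPolynomial (J ⊕ J) Z) :
    F (X i) * Psi E F P = Psi E F P * F (X i) + Psi E F (pderiv (Sum.inl i) P) := by
  induction P using MvPolynomial.induction_on' with
  | add p q hp hq => simp only [map_add, mul_add, hp, hq, add_mul]; abel
  | monomial m c =>
    have h1 := ad_eq E i (F (X i)) 1 (hEF i)
    rw [pderiv_monomial, Psi_monomial, Psi_monomial, mul_smul_comm, ← mul_assoc, h1, comap_sub_inl,
      comap_sub_inl', pderiv_monomial, one_smul, one_mul, add_mul, mul_assoc, ← map_mul F,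
      mul_comm (X i), map_mul, ← mul_assoc, smul_add, smul_mul_assoc]
    congr 1
    rw [mul_smul, ← smul_mul_assoc ((m (Sum.inl i) : ℕ) : Z), ← map_smul, smul_monomial]
    simp

theorem ad_Psi_r (E F : MvPolynomial J Z →ₐ[Z] A)
    (hEF : ∀ i j, F (X i) * E (X j) = E (X j) * F (X i) + (if i = j then algebraMap Z A 1 else 0))
    (i : J) (P : MvPolynomial (J ⊕ J) Z) :
    Psi E F P * E (X i) = E (X i) * Psi E F P + Psi E F (pderiv (Sum.inr i) P) := by
  induction P using MvPolynomial.induction_on' with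
  | add p q hp hq => simp only [map_add, mul_add, hp, hq, add_mul]; abel
  | monomial m c =>
    have h1 := ad_eq F i (E (X i)) (-1) (fun j => by
      rw [hEF j i]; by_cases h : i = j
      · subst h; simp
      · rw [if_neg h, if_neg (Ne.symm h)]; simp)
    have h2 : ∀ g, F g * E (X i) = E (X i) * F g + F (pderiv i g) := by
      intro g; rw [h1 g]; simp
    rw [pderiv_monomial, Psi_monomial, Psi_monomial, smul_mul_assoc, mul_assoc, h2, comap_sub_inr,
      comap_sub_inr', pderiv_monomial, one_mul, mul_add, ← mul_assoc, ← map_mul E,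
      mul_comm _ (X i), map_mul, mul_assoc, smul_add, mul_smul_comm]
    congr 1
    rw [mul_smul, ← mul_smul_comm ((m (Sum.inr i) : ℕ) : Z), ← map_smul, smul_monomial]
    simp

end weyl

section bern
variable {Z : Type*} [CommRing Z] [IsDomain Z] [CharZero Z] {M : Type*} [AddCommGroup M] [Module Z M]
  [Module.IsTorsionFree Z M] {J : Type*} [Fintype J] [DecidableEq J]

omit [CharZero Z] [IsDomain Z] in
theorem Dg_pderiv {σ : Type*} (i : σ) (P : MvPolynomial σ Z) (s : ℕ)
    (h : ∀ m, coeff m P ≠ 0 → m.degree ≤ s + 1) : ∀ m, coeff m (pderiv i P) ≠ 0 → m.degree ≤ s := by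
  intro m hm
  rw [coeff_pderiv] at hm
  have := h _ (left_ne_zero_of_mul hm)
  rw [map_add, Finsupp.degree_single] at this
  omega

theorem eq_C_of_pderiv {σ : Type*} (P : MvPolynomial σ Z) (h : ∀ i, pderiv i P = 0) :
    P = C (coeff 0 P) := by
  classical
  ext m
  rw [coeff_C]
  split_ifs with hm
  · rw [hm]
  · obtain ⟨i, hi⟩ : ∃ i, m i ≠ 0 := by
      by_contra! hc
      exact hm (by ext i; simp [hc i])
    have h1 := congrArg (coeff (m - Finsupp.single i 1)) (h i)
    rw [coeff_pderiv, coeff_zero] at h1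
    have h2 : m - Finsupp.single i 1 + Finsupp.single i 1 = m := by
      ext j
      by_cases hj : i = j
      · subst hj; simp; omega
      · simp [Finsupp.single_apply, hj]
    rw [h2] at h1
    rcases mul_eq_zero.1 h1 with h1 | h1
    · exact h1
    · exfalso
      exact Nat.cast_add_one_ne_zero _ h1

variable {y D : J → Module.End Z M} {V : ℕ → Submodule Z M}

omit [Fintype J] in
theorem Psi_kill (E F : MvPolynomial J Z →ₐ[Z] Module.End Z M)
    (hEF : ∀ i j, F (X i) * E (X j) = E (X j) * F (X i) +
      (if i = j then algebraMap Z (Module.End Z M) 1 else 0))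
    (hV : Monotone V) (hy : ∀ i t, ∀ v ∈ V t, E (X i) v ∈ V (t + 1))
    (hD : ∀ i t, ∀ v ∈ V t, F (X i) v ∈ V (t + 1)) {u : M} (hu : u ∈ V 0) (hu0 : u ≠ 0) (s : ℕ) :
    ∀ P : MvPolynomial (J ⊕ J) Z, (∀ m, coeff m P ≠ 0 → m.degree ≤ s) →
      (∀ v ∈ V s, Psi E F P v = 0) → P = 0 := by
  have hC : ∀ c : Z, Psi E F (C c) u = 0 → c = 0 := by
    intro c hc
    have h1 : (0 : J ⊕ J →₀ ℕ).comapDomain Sum.inl Sum.inl_injective.injOn = 0 := by ext; simp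
    have h2 : (0 : J ⊕ J →₀ ℕ).comapDomain Sum.inr Sum.inr_injective.injOn = 0 := by ext; simp
    rw [← monomial_zero', Psi_monomial, h1, h2, monomial_zero', C_1, map_one, map_one, mul_one,
      LinearMap.smul_apply, Module.End.one_apply] at hc
    exact (smul_eq_zero.1 hc).resolve_right hu0
  induction s with
  | zero =>
    intro P hP hk
    have : P = C (coeff 0 P) := by
      ext m
      rw [coeff_C]
      split_ifs with hm
      · rw [hm]
      · by_contra hc
        have := hP m hc
        rw [Nat.le_zero, Finsupp.degree_eq_zero_iff] at this
        exact hm this.symm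
    have h0 := hk u hu
    rw [this] at h0
    rw [this, hC _ h0, C_0]
  | succ s ih =>
    intro P hP hk
    have hl : ∀ i, pderiv (Sum.inl i) P = 0 := by
      intro i
      refine ih _ (Dg_pderiv _ _ _ hP) fun v hv => ?_
      have h := LinearMap.congr_fun (ad_Psi_l E F hEF i P) v
      simp only [Module.End.mul_apply, LinearMap.add_apply] at h
      rw [hk v (hV (Nat.le_succ s) hv), hk _ (hD i s v hv), map_zero, zero_add] at h
      exact h.symm
    have hr : ∀ i, pderiv (Sum.inr i) P = 0 := by
      intro i
      refine ih _ (Dg_pderiv _ _ _ hP) fun v hv => ?_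
      have h := LinearMap.congr_fun (ad_Psi_r E F hEF i P) v
      simp only [Module.End.mul_apply, LinearMap.add_apply] at h
      rw [hk v (hV (Nat.le_succ s) hv), hk _ (hy i s v hv), map_zero, zero_add] at h
      exact h.symm
    have := eq_C_of_pderiv P (by rintro (i | i); exacts [hl i, hr i])
    have h0 := hk u (hV (Nat.zero_le _) hu)
    rw [this] at h0
    rw [this, hC _ h0, C_0]

omit [IsDomain Z] [CharZero Z] [Module.IsTorsionFree Z M] [Fintype J] [DecidableEq J] in
theorem mono_mem (E : MvPolynomial J Z →ₐ[Z] Module.End Z M)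
    (hy : ∀ i t, ∀ v ∈ V t, E (X i) v ∈ V (t + 1)) (m : J →₀ ℕ) :
    ∀ t, ∀ v ∈ V t, E (monomial m 1) v ∈ V (t + m.degree) := by
  classical
  have key : ∀ d : ℕ, ∀ m : J →₀ ℕ, m.degree = d → ∀ t, ∀ v ∈ V t, E (monomial m 1) v ∈ V (t + d) := by
    intro d
    induction d with
    | zero =>
      intro m hm t v hv
      rw [Finsupp.degree_eq_zero_iff] at hm
      subst hm
      rw [monomial_zero', C_1, map_one]
      exact hv
    | succ d ih =>
      intro m hm t v hv
      obtain ⟨i, hi⟩ : ∃ i, m i ≠ 0 := by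
        by_contra! hc
        have : m = 0 := by ext i; simp [hc i]
        rw [this, map_zero] at hm
        omega
      have h2 : m - Finsupp.single i 1 + Finsupp.single i 1 = m := by
        ext j
        by_cases hj : i = j
        · subst hj; simp; omega
        · simp [Finsupp.single_apply, hj]
      have h3 : (m - Finsupp.single i 1).degree = d := by
        have := congrArg Finsupp.degree h2
        rw [map_add, Finsupp.degree_single] at this
        omega
      have h4 : (monomial m (1 : Z)) = X i * monomial (m - Finsupp.single i 1) 1 := by
        rw [X, monomial_mul, add_comm, h2, one_mul]
      rw [h4, map_mul, Module.End.mul_apply]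
      exact hy i _ _ (ih _ h3 t v hv)
  exact key _ m rfl

/-- Bernstein's inequality -/
theorem bernstein (hV : Monotone V)
    (hyy : ∀ i j, y i * y j = y j * y i) (hDD : ∀ i j, D i * D j = D j * D i)
    (hDy : ∀ i j, D i * y j = y j * D i + (if i = j then 1 else 0))
    (hy : ∀ i t, ∀ v ∈ V t, y i v ∈ V (t + 1))
    (hD : ∀ i t, ∀ v ∈ V t, D i v ∈ V (t + 1)) {u : M} (hu : u ∈ V 0) (hu0 : u ≠ 0) (m : ℕ) :
    (((m + 1) ^ (2 * Fintype.card J) : ℕ) : ℕ∞) ≤ rk (V (2 * Fintype.card J * m)) *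
      rk (V (2 * (2 * Fintype.card J * m))) := by
  set t := 2 * Fintype.card J * m with ht
  obtain ⟨E, hE⟩ := exists_aeval_comm (Z := Z) y hyy
  obtain ⟨F, hF⟩ := exists_aeval_comm (Z := Z) D hDD
  have hEF : ∀ i j, F (X i) * E (X j) = E (X j) * F (X i) +
      (if i = j then algebraMap Z (Module.End Z M) 1 else 0) := by
    intro i j; rw [hE, hF, map_one]; exact hDy i j
  have hy' : ∀ i t, ∀ v ∈ V t, E (X i) v ∈ V (t + 1) := by
    intro i; rw [hE]; exact hy i
  have hD' : ∀ i t, ∀ v ∈ V t, F (X i) v ∈ V (t + 1) := by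
    intro i; rw [hF]; exact hD i
  by_cases htop : rk (V t) = ⊤
  · have h1 : ((Fintype.card Unit : ℕ) : ℕ∞) ≤ rk (V (2 * t)) :=
      le_rk_of_li (fun _ : Unit => u) (fun _ => hV (Nat.zero_le _) hu) (by
        rw [linearIndependent_unique_iff]; exact hu0)
    have h2 : rk (V (2 * t)) ≠ 0 := by
      intro h; rw [h] at h1; simp at h1
    rw [htop, ENat.top_mul h2]
    exact le_top
  obtain ⟨p, hp⟩ := ENat.ne_top_iff_exists.1 htop
  obtain ⟨v, hv, hmax⟩ := exists_max_li hp.symm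
  have hbox : ((Fintype.card (J ⊕ J → Fin (m + 1)) : ℕ) : ℕ∞) ≤
      rk (restrictDegree (J ⊕ J) Z m) := by
    let ee : (J ⊕ J → Fin (m + 1)) → (J ⊕ J →₀ ℕ) := fun a => Finsupp.equivFunOnFinite.symm (fun i => (a i : ℕ))
    have hinj : Function.Injective ee := by
      intro a b hab
      funext i
      have := DFunLike.congr_fun hab i
      exact Fin.ext this
    refine le_rk_of_li (fun a => monomial (ee a) (1 : Z)) ?_ ?_
    · intro a
      rw [mem_restrictDegree]
      intro s hs i
      have := support_monomial_subset hs
      rw [Finset.mem_singleton] at this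
      subst this
      exact Nat.lt_succ_iff.1 (a i).2
    · have h := (basisMonomials (J ⊕ J) Z).linearIndependent
      rw [coe_basisMonomials] at h
      exact h.comp ee hinj
  have hcard : Fintype.card (J ⊕ J → Fin (m + 1)) = (m + 1) ^ (2 * Fintype.card J) := by
    rw [Fintype.card_fun, Fintype.card_fin, Fintype.card_sum, two_mul]
  rw [← hcard]
  refine hbox.trans ?_
  have hdeg : ∀ P ∈ restrictDegree (J ⊕ J) Z m, ∀ a, coeff a P ≠ 0 → a.degree ≤ t := by
    intro P hP a ha
    rw [mem_restrictDegree] at hP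
    have := hP a (mem_support_iff.2 ha)
    rw [Finsupp.degree_eq_sum]
    calc ∑ i, a i ≤ ∑ i : J ⊕ J, m := Finset.sum_le_sum fun i _ => this i
      _ = t := by rw [Finset.sum_const, Finset.card_univ, Fintype.card_sum, smul_eq_mul, ht, two_mul]
  have hPsi : ∀ P ∈ restrictDegree (J ⊕ J) Z m, ∀ w ∈ V t, Psi E F P w ∈ V (2 * t) := by
    intro P hP w hw
    rw [P.as_sum, map_sum, LinearMap.sum_apply]
    refine Submodule.sum_mem _ fun a ha => ?_
    rw [Psi_monomial, LinearMap.smul_apply, Module.End.mul_apply]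
    refine Submodule.smul_mem _ _ ?_
    have h1 := mono_mem F hD' (a.comapDomain Sum.inr Sum.inr_injective.injOn) _ _ hw
    have h2 := mono_mem E hy' (a.comapDomain Sum.inl Sum.inl_injective.injOn) _ _ h1
    refine hV ?_ h2
    have h3 := hdeg P hP a (mem_support_iff.1 ha)
    rw [Finsupp.degree_eq_sum, Fintype.sum_sum_type] at h3
    rw [Finsupp.degree_eq_sum, Finsupp.degree_eq_sum]
    simp only [Finsupp.comapDomain_apply]
    omega
  rw [← hp]
  refine rk_pi_le _ (fun i => (LinearMap.applyₗ (v i)).comp (Psi E F)) (fun i P hP => hPsi P hP _ (hv i)) ?_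
  intro P hP hz
  refine Psi_kill E F hEF hV hy' hD' hu hu0 t P (hdeg P hP) fun w hw => ?_
  obtain ⟨c, hc, hcw⟩ := hmax w hw
  have h1 : Submodule.span Z (Set.range v) ≤ LinearMap.ker (Psi E F P) := by
    rw [Submodule.span_le]; rintro _ ⟨i, rfl⟩; exact hz i
  have h2 := h1 hcw
  rw [LinearMap.mem_ker, map_smul] at h2
  exact (smul_eq_zero.1 h2).resolve_left hc

end bern
end LCF
end

section
namespace LCF
open Polynomial

theorem growth_arith (r C t0 : ℕ) (h g : ℕ → ℕ∞) (hm : Monotone h)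
    (hb : ∀ m : ℕ, (((m + 1) ^ (2 * r) : ℕ) : ℕ∞) ≤ h (2 * r * m) * h (2 * (2 * r * m)))
    (hg : ∀ t, g t ≤ ((C * (t + 1) ^ r : ℕ) : ℕ∞))
    (ht : ∀ t : ℕ, (t : ℕ∞) * h t ≤ g (2 * t + 2 * t0)) : False := by
  set K := 8 * (r + 1) + 2 * t0 + 1 with hK
  set m := C * K ^ r + 1 with hmdef
  set t := 2 * (r + 1) * m with htdef
  have h1 : (((m + 1) ^ (2 * r) : ℕ) : ℕ∞) ≤ h t * h (2 * t) := by
    refine (hb m).trans (mul_le_mul' (hm ?_) (hm ?_)) <;> rw [htdef] <;> nlinarith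
  have h2 : ((t * (2 * t) * (m + 1) ^ (2 * r) : ℕ) : ℕ∞) ≤
      ((C * (2 * t + 2 * t0 + 1) ^ r * (C * (2 * (2 * t) + 2 * t0 + 1) ^ r) : ℕ) : ℕ∞) := by
    calc ((t * (2 * t) * (m + 1) ^ (2 * r) : ℕ) : ℕ∞) = (t : ℕ∞) * ((2 * t : ℕ) : ℕ∞) * (((m + 1) ^ (2 * r) : ℕ) : ℕ∞) := by
          push_cast; rfl
      _ ≤ (t : ℕ∞) * ((2 * t : ℕ) : ℕ∞) * (h t * h (2 * t)) := by gcongr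
      _ = ((t : ℕ∞) * h t) * (((2 * t : ℕ) : ℕ∞) * h (2 * t)) := by ring
      _ ≤ g (2 * t + 2 * t0) * g (2 * (2 * t) + 2 * t0) := mul_le_mul' (ht _) (ht _)
      _ ≤ _ := by
        rw [Nat.cast_mul]
        exact mul_le_mul' (hg _) (hg _)
  have h3 := Nat.cast_le.1 h2
  have h4 : 2 * t + 2 * t0 + 1 ≤ K * (m + 1) := by rw [htdef, hK]; nlinarith
  have h5 : 2 * (2 * t) + 2 * t0 + 1 ≤ K * (m + 1) := by rw [htdef, hK]; nlinarith
  have h6 : C * (2 * t + 2 * t0 + 1) ^ r * (C * (2 * (2 * t) + 2 * t0 + 1) ^ r) ≤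
      (C * K ^ r) * (C * K ^ r) * (m + 1) ^ (2 * r) := by
    calc _ ≤ C * (K * (m + 1)) ^ r * (C * (K * (m + 1)) ^ r) := by gcongr
      _ = _ := by rw [mul_pow, two_mul r, pow_add]; ring
  have h7 := h3.trans h6
  have h8 := Nat.le_of_mul_le_mul_right h7 (by positivity)
  have h9 : C * K ^ r + 1 ≤ t := by rw [htdef, ← hmdef]; nlinarith
  have h10 := Nat.mul_le_mul h9 h9
  generalize C * K ^ r = q at *
  nlinarith

theorem rk_le_of_sat {Z M : Type*} [CommRing Z] [IsDomain Z] [AddCommGroup M] [Module Z M]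
    {W U : Submodule Z M} (h : ∀ w ∈ W, ∃ c : Z, c ≠ 0 ∧ c • w ∈ U) : rk W ≤ rk U := by
  rw [← rk_map_add_ker W U.mkQ, Submodule.ker_mkQ]
  have : rk (W.map U.mkQ) = 0 := by
    rw [rk, Cardinal.toENat_eq_zero, rank_eq_zero_iff]
    rintro ⟨_, w, hw, rfl⟩
    obtain ⟨c, hc, hcw⟩ := h w hw
    refine ⟨c, hc, Subtype.ext ?_⟩
    change c • U.mkQ w = 0
    rw [← map_smul, Submodule.mkQ_apply, Submodule.Quotient.mk_eq_zero]
    exact hcw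
  rw [this, zero_add]
  exact rk_mono inf_le_right

theorem exists_li_cons {Z M : Type*} [CommRing Z] [IsDomain Z] [AddCommGroup M] [Module Z M] {p : ℕ}
    {v : Fin p → M} (hli : LinearIndependent Z v) {w : M}
    (hc : ∀ c : Z, c ≠ 0 → c • w ∉ Submodule.span Z (Set.range v)) :
    LinearIndependent Z (Fin.cons w v : Fin (p + 1) → M) := by
  rw [Fintype.linearIndependent_iff]
  intro a ha
  rw [Fin.sum_univ_succ] at ha
  simp only [Fin.cons_zero, Fin.cons_succ] at ha
  have h0 : a 0 = 0 := by
    by_contra h0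
    refine hc (a 0) h0 ?_
    rw [eq_neg_of_add_eq_zero_left ha]
    exact Submodule.neg_mem _ (Submodule.sum_mem _ fun i _ => Submodule.smul_mem _ _
      (Submodule.subset_span ⟨i, rfl⟩))
  rw [h0, zero_smul, zero_add] at ha
  intro i
  refine Fin.cases h0 (fun j => ?_) i
  exact Fintype.linearIndependent_iff.1 hli _ ha j

theorem exists_li_in_gens {Z M : Type*} [CommRing Z] [IsDomain Z] [AddCommGroup M] [Module Z M]
    (S : Set M) (p : ℕ) (hp : (p : ℕ∞) ≤ rk (Submodule.span Z S)) :
    ∃ w : Fin p → M, (∀ i, w i ∈ S) ∧ LinearIndependent Z w := by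
  induction p with
  | zero => exact ⟨fun i => i.elim0, fun i => i.elim0, linearIndependent_empty_type⟩
  | succ p ih =>
    obtain ⟨w, hw, hli⟩ := ih (le_trans (by exact_mod_cast Nat.le_succ p) hp)
    by_contra! hcon
    have h1 : ∀ e ∈ S, ∃ c : Z, c ≠ 0 ∧ c • e ∈ Submodule.span Z (Set.range w) := by
      intro e he
      by_contra! hc
      exact hcon (Fin.cons e w) (fun i => Fin.cases he hw i) (exists_li_cons hli hc)
    have h2 : rk (Submodule.span Z S) ≤ rk (Submodule.span Z (Set.range w)) := by
      refine rk_le_of_sat fun e he => ?_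
      induction he using Submodule.span_induction with
      | mem x hx => exact h1 x hx
      | zero => exact ⟨1, one_ne_zero, by rw [smul_zero]; exact Submodule.zero_mem _⟩
      | add x y _ _ hx hy =>
        obtain ⟨c, hc, hx⟩ := hx
        obtain ⟨d, hd, hy⟩ := hy
        refine ⟨c * d, mul_ne_zero hc hd, ?_⟩
        rw [smul_add, mul_comm, mul_smul, mul_comm, mul_smul]
        exact Submodule.add_mem _ (Submodule.smul_mem _ _ hx) (Submodule.smul_mem _ _ hy)
      | smul a x _ hx =>
        obtain ⟨c, hc, hx⟩ := hx
        refine ⟨c, hc, ?_⟩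
        rw [smul_comm]; exact Submodule.smul_mem _ _ hx
    have h3 := hp.trans (h2.trans (rk_span_le w le_rfl))
    rw [Fintype.card_fin] at h3
    exact absurd (Nat.cast_le.1 h3) (by omega)

section
variable {Z : Type*} [CommRing Z] [IsDomain Z] [CharZero Z] {N : Type*} [AddCommGroup N] [Module Z N]
  [Module Z[X] N] [IsScalarTower Z Z[X] N]
  {J : Type*} [Fintype J] [DecidableEq J]

/-- lower bound of the Z-rank by Z[s]-rank -/
theorem rk_poly_le (V : ℕ → Submodule Z N) (hV : Monotone V)
    (hs : ∀ t, ∀ v ∈ V t, (X : Z[X]) • v ∈ V (t + 1))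
    (t a : ℕ) {N' : Type*} [AddCommGroup N'] [Module Z[X] N'] (π : N →ₗ[Z[X]] N')
    (W : Submodule Z[X] N') (hW : W = Submodule.span Z[X] (π '' (V a))) :
    (t : ℕ∞) * rk W ≤ rk (V (a + t)) := by
  have key : ∀ p : ℕ, (p : ℕ∞) ≤ rk W → (t : ℕ∞) * p ≤ rk (V (a + t)) := by
    intro p hp
    obtain ⟨w, hw, hli⟩ : ∃ w : Fin p → N, (∀ i, w i ∈ V a) ∧ LinearIndependent Z[X] (π ∘ w) := by
      rw [hW] at hp
      obtain ⟨w', hw', hli'⟩ := exists_li_in_gens _ p hp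
      choose w hw hww using hw'
      refine ⟨w, hw, ?_⟩
      have : π ∘ w = w' := funext hww
      rw [this]; exact hli'
    have hsm : ∀ n : ℕ, ∀ v ∈ V a, (X ^ n : Z[X]) • v ∈ V (a + n) := by
      intro n v hv
      induction n with
      | zero => simpa using hv
      | succ n ih => rw [pow_succ', mul_smul]; exact hs _ _ ih
    have := le_rk_of_li (W := V (a + t)) (κ := Fin p × Fin t) (fun x => (X ^ (x.2 : ℕ) : Z[X]) • w x.1) 
      (fun x => hV (by omega) (hsm x.2 _ (hw x.1))) (by
        rw [Fintype.linearIndependent_iff]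
        intro g hg
        let P : Fin p → Z[X] := fun i => ∑ j : Fin t, C (g (i, j)) * X ^ (j : ℕ)
        have h0 : ∑ i, P i • (π ∘ w) i = 0 := by
          have := congrArg π hg
          rw [map_zero, map_sum, Fintype.sum_prod_type] at this
          rw [← this]
          refine Finset.sum_congr rfl fun i _ => ?_
          simp only [P]
          rw [Finset.sum_smul]
          refine Finset.sum_congr rfl fun j _ => ?_
          rw [mul_smul, Function.comp, ← map_smul, ← map_smul, ← Polynomial.algebraMap_eq, algebraMap_smul]
        have h1 := Fintype.linearIndependent_iff.1 hli P h0
        rintro ⟨i, j⟩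
        have h2 := congrArg (fun q => coeff q (j : ℕ)) (h1 i)
        simp only [P, finset_sum_coeff, coeff_C_mul, coeff_X_pow, coeff_zero] at h2
        rw [Finset.sum_eq_single j] at h2
        · simpa using h2
        · intro b _ hb
          rw [if_neg (fun h => hb (Fin.ext h.symm)), mul_zero]
        · simp)
    rw [Fintype.card_prod, Fintype.card_fin, Fintype.card_fin] at this
    rw [mul_comm]; exact_mod_cast this
  by_cases htop : rk W = ⊤
  · rcases Nat.eq_zero_or_pos t with rfl | ht
    · simp
    rw [htop, ENat.mul_top (by exact_mod_cast ht.ne')]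
    rw [top_le_iff, ENat.eq_top_iff_forall_ge]
    intro p
    refine le_trans ?_ (key p (by rw [htop]; exact le_top))
    exact_mod_cast Nat.le_mul_of_pos_left p ht
  · obtain ⟨p, hp⟩ := ENat.ne_top_iff_exists.1 htop
    rw [← hp]; exact key p hp.le


theorem not_nontorsion (y D : J → Module.End Z[X] N)
    (hyy : ∀ i j, y i * y j = y j * y i) (hDD : ∀ i j, D i * D j = D j * D i)
    (hDy : ∀ i j, D i * y j = y j * D i + (if i = j then 1 else 0))
    (V : ℕ → Submodule Z N) (hV : Monotone V) (hVex : ∀ v, ∃ t, v ∈ V t)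
    (hs : ∀ t, ∀ v ∈ V t, (X : Z[X]) • v ∈ V (t + 1))
    (hy : ∀ i t, ∀ v ∈ V t, y i v ∈ V (t + 1))
    (hD : ∀ i t, ∀ v ∈ V t, D i v ∈ V (t + 1))
    (C : ℕ) (hC : ∀ t, rk (V t) ≤ ((C * (t + 1) ^ Fintype.card J : ℕ) : ℕ∞)) (u : N) :
    ∃ p : Z[X], p ≠ 0 ∧ p • u = 0 := by
  by_contra! hcon
  let To := Submodule.torsion Z[X] N
  have hst : ∀ (g : Module.End Z[X] N), To ≤ To.comap g := by
    intro g v hv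
    rw [Submodule.mem_comap, Submodule.mem_torsion_iff] at *
    obtain ⟨a, ha⟩ := hv
    refine ⟨a, ?_⟩
    rw [Submonoid.smul_def] at *
    rw [← map_smul, ha, map_zero]
  let q : Module.End Z[X] N → Module.End Z[X] (N ⧸ To) := fun g => To.mapQ To g (hst g)
  have qmul : ∀ g h, q (g * h) = q g * q h := by
    intro g h
    apply Submodule.linearMap_qext
    ext v; rfl
  have qadd : ∀ g h, q (g + h) = q g + q h := by
    intro g h
    apply Submodule.linearMap_qext
    ext v; rfl
  have qif : ∀ i j : J, q (if i = j then 1 else 0) = if i = j then 1 else 0 := by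
    intro i j
    apply Submodule.linearMap_qext
    split_ifs
    · ext v; rfl
    · ext v; rfl
  obtain ⟨t0, ht0⟩ := hVex u
  let W : ℕ → Submodule Z[X] (N ⧸ To) := fun t => Submodule.span Z[X] (To.mkQ '' (V (t + t0)))
  have hW : Monotone W := fun a b hab => Submodule.span_mono (Set.image_mono (hV (by omega)))
  have hWst : ∀ (g : Module.End Z[X] N), (∀ t, ∀ v ∈ V t, g v ∈ V (t + 1)) →
      ∀ t, ∀ v ∈ W t, q g v ∈ W (t + 1) := by
    intro g hg t v hv
    have : W t ≤ (W (t + 1)).comap (q g) := by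
      rw [Submodule.span_le]
      rintro _ ⟨w, hw, rfl⟩
      refine Submodule.subset_span ⟨g w, ?_, rfl⟩
      have := hg _ _ hw
      rw [add_right_comm] at this
      exact this
    exact this hv
  have hb := bernstein (y := fun i => q (y i)) (D := fun i => q (D i)) (V := W) hW
    (fun i j => by rw [← qmul, ← qmul, hyy]) (fun i j => by rw [← qmul, ← qmul, hDD])
    (fun i j => by rw [← qmul, ← qmul, hDy, qadd, qif]) (fun i => hWst _ (hy i)) (fun i => hWst _ (hD i))
    (u := To.mkQ u) (Submodule.subset_span ⟨u, by simpa using ht0, rfl⟩) (by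
      intro h
      rw [Submodule.mkQ_apply, Submodule.Quotient.mk_eq_zero, Submodule.mem_torsion_iff] at h
      obtain ⟨a, ha⟩ := h
      exact hcon a (nonZeroDivisors.ne_zero a.2) ha)
  refine growth_arith (Fintype.card J) C t0 (fun t => rk (W t)) (fun t => rk (V t))
    (fun a b hab => rk_mono (hW hab)) hb hC fun t => ?_
  refine (rk_poly_le V hV hs t (t + t0) To.mkQ (W t) rfl).trans (rk_mono (hV (by omega)))

end
end LCF
end

section
namespace LCF
open Polynomial

/-- coefficientwise derivation, as a function -/
noncomputable def dmapFun {k A : Type*} [CommRing k] [CommRing A] [Algebra k A] (d : Derivation k A A) (p : A[X]) : A[X] :=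
  ∑ i ∈ p.support, monomial i (d (p.coeff i))

theorem coeff_dmapFun {k A : Type*} [CommRing k] [CommRing A] [Algebra k A] (d : Derivation k A A) (p : A[X]) (i : ℕ) :
    (dmapFun d p).coeff i = d (p.coeff i) := by
  rw [dmapFun, finset_sum_coeff]
  simp only [coeff_monomial]
  rw [Finset.sum_ite_eq']
  split_ifs with h
  · rfl
  · rw [notMem_support_iff.1 h, map_zero]

/-- coefficientwise derivation -/
noncomputable def dmap {k A : Type*} [CommRing k] [CommRing A] [Algebra k A] (d : Derivation k A A) :
    Derivation k A[X] A[X] :=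
  Derivation.mk' 
    { toFun := dmapFun d
      map_add' := fun p q => by
        ext i; rw [coeff_add, coeff_dmapFun, coeff_dmapFun, coeff_dmapFun, coeff_add, map_add]
      map_smul' := fun c p => by
        ext i; rw [RingHom.id_apply, coeff_smul, coeff_dmapFun, coeff_dmapFun, coeff_smul, d.map_smul] } (by
    intro p q
    ext n
    change (dmapFun d (p * q)).coeff n = (p * dmapFun d q + q * dmapFun d p).coeff n
    rw [coeff_dmapFun, coeff_mul, map_sum, coeff_add, coeff_mul, mul_comm q, coeff_mul, ← Finset.sum_add_distrib]
    refine Finset.sum_congr rfl fun x _ => ?_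
    rw [Derivation.leibniz, smul_eq_mul, smul_eq_mul, mul_comm (q.coeff _), coeff_dmapFun, coeff_dmapFun])

theorem coeff_dmap {k A : Type*} [CommRing k] [CommRing A] [Algebra k A] (d : Derivation k A A) (p : A[X]) (i : ℕ) :
    (dmap d p).coeff i = d (p.coeff i) := coeff_dmapFun d p i

theorem dmap_monomial {k A : Type*} [CommRing k] [CommRing A] [Algebra k A] (d : Derivation k A A) (i : ℕ) (a : A) :
    dmap d (monomial i a) = monomial i (d a) := by
  ext j
  rw [coeff_dmap, coeff_monomial, coeff_monomial]
  split_ifs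
  · rfl
  · exact map_zero d

section
variable {k Z : Type*} [Field k] [CharZero k] [CommRing Z] [IsDomain Z] [Algebra k Z] {N : Type*} [AddCommGroup N] [Module Z N]
  [Module Z[X] N] [IsScalarTower Z Z[X] N] [Module.IsTorsionFree Z N]
  {J : Type*} [Fintype J] [DecidableEq J] {τ : Type*}

theorem der_smul (dz : Derivation k Z Z) (δ : N →+ N)
    (hδ : ∀ (c : Z) v, δ (c • v) = dz c • v + c • δ v) (hδs : ∀ v, δ ((X : Z[X]) • v) = (X : Z[X]) • δ v)
    (P : Z[X]) : ∀ (v : N), δ (P • v) = (dmap dz P : Z[X]) • v + P • δ v := by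
  induction P using Polynomial.induction_on' with
  | add p q hp hq => intro v; rw [add_smul, map_add, hp, hq, map_add, add_smul, add_smul]; abel
  | monomial n a =>
    have hX : ∀ n : ℕ, ∀ v, δ ((X ^ n : Z[X]) • v) = (X ^ n : Z[X]) • δ v := by
      intro n
      induction n with
      | zero => simp
      | succ n ih => intro v; rw [pow_succ', mul_smul, hδs, ih, mul_smul]
    intro v
    have h1 : ∀ (c : Z) (w : N), (C c : Z[X]) • w = c • w := fun c w => by
      rw [← Polynomial.algebraMap_eq, algebraMap_smul]
    rw [dmap_monomial, ← C_mul_X_pow_eq_monomial, ← C_mul_X_pow_eq_monomial, mul_smul, mul_smul, mul_smul, h1, h1, h1, hδ, hX]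

theorem torsion_case (hpos : ∀ n : ℕ, n ≠ 0 → (n : Z) ≠ 0) (y D : J → Module.End Z[X] N)
    (hyy : ∀ i j, y i * y j = y j * y i) (hDD : ∀ i j, D i * D j = D j * D i)
    (hDy : ∀ i j, D i * y j = y j * D i + (if i = j then 1 else 0))
    (V : ℕ → Submodule Z N) (hV : Monotone V) (hVex : ∀ v, ∃ t, v ∈ V t)
    (hy : ∀ i t, ∀ v ∈ V t, y i v ∈ V (t + 1))
    (hD : ∀ i t, ∀ v ∈ V t, D i v ∈ V (t + 1))
    (C₀ : ℕ) (hC : ∀ t, rk (V t) ≤ ((C₀ * (t + 1) ^ Fintype.card J : ℕ) : ℕ∞))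
    (dz : Derivation k Z Z) (δ : N →+ N) (hVδ : ∀ t, ∀ v ∈ V t, δ v ∈ V (t + 1))
    (hδ : ∀ (c : Z) v, δ (c • v) = dz c • v + c • δ v) (hδs : ∀ v, δ ((X : Z[X]) • v) = (X : Z[X]) • δ v)
    (p : Z[X]) (c : Z)
    (hinj : ∀ v : N, (C c * dmap dz p - C (dz c) * p) • v = 0 → v = 0)
    (u : N) (hu : p • u = 0) : u = 0 := by
  by_contra hu0
  haveI : CharZero Z := charZero_of_inj_zero (fun n hn => by by_contra h; exact hpos n h hn)
  set p' := C c * dmap dz p - C (dz c) * p with hp'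
  let mu : Z[X] →ₐ[Z] Module.End Z N := Algebra.lsmul Z Z N
  have hmu : ∀ P v, mu P v = P • v := fun P v => rfl
  let W : ℕ → Submodule Z N := fun i => LinearMap.ker (mu (p ^ i))
  have hWmem : ∀ i v, v ∈ W i ↔ p ^ i • v = 0 := fun i v => Iff.rfl
  have hCs : ∀ (c : Z) (w : N), (C c : Z[X]) • w = c • w := fun c w => by
      rw [← Polynomial.algebraMap_eq, algebraMap_smul]
  -- main identity
  have key : ∀ i v, p ^ (i + 1) • v = 0 → p ^ (i + 1) • (c • δ v) = -(((i + 1 : ℕ) : Z[X]) • p' • p ^ i • v) := by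
    intro i v hv
    have h1 := der_smul dz δ hδ hδs (p ^ (i + 1)) v
    rw [hv, map_zero, Derivation.leibniz_pow, Nat.add_sub_cancel] at h1
    have h2 : p ^ (i + 1) • (c • δ v) = C c • p ^ (i + 1) • δ v := by
      rw [hCs, smul_comm]
    have h3 : p ^ (i + 1) • δ v = -(((i + 1) • p ^ i • dmap dz p) • v) := by
      rw [eq_neg_iff_add_eq_zero, add_comm]; exact h1.symm
    rw [h2, h3, smul_neg, hp']
    congr 1
    rw [smul_smul, smul_smul, smul_smul]
    have h4 : ((i + 1 : ℕ) : Z[X]) * (p' * p ^ i) = C c * ((i + 1) • p ^ i • dmap dz p) - ((i + 1 : ℕ) : Z[X]) * C (dz c) * p ^ (i + 1) := by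
      rw [hp', nsmul_eq_mul, smul_eq_mul]; ring
    rw [mul_assoc, ← hp', h4, sub_smul, mul_smul (_ * C (dz c)), hv, smul_zero, sub_zero]
  let ρ : ℕ → ℕ → ℕ∞ := fun i t => rk ((V t ⊓ W (i + 1)).map (mu (p ^ i)))
  have hW1 : ∀ i t, rk (V t ⊓ W (i + 1)) = ρ i t + rk (V t ⊓ W i) := by
    intro i t
    rw [← rk_map_add_ker (V t ⊓ W (i + 1)) (mu (p ^ i))]
    congr 2
    ext v
    constructor
    · rintro ⟨⟨h1, h2⟩, h3⟩; exact ⟨h1, h3⟩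
    · rintro ⟨h1, h3⟩
      refine ⟨⟨h1, ?_⟩, h3⟩
      rw [SetLike.mem_coe, hWmem] at h3 ⊢
      rw [pow_succ', mul_smul, h3, smul_zero]
  have hρ1 : ∀ i t, ρ i t ≤ ρ (i + 1) (t + 1) := by
    intro i t
    have h1 := rk_map_inj ((V t ⊓ W (i + 1)).map (mu (p ^ i))) (mu (((i + 1 : ℕ) : Z[X]) * p')) (by
      intro v _ hv
      rw [hmu, mul_smul] at hv
      refine hinj v ?_
      have : ((i + 1 : ℕ) : Z[X]) = C ((i + 1 : ℕ) : Z) := by simp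
      rw [this, hCs] at hv
      exact (smul_eq_zero.1 hv).resolve_left (hpos _ (Nat.succ_ne_zero i)))
    simp only [ρ]
    rw [← h1]
    refine rk_mono ?_
    rintro _ ⟨_, ⟨v, ⟨hv1, hv2⟩, rfl⟩, rfl⟩
    have hv2' := (hWmem _ _).1 hv2
    have h2 := key i v hv2'
    refine ⟨-(c • δ v), ⟨?_, ?_⟩, ?_⟩
    · exact Submodule.neg_mem _ (Submodule.smul_mem _ _ (hVδ t v hv1))
    · rw [SetLike.mem_coe, hWmem, pow_succ', mul_smul, smul_neg, h2, neg_neg]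
      have : p * (((i + 1 : ℕ) : Z[X]) * (p' * p ^ i)) = (((i + 1 : ℕ) : Z[X]) * p') * p ^ (i + 1) := by ring
      rw [smul_smul p', smul_smul ((i + 1 : ℕ) : Z[X]), smul_smul p, this, mul_smul, hv2', smul_zero]
    · rw [hmu, hmu, hmu, smul_neg, h2, neg_neg, mul_smul]
  have hρmono : ∀ i, Monotone (ρ i) := fun i a b hab => rk_mono (Submodule.map_mono (inf_le_inf_right _ (hV hab)))
  have hρ0 : ∀ i t, ρ 0 t ≤ ρ i (t + i) := by
    intro i t
    induction i with
    | zero => exact le_rfl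
    | succ i ih => exact ih.trans (hρ1 i (t + i))
  have hρ00 : ∀ t, ρ 0 t = rk (V t ⊓ W 1) := by
    intro t
    rw [hW1 0 t]
    have : rk (V t ⊓ W 0) = 0 := by
      have : V t ⊓ W 0 = ⊥ := by
        rw [eq_bot_iff]; rintro v ⟨_, h2⟩
        rw [SetLike.mem_coe, hWmem, pow_zero, one_smul] at h2; exact h2
      rw [this]; simp [rk]
    rw [this, add_zero]
  obtain ⟨t0, ht0⟩ := hVex u
  have hsum : ∀ (t n : ℕ), (n : ℕ∞) * ρ 0 t ≤ rk (V (t + n) ⊓ W n) := by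
    intro t n
    have : ∀ i ≤ n, (i : ℕ∞) * ρ 0 t ≤ rk (V (t + n) ⊓ W i) := by
      intro i
      induction i with
      | zero => simp
      | succ i ih =>
        intro hi
        rw [hW1]
        push_cast
        rw [add_mul, one_mul, add_comm]
        refine add_le_add ((hρ0 i t).trans (hρmono i (by omega))) (ih (by omega))
    exact this n le_rfl
  have rs : ∀ g h : Module.End Z[X] N, (g * h).restrictScalars Z = g.restrictScalars Z * h.restrictScalars Z :=
    fun _ _ => rfl
  have hst : ∀ (g : Module.End Z[X] N), (∀ t, ∀ v ∈ V t, g v ∈ V (t + 1)) →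
      ∀ t, ∀ v ∈ V (t + t0) ⊓ W 1, g.restrictScalars Z v ∈ V (t + 1 + t0) ⊓ W 1 := by
    rintro g hg t v ⟨h1, h2⟩
    refine ⟨?_, ?_⟩
    · have := hg _ _ h1; rw [add_right_comm] at this; exact this
    · rw [SetLike.mem_coe, hWmem] at h2 ⊢
      rw [LinearMap.restrictScalars_apply, ← map_smul, h2, map_zero]
  have hVW : Monotone (fun t => V (t + t0) ⊓ W 1) := fun a b hab => inf_le_inf_right _ (hV (by omega))
  have hb := bernstein (Z := Z) (y := fun i => (y i).restrictScalars Z) (D := fun i => (D i).restrictScalars Z)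
    (V := fun t => V (t + t0) ⊓ W 1) hVW
    (fun i j => by rw [← rs, ← rs, hyy]) (fun i j => by rw [← rs, ← rs, hDD])
    (fun i j => by
      rw [← rs, ← rs, hDy]
      split_ifs <;> rfl) (fun i => hst _ (hy i)) (fun i => hst _ (hD i))
    (u := u) ⟨by simpa using ht0, by rw [SetLike.mem_coe, hWmem, pow_one]; exact hu⟩ hu0
  refine growth_arith (Fintype.card J) C₀ t0 (fun t => rk (V (t + t0) ⊓ W 1)) (fun t => rk (V t))
    (fun a b hab => rk_mono (hVW hab)) hb hC fun t => ?_
  rw [← hρ00]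
  exact (hsum _ t).trans (rk_mono (inf_le_left.trans (hV (by omega))))

theorem core_abs' (y D : J → Module.End Z[X] N)
    (hyy : ∀ i j, y i * y j = y j * y i) (hDD : ∀ i j, D i * D j = D j * D i)
    (hDy : ∀ i j, D i * y j = y j * D i + (if i = j then 1 else 0))
    (V : ℕ → Submodule Z N) (hV : Monotone V) (hVex : ∀ v, ∃ t, v ∈ V t)
    (hs : ∀ t, ∀ v ∈ V t, (X : Z[X]) • v ∈ V (t + 1))
    (hy : ∀ i t, ∀ v ∈ V t, y i v ∈ V (t + 1))
    (hD : ∀ i t, ∀ v ∈ V t, D i v ∈ V (t + 1))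
    (C₀ : ℕ) (hC : ∀ t, rk (V t) ≤ ((C₀ * (t + 1) ^ Fintype.card J : ℕ) : ℕ∞))
    (dz : τ → Derivation k Z Z) (δ : τ → N →+ N) (hVδ : ∀ z t, ∀ v ∈ V t, δ z v ∈ V (t + 1))
    (hδ : ∀ z (c : Z) v, δ z (c • v) = dz z c • v + c • δ z v)
    (hδs : ∀ z v, δ z ((X : Z[X]) • v) = (X : Z[X]) • δ z v)
    (hconst : ∀ c h : Z, c ≠ 0 → (∀ z, c * dz z h = h * dz z c) → ∃ a : k, h = algebraMap k Z a * c)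
    (hks : ∀ q : k[X], q ≠ 0 → ∀ v : N, q.map (algebraMap k Z) • v = 0 → v = 0) (u : N) : u = 0 := by
  classical
  haveI : CharZero Z := charZero_of_injective_algebraMap (algebraMap k Z).injective
  by_contra hu0
  have hCs : ∀ (c : Z) (w : N), (C c : Z[X]) • w = c • w := fun c w => by
      rw [← Polynomial.algebraMap_eq, algebraMap_smul]
  have hex : ∃ n, ∃ p : Z[X], p.natDegree = n ∧ p ≠ 0 ∧ ∃ v : N, v ≠ 0 ∧ p • v = 0 := by
    obtain ⟨p, hp, hpu⟩ := not_nontorsion y D hyy hDD hDy V hV hVex hs hy hD C₀ hC u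
    exact ⟨_, p, rfl, hp, u, hu0, hpu⟩
  obtain ⟨p, hpn, hp0, v, hv0, hpv⟩ := Nat.find_spec hex
  have hmin : ∀ q : Z[X], q ≠ 0 → q.natDegree < p.natDegree → ∀ w : N, q • w = 0 → w = 0 := by
    intro q hq hlt w hw
    by_contra hw0
    rw [hpn] at hlt
    exact Nat.find_min hex hlt ⟨q, rfl, hq, w, hw0, hw⟩
  have hpos : 0 < p.natDegree := by
    rw [Nat.pos_iff_ne_zero]
    intro h0
    rw [natDegree_eq_zero] at h0
    obtain ⟨c, rfl⟩ := h0
    rw [hCs] at hpv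
    rcases smul_eq_zero.1 hpv with h | h
    · rw [h, C_0] at hp0; exact hp0 rfl
    · exact hv0 h
  set c := p.leadingCoeff with hc
  have hc0 : c ≠ 0 := leadingCoeff_ne_zero.2 hp0
  by_cases hall : ∀ z, C c * dmap (dz z) p - C (dz z c) * p = 0
  · have h1 : ∀ i, ∃ a : k, p.coeff i = algebraMap k Z a * c := by
      intro i
      refine hconst c _ hc0 fun z => ?_
      have := congrArg (fun q => coeff q i) (hall z)
      simp only [coeff_sub, coeff_C_mul, coeff_dmap, coeff_zero] at this
      rw [sub_eq_zero] at this
      rw [this, mul_comm]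
    choose a ha using h1
    let q : k[X] := ∑ i ∈ Finset.range (p.natDegree + 1), C (a i) * X ^ i
    have hq : p = C c * q.map (algebraMap k Z) := by
      rw [p.as_sum_range_C_mul_X_pow]
      simp only [q, Polynomial.map_sum, Polynomial.map_mul, Polynomial.map_pow, map_C, map_X]
      rw [Finset.mul_sum]
      refine Finset.sum_congr rfl fun i _ => ?_
      rw [ha i, C_mul, mul_comm (C _) (C c), mul_assoc]
    have hq0 : q ≠ 0 := by
      intro h; rw [h, Polynomial.map_zero, mul_zero] at hq; exact hp0 hq
    rw [hq, mul_smul, hCs] at hpv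
    exact hv0 (hks q hq0 v ((smul_eq_zero.1 hpv).resolve_left hc0))
  · push Not at hall
    obtain ⟨z, hz⟩ := hall
    refine hv0 (torsion_case (fun n hn => Nat.cast_ne_zero.2 hn) y D hyy hDD hDy V hV hVex hy hD C₀ hC
      (dz z) (δ z) (hVδ z) (hδ z) (hδs z) p c (fun w hw => hmin _ hz ?_ w hw) v hpv)
    have hle : (C c * dmap (dz z) p - C (dz z c) * p).natDegree ≤ p.natDegree := by
      rw [natDegree_le_iff_coeff_eq_zero]
      intro i hi
      rw [coeff_sub, coeff_C_mul, coeff_C_mul, coeff_dmap, coeff_eq_zero_of_natDegree_lt hi, map_zero, mul_zero, mul_zero, sub_zero]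
    refine lt_of_le_of_ne hle fun heq => ?_
    have h0 : (C c * dmap (dz z) p - C (dz z c) * p).coeff p.natDegree = 0 := by
      rw [coeff_sub, coeff_C_mul, coeff_C_mul, coeff_dmap, coeff_natDegree, ← hc, mul_comm, sub_self]
    rw [← heq, coeff_natDegree, leadingCoeff_eq_zero] at h0
    exact hz h0

end
end LCF
end

section
namespace LCF
open Polynomial

section
variable {k Z : Type*} [Field k] [CharZero k] [CommRing Z] [IsDomain Z] [Algebra k Z] {N : Type*} [AddCommGroup N] [Module Z N]
  [Module.IsTorsionFree Z N]
  {J : Type*} [Fintype J] [DecidableEq J] {τ : Type*}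

theorem core_abs (s : Module.End Z N) (y D : J → Module.End Z N)
    (hsy : ∀ i, s * y i = y i * s) (hsD : ∀ i, s * D i = D i * s)
    (hyy : ∀ i j, y i * y j = y j * y i) (hDD : ∀ i j, D i * D j = D j * D i)
    (hDy : ∀ i j, D i * y j = y j * D i + (if i = j then 1 else 0))
    (V : ℕ → Submodule Z N) (hV : Monotone V) (hVex : ∀ v, ∃ t, v ∈ V t)
    (hs : ∀ t, ∀ v ∈ V t, s v ∈ V (t + 1))
    (hy : ∀ i t, ∀ v ∈ V t, y i v ∈ V (t + 1))
    (hD : ∀ i t, ∀ v ∈ V t, D i v ∈ V (t + 1))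
    (C₀ : ℕ) (hC : ∀ t, rk (V t) ≤ ((C₀ * (t + 1) ^ Fintype.card J : ℕ) : ℕ∞))
    (dz : τ → Derivation k Z Z) (δ : τ → N →+ N) (hVδ : ∀ z t, ∀ v ∈ V t, δ z v ∈ V (t + 1))
    (hδ : ∀ z (c : Z) v, δ z (c • v) = dz z c • v + c • δ z v)
    (hδs : ∀ z v, δ z (s v) = s (δ z v))
    (hconst : ∀ c h : Z, c ≠ 0 → (∀ z, c * dz z h = h * dz z c) → ∃ a : k, h = algebraMap k Z a * c)
    (hks : ∀ q : k[X], q ≠ 0 → ∀ v : N, aeval s (q.map (algebraMap k Z)) v = 0 → v = 0) (u : N) : u = 0 := by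
  letI : Module Z[X] N := Module.compHom N (aeval s : Z[X] →ₐ[Z] Module.End Z N).toRingHom
  have hsm : ∀ (P : Z[X]) (v : N), P • v = aeval s P v := fun P v => rfl
  haveI : IsScalarTower Z Z[X] N := ⟨fun c P v => by rw [hsm, hsm, map_smul]; rfl⟩
  have hX : ∀ v : N, (X : Z[X]) • v = s v := fun v => by rw [hsm, aeval_X]
  have hcm : ∀ g : Module.End Z N, s * g = g * s → ∀ (P : Z[X]) v, g (P • v) = P • g v := by
    intro g hg P v
    have : Commute g (aeval s P) := by
      induction P using Polynomial.induction_on' with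
      | add p q hp hq => rw [map_add]; exact hp.add_right hq
      | monomial n a =>
        rw [aeval_monomial]
        exact (show Commute g _ from (Algebra.commutes a g).symm).mul_right ((show Commute g s from hg.symm).pow_right n)
    exact LinearMap.congr_fun this v
  let lft : (g : Module.End Z N) → (s * g = g * s) → Module.End Z[X] N := fun g hg =>
    { toFun := g, map_add' := map_add g, map_smul' := fun P v => hcm g hg P v }
  refine core_abs' (k := k) (fun i => lft (y i) (hsy i)) (fun i => lft (D i) (hsD i)) ?_ ?_ ?_ V hV hVex
    (fun t v hv => by rw [hX]; exact hs t v hv) hy hD C₀ hC dz δ hVδ hδ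
    (fun z v => by rw [hX, hX, hδs]) hconst (fun q hq v hv => hks q hq v hv) u
  · intro i j
    ext v; exact LinearMap.congr_fun (hyy i j) v
  · intro i j
    ext v; exact LinearMap.congr_fun (hDD i j) v
  · intro i j
    ext v
    have := LinearMap.congr_fun (hDy i j) v
    split_ifs at this ⊢ <;> exact this

theorem core_Q (s T : Module.End Z N) (y D : J → Module.End Z N)
    (hTs : ∀ v, T (s v) = s (T v) + T v)
    (hTy : ∀ i, T * y i = y i * T) (hTD : ∀ i, T * D i = D i * T)
    (hsy : ∀ i, s * y i = y i * s) (hsD : ∀ i, s * D i = D i * s)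
    (hyy : ∀ i j, y i * y j = y j * y i) (hDD : ∀ i j, D i * D j = D j * D i)
    (hDy : ∀ i j, D i * y j = y j * D i + (if i = j then 1 else 0))
    (V : ℕ → Submodule Z N) (hV : Monotone V) (hVex : ∀ v, ∃ t, v ∈ V t)
    (hVT : ∀ t, V t ≤ (V (t + 1)).map T)
    (hs : ∀ t, ∀ v ∈ V t, s v ∈ V (t + 1))
    (hy : ∀ i t, ∀ v ∈ V t, y i v ∈ V (t + 1))
    (hD : ∀ i t, ∀ v ∈ V t, D i v ∈ V (t + 1))
    (C₀ : ℕ) (hC : ∀ t, rk (V t) ≤ ((C₀ * (t + 1) ^ (Fintype.card J + 1) : ℕ) : ℕ∞))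
    (dz : τ → Derivation k Z Z) (δ : τ → N →+ N) (hVδ : ∀ z t, ∀ v ∈ V t, δ z v ∈ V (t + 1))
    (hTδ : ∀ z v, T (δ z v) = δ z (T v))
    (hδ : ∀ z (c : Z) v, δ z (c • v) = dz z c • v + c • δ z v)
    (hδs : ∀ z v, δ z (s v) = s (δ z v))
    (hconst : ∀ c h : Z, c ≠ 0 → (∀ z, c * dz z h = h * dz z c) → ∃ a : k, h = algebraMap k Z a * c)
    (hks : ∀ q : k[X], q ≠ 0 → ∀ v : N, aeval s (q.map (algebraMap k Z)) v = 0 → v = 0)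
    (u : N) (hu : T u = 0) : u = 0 := by
  let K := LinearMap.ker T
  have rst : ∀ g : Module.End Z N, T * g = g * T → ∀ v ∈ K, g v ∈ K := by
    intro g hg v hv
    have := LinearMap.congr_fun hg v
    change T (g v) = g (T v) at this
    change T (g v) = 0
    rw [this, LinearMap.mem_ker.1 hv, map_zero]
  have sK : ∀ v ∈ K, s v ∈ K := by
    intro v hv
    change T (s v) = 0
    rw [hTs, LinearMap.mem_ker.1 hv, map_zero, add_zero]
  let W : ℕ → Submodule Z K := fun t => (V t).comap K.subtype
  have hWrk : ∀ t, rk (W t) = rk (V t ⊓ K) := by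
    intro t
    rw [← rk_map_inj (W t) K.subtype (fun x _ hx => Subtype.ext hx)]
    congr 1
    rw [Submodule.map_comap_subtype, inf_comm]
  have hstep : ∀ t, rk (W (t + 1)) + rk (V t) ≤ rk (V (t + 1)) := by
    intro t
    rw [hWrk, ← rk_map_add_ker (V (t + 1)) T, add_comm]
    exact add_le_add (rk_mono (hVT t)) le_rfl
  have hWm : Monotone W := fun a b hab => Submodule.comap_mono (hV hab)
  have hmul : ∀ t n : ℕ, (n : ℕ∞) * rk (W t) ≤ rk (V (t + n)) := by
    intro t n
    induction n with
    | zero => simp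
    | succ n ih =>
      refine le_trans ?_ (hstep (t + n))
      push_cast
      rw [add_mul, one_mul, add_comm]
      exact add_le_add (rk_mono (hWm (by omega))) ih
  have hWC : ∀ t, rk (W t) ≤ ((C₀ * 2 ^ (Fintype.card J + 1) * (t + 1) ^ Fintype.card J : ℕ) : ℕ∞) := by
    intro t
    have h1 := (hmul t (t + 1)).trans (hC _)
    by_cases htop : rk (W t) = ⊤
    · rw [htop, ENat.mul_top (by exact_mod_cast Nat.succ_ne_zero t)] at h1
      exact absurd h1 (by simp only [top_le_iff]; exact ENat.coe_ne_top _)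
    · obtain ⟨p, hp⟩ := ENat.ne_top_iff_exists.1 htop
      rw [← hp] at h1 ⊢
      rw [← Nat.cast_mul, Nat.cast_le] at h1
      rw [Nat.cast_le]
      refine Nat.le_of_mul_le_mul_left (h1.trans (le_of_eq ?_)) (Nat.succ_pos t)
      have : t + (t + 1) + 1 = 2 * (t + 1) := by ring
      rw [this, mul_pow, pow_succ (t + 1)]; ring
  have hpol : ∀ (P : Z[X]) (v : K), ((aeval (s.restrict sK) P v : K) : N) = aeval s P (v : N) := by
    intro P
    induction P using Polynomial.induction_on' with
    | add p q hp hq => intro v; simp only [map_add, LinearMap.add_apply, Submodule.coe_add, hp, hq]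
    | monomial n a =>
      intro v
      have : ∀ n : ℕ, ∀ v : K, ((((s.restrict sK) ^ n) v : K) : N) = (s ^ n) (v : N) := by
        intro n
        induction n with
        | zero => intro v; rfl
        | succ n ih =>
          intro v
          rw [pow_succ, pow_succ, Module.End.mul_apply, Module.End.mul_apply, ih]; rfl
      rw [aeval_monomial, aeval_monomial, Module.End.mul_apply, Module.End.mul_apply, ← this]; rfl
  have := core_abs (k := k) (N := K) (s.restrict sK) (fun i => (y i).restrict (rst _ (hTy i)))
    (fun i => (D i).restrict (rst _ (hTD i)))
    (fun i => by ext v; exact LinearMap.congr_fun (hsy i) (v : N))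
    (fun i => by ext v; exact LinearMap.congr_fun (hsD i) (v : N))
    (fun i j => by ext v; exact LinearMap.congr_fun (hyy i j) (v : N))
    (fun i j => by ext v; exact LinearMap.congr_fun (hDD i j) (v : N))
    (fun i j => by
      ext v
      have := LinearMap.congr_fun (hDy i j) (v : N)
      split_ifs at this ⊢ <;> exact this)
    W hWm (fun v => hVex v) (fun t v hv => hs t _ hv) (fun i t v hv => hy i t _ hv)
    (fun i t v hv => hD i t _ hv) _ hWC dz
    (fun z => 
      { toFun := fun v => ⟨δ z v, by
          change T (δ z v) = 0
          rw [hTδ, LinearMap.mem_ker.1 v.2, map_zero]⟩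
        map_zero' := Subtype.ext (map_zero (δ z))
        map_add' := fun a b => Subtype.ext (map_add (δ z) (a : N) b) })
    (fun z t v hv => hVδ z t _ hv)
    (fun z c v => Subtype.ext (hδ z c v)) (fun z v => Subtype.ext (hδs z v)) hconst
    (fun q hq v hv => Subtype.ext (hks q hq v (by rw [← hpol, hv]; rfl))) ⟨u, hu⟩
  exact congrArg Subtype.val this

end
end LCF
end

section
namespace LCF
open Polynomial

section derext
variable {k R L : Type*} [CommRing k] [CommRing R] [CommRing L] [Algebra k R] [Algebra R L] [Algebra k L]
  [IsScalarTower k R L]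

theorem exists_der_ext (M : Submonoid R) [IsLocalization M L] (δ : Derivation k R R) :
    ∃ δ' : Derivation k L L, ∀ r, δ' (algebraMap R L r) = algebraMap R L (δ r) := by
  let g : R →+* TrivSqZeroExt L L :=
    { toFun := fun r => TrivSqZeroExt.inl (algebraMap R L r) + TrivSqZeroExt.inr (algebraMap R L (δ r))
      map_one' := by simp
      map_zero' := by simp
      map_add' := fun a b => by ext <;> simp [Algebra.smul_def]
      map_mul' := fun a b => by
        ext
        · simp
        · simp [mul_comm]
          simp only [Algebra.smul_def]; ring }
  have hg : ∀ m : M, IsUnit (g m) := by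
    intro m
    rw [TrivSqZeroExt.isUnit_iff_isUnit_fst]
    simp only [g, RingHom.coe_mk, MonoidHom.coe_mk, OneHom.coe_mk]
    simpa using IsLocalization.map_units L m
  let G : L →+* TrivSqZeroExt L L := IsLocalization.lift (M := M) hg
  have hG : ∀ r, G (algebraMap R L r) = g r := fun r => IsLocalization.lift_eq hg r
  have hfst : ∀ x, (G x).fst = x := by
    have : (TrivSqZeroExt.fstHom L L L).toRingHom.comp G = RingHom.id L := by
      refine IsLocalization.ringHom_ext M ?_
      ext r
      change (G (algebraMap R L r)).fst = _
      rw [hG]; simp [g]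
    exact fun x => RingHom.congr_fun this x
  have hsnd : ∀ r, (G (algebraMap R L r)).snd = algebraMap R L (δ r) := by
    intro r; rw [hG]; simp [g]; simp only [Algebra.smul_def, mul_one]
  refine ⟨Derivation.mk' 
    { toFun := fun x => (G x).snd
      map_add' := fun a b => by simp
      map_smul' := fun c x => by
        have h1 : (G (algebraMap k L c)).snd = 0 := by
          rw [IsScalarTower.algebraMap_apply k R L, hsnd, Derivation.map_algebraMap, map_zero]
        simp only [RingHom.id_apply]
        rw [Algebra.smul_def, map_mul, TrivSqZeroExt.snd_mul, h1, hfst, hfst, smul_zero, add_zero, smul_eq_mul, Algebra.smul_def] } ?_, hsnd⟩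
  intro a b
  simp only [LinearMap.coe_mk, AddHom.coe_mk]
  rw [map_mul, TrivSqZeroExt.snd_mul, hfst, hfst]
  simp [mul_comm]

theorem der_ext_unique (M : Submonoid R) [IsLocalization M L] (d d' : Derivation k L L)
    (h : ∀ r : R, d (algebraMap R L r) = d' (algebraMap R L r)) : d = d' := by
  ext x
  obtain ⟨⟨a, m⟩, hx⟩ := IsLocalization.surj M x
  simp only at hx
  have h1 := congrArg d hx
  have h2 := congrArg d' hx
  rw [Derivation.leibniz] at h1 h2
  rw [h, h, ← h2] at h1
  have h3 := add_left_cancel h1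
  simp only [smul_eq_mul] at h3
  exact (IsLocalization.map_units L m).mul_left_cancel h3

end derext

section bs
variable {k R : Type*} (L : Type*) [Field k] [CommRing R] [CommRing L] [Algebra k R] [Algebra R L] [Algebra k L]
  [IsScalarTower k R L] (f : R) [IsLocalization.Away f L]

/-- extension of a derivation to the localization -/
noncomputable def dl (δ : Derivation k R R) : Derivation k L L :=
  (exists_der_ext (Submonoid.powers f) δ).choose

theorem dl_alg (δ : Derivation k R R) (r : R) : dl L f δ (algebraMap R L r) = algebraMap R L (δ r) :=
  (exists_der_ext (L := L) (Submonoid.powers f) δ).choose_spec r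

/-- the inverse of f -/
noncomputable def fi : L := IsLocalization.Away.invSelf f

theorem f_fi : algebraMap R L f * fi L f = 1 := IsLocalization.Away.mul_invSelf f

theorem dl_fi (δ : Derivation k R R) : dl L f δ (fi L f) = - (fi L f * fi L f * algebraMap R L (δ f)) := by
  have h := congrArg (dl L f δ) (f_fi L f)
  rw [Derivation.leibniz, Derivation.map_one_eq_zero, dl_alg, smul_eq_mul, smul_eq_mul] at h
  have h2 := congrArg (fun t => fi L f * t) h
  simp only [mul_add, mul_zero, ← mul_assoc] at h2
  rw [mul_comm (fi L f) (algebraMap R L f), f_fi, one_mul] at h2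
  exact eq_neg_of_add_eq_zero_left h2

/-- the twisted connection -/
noncomputable def nab (δ : Derivation k R R) : L[X] →+ L[X] where
  toFun g := dmap (dl L f δ) g + X * (C (algebraMap R L (δ f) * fi L f) * g)
  map_zero' := by simp
  map_add' a b := by rw [map_add]; ring

theorem nab_apply (δ : Derivation k R R) (g : L[X]) :
    nab L f δ g = dmap (dl L f δ) g + X * (C (algebraMap R L (δ f) * fi L f) * g) := rfl

theorem dmap_C {A : Type*} [CommRing A] [Algebra k A] (d : Derivation k A A) (a : A) : dmap d (C a) = C (d a) := by
  rw [← monomial_zero_left, dmap_monomial, monomial_zero_left]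

theorem dmap_X {A : Type*} [CommRing A] [Algebra k A] (d : Derivation k A A) : dmap d (X : A[X]) = 0 := by
  rw [← monomial_one_one_eq_X, dmap_monomial, Derivation.map_one_eq_zero, monomial_zero_right]

theorem dmap_comp {A : Type*} [CommRing A] [Algebra k A] (d : Derivation k A A) (w : A[X]) (hw : dmap d w = 0) (g : A[X]) :
    dmap d (g.comp w) = (dmap d g).comp w := by
  induction g using Polynomial.induction_on' with
  | add p q hp hq => simp only [add_comp, map_add, hp, hq]
  | monomial n a =>
    rw [dmap_monomial, monomial_comp, monomial_comp, Derivation.leibniz, Derivation.leibniz_pow, hw, dmap_C]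
    simp [mul_comm]

theorem nab_C_mul (δ : Derivation k R R) (a : L) (g : L[X]) :
    nab L f δ (C a * g) = C (dl L f δ a) * g + C a * nab L f δ g := by
  rw [nab_apply, nab_apply, Derivation.leibniz, dmap_C, smul_eq_mul, smul_eq_mul]; ring

theorem nab_X_mul (δ : Derivation k R R) (g : L[X]) : nab L f δ (X * g) = X * nab L f δ g := by
  rw [nab_apply, nab_apply, Derivation.leibniz, dmap_X, smul_eq_mul, smul_zero]; ring

/-- the shift -/
noncomputable def TT : L[X] →+ L[X] where
  toFun g := C (algebraMap R L f) * g.comp (X + 1)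
  map_zero' := by simp
  map_add' a b := by rw [add_comp]; ring

/-- the inverse shift -/
noncomputable def TI : L[X] →+ L[X] where
  toFun g := C (fi L f) * g.comp (X - 1)
  map_zero' := by simp
  map_add' a b := by rw [add_comp]; ring

theorem TT_apply (g : L[X]) : TT L f g = C (algebraMap R L f) * g.comp (X + 1) := rfl
theorem TI_apply (g : L[X]) : TI L f g = C (fi L f) * g.comp (X - 1) := rfl

theorem TT_TI (g : L[X]) : TT L f (TI L f g) = g := by
  rw [TT_apply, TI_apply, mul_comp, C_comp, ← mul_assoc, ← C_mul, f_fi, C_1, one_mul, comp_assoc]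
  simp

theorem TI_TT (g : L[X]) : TI L f (TT L f g) = g := by
  rw [TT_apply, TI_apply, mul_comp, C_comp, ← mul_assoc, ← C_mul, mul_comm, mul_comm (fi L f), f_fi, C_1, mul_one, comp_assoc]
  simp

theorem TT_C_mul (a : L) (g : L[X]) : TT L f (C a * g) = C a * TT L f g := by
  rw [TT_apply, TT_apply, mul_comp, C_comp]; ring

theorem TI_C_mul (a : L) (g : L[X]) : TI L f (C a * g) = C a * TI L f g := by
  rw [TI_apply, TI_apply, mul_comp, C_comp]; ring

theorem TT_X_mul (g : L[X]) : TT L f (X * g) = X * TT L f g + TT L f g := by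
  rw [TT_apply, TT_apply, mul_comp, X_comp]; ring

theorem TI_X_mul (g : L[X]) : TI L f (X * g) = X * TI L f g - TI L f g := by
  rw [TI_apply, TI_apply, mul_comp, X_comp]; ring

theorem TT_nab (δ : Derivation k R R) (g : L[X]) : TT L f (nab L f δ g) = nab L f δ (TT L f g) := by
  have h1 : dmap (dl L f δ) (X + 1) = 0 := by rw [map_add, dmap_X, Derivation.map_one_eq_zero, add_zero]
  rw [nab_apply, nab_apply, map_add, TT_X_mul, TT_C_mul, TT_apply L f (dmap _ g), ← dmap_comp _ _ h1, TT_apply L f g,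
    Derivation.leibniz, dmap_C, dl_alg, smul_eq_mul, smul_eq_mul]
  have h2 : C (algebraMap R L (δ f) * fi L f) * (C (algebraMap R L f) * g.comp (X + 1)) =
      g.comp (X + 1) * C (algebraMap R L (δ f)) := by
    rw [← mul_assoc, ← C_mul, mul_assoc, mul_comm (fi L f), f_fi, mul_one, mul_comm]
  rw [h2]; ring

theorem TI_nab (δ : Derivation k R R) (g : L[X]) : TI L f (nab L f δ g) = nab L f δ (TI L f g) := by
  have := TT_nab L f δ (TI L f g)
  rw [TT_TI] at this
  rw [← this, TI_TT]

/-- elements of order at most `A` over `v`. -/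
inductive Ord (k : Type*) {R : Type*} (L : Type*) [Field k] [CommRing R] [CommRing L] [Algebra k R] [Algebra R L] [Algebra k L]
    [IsScalarTower k R L] (f : R) [IsLocalization.Away f L] (v : L[X]) : ℕ → L[X] → Prop
  | base (A : ℕ) : Ord k L f v A v
  | add (A : ℕ) (a b : L[X]) : Ord k L f v A a → Ord k L f v A b → Ord k L f v A (a + b)
  | smul (A : ℕ) (r : R) (a : L[X]) : Ord k L f v A a → Ord k L f v A (C (algebraMap R L r) * a)
  | X_mul (A : ℕ) (a : L[X]) : Ord k L f v A a → Ord k L f v A (X * a)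
  | nab (A : ℕ) (δ : Derivation k R R) (a : L[X]) : Ord k L f v A a → Ord k L f v (A + 1) (nab L f δ a)
  | succ (A : ℕ) (a : L[X]) : Ord k L f v A a → Ord k L f v (A + 1) a

variable {L f}

theorem Ord.mono {v a : L[X]} {A B : ℕ} (h : A ≤ B) (ha : Ord k L f v A a) : Ord k L f v B a := by
  induction h with
  | refl => exact ha
  | step _ ih => exact Ord.succ _ _ ih

theorem Ord.TT {v a : L[X]} {A : ℕ} (ha : Ord k L f v A a) : Ord k L f (TT L f v) A (TT L f a) := by
  induction ha with
  | base A => exact Ord.base A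
  | add A a b _ _ h1 h2 => rw [map_add]; exact Ord.add _ _ _ h1 h2
  | smul A r a _ h => rw [TT_C_mul]; exact Ord.smul _ _ _ h
  | X_mul A a _ h => rw [TT_X_mul]; exact Ord.add _ _ _ (Ord.X_mul _ _ h) h
  | nab A δ a _ h => rw [TT_nab]; exact Ord.nab _ _ _ h
  | succ A a _ h => exact Ord.succ _ _ h

theorem Ord.neg {v a : L[X]} {A : ℕ} (ha : Ord k L f v A a) : Ord k L f v A (-a) := by
  have := Ord.smul A (-1) a ha
  rwa [map_neg, map_one, C_neg, C_1, neg_one_mul] at this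

theorem Ord.TI {v a : L[X]} {A : ℕ} (ha : Ord k L f v A a) : Ord k L f (TI L f v) A (TI L f a) := by
  induction ha with
  | base A => exact Ord.base A
  | add A a b _ _ h1 h2 => rw [map_add]; exact Ord.add _ _ _ h1 h2
  | smul A r a _ h => rw [TI_C_mul]; exact Ord.smul _ _ _ h
  | X_mul A a _ h => rw [TI_X_mul, sub_eq_add_neg]; exact Ord.add _ _ _ (Ord.X_mul _ _ h) h.neg
  | nab A δ a _ h => rw [TI_nab]; exact Ord.nab _ _ _ h
  | succ A a _ h => exact Ord.succ _ _ h

theorem Ord.poly {v a : L[X]} {A : ℕ} (ha : Ord k L f v A a) (q : R[X]) :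
    Ord k L f v A (q.map (algebraMap R L) * a) := by
  induction q using Polynomial.induction_on' with
  | add p q hp hq => rw [Polynomial.map_add, add_mul]; exact Ord.add _ _ _ hp hq
  | monomial n c =>
    rw [map_monomial, ← C_mul_X_pow_eq_monomial, mul_assoc]
    refine Ord.smul _ _ _ ?_
    induction n with
    | zero => simpa using ha
    | succ n ih => rw [pow_succ', mul_assoc]; exact Ord.X_mul _ _ ih

theorem Ord.kpoly {v a : L[X]} {A : ℕ} (ha : Ord k L f v A a) (q : k[X]) :
    Ord k L f v A (q.map (algebraMap k L) * a) := by
  have := ha.poly (q.map (algebraMap k R))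
  rwa [Polynomial.map_map, ← IsScalarTower.algebraMap_eq] at this

variable (k L f)

/-- the ideal of b with `b f⁻¹` torsion modulo `D[s]`. -/
def bId : Ideal R where
  carrier := {b | ∃ q : k[X], q ≠ 0 ∧ ∃ A, Ord k L f 1 A (q.map (algebraMap k L) * C (algebraMap R L b * fi L f))}
  zero_mem' := ⟨1, one_ne_zero, 0, by
    rw [map_zero, zero_mul, C_0, mul_zero]
    have := Ord.smul (k := k) 0 0 (1 : L[X]) (Ord.base (f := f) 0)
    rwa [map_zero, C_0, zero_mul] at this⟩
  add_mem' := by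
    rintro a b ⟨p, hp, A, hA⟩ ⟨q, hq, B, hB⟩
    refine ⟨p * q, mul_ne_zero hp hq, max A B, ?_⟩
    have h1 := (hA.mono (le_max_left A B)).kpoly q
    have h2 := (hB.mono (le_max_right A B)).kpoly p
    have := Ord.add _ _ _ h1 h2
    convert this using 1
    rw [map_add, add_mul, C_add, Polynomial.map_mul]; ring
  smul_mem' := by
    rintro r a ⟨p, hp, A, hA⟩
    refine ⟨p, hp, A, ?_⟩
    have := Ord.smul _ r _ hA
    convert this using 1
    rw [smul_eq_mul, map_mul (algebraMap R L), mul_assoc, C_mul]; ring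

theorem mem_bId {b : R} : b ∈ bId k L f ↔ ∃ q : k[X], q ≠ 0 ∧ ∃ A, Ord k L f 1 A (q.map (algebraMap k L) * C (algebraMap R L b * fi L f)) :=
  Iff.rfl

end bs
end LCF
end

section
namespace LCF
open Polynomial

section core
variable (k : Type*) {R : Type*} (Z L : Type*) [Field k] [CommRing R] [CommRing Z] [IsDomain Z] [CommRing L]
  [Algebra k R] [Algebra R L] [Algebra k L] [IsScalarTower k R L] (f : R) [IsLocalization.Away f L]
  [Algebra k Z] [Algebra Z R] [Algebra Z L] [IsScalarTower Z R L] [IsScalarTower k Z R] [IsScalarTower k Z L]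

theorem Zsmul (c : Z) (g : L[X]) : c • g = C (algebraMap Z L c) * g := by
  rw [Algebra.smul_def, Polynomial.algebraMap_apply]

variable {Z L f} in
theorem Ord.zsmul {v a : L[X]} {A : ℕ} (ha : Ord k L f v A a) (c : Z) : Ord k L f v A (C (algebraMap Z L c) * a) := by
  rw [IsScalarTower.algebraMap_apply Z R L]
  exact Ord.smul _ _ _ ha

variable {k L f} in
theorem Ord.trans' {v w a : L[X]} {A B : ℕ} (ha : Ord k L f v A a) (hv : Ord k L f w B v) : Ord k L f w (A + B) a := by
  induction ha with
  | base A => exact hv.mono (by omega)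
  | add A a b _ _ h1 h2 => exact Ord.add _ _ _ h1 h2
  | smul A r a _ h => exact Ord.smul _ _ _ h
  | X_mul A a _ h => exact Ord.X_mul _ _ h
  | nab A δ a _ h => rw [show A + 1 + B = A + B + 1 by omega]; exact Ord.nab _ _ _ h
  | succ A a _ h => rw [show A + 1 + B = A + B + 1 by omega]; exact Ord.succ _ _ h

/-- torsion saturation -/
def EZ : Submodule Z L[X] where
  carrier := {m | ∃ b : Z, b ≠ 0 ∧ ∃ q : k[X], q ≠ 0 ∧ ∃ A, Ord k L f 1 A (C (algebraMap Z L b) * (q.map (algebraMap k L) * m))}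
  zero_mem' := ⟨1, one_ne_zero, 1, one_ne_zero, 0, by
    rw [mul_zero, mul_zero]
    have := Ord.smul (k := k) 0 0 (1 : L[X]) (Ord.base (f := f) 0)
    rwa [map_zero, C_0, zero_mul] at this⟩
  add_mem' := by
    rintro m m' ⟨a, ha, p, hp, A, hA⟩ ⟨b, hb, q, hq, B, hB⟩
    refine ⟨a * b, mul_ne_zero ha hb, p * q, mul_ne_zero hp hq, max A B, ?_⟩
    have h1 := ((hA.mono (le_max_left A B)).kpoly q).zsmul k b
    have h2 := ((hB.mono (le_max_right A B)).kpoly p).zsmul k a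
    have := Ord.add _ _ _ h1 h2
    convert this using 1
    rw [map_mul (algebraMap Z L), C_mul, Polynomial.map_mul]; ring
  smul_mem' := by
    rintro r a ⟨b, hb, p, hp, A, hA⟩
    refine ⟨b, hb, p, hp, A, ?_⟩
    have := hA.zsmul k r
    convert this using 1
    rw [Zsmul]; ring

theorem mem_EZ {m : L[X]} : m ∈ EZ k Z L f ↔ ∃ b : Z, b ≠ 0 ∧ ∃ q : k[X], q ≠ 0 ∧ ∃ A, Ord k L f 1 A (C (algebraMap Z L b) * (q.map (algebraMap k L) * m)) := Iff.rfl

theorem EZ_one : (1 : L[X]) ∈ EZ k Z L f := ⟨1, one_ne_zero, 1, one_ne_zero, 0, by simpa using Ord.base 0⟩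

variable {k Z L f}
theorem EZ_R (r : R) {m : L[X]} (hm : m ∈ EZ k Z L f) : C (algebraMap R L r) * m ∈ EZ k Z L f := by
  obtain ⟨b, hb, p, hp, A, hA⟩ := hm
  refine ⟨b, hb, p, hp, A, ?_⟩
  convert Ord.smul _ r _ hA using 1
  ring

theorem EZ_X {m : L[X]} (hm : m ∈ EZ k Z L f) : X * m ∈ EZ k Z L f := by
  obtain ⟨b, hb, p, hp, A, hA⟩ := hm
  refine ⟨b, hb, p, hp, A, ?_⟩
  convert Ord.X_mul _ _ hA using 1
  ring

theorem nab_k (δ : Derivation k R R) (q : k[X]) (g : L[X]) :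
    nab L f δ (q.map (algebraMap k L) * g) = q.map (algebraMap k L) * nab L f δ g := by
  induction q using Polynomial.induction_on' with
  | add p q hp hq => simp only [Polynomial.map_add, add_mul, map_add, hp, hq]
  | monomial n a =>
    rw [map_monomial, ← C_mul_X_pow_eq_monomial, mul_assoc, nab_C_mul, Derivation.map_algebraMap, C_0, zero_mul, zero_add, mul_assoc]
    congr 1
    induction n with
    | zero => simp
    | succ n ih => rw [pow_succ', mul_assoc, nab_X_mul, ih, mul_assoc]

theorem EZ_nab (δ : Derivation k R R) {m : L[X]} (hm : m ∈ EZ k Z L f) : nab L f δ m ∈ EZ k Z L f := by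
  obtain ⟨b, hb, p, hp, A, hA⟩ := hm
  refine ⟨b * b, mul_ne_zero hb hb, p, hp, A + 1, ?_⟩
  have h1 := (Ord.nab _ δ _ hA).zsmul k b
  have h2 := (Ord.succ _ _ (Ord.smul _ (δ (algebraMap Z R b)) _ hA)).neg
  convert Ord.add _ _ _ h1 h2 using 1
  rw [nab_C_mul, nab_k, IsScalarTower.algebraMap_apply Z R L b, dl_alg, map_mul (algebraMap Z L), C_mul, IsScalarTower.algebraMap_apply Z R L b]
  ring

theorem EZ_TT {m : L[X]} (hm : m ∈ EZ k Z L f) : TT L f m ∈ EZ k Z L f := by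
  obtain ⟨b, hb, p, hp, A, hA⟩ := hm
  have hc : p.comp (X + 1) ≠ 0 := by
    intro h
    have := congrArg (fun r => r.comp (X - 1)) h
    simp only [comp_assoc] at this
    simp at this; exact hp this
  refine ⟨b, hb, p.comp (X + 1), hc, A + 0, ?_⟩
  have h1 : Ord k L f 1 0 (TT L f 1) := by
    have := Ord.smul (k := k) 0 f (1 : L[X]) (Ord.base (f := f) 0)
    rwa [TT_apply, one_comp]
  convert (hA.TT).trans' h1 using 1
  rw [TT_C_mul, TT_apply, TT_apply, mul_comp, Polynomial.map_comp]
  simp only [Polynomial.map_add, Polynomial.map_X, Polynomial.map_one]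
  ring

theorem EZ_sat {c : Z} (hc : c ≠ 0) {m : L[X]} (h : C (algebraMap Z L c) * m ∈ EZ k Z L f) : m ∈ EZ k Z L f := by
  obtain ⟨b, hb, p, hp, A, hA⟩ := h
  refine ⟨b * c, mul_ne_zero hb hc, p, hp, A, ?_⟩
  convert hA using 1
  rw [map_mul, C_mul]; ring

theorem EZ_satk {q : k[X]} (hc : q ≠ 0) {m : L[X]} (h : q.map (algebraMap k L) * m ∈ EZ k Z L f) : m ∈ EZ k Z L f := by
  obtain ⟨b, hb, p, hp, A, hA⟩ := h
  refine ⟨b, hb, p * q, mul_ne_zero hp hc, A, ?_⟩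
  convert hA using 1
  rw [Polynomial.map_mul]; ring

theorem der_pow_mem (𝔟 : Ideal R) (δ : Derivation k R R) (n : ℕ) {r : R} (hr : r ∈ 𝔟 ^ (n + 1)) : δ r ∈ 𝔟 ^ n := by
  induction n generalizing r with
  | zero => simp
  | succ n ih =>
    rw [pow_succ] at hr
    induction hr using Submodule.mul_induction_on' with
    | mem_mul_mem a ha b hb =>
      rw [Derivation.leibniz, smul_eq_mul, smul_eq_mul]
      refine add_mem (Ideal.mul_mem_right _ _ ha) ?_
      rw [pow_succ, mul_comm b]
      exact Ideal.mul_mem_mul (ih ha) hb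
    | add a _ b _ h1 h2 => rw [map_add]; exact add_mem h1 h2

theorem growth_ord (𝔟 : Ideal R) {v m : L[X]} {A : ℕ} (h : Ord k L f v A m) (N : ℕ)
    (hv : ∀ r ∈ 𝔟 ^ N, C (algebraMap R L r) * v ∈ EZ k Z L f) :
    ∀ r ∈ 𝔟 ^ (N + A), C (algebraMap R L r) * m ∈ EZ k Z L f := by
  induction h with
  | base A => exact fun r hr => hv r (Ideal.pow_le_pow_right (by omega) hr)
  | add A a b _ _ h1 h2 => intro r hr; rw [mul_add]; exact add_mem (h1 r hr) (h2 r hr)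
  | smul A r' a _ h => intro r hr; rw [mul_left_comm]; exact EZ_R _ (h r hr)
  | X_mul A a _ h => intro r hr; rw [mul_left_comm]; exact EZ_X (h r hr)
  | succ A a _ h => exact fun r hr => h r (Ideal.pow_le_pow_right (by omega) hr)
  | nab A δ a _ h =>
    intro r hr
    have h1 := EZ_nab δ (h r (Ideal.pow_le_pow_right (by omega) hr))
    have h2 := h (δ r) (der_pow_mem 𝔟 δ (N + A) hr)
    rw [nab_C_mul, dl_alg] at h1
    simpa using sub_mem h1 h2

theorem bId_unif [IsNoetherianRing R] : ∃ A, ∀ b ∈ bId k L f, ∃ q : k[X], q ≠ 0 ∧ Ord k L f 1 A (q.map (algebraMap k L) * C (algebraMap R L b * fi L f)) := by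
  obtain ⟨S, hS⟩ := (isNoetherianRing_iff_ideal_fg R).1 ‹_› (bId k L f)
  have hSm : ∀ b ∈ S, b ∈ bId k L f := fun b hb => hS ▸ Submodule.subset_span hb
  have hex : ∀ b : S, ∃ A, ∃ q : k[X], q ≠ 0 ∧ Ord k L f 1 A (q.map (algebraMap k L) * C (algebraMap R L b.1 * fi L f)) := by
    rintro ⟨b, hb⟩
    obtain ⟨q, hq, A, hA⟩ := hSm b hb
    exact ⟨A, q, hq, hA⟩
  choose A hA using hex
  refine ⟨Finset.univ.sup A, fun b hb => ?_⟩
  rw [← hS] at hb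
  induction hb using Submodule.span_induction with
  | mem b hb =>
    obtain ⟨q, hq, h⟩ := hA ⟨b, hb⟩
    exact ⟨q, hq, h.mono (Finset.le_sup (Finset.mem_univ _))⟩
  | zero =>
    refine ⟨1, one_ne_zero, ?_⟩
    rw [map_zero, zero_mul, C_0, mul_zero]
    have := Ord.smul (k := k) (Finset.univ.sup A) 0 (1 : L[X]) (Ord.base (f := f) _)
    rwa [map_zero, C_0, zero_mul] at this
  | add a b _ _ ha hb =>
    obtain ⟨p, hp, hA⟩ := ha
    obtain ⟨q, hq, hB⟩ := hb
    refine ⟨p * q, mul_ne_zero hp hq, ?_⟩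
    convert Ord.add _ _ _ (hA.kpoly q) (hB.kpoly p) using 1
    rw [map_add, add_mul, C_add, Polynomial.map_mul]; ring
  | smul r a _ ha =>
    obtain ⟨p, hp, hA⟩ := ha
    refine ⟨p, hp, ?_⟩
    convert Ord.smul _ r _ hA using 1
    rw [smul_eq_mul, map_mul (algebraMap R L), mul_assoc, C_mul]; ring

theorem growth_f [IsNoetherianRing R] : ∃ K, ∀ t, ∀ r ∈ (bId k L f) ^ (K * t), C (algebraMap R L r) * C (fi L f ^ t) ∈ EZ k Z L f := by
  obtain ⟨A, hA⟩ := bId_unif (k := k) (L := L) (f := f)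
  refine ⟨A + 1, fun t => ?_⟩
  have hTI : ∀ (t : ℕ), ∀ b ∈ bId k L f, ∃ q : k[X], q ≠ 0 ∧ Ord k L f (C (fi L f ^ t)) A (q.map (algebraMap k L) * C (algebraMap R L b * fi L f ^ (t + 1))) := by
    intro t
    induction t with
    | zero => simpa using hA
    | succ t ih =>
      intro b hb
      obtain ⟨q, hq, h⟩ := ih b hb
      refine ⟨q.comp (X - 1), ?_, ?_⟩
      · intro h
        have := congrArg (fun r => r.comp (X + 1)) h
        simp only [comp_assoc] at this
        simp at this; exact hq this
      · convert h.TI using 1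
        · rw [TI_apply, C_comp, ← C_mul, pow_succ']
        · rw [TI_apply, mul_comp, C_comp, Polynomial.map_comp, Polynomial.map_sub, Polynomial.map_X, Polynomial.map_one, pow_succ' _ (t + 1), mul_left_comm, C_mul]
          ring
  induction t with
  | zero => intro r _; simpa using EZ_R r (EZ_one k Z L f)
  | succ t ih =>
    intro r hr
    rw [show (A + 1) * (t + 1) = ((A + 1) * t + A) + 1 by ring, pow_succ] at hr
    induction hr using Submodule.mul_induction_on' with
    | mem_mul_mem a ha b hb =>
      obtain ⟨q, hq, h⟩ := hTI t b hb
      have := growth_ord _ h _ ih a ha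
      rw [mul_left_comm] at this
      convert EZ_satk hq this using 1
      rw [map_mul, C_mul, C_mul]; ring
    | add a _ b _ h1 h2 => rw [map_add, C_add, add_mul]; exact add_mem h1 h2

end core
end LCF
end

section
namespace LCF

section nak
variable {R Z : Type*} [CommRing R] [CommRing Z] [Algebra Z R]

theorem mem_smul_top_pi {κ : Type*} [Finite κ] (J : Ideal Z) (x : κ → Z) :
    x ∈ (J • ⊤ : Submodule Z (κ → Z)) ↔ ∀ i, x i ∈ J := by
  classical
  have := Fintype.ofFinite κ
  constructor
  · intro h i
    induction h using Submodule.smul_induction_on' with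
    | smul r hr n _ => exact Ideal.mul_mem_right _ _ hr
    | add a _ b _ h1 h2 => exact add_mem h1 h2
  · intro h
    rw [← Finset.univ_sum_single x]
    refine Submodule.sum_mem _ fun i _ => ?_
    have : Pi.single i (x i) = x i • (Pi.single i 1 : κ → Z) := by
      rw [← Pi.single_smul', smul_eq_mul, mul_one]
    rw [this]
    exact Submodule.smul_mem_smul (h i) trivial

theorem precomplete_pi {κ : Type*} [Finite κ] (I : Ideal Z) [IsPrecomplete I Z] : IsPrecomplete I (κ → Z) := by
  refine ⟨fun f hf => ?_⟩
  have h1 : ∀ i, ∃ L : Z, ∀ n, f n i ≡ L [SMOD (I ^ n • ⊤ : Submodule Z Z)] := by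
    intro i
    refine IsPrecomplete.prec ‹_› (fun {m n} hmn => ?_)
    have := hf hmn
    rw [SModEq.sub_mem, mem_smul_top_pi] at this
    rw [SModEq.sub_mem, smul_eq_mul, Ideal.mul_top]
    exact this i
  choose L hL using h1
  refine ⟨L, fun n => ?_⟩
  rw [SModEq.sub_mem, mem_smul_top_pi]
  intro i
  have := hL i n
  rw [SModEq.sub_mem, smul_eq_mul, Ideal.mul_top] at this
  exact this

theorem sup_pow_le (a b : Ideal R) (n : ℕ) : (a ⊔ b) ^ n ≤ a ^ n ⊔ b := by
  induction n with
  | zero => simp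
  | succ n ih =>
    rw [pow_succ]
    refine (Ideal.mul_mono_left ih).trans ?_
    rw [Ideal.mul_sup, Ideal.sup_mul, ← pow_succ]
    refine sup_le (sup_le le_sup_left ?_) ?_
    · have h5 : b * a ≤ b := Ideal.mul_le_left
      exact h5.trans le_sup_right
    · have h5 : (a ^ n ⊔ b) * b ≤ b := Ideal.mul_le_right
      exact h5.trans le_sup_right

variable {J : Type*} [Fintype J] (y : J → R) 

/-- span of monomials of degree less than n -/
def Wm (Z : Type*) [CommRing Z] [Algebra Z R] (n : ℕ) : Submodule Z R :=
  Submodule.span Z {r | ∃ e : J → ℕ, ∑ j, e j < n ∧ r = ∏ j, y j ^ e j}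

theorem Wm_mono {a b : ℕ} (h : a ≤ b) : Wm y Z a ≤ Wm y Z b :=
  Submodule.span_mono (by rintro _ ⟨e, he, rfl⟩; exact ⟨e, by omega, rfl⟩)

theorem y_mul_Wm (j : J) (n : ℕ) {w : R} (hw : w ∈ Wm y Z n) : y j * w ∈ Wm y Z (n + 1) := by
  classical
  unfold Wm at hw
  induction hw using Submodule.span_induction with
  | mem w hw =>
    obtain ⟨e, he, rfl⟩ := hw
    refine Submodule.subset_span ⟨e + Pi.single j 1, ?_, ?_⟩
    · simp only [Pi.add_apply, Finset.sum_add_distrib]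
      simp; omega
    · simp only [Pi.add_apply, pow_add, Finset.prod_mul_distrib]
      rw [mul_comm]
      congr 1
      rw [Finset.prod_eq_single j]
      · simp
      · intro b _ hb; simp [hb]
      · simp
  | zero => simp
  | add a b _ _ h1 h2 => rw [mul_add]; exact add_mem h1 h2
  | smul c a _ h => rw [mul_smul_comm]; exact Submodule.smul_mem _ _ h

theorem ypow_le (I : Ideal R) (hRk : ∀ r : R, ∃ z : Z, r - algebraMap Z R z ∈ Ideal.span (Set.range y) ⊔ I) (M : ℕ) :
    ∀ r ∈ Ideal.span (Set.range y) ^ M, ∃ w ∈ Wm y Z (M + 1), r - w ∈ Ideal.span (Set.range y) ^ (M + 1) ⊔ I := by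
  induction M with
  | zero =>
    intro r _
    obtain ⟨z, hz⟩ := hRk r
    refine ⟨algebraMap Z R z, ?_, by simpa using hz⟩
    rw [Algebra.algebraMap_eq_smul_one]
    exact Submodule.smul_mem _ _ (Submodule.subset_span ⟨0, by simp, by simp⟩)
  | succ M ih =>
    have key : ∀ a ∈ Ideal.span (Set.range y), ∀ b ∈ Ideal.span (Set.range y) ^ M,
        ∃ w ∈ Wm y Z (M + 2), a * b - w ∈ Ideal.span (Set.range y) ^ (M + 2) ⊔ I := by
      intro a ha
      induction ha using Submodule.span_induction with
      | mem a ha =>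
        obtain ⟨j, rfl⟩ := ha
        intro b hb
        obtain ⟨w, hw, h⟩ := ih b hb
        refine ⟨y j * w, y_mul_Wm y j _ hw, ?_⟩
        rw [← mul_sub]
        have := Ideal.mul_mem_mul (Ideal.subset_span (Set.mem_range_self j) : y j ∈ Ideal.span (Set.range y)) h
        rw [Ideal.mul_sup, ← pow_succ'] at this
        have h8 : Ideal.span (Set.range y) * I ≤ I := Ideal.mul_le_right
        have h5 : Ideal.span (Set.range y) ^ (M + 1 + 1) ⊔ Ideal.span (Set.range y) * I ≤ Ideal.span (Set.range y) ^ (M + 2) ⊔ I :=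
          sup_le le_sup_left (h8.trans le_sup_right)
        exact h5 this
      | zero => exact fun b _ => ⟨0, zero_mem _, by simp⟩
      | add a a' _ _ h1 h2 =>
        intro b hb
        obtain ⟨w, hw, h⟩ := h1 b hb
        obtain ⟨w', hw', h'⟩ := h2 b hb
        refine ⟨w + w', add_mem hw hw', ?_⟩
        convert add_mem h h' using 1; ring
      | smul c a _ h =>
        intro b hb
        obtain ⟨w, hw, h⟩ := h (c * b) (Ideal.mul_mem_left _ _ hb)
        refine ⟨w, hw, ?_⟩
        convert h using 1
        rw [smul_eq_mul]; ring
    intro r hr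
    rw [pow_succ'] at hr
    induction hr using Submodule.mul_induction_on' with
    | mem_mul_mem a ha b hb => exact key a ha b hb
    | add a _ b _ h1 h2 =>
      obtain ⟨w, hw, h⟩ := h1
      obtain ⟨w', hw', h'⟩ := h2
      refine ⟨w + w', add_mem hw hw', ?_⟩
      convert add_mem h h' using 1; ring

theorem top_le_W (I : Ideal R) (hRk : ∀ r : R, ∃ z : Z, r - algebraMap Z R z ∈ Ideal.span (Set.range y) ⊔ I) (M : ℕ) (r : R) :
    ∃ w ∈ Wm y Z M, r - w ∈ Ideal.span (Set.range y) ^ M ⊔ I := by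
  induction M with
  | zero => exact ⟨0, zero_mem _, by simp⟩
  | succ M ih =>
    obtain ⟨w, hw, h⟩ := ih
    obtain ⟨a, ha, b, hb, hab⟩ := Submodule.mem_sup.1 h
    obtain ⟨w', hw', h'⟩ := ypow_le y I hRk M a ha
    refine ⟨w + w', add_mem (Wm_mono y (by omega) hw) hw', ?_⟩
    convert add_mem h' (Ideal.mem_sup_right hb) using 1
    rw [sub_add_eq_sub_sub, ← hab]; ring

theorem nak_box [IsNoetherianRing R] [IsLocalRing R] (I : Ideal Z) [IsAdicComplete I Z]
    (hI : I.map (algebraMap Z R) ≤ IsLocalRing.maximalIdeal R)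
    (hRk : ∀ r : R, ∃ z : Z, r - algebraMap Z R z ∈ Ideal.span (Set.range y) ⊔ I.map (algebraMap Z R))
    (𝔟 : Ideal R) (c : ℕ) (hc : Ideal.span (Set.range y) ^ c ≤ 𝔟 ⊔ I.map (algebraMap Z R)) (N : ℕ) (r : R) :
    ∃ w ∈ Submodule.span Z (Set.range fun e : J → Fin (c * N) => ∏ j, y j ^ (e j : ℕ)), r - w ∈ 𝔟 ^ N := by
  classical
  let m : (J → Fin (c * N)) → R := fun e => ∏ j, y j ^ (e j : ℕ)
  have hW : Wm y Z (c * N) ≤ Submodule.span Z (Set.range m) := by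
    refine Submodule.span_mono ?_
    rintro _ ⟨e, he, rfl⟩
    refine ⟨fun j => ⟨e j, lt_of_le_of_lt (Finset.single_le_sum (fun _ _ => Nat.zero_le _) (Finset.mem_univ j)) he⟩, rfl⟩
  let π : R →ₗ[Z] (R ⧸ 𝔟 ^ N) := (Submodule.mkQ (𝔟 ^ N)).restrictScalars Z
  let φ : ((J → Fin (c * N)) → Z) →ₗ[Z] (R ⧸ 𝔟 ^ N) := π ∘ₗ Fintype.linearCombination Z m
  haveI := precomplete_pi (κ := J → Fin (c * N)) I
  haveI : IsHausdorff I (R ⧸ 𝔟 ^ N) := by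
    refine IsHausdorff.of_map (J := IsLocalRing.maximalIdeal R) hI
  have hrange : ∀ w ∈ Submodule.span Z (Set.range m), ∃ x, Fintype.linearCombination Z m x = w := by
    intro w hw
    rw [← Fintype.range_linearCombination] at hw
    exact hw
  have hs : Function.Surjective φ := by
    refine surjective_of_mkQ_comp_surjective (I := I) ?_
    intro q
    obtain ⟨q, rfl⟩ := Submodule.mkQ_surjective _ q
    obtain ⟨r, rfl⟩ := Submodule.mkQ_surjective _ q
    obtain ⟨w, hw, h⟩ := top_le_W y _ hRk (c * N) r
    obtain ⟨x, hx⟩ := hrange w (hW hw)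
    refine ⟨x, ?_⟩
    have h2 : r - w ∈ 𝔟 ^ N ⊔ I.map (algebraMap Z R) := by
      have h5 : Ideal.span (Set.range y) ^ (c * N) ⊔ I.map (algebraMap Z R) ≤ 𝔟 ^ N ⊔ I.map (algebraMap Z R) := by
        refine sup_le ?_ le_sup_right
        rw [pow_mul]
        exact (Ideal.pow_right_mono hc N).trans (sup_pow_le _ _ _)
      exact h5 h
    obtain ⟨a, ha, b, hb, hab⟩ := Submodule.mem_sup.1 h2
    have h3 : π r - π w = π b := by
      rw [← map_sub, ← hab, map_add]
      have : π a = 0 := (Submodule.Quotient.mk_eq_zero _).2 ha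
      rw [this, zero_add]
    change Submodule.mkQ _ (φ x) = Submodule.mkQ _ (π r)
    have h4 : φ x = π w := by
      change π (Fintype.linearCombination Z m x) = _
      rw [hx]
    rw [h4]
    symm
    rw [← sub_eq_zero, ← map_sub, h3]
    rw [Submodule.mkQ_apply, Submodule.Quotient.mk_eq_zero]
    have h6 := Ideal.smul_restrictScalars I (⊤ : Submodule R (R ⧸ 𝔟 ^ N))
    rw [Submodule.restrictScalars_top] at h6
    rw [← h6, Submodule.restrictScalars_mem]
    have h7 : π b = b • (Submodule.mkQ (𝔟 ^ N) 1) := by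
      rw [← map_smul, smul_eq_mul, mul_one]; rfl
    rw [h7]
    exact Submodule.smul_mem_smul hb trivial
  obtain ⟨x, hx⟩ := hs (π r)
  refine ⟨Fintype.linearCombination Z m x, ?_, ?_⟩
  · rw [← Fintype.range_linearCombination]; exact ⟨x, rfl⟩
  · have : π (r - Fintype.linearCombination Z m x) = 0 := by
      rw [map_sub, ← hx]; exact sub_self _
    exact (Submodule.Quotient.mk_eq_zero _).1 this

end nak
end LCF
end

section
namespace LCF
open Polynomial

section core
variable {k : Type*} {R : Type*} {Z L : Type*} [Field k] [CommRing R] [CommRing Z] [IsDomain Z] [CommRing L]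
  [Algebra k R] [Algebra R L] [Algebra k L] [IsScalarTower k R L] {f : R} [IsLocalization.Away f L]
  [Algebra k Z] [Algebra Z R] [Algebra Z L] [IsScalarTower Z R L] [IsScalarTower k Z R] [IsScalarTower k Z L]

/-- induced endomorphism of the quotient -/
noncomputable def qmap (g : L[X] →+ L[X]) (hg : ∀ (c : Z) m, g (C (algebraMap Z L c) * m) = C (algebraMap Z L c) * g m)
    (hE : ∀ m ∈ EZ k Z L f, g m ∈ EZ k Z L f) : Module.End Z (L[X] ⧸ EZ k Z L f) :=
  Submodule.mapQ (EZ k Z L f) (EZ k Z L f)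
    { toFun := g, map_add' := map_add g, map_smul' := fun c m => by rw [Zsmul, hg, Zsmul]; rfl } hE

theorem qmap_mk (g : L[X] →+ L[X]) (hg : ∀ (c : Z) m, g (C (algebraMap Z L c) * m) = C (algebraMap Z L c) * g m)
    (hE : ∀ m ∈ EZ k Z L f, g m ∈ EZ k Z L f) (m : L[X]) :
    qmap g hg hE (Submodule.Quotient.mk m) = Submodule.Quotient.mk (g m) := rfl

theorem nab_comm (δ δ' : Derivation k R R) (h : ∀ r, δ (δ' r) = δ' (δ r)) (g : L[X]) :
    nab L f δ (nab L f δ' g) = nab L f δ' (nab L f δ g) := by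
  have h1 : ∀ x : L, dl L f δ (dl L f δ' x) = dl L f δ' (dl L f δ x) := by
    have : ⁅dl L f δ, dl L f δ'⁆ = 0 := by
      refine der_ext_unique (R := R) (Submonoid.powers f) _ _ fun r => ?_
      rw [Derivation.commutator_apply, dl_alg, dl_alg, dl_alg, dl_alg, h, sub_self]; rfl
    intro x
    have h2 := congrArg (fun d => d x) this
    simp only [Derivation.commutator_apply] at h2
    exact sub_eq_zero.1 h2
  have h2 : ∀ g : L[X], dmap (dl L f δ) (dmap (dl L f δ') g) = dmap (dl L f δ') (dmap (dl L f δ) g) := by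
    intro g
    ext n
    rw [coeff_dmap, coeff_dmap, coeff_dmap, coeff_dmap, h1]
  simp only [nab_apply, map_add, Derivation.leibniz, dmap_X, dmap_C, h2, smul_eq_mul, dl_alg, dl_fi, h]
  simp only [map_add, map_mul, map_neg]
  ring

variable (k f L) in
/-- pole filtration -/
noncomputable def Pf (Z : Type*) [CommRing Z] [Algebra Z R] [Algebra Z L] [IsScalarTower Z R L] (t : ℕ) : Submodule Z L[X] where
  carrier := {g | ∃ h : R[X], h.natDegree ≤ t ∧ g = h.map (algebraMap R L) * C (fi L f ^ t)}
  zero_mem' := ⟨0, by simp, by simp⟩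
  add_mem' := by
    rintro _ _ ⟨a, ha, rfl⟩ ⟨b, hb, rfl⟩
    exact ⟨a + b, natDegree_add_le_of_degree_le ha hb, by rw [Polynomial.map_add, add_mul]⟩
  smul_mem' := by
    rintro c _ ⟨a, ha, rfl⟩
    refine ⟨C (algebraMap Z R c) * a, (natDegree_C_mul_le _ _).trans ha, ?_⟩
    rw [Algebra.smul_def, Polynomial.algebraMap_apply, Polynomial.map_mul, map_C, ← IsScalarTower.algebraMap_apply, mul_assoc]

theorem C_fi_pow (t : ℕ) : C (fi L f ^ t) = C (algebraMap R L f) * C (fi L f ^ (t + 1)) := by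
  rw [← C_mul, pow_succ', ← mul_assoc, f_fi, one_mul]

theorem Pf_R (t : ℕ) (r : R) {m : L[X]} (hm : m ∈ Pf L f Z t) : C (algebraMap R L r) * m ∈ Pf L f Z t := by
  obtain ⟨h, hh, rfl⟩ := hm
  exact ⟨C r * h, (natDegree_C_mul_le _ _).trans hh, by rw [Polynomial.map_mul, map_C, mul_assoc]⟩

theorem Pf_mono : Monotone (Pf L f Z) := by
  refine monotone_nat_of_le_succ fun t => ?_
  rintro _ ⟨h, hh, rfl⟩
  refine ⟨C f * h, ((natDegree_C_mul_le _ _).trans hh).trans (Nat.le_succ t), ?_⟩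
  rw [C_fi_pow t, Polynomial.map_mul, map_C]; ring

theorem Pf_X (t : ℕ) {m : L[X]} (hm : m ∈ Pf L f Z t) : X * m ∈ Pf L f Z (t + 1) := by
  obtain ⟨h, hh, rfl⟩ := hm
  refine ⟨C f * (X * h), (natDegree_C_mul_le _ _).trans ((natDegree_mul_le).trans ?_), ?_⟩
  · have := natDegree_X_le (R := R); omega
  · rw [C_fi_pow t, Polynomial.map_mul, Polynomial.map_mul, map_C, map_X]; ring

theorem dmap_map (δ : Derivation k R R) (h : R[X]) :
    dmap (dl L f δ) (h.map (algebraMap R L)) = (dmap δ h).map (algebraMap R L) := by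
  ext n
  rw [coeff_dmap, coeff_map, coeff_map, coeff_dmap, dl_alg]

theorem natDegree_dmap_le (δ : Derivation k R R) (h : R[X]) : (dmap δ h).natDegree ≤ h.natDegree := by
  rw [natDegree_le_iff_coeff_eq_zero]
  intro n hn
  rw [coeff_dmap, coeff_eq_zero_of_natDegree_lt hn, map_zero]

theorem dl_fi_pow (δ : Derivation k R R) (t : ℕ) :
    dl L f δ (fi L f ^ t) = - ((t : L) * algebraMap R L (δ f) * fi L f ^ (t + 1)) := by
  cases t with
  | zero => simp
  | succ t =>
    rw [Derivation.leibniz_pow, dl_fi, Nat.add_sub_cancel]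
    simp only [nsmul_eq_mul, smul_eq_mul]
    ring

theorem Pf_nab (δ : Derivation k R R) (t : ℕ) {m : L[X]} (hm : m ∈ Pf L f Z t) : nab L f δ m ∈ Pf L f Z (t + 1) := by
  obtain ⟨h, hh, rfl⟩ := hm
  refine ⟨C f * dmap δ h - C ((t : R) * δ f) * h + C (δ f) * (X * h), ?_, ?_⟩
  · refine (natDegree_add_le _ _).trans (max_le ((natDegree_sub_le _ _).trans (max_le ?_ ?_)) ?_)
    · exact (natDegree_C_mul_le _ _).trans ((natDegree_dmap_le δ h).trans (by omega))
    · exact (natDegree_C_mul_le _ _).trans (by omega)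
    · refine (natDegree_C_mul_le _ _).trans ((natDegree_mul_le).trans ?_)
      have := natDegree_X_le (R := R); omega
  · rw [nab_apply, Derivation.leibniz, dmap_C, dmap_map, dl_fi_pow]
    simp only [smul_eq_mul, Polynomial.map_add, Polynomial.map_sub, Polynomial.map_mul, map_C, map_X, map_mul, C_mul, map_natCast, Polynomial.map_natCast, C_neg]
    rw [show C (fi L f ^ t) = C (algebraMap R L f) * C (fi L f ^ (t + 1)) from C_fi_pow t]
    have h1 : C (fi L f) * (C (algebraMap R L f)) = 1 := by rw [← C_mul, mul_comm, f_fi, C_1]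
    linear_combination (X * C (algebraMap R L (δ f)) * Polynomial.map (algebraMap R L) h * C (fi L f ^ (t + 1))) * h1

theorem Pf_TT (t : ℕ) {m : L[X]} (hm : m ∈ Pf L f Z t) : ∃ m' ∈ Pf L f Z (t + 1), TT L f m' = m := by
  obtain ⟨h, hh, rfl⟩ := hm
  refine ⟨_, ⟨h.comp (X - 1), ?_, rfl⟩, ?_⟩
  · refine natDegree_comp_le.trans ?_
    have : (X - 1 : R[X]).natDegree ≤ 1 := by
      have := natDegree_X_sub_C_le (1 : R); simpa using this
    calc _ ≤ h.natDegree * 1 := Nat.mul_le_mul_left _ this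
      _ ≤ t + 1 := by omega
  · rw [TT_apply, mul_comp, C_comp, Polynomial.map_comp, comp_assoc, C_fi_pow t]
    simp
    ring

theorem Pf_ex (m : L[X]) : ∃ t, m ∈ Pf L f Z t := by
  have hL : ∀ a : L, ∃ t, ∃ r : R, a = algebraMap R L r * fi L f ^ t := by
    intro a
    obtain ⟨t, r, h⟩ := IsLocalization.Away.surj f a
    refine ⟨t, r, ?_⟩
    rw [← h, mul_assoc, ← mul_pow, f_fi, one_pow, mul_one]
  induction m using Polynomial.induction_on' with
  | add p q hp hq =>
    obtain ⟨a, ha⟩ := hp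
    obtain ⟨b, hb⟩ := hq
    exact ⟨max a b, add_mem (Pf_mono (le_max_left a b) ha) (Pf_mono (le_max_right a b) hb)⟩
  | monomial n a =>
    obtain ⟨t, r, rfl⟩ := hL a
    refine ⟨t + n, C r * (X ^ n * C (f ^ n)), ?_, ?_⟩
    · refine (natDegree_C_mul_le _ _).trans ((natDegree_mul_C_le _ _).trans ((natDegree_X_pow_le n).trans (by omega)))
    · rw [← C_mul_X_pow_eq_monomial]
      simp only [Polynomial.map_mul, map_C, Polynomial.map_pow, map_X, map_pow]
      have h1 : C (algebraMap R L f ^ n) * C (fi L f ^ (t + n)) = C (fi L f ^ t) := by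
        rw [← C_mul, pow_add, mul_comm (fi L f ^ t), ← mul_assoc, ← mul_pow, f_fi, one_pow, one_mul]
      rw [C_mul, ← h1, ← C_pow, ← C_pow]
      ring

end core
end LCF
end

section
namespace LCF
open Polynomial

section core
variable {k : Type*} {R : Type*} {Z L : Type*} [Field k] [CharZero k] [CommRing R] [CommRing Z] [IsDomain Z] [CommRing L]
  [Algebra k R] [Algebra R L] [Algebra k L] [IsScalarTower k R L] {f : R} [IsLocalization.Away f L]
  [Algebra k Z] [Algebra Z R] [Algebra Z L] [IsScalarTower Z R L] [IsScalarTower k Z R] [IsScalarTower k Z L]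

theorem EZ_tf : Module.IsTorsionFree Z (L[X] ⧸ EZ k Z L f) := by
  refine ⟨fun c hc => ?_⟩
  intro a b hab
  obtain ⟨a, rfl⟩ := Submodule.Quotient.mk_surjective _ a
  obtain ⟨b, rfl⟩ := Submodule.Quotient.mk_surjective _ b
  change c • (Submodule.Quotient.mk a : L[X] ⧸ EZ k Z L f) = c • Submodule.Quotient.mk b at hab
  rw [← Submodule.Quotient.mk_smul, ← Submodule.Quotient.mk_smul, Submodule.Quotient.eq, ← smul_sub, Zsmul] at hab
  rw [Submodule.Quotient.eq]
  exact EZ_sat (IsRegular.ne_zero hc) hab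

theorem rk_Pf [IsNoetherianRing R] [IsLocalRing R] (I : Ideal Z) [IsAdicComplete I Z]
    (hI : I.map (algebraMap Z R) ≤ IsLocalRing.maximalIdeal R)
    {J : Type*} [Fintype J] [DecidableEq J] (y : J → R)
    (hRk : ∀ r : R, ∃ z : Z, r - algebraMap Z R z ∈ Ideal.span (Set.range y) ⊔ I.map (algebraMap Z R))
    (c : ℕ) (hc : Ideal.span (Set.range y) ^ c ≤ bId k L f ⊔ I.map (algebraMap Z R)) :
    ∃ C₀ : ℕ, ∀ t, rk ((Pf L f Z t).map (EZ k Z L f).mkQ) ≤ ((C₀ * (t + 1) ^ (Fintype.card J + 1) : ℕ) : ℕ∞) := by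
  obtain ⟨K, hK⟩ := growth_f (k := k) (Z := Z) (L := L) (f := f)
  refine ⟨(c * K) ^ Fintype.card J, fun t => ?_⟩
  let m : (J → Fin (c * (K * t))) → R := fun e => ∏ j, y j ^ (e j : ℕ)
  let v : Fin (t + 1) × (J → Fin (c * (K * t))) → L[X] ⧸ EZ k Z L f := fun p =>
    Submodule.Quotient.mk (X ^ (p.1 : ℕ) * (C (algebraMap R L (m p.2)) * C (fi L f ^ t)))
  have hle : (Pf L f Z t).map (EZ k Z L f).mkQ ≤ Submodule.span Z (Set.range v) := by
    rintro _ ⟨_, ⟨h, hh, rfl⟩, rfl⟩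
    rw [h.as_sum_range_C_mul_X_pow' (Nat.lt_succ_of_le hh), Polynomial.map_sum, Finset.sum_mul, map_sum]
    refine Submodule.sum_mem _ fun i hi => ?_
    obtain ⟨w, hw, hr⟩ := nak_box y I hI hRk _ c hc (K * t) (h.coeff i)
    have h1 : (EZ k Z L f).mkQ (Polynomial.map (algebraMap R L) (C (h.coeff i) * X ^ i) * C (fi L f ^ t)) =
        (Submodule.Quotient.mk (X ^ i * (C (algebraMap R L w) * C (fi L f ^ t))) : L[X] ⧸ EZ k Z L f) := by
      rw [Submodule.mkQ_apply, Submodule.Quotient.eq]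
      have h2 : ∀ i : ℕ, ∀ g ∈ EZ k Z L f, X ^ i * g ∈ EZ k Z L f := by
        intro i
        induction i with
        | zero => intro g hg; simpa using hg
        | succ i ih => intro g hg; rw [pow_succ', mul_assoc]; exact EZ_X (ih g hg)
      convert h2 i _ (hK t _ hr) using 1
      simp only [Polynomial.map_mul, map_C, Polynomial.map_pow, map_X, map_sub, C_sub]
      ring
    rw [h1]
    clear h1 hr
    induction hw using Submodule.span_induction with
    | mem w hw =>
      obtain ⟨e, rfl⟩ := hw
      exact Submodule.subset_span ⟨(⟨i, Finset.mem_range.1 hi⟩, e), rfl⟩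
    | zero => simp
    | add a b _ _ h1 h2 =>
      rw [map_add, C_add, add_mul, mul_add, Submodule.Quotient.mk_add]; exact add_mem h1 h2
    | smul z a _ h =>
      have : X ^ i * (C (algebraMap R L (z • a)) * C (fi L f ^ t)) = z • (X ^ i * (C (algebraMap R L a) * C (fi L f ^ t))) := by
        rw [Algebra.smul_def, map_mul, ← IsScalarTower.algebraMap_apply, Zsmul, C_mul]; ring
      rw [this, Submodule.Quotient.mk_smul]
      exact Submodule.smul_mem _ _ h
  refine (rk_span_le v hle).trans ?_
  rw [Fintype.card_prod, Fintype.card_fun, Fintype.card_fin, Fintype.card_fin, Nat.cast_le, pow_succ]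
  calc (t + 1) * (c * (K * t)) ^ Fintype.card J ≤ (t + 1) * (c * K * (t + 1)) ^ Fintype.card J := by
        refine Nat.mul_le_mul_left _ (Nat.pow_le_pow_left ?_ _)
        rw [← mul_assoc]; exact Nat.mul_le_mul_left _ (by omega)
    _ = _ := by rw [mul_pow]; ring

set_option maxHeartbeats 1600000 in
theorem core_bs [IsNoetherianRing R] [IsLocalRing R] (I : Ideal Z) [IsAdicComplete I Z]
    (hI : I.map (algebraMap Z R) ≤ IsLocalRing.maximalIdeal R)
    {J τ : Type*} [Fintype J] [DecidableEq J] (y : J → R)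
    (D : J → Derivation k R R) (hDy : ∀ i j, D i (y j) = if i = j then 1 else 0)
    (hDZ : ∀ i (z : Z), D i (algebraMap Z R z) = 0) (hDD : ∀ i j r, D i (D j r) = D j (D i r))
    (dz : τ → Derivation k Z Z) (pz : τ → Derivation k R R) (hpz : ∀ t z, pz t (algebraMap Z R z) = algebraMap Z R (dz t z))
    (hconst : ∀ c h : Z, c ≠ 0 → (∀ z, c * dz z h = h * dz z c) → ∃ a : k, h = algebraMap k Z a * c)
    (hRk : ∀ r : R, ∃ z : Z, r - algebraMap Z R z ∈ Ideal.span (Set.range y) ⊔ I.map (algebraMap Z R))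
    (c : ℕ) (hc : Ideal.span (Set.range y) ^ c ≤ bId k L f ⊔ I.map (algebraMap Z R)) :
    ∃ b : Z, b ≠ 0 ∧ algebraMap Z R b ∈ bId k L f := by
  have hZL : ∀ z : Z, algebraMap Z L z = algebraMap R L (algebraMap Z R z) := fun z => IsScalarTower.algebraMap_apply Z R L z
  haveI := EZ_tf (k := k) (Z := Z) (L := L) (f := f)
  let E := EZ k Z L f
  let s : Module.End Z (L[X] ⧸ E) := qmap (AddMonoidHom.mulLeft X) (fun c m => mul_left_comm _ _ _) (fun m hm => EZ_X hm)
  let T : Module.End Z (L[X] ⧸ E) := qmap (TT L f) (fun c m => TT_C_mul _ _ _ _) (fun m hm => EZ_TT hm)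
  let Y : J → Module.End Z (L[X] ⧸ E) := fun j => qmap (AddMonoidHom.mulLeft (C (algebraMap R L (y j)))) (fun c m => mul_left_comm _ _ _) (fun m hm => EZ_R _ hm)
  let DD : J → Module.End Z (L[X] ⧸ E) := fun j => qmap (nab L f (D j)) (fun c m => by
    rw [nab_C_mul, hZL, dl_alg, hDZ, map_zero, C_0, zero_mul, zero_add]) (fun m hm => EZ_nab _ hm)
  let δ : τ → (L[X] ⧸ E) →+ (L[X] ⧸ E) := fun t =>
    QuotientAddGroup.map E.toAddSubgroup E.toAddSubgroup (nab L f (pz t)) (fun m hm => EZ_nab (pz t) hm)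
  obtain ⟨C₀, hC₀⟩ := rk_Pf (k := k) (L := L) (f := f) I hI y hRk c hc
  let u : L[X] ⧸ E := Submodule.Quotient.mk (C (fi L f))
  have hu : T u = 0 := by
    change (Submodule.Quotient.mk (TT L f (C (fi L f))) : L[X] ⧸ E) = 0
    rw [Submodule.Quotient.mk_eq_zero, TT_apply, C_comp, ← C_mul, f_fi, C_1]
    exact EZ_one k Z L f
  have hmk := Submodule.Quotient.mk_surjective E
  have ind : ∀ (P : (L[X] ⧸ E) → Prop), (∀ m : L[X], P (Submodule.Quotient.mk m)) → ∀ v, P v := by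
    intro P hP v; obtain ⟨m, rfl⟩ := hmk v; exact hP m
  have main : u = 0 := by
    refine core_Q (k := k) s T Y DD ?_ ?_ ?_ ?_ ?_ ?_ ?_ ?_ (fun t => (Pf L f Z t).map E.mkQ) ?_ ?_ ?_ ?_ ?_ ?_ C₀ hC₀ dz δ ?_ ?_ ?_ ?_ hconst ?_ u hu
    · refine ind _ fun m => ?_
      exact congrArg Submodule.Quotient.mk (TT_X_mul L f m)
    · intro i; refine LinearMap.ext (ind _ fun m => ?_)
      exact congrArg Submodule.Quotient.mk (TT_C_mul L f _ m)
    · intro i; refine LinearMap.ext (ind _ fun m => ?_)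
      exact congrArg Submodule.Quotient.mk (TT_nab L f _ m)
    · intro i; refine LinearMap.ext (ind _ fun m => ?_)
      exact congrArg Submodule.Quotient.mk (mul_left_comm _ _ m)
    · intro i; refine LinearMap.ext (ind _ fun m => ?_)
      exact congrArg Submodule.Quotient.mk (nab_X_mul L f _ m).symm
    · intro i j; refine LinearMap.ext (ind _ fun m => ?_)
      exact congrArg Submodule.Quotient.mk (mul_left_comm _ _ m)
    · intro i j; refine LinearMap.ext (ind _ fun m => ?_)
      exact congrArg Submodule.Quotient.mk (nab_comm _ _ (hDD i j) m)
    · intro i j; refine LinearMap.ext (ind _ fun m => ?_)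
      have h1 := nab_C_mul L f (D i) (algebraMap R L (y j)) m
      rw [dl_alg, hDy] at h1
      have h2 := congrArg (Submodule.Quotient.mk : L[X] → L[X] ⧸ E) h1
      refine Eq.trans h2 ?_
      rw [Submodule.Quotient.mk_add, add_comm]
      refine congrArg₂ (· + ·) rfl ?_
      split_ifs with hij
      · rw [map_one, C_1, one_mul]; rfl
      · rw [map_zero, C_0, zero_mul]; rfl
    · exact fun a b hab => Submodule.map_mono (Pf_mono hab)
    · refine ind _ fun m => ?_
      obtain ⟨t, ht⟩ := Pf_ex (Z := Z) (f := f) m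
      exact ⟨t, m, ht, rfl⟩
    · rintro t _ ⟨m, hm, rfl⟩
      obtain ⟨m', hm', rfl⟩ := Pf_TT t hm
      exact ⟨_, ⟨m', hm', rfl⟩, rfl⟩
    · rintro t _ ⟨m, hm, rfl⟩
      exact ⟨_, Pf_X t hm, rfl⟩
    · rintro i t _ ⟨m, hm, rfl⟩
      exact ⟨_, Pf_mono (Nat.le_succ t) (Pf_R t (y i) hm), rfl⟩
    · rintro i t _ ⟨m, hm, rfl⟩
      exact ⟨_, Pf_nab (D i) t hm, rfl⟩
    · rintro i t _ ⟨m, hm, rfl⟩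
      exact ⟨_, Pf_nab (pz i) t hm, rfl⟩
    · intro z; refine ind _ fun m => ?_
      exact congrArg Submodule.Quotient.mk (TT_nab L f _ m)
    · intro z c; refine ind _ fun m => ?_
      have h1 := nab_C_mul L f (pz z) (algebraMap Z L c) m
      rw [hZL, dl_alg, hpz, ← hZL, ← hZL, ← Zsmul, ← Zsmul, ← Zsmul] at h1
      exact congrArg (Submodule.Quotient.mk : L[X] → L[X] ⧸ E) h1
    · intro z; refine ind _ fun m => ?_
      exact congrArg Submodule.Quotient.mk (nab_X_mul L f _ m)
    · intro q hq
      refine ind _ fun m hm => ?_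
      have hq' : ∀ q : k[X], ∀ m : L[X], aeval s (q.map (algebraMap k Z)) (Submodule.Quotient.mk m : L[X] ⧸ E) =
          Submodule.Quotient.mk (q.map (algebraMap k L) * m) := by
        intro q m
        induction q using Polynomial.induction_on' with
        | add p q hp hq =>
          rw [Polynomial.map_add, Polynomial.map_add, map_add, add_mul, Submodule.Quotient.mk_add, ← hp, ← hq]; rfl
        | monomial n a =>
          have h1 : ∀ n : ℕ, (s ^ n) (Submodule.Quotient.mk m) = (Submodule.Quotient.mk (X ^ n * m) : L[X] ⧸ E) := by
            intro n
            induction n with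
            | zero => simp
            | succ n ih =>
              rw [pow_succ', pow_succ', Module.End.mul_apply, ih, mul_assoc]; rfl
          rw [map_monomial, map_monomial, aeval_monomial, Module.End.mul_apply, h1, Module.algebraMap_end_apply,
            ← Submodule.Quotient.mk_smul, Zsmul, ← IsScalarTower.algebraMap_apply, ← C_mul_X_pow_eq_monomial, mul_assoc]
      rw [hq', Submodule.Quotient.mk_eq_zero] at hm
      rw [Submodule.Quotient.mk_eq_zero]
      exact EZ_satk hq hm
  rw [Submodule.Quotient.mk_eq_zero] at main
  obtain ⟨b, hb, q, hq, A, hA⟩ := main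
  refine ⟨b, hb, q, hq, A, ?_⟩
  convert hA using 1
  rw [C_mul, hZL]; ring

end core
end LCF
end

section
namespace LCF
open MvPowerSeries

section consts
variable {k : Type*} [Field k] [CharZero k] {d : ℕ}

theorem coeff_euler {σ : Type*} [DecidableEq σ] {k : Type*} [CommRing k] (i : σ) (h : MvPowerSeries σ k) (b : σ →₀ ℕ) :
    coeff b (X i * pderiv k i h) = b i * coeff b h := by
  by_cases hb : b i = 0
  · rw [hb, Nat.cast_zero, zero_mul]
    have : ∀ m, coeff b (X i * m : MvPowerSeries σ k) = 0 := fun m =>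
      (X_dvd_iff.1 (Dvd.intro m rfl)) b hb
    exact this _
  · obtain ⟨c, rfl⟩ : ∃ c, b = c + Finsupp.single i 1 :=
      ⟨b - Finsupp.single i 1, (tsub_add_cancel_of_le (by
        rw [Finsupp.single_le_iff]; omega)).symm⟩
    rw [mul_comm, X_def, coeff_add_mul_monomial, coeff_pderiv]
    simp [mul_comm]

theorem consts (c h : MvPowerSeries (Fin d) k) (hc : c ≠ 0)
    (hd : ∀ i, c * pderiv k i h = h * pderiv k i c) : ∃ a : k, h = algebraMap k _ a * c := by
  obtain ⟨e, he⟩ := exists_finsupp_eq_lexOrder_of_ne_zero hc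
  have hce := coeff_ne_zero_of_lexOrder he.symm
  refine ⟨coeff e h / coeff e c, ?_⟩
  by_contra hne
  set h' := h - algebraMap k _ (coeff e h / coeff e c) * c with hh'
  have h0 : h' ≠ 0 := fun h0 => hne (sub_eq_zero.1 h0)
  have hrel : ∀ i, c * pderiv k i h' = h' * pderiv k i c := by
    intro i
    rw [hh', map_sub, Derivation.leibniz, Derivation.map_algebraMap, smul_eq_mul, smul_zero, add_zero, mul_sub, hd i]
    ring
  have hz : coeff e h' = 0 := by
    rw [hh', map_sub, ← Algebra.smul_def, map_smul, smul_eq_mul, div_mul_cancel₀ _ hce, sub_self]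
  obtain ⟨e', he'⟩ := exists_finsupp_eq_lexOrder_of_ne_zero h0
  have hce' := coeff_ne_zero_of_lexOrder he'.symm
  have key : ∀ u v : MvPowerSeries (Fin d) k, (∀ b, toLex b < toLex e → coeff b u = 0) →
      (∀ b, toLex b < toLex e' → coeff b v = 0) → coeff (e + e') (u * v) = coeff e u * coeff e' v := by
    intro u v hu hv
    rw [coeff_mul, Finset.sum_eq_single_of_mem (e, e') (by simp)]
    rintro ⟨a, b⟩ hab hne
    rw [Finset.HasAntidiagonal.mem_antidiagonal] at hab
    rcases trichotomy_of_add_eq_add (congrArg toLex hab) with h1 | h1 | h1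
    · exact absurd (Prod.ext h1.1 h1.2) hne
    · rw [hu a h1, zero_mul]
    · rw [hv b h1, mul_zero]
  have cz : ∀ b, toLex b < toLex e → coeff b c = 0 := fun b hb =>
    coeff_eq_zero_of_lt_lexOrder (by rw [he]; exact_mod_cast hb)
  have hz' : ∀ b, toLex b < toLex e' → coeff b h' = 0 := fun b hb =>
    coeff_eq_zero_of_lt_lexOrder (by rw [he']; exact_mod_cast hb)
  have hee : e = e' := by
    ext i
    have h1 : c * (X i * pderiv k i h') = (X i * pderiv k i c) * h' := by
      linear_combination (X i : MvPowerSeries (Fin d) k) * hrel i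
    have h2 := congrArg (coeff (e + e')) h1
    rw [key _ _ cz (fun b hb => by rw [coeff_euler, hz' b hb, mul_zero]),
      key _ _ (fun b hb => by rw [coeff_euler, cz b hb, mul_zero]) hz', coeff_euler, coeff_euler] at h2
    have h3 : ((e i : k) - e' i) * (coeff e c * coeff e' h') = 0 := by linear_combination -h2
    have h4 := (mul_eq_zero.1 h3).resolve_right (mul_ne_zero hce hce')
    exact_mod_cast sub_eq_zero.1 h4
  subst hee
  exact hce' hz

end consts

section span
variable {σ k : Type*} [CommRing k]

theorem mem_span_X (S : Finset σ) (u : MvPowerSeries σ k)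
    (hu : ∀ e : σ →₀ ℕ, (∀ i ∈ S, e i = 0) → coeff e u = 0) :
    u ∈ Ideal.span ((fun i => (X i : MvPowerSeries σ k)) '' (S : Set σ)) := by
  classical
  induction S using Finset.induction_on generalizing u with
  | empty =>
    have : u = 0 := by ext e; exact hu e (by simp)
    rw [this]; exact zero_mem _
  | insert j S hj ih =>
    let u1 : MvPowerSeries σ k := fun e => if e j = 0 then coeff e u else 0
    have c1 : ∀ e, coeff e u1 = if e j = 0 then coeff e u else 0 := fun e => rfl
    have h1 := ih u1 (by
      intro e he
      rw [c1]
      split_ifs with hh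
      · refine hu e fun i hi => ?_
        rcases Finset.mem_insert.1 hi with rfl | hi
        · exact hh
        · exact he i hi
      · rfl)
    have h2 : (X j : MvPowerSeries σ k) ∣ u - u1 := by
      rw [X_dvd_iff]
      intro m hm
      rw [map_sub, c1, if_pos hm, sub_self]
    have h3 : u - u1 ∈ Ideal.span ((fun i => (X i : MvPowerSeries σ k)) '' ((insert j S : Finset σ) : Set σ)) :=
      Ideal.mem_of_dvd _ h2 (Ideal.subset_span ⟨j, by simp, rfl⟩)
    have h4 : u1 ∈ Ideal.span ((fun i => (X i : MvPowerSeries σ k)) '' ((insert j S : Finset σ) : Set σ)) :=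
      Ideal.span_mono (Set.image_mono (by simp)) h1
    have := Ideal.add_mem _ h3 h4
    rwa [sub_add_cancel] at this

end span
end LCF
end

section
namespace LCF
open MvPowerSeries

section coord
variable {σ k : Type*} [Fintype σ] [DecidableEq σ] [Field k]

theorem exists_mu [Infinite k] (l : σ) (b : MvPowerSeries σ k) (hb : b ≠ 0) : ∃ μ : σ → k, μ l = 1 ∧ ∃ N : ℕ,
    ∑ d ∈ Finset.finsuppAntidiag Finset.univ N, coeff d b * ∏ i, μ i ^ d i ≠ 0 := by
  obtain ⟨e, he⟩ : ∃ e, coeff e b ≠ 0 := by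
    by_contra h; push Not at h; exact hb (MvPowerSeries.ext h)
  let N := ∑ i, e i
  let S := Finset.finsuppAntidiag (Finset.univ : Finset σ) N
  let F : MvPolynomial σ k := ∑ d ∈ S, MvPolynomial.monomial d (coeff d b)
  have heS : e ∈ S := by simp [S, N, Finset.mem_finsuppAntidiag]
  have hF : F ≠ 0 := by
    intro h
    have := congrArg (MvPolynomial.coeff e) h
    simp only [F, MvPolynomial.coeff_sum, MvPolynomial.coeff_monomial, MvPolynomial.coeff_zero] at this
    rw [Finset.sum_ite_eq' , if_pos heS] at this
    exact he this
  have hev : ∀ ν : σ → k, MvPolynomial.eval ν F = ∑ d ∈ S, coeff d b * ∏ i, ν i ^ d i := by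
    intro ν
    simp only [F, map_sum, MvPolynomial.eval_monomial]
    refine Finset.sum_congr rfl fun d _ => ?_
    rw [Finsupp.prod_fintype _ _ (by simp)]
  obtain ⟨ν, hν⟩ : ∃ ν : σ → k, MvPolynomial.eval ν (F * MvPolynomial.X l) ≠ 0 := by
    by_contra h; push Not at h
    exact mul_ne_zero hF (MvPolynomial.X_ne_zero l) (MvPolynomial.funext fun ν => by rw [h ν, map_zero])
  rw [map_mul, MvPolynomial.eval_X] at hν
  have h1 := right_ne_zero_of_mul hν
  have h2 := left_ne_zero_of_mul hν
  refine ⟨fun i => ν i / ν l, div_self h1, N, ?_⟩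
  have : ∑ d ∈ S, coeff d b * ∏ i, (ν i / ν l) ^ d i = (∑ d ∈ S, coeff d b * ∏ i, ν i ^ d i) / ν l ^ N := by
    rw [Finset.sum_div]
    refine Finset.sum_congr rfl fun d hd => ?_
    rw [Finset.mem_finsuppAntidiag] at hd
    simp only [div_pow]
    rw [Finset.prod_div_distrib, Finset.prod_pow_eq_pow_sum, hd.1, mul_div_assoc]
  change ∑ d ∈ S, coeff d b * ∏ i, (ν i / ν l) ^ d i ≠ 0
  rw [this, ← hev]
  exact div_ne_zero h2 (pow_ne_zero _ h1)

/-- the coordinate change `x_i ↦ x_i + ν_i x_l` -/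
noncomputable def sh (l : σ) (ν : σ → k) : σ → MvPowerSeries σ k := fun i => X i + C (ν i) * X l

omit [DecidableEq σ] in
theorem sh_has (l : σ) (ν : σ → k) : HasSubst (sh l ν) := by
  refine hasSubst_of_constantCoeff_zero fun i => ?_
  simp [sh]

theorem coeff_sh (l : σ) (ν μ : σ → k) (hl : μ l = 1) (hμ : ∀ i, i ≠ l → ν i = μ i) (hν : ν l = 0)
    (b : MvPowerSeries σ k) (N : ℕ) :
    coeff (Finsupp.single l N) (subst (sh l ν) b) =
      ∑ d ∈ Finset.finsuppAntidiag Finset.univ N, coeff d b * ∏ i, μ i ^ d i := by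
  let e : Unit ↪ σ := ⟨fun _ => l, fun _ _ _ => rfl⟩
  have hk : ∀ i, killCompl e (sh l ν i) = C (μ i) * X () := by
    intro i
    have hXl : killCompl (R := k) e (X l) = X () := killCompl_X (R := k) (e := e) ()
    rw [sh, map_add, map_mul, hXl, killCompl_C]
    by_cases h : i = l
    · subst h; rw [hXl, hν, hl]; simp
    · rw [killCompl_X_eq_zero (by rintro ⟨_, rfl⟩; exact h rfl), hμ i h, zero_add]
  have hd : ∀ d : σ →₀ ℕ, coeff (Finsupp.single l N) (d.prod fun s e => sh l ν s ^ e) =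
      if ∑ i, d i = N then ∏ i, μ i ^ d i else 0 := by
    intro d
    have h1 : Finsupp.single l N = Finsupp.embDomain e (Finsupp.single () N) := by
      rw [Finsupp.embDomain_single]; rfl
    rw [h1, ← coeff_killCompl, Finsupp.prod_fintype _ _ (by simp), map_prod]
    simp only [map_pow, hk, mul_pow]
    rw [Finset.prod_mul_distrib, Finset.prod_pow_eq_pow_sum]
    simp only [← map_pow]
    rw [← map_prod, coeff_C_mul, coeff_X_pow]
    by_cases h : ∑ i, d i = N
    · rw [h, if_pos rfl, if_pos rfl, mul_one]
    · have : Finsupp.single () N ≠ Finsupp.single () (∑ i, d i) := fun h' => h (by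
        have := DFunLike.congr_fun h' ()
        simpa using this.symm)
      rw [if_neg this, if_neg h, mul_zero]
  rw [coeff_subst (sh_has l ν)]
  simp only [hd, smul_eq_mul]
  rw [finsum_eq_sum_of_support_subset (s := Finset.finsuppAntidiag Finset.univ N)]
  · refine Finset.sum_congr rfl fun d hd => ?_
    rw [Finset.mem_finsuppAntidiag] at hd
    rw [if_pos hd.1]
  · intro d hd
    rw [Finset.mem_coe, Finset.mem_finsuppAntidiag]
    refine ⟨?_, by simp⟩
    by_contra h
    exact hd (by simp only [if_neg h, mul_zero])

theorem exists_coord [Infinite k] (l : σ) (b : MvPowerSeries σ k) (hb : b ≠ 0) : ∃ ν : σ → k, ν l = 0 ∧ ∃ (e : ℕ)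
    (u : MvPowerSeries σ k), IsUnit u ∧
      subst (sh l ν) b - u * X l ^ e ∈ Ideal.span ((fun i => (X i : MvPowerSeries σ k)) '' {i | i ≠ l}) := by
  obtain ⟨μ, hl, hN⟩ := exists_mu l b hb
  let ν : σ → k := Function.update μ l 0
  have hν : ν l = 0 := by simp [ν]
  refine ⟨ν, hν, ?_⟩
  have hc := coeff_sh l ν μ hl (fun i hi => by simp [ν, hi]) hν b
  set w := subst (sh l ν) b with hw
  have hex : ∃ N, coeff (Finsupp.single l N) w ≠ 0 := by
    obtain ⟨N, h⟩ := hN; exact ⟨N, by rw [hc]; exact h⟩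
  classical
  let e := Nat.find hex
  have he : coeff (Finsupp.single l e) w ≠ 0 := Nat.find_spec hex
  have hmin : ∀ m < e, coeff (Finsupp.single l m) w = 0 := fun m hm => by
    by_contra h; exact Nat.find_min hex hm h
  let u : MvPowerSeries σ k := fun d => coeff (d + Finsupp.single l e) w
  have hu : ∀ d, coeff d u = coeff (d + Finsupp.single l e) w := fun d => rfl
  refine ⟨e, u, ?_, ?_⟩
  · rw [MvPowerSeries.isUnit_iff_constantCoeff, isUnit_iff_ne_zero, ← coeff_zero_eq_constantCoeff_apply, hu, zero_add]
    exact he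
  · have := mem_span_X (Finset.univ.erase l) (w - u * X l ^ e) (by
      intro d hd
      obtain ⟨m, rfl⟩ : ∃ m, d = Finsupp.single l m := by
        refine ⟨d l, ?_⟩
        ext i
        by_cases h : i = l
        · subst h; simp
        · rw [hd i (by simp [h]), Finsupp.single_apply, if_neg (Ne.symm h)]
      rw [map_sub]
      rcases lt_or_ge m e with h | h
      · rw [hmin m h, zero_sub, neg_eq_zero]
        exact X_pow_dvd_iff.1 (Dvd.intro_left u rfl) _ (by simpa using h)
      · obtain ⟨m, rfl⟩ := Nat.exists_eq_add_of_le' h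
        rw [Finsupp.single_add, X_pow_eq, coeff_add_mul_monomial, mul_one, hu, sub_self])
    convert this using 3
    ext i; simp

end coord
end LCF
end

section
namespace LCF
open MvPowerSeries

section ren
variable {σ τ k : Type*} [CommRing k]

theorem pderiv_rename_zero (e : σ ↪ τ) (j : τ) (hj : j ∉ Set.range e) (z : MvPowerSeries σ k) :
    pderiv k j (rename e z) = 0 := by
  ext m
  rw [coeff_pderiv, coeff_rename_eq_zero, zero_mul, map_zero]
  rintro ⟨x, hx⟩
  rw [← Finsupp.embDomain_eq_mapDomain] at hx
  have := DFunLike.congr_fun hx j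
  rw [Finsupp.embDomain_of_notMem_range _ _ _ hj] at this
  simp at this

theorem pderiv_rename (e : σ ↪ τ) (t : σ) (z : MvPowerSeries σ k) :
    pderiv k (e t) (rename e z) = rename e (pderiv k t z) := by
  ext m
  rw [coeff_pderiv]
  by_cases hm : m ∈ Set.range (Finsupp.embDomain (M := ℕ) e)
  · obtain ⟨x, rfl⟩ := hm
    rw [coeff_embDomain_rename, coeff_pderiv]
    have : Finsupp.embDomain e x + Finsupp.single (e t) 1 = Finsupp.embDomain e (x + Finsupp.single t 1) := by
      simp only [Finsupp.embDomain_eq_mapDomain, Finsupp.mapDomain_add, Finsupp.mapDomain_single]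
    rw [this, coeff_embDomain_rename, Finsupp.embDomain_apply_self]
  · have h1 : coeff m (rename e (pderiv k t z)) = 0 := coeff_rename_eq_zero _ _ (by
      rintro ⟨x, hx⟩; exact hm ⟨x, by rw [Finsupp.embDomain_eq_mapDomain, hx]⟩)
    rw [h1, coeff_rename_eq_zero, zero_mul]
    rintro ⟨x, hx⟩
    rw [← Finsupp.embDomain_eq_mapDomain] at hx
    exact hm (Finsupp.isLowerSet_range_embDomain e (a := Finsupp.embDomain e x) (by rw [hx]; exact le_self_add) ⟨x, rfl⟩)

theorem pderiv_pderiv (i j : σ) (z : MvPowerSeries σ k) :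
    pderiv k i (pderiv k j z) = pderiv k j (pderiv k i z) := by
  classical
  ext m
  simp only [coeff_pderiv, Finsupp.add_apply, Finsupp.single_apply]
  rw [add_right_comm]
  by_cases h : i = j
  · subst h; ring
  · rw [if_neg h, if_neg (Ne.symm h), Nat.add_zero, Nat.add_zero]; ring

/-- conjugation of a derivation by an automorphism -/
noncomputable def conjD {R : Type*} [CommRing R] [Algebra k R] (θ : R ≃ₐ[k] R) (δ : Derivation k R R) : Derivation k R R :=
  Derivation.mk' (θ.toLinearMap ∘ₗ δ.toLinearMap ∘ₗ θ.symm.toLinearMap) (by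
    intro a b
    simp [Derivation.leibniz])

theorem conjD_apply {R : Type*} [CommRing R] [Algebra k R] (θ : R ≃ₐ[k] R) (δ : Derivation k R R) (r : R) :
    conjD θ δ r = θ (δ (θ.symm r)) := rfl

end ren

section stepZ
variable {k : Type*} [Field k] [CharZero k] {n : ℕ} {L : Type*} [CommRing L] [Algebra (MvPowerSeries (Fin n) k) L]
  [Algebra k L] [IsScalarTower k (MvPowerSeries (Fin n) k) L] {f : MvPowerSeries (Fin n) k} [IsLocalization.Away f L]

theorem constCoeff_sub_mem {σ : Type*} [Fintype σ] (r : MvPowerSeries σ k) :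
    r - C (constantCoeff r) ∈ Ideal.span (Set.range (fun i => (X i : MvPowerSeries σ k))) := by
  have := mem_span_X Finset.univ (r - C (constantCoeff r)) (by
    intro e he
    have : e = 0 := by ext i; exact he i (Finset.mem_univ _)
    subst this; simp)
  simpa using this

theorem stepZ {d : ℕ} (hd : d ≤ n) (θ : MvPowerSeries (Fin n) k ≃ₐ[k] MvPowerSeries (Fin n) k) (c : ℕ)
    (hc : IsLocalRing.maximalIdeal (MvPowerSeries (Fin n) k) ^ c ≤ bId k L f ⊔
      Ideal.span ((fun i => θ (X i)) '' {i : Fin n | (i : ℕ) < d})) :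
    ∃ b : MvPowerSeries (Fin d) k, b ≠ 0 ∧ θ (rename (Fin.castLEEmb hd) b) ∈ bId k L f := by
  let φ : MvPowerSeries (Fin d) k →ₐ[k] MvPowerSeries (Fin n) k := (θ : _ →ₐ[k] _).comp (rename (Fin.castLEEmb hd))
  letI : Algebra (MvPowerSeries (Fin d) k) (MvPowerSeries (Fin n) k) := φ.toRingHom.toAlgebra
  letI : Algebra (MvPowerSeries (Fin d) k) L := ((algebraMap (MvPowerSeries (Fin n) k) L).comp φ.toRingHom).toAlgebra
  haveI : IsScalarTower (MvPowerSeries (Fin d) k) (MvPowerSeries (Fin n) k) L := IsScalarTower.of_algebraMap_eq fun _ => rfl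
  have hφ : ∀ z, algebraMap (MvPowerSeries (Fin d) k) (MvPowerSeries (Fin n) k) z = θ (rename (Fin.castLEEmb hd) z) := fun _ => rfl
  haveI : IsScalarTower k (MvPowerSeries (Fin d) k) (MvPowerSeries (Fin n) k) :=
    IsScalarTower.of_algebraMap_eq fun a => (φ.commutes a).symm
  haveI : IsScalarTower k (MvPowerSeries (Fin d) k) L := IsScalarTower.of_algebraMap_eq fun a => by
    rw [IsScalarTower.algebraMap_apply (MvPowerSeries (Fin d) k) (MvPowerSeries (Fin n) k) L, ← IsScalarTower.algebraMap_apply k,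
      ← IsScalarTower.algebraMap_apply]
  haveI : IsDomain (MvPowerSeries (Fin d) k) := NoZeroDivisors.to_isDomain _
  let I : Ideal (MvPowerSeries (Fin d) k) := Ideal.span (Set.range X)
  have hImap : I.map (algebraMap (MvPowerSeries (Fin d) k) (MvPowerSeries (Fin n) k)) =
      Ideal.span ((fun i => θ (X i)) '' {i : Fin n | (i : ℕ) < d}) := by
    rw [Ideal.map_span, ← Set.range_comp]
    congr 1
    ext r
    constructor
    · rintro ⟨i, rfl⟩
      refine ⟨Fin.castLE hd i, i.2, ?_⟩
      simp only [Function.comp_apply, hφ]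
      rw [rename_X]; rfl
    · rintro ⟨i, hi, rfl⟩
      refine ⟨⟨i, hi⟩, ?_⟩
      simp only [Function.comp_apply, hφ]
      rw [rename_X]; rfl
  have hXm : ∀ i, θ (X i) ∈ IsLocalRing.maximalIdeal (MvPowerSeries (Fin n) k) := by
    intro i
    rw [IsLocalRing.mem_maximalIdeal, mem_nonunits_iff]
    intro h
    have h2 := h.map θ.symm
    rw [AlgEquiv.symm_apply_apply, MvPowerSeries.isUnit_iff_constantCoeff] at h2
    simp at h2
  let J := {j : Fin n // d ≤ (j : ℕ)}
  have hnr : ∀ j : J, (j : Fin n) ∉ Set.range (Fin.castLEEmb hd) := by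
    rintro ⟨j, hj⟩ ⟨i, hi⟩
    have h1 : (i : ℕ) = j := congrArg Fin.val hi
    have := i.2
    omega
  refine core_bs (k := k) (L := L) (f := f) (Z := MvPowerSeries (Fin d) k) I ?_ (J := J) (τ := Fin d)
    (fun j => θ (X (j : Fin n))) (fun j => conjD θ (pderiv k (j : Fin n))) ?_ ?_ ?_
    (fun t => pderiv k t) (fun t => conjD θ (pderiv k (Fin.castLEEmb hd t))) ?_ ?_ ?_ c ?_
  · rw [hImap, Ideal.span_le]
    rintro _ ⟨i, _, rfl⟩
    exact hXm i
  · intro i j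
    rw [conjD_apply, AlgEquiv.symm_apply_apply, pderiv_X, Pi.single_apply]
    by_cases h : i = j
    · rw [if_pos h, if_pos (by rw [h]), map_one]
    · rw [if_neg h, if_neg (fun h' => h (Subtype.ext h'.symm)), map_zero]
  · intro i z
    rw [conjD_apply, hφ, AlgEquiv.symm_apply_apply, pderiv_rename_zero _ _ (hnr i), map_zero]
  · intro i j r
    simp only [conjD_apply, AlgEquiv.symm_apply_apply]
    rw [pderiv_pderiv]
  · intro t z
    rw [conjD_apply, hφ, hφ, AlgEquiv.symm_apply_apply, pderiv_rename]
  · intro c h hc hh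
    exact consts c h hc hh
  · intro r
    refine ⟨C (constantCoeff (θ.symm r)), ?_⟩
    rw [hImap, hφ, rename_C, ← Ideal.span_union]
    have h1 := Ideal.mem_map_of_mem (RingHomClass.toRingHom θ) (constCoeff_sub_mem (θ.symm r))
    rw [Ideal.map_span] at h1
    rw [map_sub] at h1
    have h2 : (RingHomClass.toRingHom θ) (θ.symm r) = r := AlgEquiv.apply_symm_apply θ r
    rw [h2] at h1
    refine Ideal.span_mono ?_ h1
    rintro _ ⟨_, ⟨i, rfl⟩, rfl⟩
    rcases lt_or_ge (i : ℕ) d with h | h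
    · exact Or.inr ⟨i, h, rfl⟩
    · exact Or.inl ⟨⟨i, h⟩, rfl⟩
  · rw [hImap]
    refine le_trans (Ideal.pow_right_mono ?_ c) hc
    rw [Ideal.span_le]
    rintro _ ⟨i, rfl⟩
    exact hXm i

end stepZ
end LCF
end

section
namespace LCF
open MvPowerSeries

section chi
variable {σ k : Type*} [Fintype σ] [Field k]

theorem subst_sh_inv (l : σ) (ν : σ → k) (hν : ν l = 0) (r : MvPowerSeries σ k) :
    subst (sh l (-ν)) (subst (sh l ν) r) = r := by
  rw [subst_comp_subst_apply (sh_has l ν) (sh_has l (-ν))]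
  have : (fun s => subst (sh l (-ν)) (sh l ν s)) = (X : σ → MvPowerSeries σ k) := by
    funext s
    have h1 : ∀ s, subst (sh l (-ν)) (X s : MvPowerSeries σ k) = sh l (-ν) s := fun s => subst_X (sh_has l (-ν)) s
    have h2 : sh l ν s = X s + ν s • X l := by rw [sh, ← smul_eq_C_mul]
    rw [h2, subst_add (sh_has l (-ν)), subst_smul (sh_has l (-ν)), h1, h1]
    simp only [sh, Pi.neg_apply, hν, smul_eq_C_mul]
    simp
  rw [this, subst_self, id]

/-- the coordinate change as an automorphism -/
noncomputable def chi (l : σ) (ν : σ → k) (hν : ν l = 0) : MvPowerSeries σ k ≃ₐ[k] MvPowerSeries σ k :=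
  AlgEquiv.ofAlgHom (substAlgHom (sh_has l ν)) (substAlgHom (sh_has l (-ν)))
    (by
      ext1 r
      have h := subst_sh_inv l (-ν) (by simp [hν]) r
      rw [neg_neg] at h
      simpa using h)
    (by
      ext1 r
      simpa using subst_sh_inv l ν hν r)

theorem chi_apply (l : σ) (ν : σ → k) (hν : ν l = 0) (r : MvPowerSeries σ k) : chi l ν hν r = subst (sh l ν) r := by
  rw [← substAlgHom_apply (sh_has l ν)]; rfl

theorem chi_X (l : σ) (ν : σ → k) (hν : ν l = 0) (i : σ) : chi l ν hν (X i) = X i + C (ν i) * X l := by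
  rw [chi_apply]; exact subst_X (sh_has l ν) i

theorem chi_rename {τ : Type*} [Fintype τ] (e : σ ↪ τ) (l : σ) (ν : σ → k) (ν' : τ → k) (h : ∀ i, ν' (e i) = ν i)
    (b : MvPowerSeries σ k) : subst (sh (e l) ν') (rename e b) = rename e (subst (sh l ν) b) := by
  rw [rename_eq_subst, rename_eq_subst, subst_comp_subst_apply (HasSubst.X_comp (e : σ → τ)) (sh_has _ _),
    subst_comp_subst_apply (sh_has _ _) (HasSubst.X_comp (e : σ → τ))]
  congr 1
  funext s
  have h2 : sh l ν s = X s + ν s • X l := by rw [sh, ← smul_eq_C_mul]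
  have h3 : ∀ s, subst (X ∘ e : σ → MvPowerSeries τ k) (X s : MvPowerSeries σ k) = X (e s) := fun s =>
    subst_X (HasSubst.X_comp (e : σ → τ)) s
  rw [Function.comp_apply, subst_X (sh_has _ _), h2, subst_add (HasSubst.X_comp (e : σ → τ)),
    subst_smul (HasSubst.X_comp (e : σ → τ)), h3, h3, sh, h, smul_eq_C_mul]

end chi

section P
variable {k : Type*} [Field k] [CharZero k] {n : ℕ} {L : Type*} [CommRing L] [Algebra (MvPowerSeries (Fin n) k) L]
  [Algebra k L] [IsScalarTower k (MvPowerSeries (Fin n) k) L] {f : MvPowerSeries (Fin n) k} [IsLocalization.Away f L]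

theorem Pd (d : ℕ) : ∀ (_ : d ≤ n) (θ : MvPowerSeries (Fin n) k ≃ₐ[k] MvPowerSeries (Fin n) k) (c : ℕ)
    (_ : IsLocalRing.maximalIdeal (MvPowerSeries (Fin n) k) ^ c ≤ bId k L f ⊔
      Ideal.span ((fun i => θ (X i)) '' {i : Fin n | (i : ℕ) < d})), bId k L f = ⊤ := by
  induction d with
  | zero =>
    intro hd θ c hc
    obtain ⟨b, hb, hbb⟩ := stepZ hd θ c hc
    refine Ideal.eq_top_of_isUnit_mem _ hbb ?_
    refine IsUnit.map _ (IsUnit.map _ ?_)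
    rw [MvPowerSeries.isUnit_iff_constantCoeff, isUnit_iff_ne_zero]
    intro h0
    refine hb (MvPowerSeries.ext fun e => ?_)
    rw [Subsingleton.elim e 0, coeff_zero_eq_constantCoeff_apply, h0, map_zero]
  | succ d ih =>
    intro hd θ c hc
    obtain ⟨b, hb, hbb⟩ := stepZ hd θ c hc
    obtain ⟨ν, hν, e, u, hu, hw⟩ := exists_coord (Fin.last d) b hb
    let E := Fin.castLEEmb hd
    let l' : Fin n := E (Fin.last d)
    let ν' : Fin n → k := fun i => if h : (i : ℕ) < d + 1 then ν ⟨i, h⟩ else 0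
    have hν' : ∀ i, ν' (E i) = ν i := by
      intro i
      have : ((E i : Fin n) : ℕ) < d + 1 := i.2
      simp only [ν']; rw [dif_pos this]; rfl
    have hl0 : ν' l' = 0 := by rw [hν', hν]
    let χ := chi l' ν' hl0
    let θ₂ := χ.symm.trans θ
    have hθ₂ : ∀ r, θ₂ (χ r) = θ r := fun r => by simp [θ₂]
    let K := bId k L f ⊔ Ideal.span ((fun i => θ₂ (X i)) '' {i : Fin n | (i : ℕ) < d})
    have hmem : θ₂ (X l') ^ e ∈ K := by
      have h1 : θ₂ (rename E (subst (sh (Fin.last d) ν) b)) ∈ K := by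
        rw [← chi_rename E _ ν ν' hν', ← chi_apply (E (Fin.last d)) ν' hl0, hθ₂]
        exact Ideal.mem_sup_left hbb
      have h2 : θ₂ (rename E (subst (sh (Fin.last d) ν) b - u * X (Fin.last d) ^ e)) ∈ K := by
        let g : MvPowerSeries (Fin (d + 1)) k →+* MvPowerSeries (Fin n) k :=
          (RingHomClass.toRingHom θ₂).comp (RingHomClass.toRingHom (rename E))
        have h3 := Ideal.mem_map_of_mem g hw
        refine (?_ : Ideal.map g _ ≤ K) h3
        rw [Ideal.map_span, Ideal.span_le]
        rintro _ ⟨_, ⟨i, hi, rfl⟩, rfl⟩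
        refine Ideal.mem_sup_right (Ideal.subset_span ⟨E i, ?_, ?_⟩)
        · have : i ≠ Fin.last d := hi
          have h5 : (i : ℕ) ≠ d := fun h => this (Fin.ext h)
          have : (i : ℕ) < d := by have := i.2; omega
          exact this
        · change _ = θ₂ (rename E (X i))
          rw [rename_X]
      have h3 : θ₂ (rename E (u * X (Fin.last d) ^ e)) ∈ K := by
        have := Ideal.sub_mem _ h1 h2
        rwa [map_sub, map_sub, sub_sub_cancel] at this
      rw [map_mul, map_mul, map_pow, map_pow, rename_X] at h3
      exact (Ideal.unit_mul_mem_iff_mem _ (IsUnit.map θ₂ (IsUnit.map (rename E) hu))).1 h3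
    refine ih (by omega) θ₂ (c * e) ?_
    have h1 : IsLocalRing.maximalIdeal (MvPowerSeries (Fin n) k) ^ c ≤ Ideal.span {θ₂ (X l')} ⊔ K := by
      refine hc.trans (sup_le (le_sup_left.trans le_sup_right) ?_)
      rw [Ideal.span_le]
      rintro _ ⟨i, hi, rfl⟩
      have hX : ∀ j : Fin n, (j : ℕ) < d + 1 → θ₂ (X j) ∈ Ideal.span {θ₂ (X l')} ⊔ K := by
        intro j hj
        rcases Nat.lt_succ_iff_lt_or_eq.1 hj with h | h
        · exact Ideal.mem_sup_right (Ideal.mem_sup_right (Ideal.subset_span ⟨j, h, rfl⟩))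
        · have : j = l' := Fin.ext h
          rw [this]
          exact Ideal.mem_sup_left (Ideal.mem_span_singleton_self _)
      have h5 : θ (X i) = θ₂ (X i) + θ₂ (C (ν' i)) * θ₂ (X l') := by
        rw [← hθ₂, chi_X, map_add, map_mul]
      change θ (X i) ∈ _
      rw [h5]
      exact Ideal.add_mem _ (hX i hi) (Ideal.mul_mem_left _ _ (hX l' (Nat.lt_succ_self d)))
    rw [pow_mul]
    refine (Ideal.pow_right_mono h1 e).trans ((sup_pow_le _ _ _).trans (sup_le ?_ le_rfl))
    rw [Ideal.span_singleton_pow, Ideal.span_singleton_le_iff_mem]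
    exact hmem

theorem bId_top : bId k L f = ⊤ := by
  refine Pd n le_rfl AlgEquiv.refl 1 ?_
  rw [pow_one]
  refine le_trans ?_ le_sup_right
  intro r hr
  have h1 := constCoeff_sub_mem r
  have h0 : constantCoeff r = 0 := by
    by_contra h
    rw [IsLocalRing.mem_maximalIdeal, mem_nonunits_iff, MvPowerSeries.isUnit_iff_constantCoeff, isUnit_iff_ne_zero] at hr
    exact hr h
  rw [h0, map_zero, sub_zero] at h1
  refine Ideal.span_mono ?_ h1
  rintro _ ⟨i, rfl⟩
  exact ⟨i, i.2, rfl⟩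

end P
end LCF
end

section
namespace LCF
open Polynomial

section spec
variable {k R L : Type*} [Field k] [CommRing R] [CommRing L] [Algebra k R] [Algebra R L] [Algebra k L]
  [IsScalarTower k R L] {f : R} [IsLocalization.Away f L]

theorem eval_dmap (d : Derivation k L L) (w : L) (hw : d w = 0) (g : L[X]) : d (g.eval w) = (dmap d g).eval w := by
  induction g using Polynomial.induction_on' with
  | add p q hp hq => simp only [eval_add, map_add, hp, hq]
  | monomial n a =>
    rw [dmap_monomial, eval_monomial, eval_monomial, Derivation.leibniz, Derivation.leibniz_pow, hw]
    simp [mul_comm]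

theorem spec_ord (N : Submodule R L) (hN : ∀ (δ : Derivation k R R), ∀ x ∈ N, dl L f δ x ∈ N) (j : ℕ)
    (hj : fi L f ^ j ∈ N) {A : ℕ} {m : L[X]} (hm : Ord k L f 1 A m) : m.eval (-(j : L)) * fi L f ^ j ∈ N := by
  induction hm with
  | base A => simpa using hj
  | add A a b _ _ ha hb => rw [eval_add, add_mul]; exact N.add_mem ha hb
  | smul A r a _ ha =>
    rw [eval_mul, eval_C, mul_assoc, ← Algebra.smul_def]; exact N.smul_mem r ha
  | X_mul A a _ ha =>
    rw [eval_mul, eval_X, mul_assoc]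
    have : (-(j : L)) * (a.eval (-(j : L)) * fi L f ^ j) = (-(j : R)) • (a.eval (-(j : L)) * fi L f ^ j) := by
      rw [Algebra.smul_def]; simp
    rw [this]; exact N.smul_mem _ ha
  | nab A δ a _ ha =>
    have h1 := hN δ _ ha
    have hw : dl L f δ (-(j : L)) = 0 := by rw [map_neg, Derivation.map_natCast, neg_zero]
    rw [Derivation.leibniz, eval_dmap _ _ hw, dl_fi_pow] at h1
    convert h1 using 1
    rw [nab_apply]
    simp only [eval_add, eval_mul, eval_X, eval_C, smul_eq_mul]
    ring
  | succ A a _ ha => exact ha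

end spec

section gen
variable {k : Type*} [Field k] [CharZero k] {n : ℕ} {L : Type*} [CommRing L] [Algebra (MvPowerSeries (Fin n) k) L]
  [Algebra k L] [IsScalarTower k (MvPowerSeries (Fin n) k) L] {f : MvPowerSeries (Fin n) k} [IsLocalization.Away f L]

theorem der_eq_sum (δ : Derivation k (MvPowerSeries (Fin n) k) (MvPowerSeries (Fin n) k)) :
    δ = ∑ i, δ (MvPowerSeries.X i) • MvPowerSeries.pderiv k i := by
  let I : Ideal (MvPowerSeries (Fin n) k) := Ideal.span (Set.range MvPowerSeries.X)
  let δ' := δ - ∑ i, δ (MvPowerSeries.X i) • MvPowerSeries.pderiv k i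
  have hX : ∀ j, δ' (MvPowerSeries.X j) = 0 := by
    intro j
    change δ (MvPowerSeries.X j) - (∑ i, δ (MvPowerSeries.X i) • MvPowerSeries.pderiv k i) (MvPowerSeries.X j) = 0
    rw [← Derivation.coeFnAddMonoidHom_apply (∑ i, δ (MvPowerSeries.X i) • MvPowerSeries.pderiv k i), map_sum, Finset.sum_apply]
    simp [MvPowerSeries.pderiv_X, Pi.single_apply]
  have h : ∀ (c : ℕ) r, δ' r ∈ I ^ c := by
    intro c
    induction c with
    | zero => intro r; simp
    | succ c ih =>
      intro r
      have h1 := constCoeff_sub_mem r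
      rw [Ideal.mem_span_range_iff_exists_fun] at h1
      obtain ⟨u, hu⟩ := h1
      have h2 : r = algebraMap k _ (MvPowerSeries.constantCoeff r) + ∑ i, u i * MvPowerSeries.X i := by
        rw [hu]; change r = MvPowerSeries.C _ + _; ring
      rw [h2, map_add, Derivation.map_algebraMap, zero_add, map_sum]
      refine Ideal.sum_mem _ fun i _ => ?_
      rw [Derivation.leibniz, hX, smul_zero, zero_add, smul_eq_mul, pow_succ']
      exact Ideal.mul_mem_mul (Ideal.subset_span ⟨i, rfl⟩) (ih _)
  have h0 : δ' = 0 := by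
    ext1 r
    refine IsHausdorff.haus (I := I) inferInstance _ fun c => ?_
    rw [SModEq.zero, smul_eq_mul, Ideal.mul_top]
    exact h c r
  exact sub_eq_zero.1 h0

theorem dl_eq_sum (δ : Derivation k (MvPowerSeries (Fin n) k) (MvPowerSeries (Fin n) k)) (x : L) :
    dl L f δ x = ∑ i, δ (MvPowerSeries.X i) • dl L f (MvPowerSeries.pderiv k i) x := by
  have h0 : ∀ y, (∑ i, δ (MvPowerSeries.X i) • dl L f (MvPowerSeries.pderiv k i)) y =
      ∑ i, δ (MvPowerSeries.X i) • dl L f (MvPowerSeries.pderiv k i) y := by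
    intro y
    rw [← Derivation.coeFnAddMonoidHom_apply, map_sum, Finset.sum_apply]; rfl
  have : dl L f δ = ∑ i, δ (MvPowerSeries.X i) • dl L f (MvPowerSeries.pderiv k i) := by
    refine der_ext_unique (R := MvPowerSeries (Fin n) k) (Submonoid.powers f) _ _ fun r => ?_
    rw [h0, dl_alg]
    conv_lhs => rw [der_eq_sum δ]
    rw [← Derivation.coeFnAddMonoidHom_apply, map_sum, Finset.sum_apply, map_sum]
    refine Finset.sum_congr rfl fun i _ => ?_
    rw [dl_alg, Derivation.coeFnAddMonoidHom_apply, Derivation.smul_apply, smul_eq_mul, map_mul, ← Algebra.smul_def]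
  rw [this, h0]

theorem gen_Rf : ∃ j₀ : ℕ, ∀ N : Submodule (MvPowerSeries (Fin n) k) L,
    (∀ i, ∀ x ∈ N, dl L f (MvPowerSeries.pderiv k i) x ∈ N) → fi L f ^ j₀ ∈ N → N = ⊤ := by
  classical
  have h1 : (1 : MvPowerSeries (Fin n) k) ∈ bId k L f := by rw [bId_top]; trivial
  obtain ⟨q, hq, A, hA⟩ := (mem_bId k L f).1 h1
  rw [map_one, one_mul] at hA
  have hinj : Function.Injective (fun j : ℕ => (-(j : k))) := fun a b h => by simpa using h
  have hfin : {j : ℕ | q.eval (-(j : k)) = 0}.Finite := by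
    have : {j : ℕ | q.eval (-(j : k)) = 0} = (fun j : ℕ => (-(j : k))) ⁻¹' (q.roots.toFinset : Set k) := by
      ext j; simp [hq]
    rw [this]
    exact (Finset.finite_toSet _).preimage hinj.injOn
  obtain ⟨j₀, hj₀⟩ := hfin.bddAbove
  refine ⟨j₀ + 1, fun N hN h0 => ?_⟩
  have hN' : ∀ (δ : Derivation k _ _), ∀ x ∈ N, dl L f δ x ∈ N := by
    intro δ x hx
    rw [dl_eq_sum]
    exact N.sum_mem fun i _ => N.smul_mem _ (hN i x hx)
  have hall : ∀ t, fi L f ^ (j₀ + 1 + t) ∈ N := by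
    intro t
    induction t with
    | zero => exact h0
    | succ t ih =>
      have h2 := spec_ord N hN' _ ih hA
      have hne : q.eval (-((j₀ + 1 + t : ℕ) : k)) ≠ 0 := fun h => by
        have := hj₀ h; omega
      have h3 : (q.map (algebraMap k L) * C (fi L f)).eval (-((j₀ + 1 + t : ℕ) : L)) * fi L f ^ (j₀ + 1 + t) =
          (algebraMap k (MvPowerSeries (Fin n) k) (q.eval (-((j₀ + 1 + t : ℕ) : k)))) • fi L f ^ (j₀ + 1 + (t + 1)) := by
        rw [Algebra.smul_def, ← IsScalarTower.algebraMap_apply, eval_mul, eval_C, ← add_assoc (j₀ + 1) t 1, pow_succ']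
        have : (-((j₀ + 1 + t : ℕ) : L)) = algebraMap k L (-((j₀ + 1 + t : ℕ) : k)) := by simp
        rw [this, eval_map_algebraMap, aeval_algebraMap_apply, coe_aeval_eq_eval, mul_assoc]
      rw [h3] at h2
      have h4 := N.smul_mem (algebraMap k _ (q.eval (-((j₀ + 1 + t : ℕ) : k)))⁻¹) h2
      rwa [smul_smul, ← map_mul, inv_mul_cancel₀ hne, map_one, one_smul] at h4
  rw [eq_top_iff]
  rintro x -
  obtain ⟨⟨a, m⟩, hx⟩ := IsLocalization.surj (Submonoid.powers f) x
  obtain ⟨m, t, rfl⟩ := m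
  simp only [map_pow] at hx
  have h5 : x = (a * f ^ (j₀ + 1)) • fi L f ^ (j₀ + 1 + t) := by
    rw [Algebra.smul_def, map_mul, ← hx, map_pow, pow_add]
    have e1 : (algebraMap _ L f) ^ t * fi L f ^ t = 1 := by rw [← mul_pow, f_fi, one_pow]
    have e2 : (algebraMap _ L f) ^ (j₀ + 1) * fi L f ^ (j₀ + 1) = 1 := by rw [← mul_pow, f_fi, one_pow]
    calc x = x * 1 * 1 := by ring
      _ = x * ((algebraMap _ L f) ^ t * fi L f ^ t) * ((algebraMap _ L f) ^ (j₀ + 1) * fi L f ^ (j₀ + 1)) := by rw [e1, e2]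
      _ = _ := by ring
  rw [h5]
  exact N.smul_mem _ (hall t)

end gen
end LCF
end

section
namespace LCF

section sym
variable {R : Type*} [CommRing R] {M : Type*} [AddCommGroup M] [Module R M] {n : ℕ}

theorem exists_T (D : Fin n → AddMonoid.End M) (hcomm : ∀ i j, D i * D j = D j * D i) :
    ∃ T : (Fin n →₀ ℕ) → AddMonoid.End M, T 0 = 1 ∧ ∀ i a, T (a + Finsupp.single i 1) = D i * T a := by
  letI := Submonoid.closureCommMonoidOfComm (M := AddMonoid.End M) (s := Set.range D) (by
    rintro _ ⟨i, rfl⟩ _ ⟨j, rfl⟩; exact hcomm i j)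
  let D' : Fin n → Submonoid.closure (Set.range D) := fun i => ⟨D i, Submonoid.subset_closure ⟨i, rfl⟩⟩
  refine ⟨fun a => ((∏ i, D' i ^ a i : Submonoid.closure (Set.range D)) : AddMonoid.End M), ?_, ?_⟩
  · simp
  · intro i a
    have : (∏ j, D' j ^ (a + Finsupp.single i 1 : Fin n →₀ ℕ) j) = D' i * ∏ j, D' j ^ a j := by
      simp only [Finsupp.add_apply, pow_add, Finset.prod_mul_distrib]
      rw [mul_comm]
      congr 1
      rw [Finset.prod_eq_single i]
      · simp
      · intro b _ hb; simp [Finsupp.single_apply, hb.symm]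
      · simp
    change (((∏ j, D' j ^ (a + Finsupp.single i 1 : Fin n →₀ ℕ) j : Submonoid.closure (Set.range D))) : AddMonoid.End M) = _
    rw [this]; rfl

theorem homComp_X_mul (i : Fin n) (j : ℕ) (p : MvPolynomial (Fin n) R) :
    MvPolynomial.homogeneousComponent (j+1) (MvPolynomial.X i * p) =
      MvPolynomial.X i * MvPolynomial.homogeneousComponent j p := by
  ext d
  rw [MvPolynomial.coeff_homogeneousComponent, MvPolynomial.coeff_X_mul', MvPolynomial.coeff_X_mul',
    MvPolynomial.coeff_homogeneousComponent]
  by_cases h : i ∈ d.support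
  · simp only [h, if_true]
    have h1 : d = (d - Finsupp.single i 1) + Finsupp.single i 1 := by
      ext x; by_cases hx : x = i
      · subst hx; have := Finsupp.mem_support_iff.1 h; simp; omega
      · simp [Finsupp.single_apply, Ne.symm hx]
    have h2 : d.degree = (d - Finsupp.single i 1).degree + 1 := by
      conv_lhs => rw [h1]
      simp [Finsupp.degree_single]
    simp [h2]
  · simp [h]

theorem homComp_zero_X_mul (i : Fin n) (p : MvPolynomial (Fin n) R) :
    MvPolynomial.homogeneousComponent 0 (MvPolynomial.X i * p) = 0 := by
  ext d
  rw [MvPolynomial.coeff_homogeneousComponent]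
  split_ifs with h
  · rw [Finsupp.degree_eq_zero_iff] at h
    subst h
    simp [MvPolynomial.coeff_X_mul']
  · simp

theorem homComp_monomial (j : ℕ) (a : Fin n →₀ ℕ) (r : R) :
    MvPolynomial.homogeneousComponent j (MvPolynomial.monomial a r) =
      if a.degree = j then MvPolynomial.monomial a r else 0 := by
  ext d
  rw [MvPolynomial.coeff_homogeneousComponent, apply_ite (MvPolynomial.coeff d)]
  simp only [MvPolynomial.coeff_monomial, MvPolynomial.coeff_zero]
  by_cases h : a = d
  · subst h; simp
  · simp [h]

theorem homComp_homComp (i j : ℕ) (p : MvPolynomial (Fin n) R) :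
    MvPolynomial.homogeneousComponent i (MvPolynomial.homogeneousComponent j p) =
      if i = j then MvPolynomial.homogeneousComponent j p else 0 := by
  ext d
  rw [apply_ite (MvPolynomial.coeff d)]
  simp only [MvPolynomial.coeff_homogeneousComponent, MvPolynomial.coeff_zero]
  split_ifs <;> first | rfl | omega

set_option maxHeartbeats 1600000 in
theorem AP_der_finite [IsNoetherianRing R] (δ : Fin n → R → R) (D : Fin n → AddMonoid.End M)
    (hcomm : ∀ i j, D i * D j = D j * D i) (hD : ∀ i r m, D i (r • m) = δ i r • m + r • D i m)
    {κ : Type*} [Finite κ] (v : κ → M)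
    (hgen : ∀ N : Submodule R M, (∀ i, ∀ x ∈ N, D i x ∈ N) → (∀ l, v l ∈ N) → N = ⊤)
    (B : Submodule R M) (hB : ∀ i, ∀ x ∈ B, D i x ∈ B) : (AP R (M ⧸ B)).Finite := by
  classical
  cases nonempty_fintype κ
  obtain ⟨T, hT0, hT⟩ := exists_T D hcomm
  let P := MvPolynomial (Fin n) R
  let u : κ → P →ₗ[R] M := fun l => (MvPolynomial.basisMonomials (Fin n) R).constr R (fun a => T a (v l))
  have hu : ∀ l a r, u l (MvPolynomial.monomial a r) = r • T a (v l) := by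
    intro l a r
    have : (MvPolynomial.monomial a r : P) = r • MvPolynomial.basisMonomials (Fin n) R a := by
      rw [MvPolynomial.coe_basisMonomials, MvPolynomial.smul_monomial, smul_eq_mul, mul_one]
    rw [this, map_smul, Module.Basis.constr_basis]
  let w : (κ → P) →ₗ[R] M := ∑ l, (u l).comp (LinearMap.proj l)
  have hw : ∀ h, w h = ∑ l, u l (h l) := by intro h; simp [w]
  let F : ℕ → Submodule R M := fun j => Submodule.span R {x | ∃ a l, a.degree < j ∧ x = T a (v l)}
  have hFmem : ∀ {j a} l, a.degree < j → T a (v l) ∈ F j := fun {j a} l h =>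
    Submodule.subset_span ⟨a, l, h, rfl⟩
  have hFmono : Monotone F := fun i j hij => Submodule.span_mono (by
    rintro x ⟨a, l, h, rfl⟩; exact ⟨a, l, h.trans_le hij, rfl⟩)
  have hF0 : F 0 = ⊥ := by
    simp [F]
  have hDF : ∀ i j, ∀ x ∈ F j, D i x ∈ F (j+1) := by
    intro i j x hx
    induction hx using Submodule.span_induction with
    | mem x hx =>
      obtain ⟨a, l, h, rfl⟩ := hx
      have : D i (T a (v l)) = T (a + Finsupp.single i 1) (v l) := by rw [hT]; rfl
      rw [this]
      refine hFmem l ?_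
      simp [Finsupp.degree_single]; omega
    | zero => rw [map_zero]; exact zero_mem _
    | add x y _ _ h1 h2 => rw [map_add]; exact add_mem h1 h2
    | smul r x hx h =>
      rw [hD]
      exact add_mem (Submodule.smul_mem _ _ (hFmono (Nat.le_succ j) hx)) (Submodule.smul_mem _ _ h)
  have hsymb : ∀ i j l (p : P), D i (u l (MvPolynomial.homogeneousComponent j p)) -
      u l (MvPolynomial.X i * MvPolynomial.homogeneousComponent j p) ∈ F (j+1) := by
    intro i j l p
    induction p using MvPolynomial.induction_on' with
    | monomial a r =>
      rw [homComp_monomial]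
      split_ifs with h
      · have : (MvPolynomial.X i * MvPolynomial.monomial a r : P) = MvPolynomial.monomial (a + Finsupp.single i 1) r := by
          rw [MvPolynomial.X, MvPolynomial.monomial_mul, one_mul, add_comm]
        rw [this, hu, hu, hD, hT]
        change δ i r • T a (v l) + r • D i (T a (v l)) - r • D i (T a (v l)) ∈ _
        rw [add_sub_cancel_right]
        exact Submodule.smul_mem _ _ (hFmem l (by omega))
      · simp
    | add p q hp hq =>
      rw [map_add, map_add, mul_add, map_add, map_add, add_sub_add_comm]
      exact add_mem hp hq
  have hwc : ∀ i j (h : κ → P), D i (w fun l => MvPolynomial.homogeneousComponent j (h l)) -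
      w (fun l => MvPolynomial.X i * MvPolynomial.homogeneousComponent j (h l)) ∈ F (j+1) := by
    intro i j h
    rw [hw, hw, map_sum, ← Finset.sum_sub_distrib]
    exact sum_mem fun l _ => hsymb i j l (h l)
  have hF4 : ∀ j, ∀ x ∈ F (j+1), ∃ h : κ → P,
      x - w (fun l => MvPolynomial.homogeneousComponent j (h l)) ∈ F j := by
    intro j x hx
    induction hx using Submodule.span_induction with
    | mem x hx =>
      obtain ⟨a, l, h, rfl⟩ := hx
      by_cases ha : a.degree < j
      · refine ⟨0, ?_⟩
        have : (fun l : κ => MvPolynomial.homogeneousComponent j ((0 : κ → P) l)) = 0 := by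
          funext l; simp
        rw [this, map_zero, sub_zero]; exact hFmem l ha
      · have hj : a.degree = j := by omega
        refine ⟨Pi.single l (MvPolynomial.monomial a 1), ?_⟩
        have : (w fun l' => MvPolynomial.homogeneousComponent j
            ((Pi.single l (MvPolynomial.monomial a 1) : κ → P) l')) = T a (v l) := by
          rw [hw, Finset.sum_eq_single l]
          · rw [Pi.single_eq_same, homComp_monomial, if_pos hj, hu, one_smul]
          · intro b _ hb; rw [Pi.single_eq_of_ne hb, map_zero, map_zero]
          · simp
        rw [this, sub_self]; exact zero_mem _
    | zero =>
      refine ⟨0, ?_⟩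
      have : (fun l : κ => MvPolynomial.homogeneousComponent j ((0 : κ → P) l)) = 0 := by
        funext l; simp
      rw [this, map_zero, sub_zero]; exact zero_mem _
    | add x y _ _ h1 h2 =>
      obtain ⟨h, hh⟩ := h1
      obtain ⟨g, hg⟩ := h2
      refine ⟨h + g, ?_⟩
      have : (fun l : κ => MvPolynomial.homogeneousComponent j ((h + g) l)) =
        (fun l => MvPolynomial.homogeneousComponent j (h l)) + (fun l => MvPolynomial.homogeneousComponent j (g l)) := by
        funext l; simp
      rw [this, map_add, add_sub_add_comm]
      exact add_mem hh hg
    | smul r x hx h =>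
      obtain ⟨h, hh⟩ := h
      refine ⟨r • h, ?_⟩
      have : (fun l : κ => MvPolynomial.homogeneousComponent j ((r • h) l)) =
        r • (fun l => MvPolynomial.homogeneousComponent j (h l)) := by
        funext l; simp
      rw [this, map_smul, ← smul_sub]
      exact Submodule.smul_mem _ _ hh
  have hF5 : ∀ x, ∃ j, x ∈ F j := by
    have hdir : Directed (· ≤ ·) F := hFmono.directed_le
    have := hgen (⨆ j, F j) (by
      intro i x hx
      rw [Submodule.mem_iSup_of_directed _ hdir] at hx ⊢
      obtain ⟨j, hj⟩ := hx
      exact ⟨j+1, hDF i j x hj⟩) (by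
      intro l
      rw [Submodule.mem_iSup_of_directed _ hdir]
      refine ⟨1, ?_⟩
      have : v l = T 0 (v l) := by rw [hT0]; rfl
      rw [this]
      exact hFmem l (by simp))
    intro x
    rw [← Submodule.mem_iSup_of_directed _ hdir, this]; trivial
  let S : Submodule P (κ → P) :=
    { carrier := {h | ∀ j, w (fun l => MvPolynomial.homogeneousComponent j (h l)) ∈ B ⊔ F j}
      zero_mem' := by
        intro j
        have : (fun l : κ => MvPolynomial.homogeneousComponent j ((0 : κ → P) l)) = 0 := by
          funext l; simp
        rw [this, map_zero]; exact zero_mem _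
      add_mem' := by
        intro h g hh hg j
        have : (fun l : κ => MvPolynomial.homogeneousComponent j ((h + g) l)) =
          (fun l => MvPolynomial.homogeneousComponent j (h l)) + (fun l => MvPolynomial.homogeneousComponent j (g l)) := by
          funext l; simp
        rw [this, map_add]
        exact add_mem (hh j) (hg j)
      smul_mem' := by
        intro p
        induction p using MvPolynomial.induction_on with
        | C r =>
          intro h hh j
          have : (fun l : κ => MvPolynomial.homogeneousComponent j (((MvPolynomial.C r : P) • h : κ → P) l)) =
            r • (fun l => MvPolynomial.homogeneousComponent j (h l)) := by
            funext l
            rw [Pi.smul_apply, Pi.smul_apply, smul_eq_mul, MvPolynomial.homogeneousComponent_C_mul, MvPolynomial.smul_eq_C_mul]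
          rw [this, map_smul]
          exact Submodule.smul_mem _ _ (hh j)
        | add p q hp hq =>
          intro h hh j
          have : (fun l : κ => MvPolynomial.homogeneousComponent j (((p + q) • h : κ → P) l)) =
            (fun l => MvPolynomial.homogeneousComponent j ((p • h) l)) + (fun l => MvPolynomial.homogeneousComponent j ((q • h) l)) := by
            funext l; simp [add_mul]
          rw [this, map_add]
          exact add_mem (hp hh j) (hq hh j)
        | mul_X p i hp =>
          intro h hh
          have hph := hp hh
          intro j
          have e1 : ∀ l, ((p * MvPolynomial.X i) • h : κ → P) l = MvPolynomial.X i * (p • h) l := by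
            intro l; simp; ring
          change w (fun l => MvPolynomial.homogeneousComponent j (((p * MvPolynomial.X i) • h : κ → P) l)) ∈ _
          simp only [e1]
          generalize p • h = g at hph
          cases j with
          | zero =>
            have : (fun l => MvPolynomial.homogeneousComponent 0 (MvPolynomial.X i * g l)) = (0 : κ → P) :=
              funext fun l => homComp_zero_X_mul i (g l)
            rw [this, map_zero]; exact zero_mem _
          | succ j =>
            have e2 : (fun l => MvPolynomial.homogeneousComponent (j+1) (MvPolynomial.X i * g l)) =
                fun l => MvPolynomial.X i * MvPolynomial.homogeneousComponent j (g l) :=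
              funext fun l => homComp_X_mul i j (g l)
            rw [e2]
            have h1 := hwc i j g
            obtain ⟨b, hb, y, hy, hby⟩ := Submodule.mem_sup.1 (hph j)
            rw [← hby, map_add] at h1
            have h2 : D i b + D i y ∈ B ⊔ F (j+1) :=
              add_mem (Submodule.mem_sup_left (hB i b hb)) (Submodule.mem_sup_right (hDF i j y hy))
            have := sub_mem h2 (Submodule.mem_sup_right h1)
            rwa [sub_sub_cancel] at this }
  have hSmem : ∀ h, h ∈ S ↔ ∀ j, w (fun l => MvPolynomial.homogeneousComponent j (h l)) ∈ B ⊔ F j := fun h => Iff.rfl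
  have hfin : (AP R ((κ → P) ⧸ S)).Finite :=
    AP_finite_down (T := R) (R := P) AP_finite_of_fg
  refine hfin.subset ?_
  rintro P₀ ⟨hP, zb, hz⟩
  obtain ⟨z, rfl⟩ := Submodule.Quotient.mk_surjective B zb
  have hz' : ∀ r, r ∈ P₀ ↔ r • z ∈ B := by
    intro r; rw [hz, ← Submodule.Quotient.mk_smul, Submodule.Quotient.mk_eq_zero]
  have hex : ∃ j, ∃ s, s ∉ P₀ ∧ s • z ∈ B ⊔ F j := by
    obtain ⟨j, hj⟩ := hF5 z
    exact ⟨j, 1, fun h => hP.ne_top ((Ideal.eq_top_iff_one _).2 h), by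
      rw [one_smul]; exact Submodule.mem_sup_right hj⟩
  have hmin := fun m => Nat.find_min hex (m := m)
  have hspec := Nat.find_spec hex
  generalize Nat.find hex = j at hmin hspec
  obtain ⟨s, hs, hsz⟩ := hspec
  cases j with
  | zero =>
    rw [hF0, sup_bot_eq] at hsz
    exact absurd ((hz' s).2 hsz) hs
  | succ j =>
    obtain ⟨b, hb, y, hy, hby⟩ := Submodule.mem_sup.1 hsz
    obtain ⟨h, hh⟩ := hF4 j y hy
    let h' : κ → P := fun l => MvPolynomial.homogeneousComponent j (h l)
    refine ⟨hP, Submodule.Quotient.mk h', fun r => ?_⟩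
    rw [← Submodule.Quotient.mk_smul, Submodule.Quotient.mk_eq_zero]
    have e0 : ∀ i, (fun l : κ => MvPolynomial.homogeneousComponent i ((r • h' : κ → P) l)) =
        if i = j then r • h' else 0 := by
      intro i
      funext l
      rw [Pi.smul_apply, map_smul, homComp_homComp]
      split_ifs <;> simp [h']
    have e1 : r • h' ∈ S ↔ r • w h' ∈ B ⊔ F j := by
      rw [hSmem]
      constructor
      · intro H
        have := H j
        rwa [e0, if_pos rfl, map_smul] at this
      · intro H i
        rw [e0]
        split_ifs with hi
        · subst hi; rwa [map_smul]
        · rw [map_zero]; exact zero_mem _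
    rw [e1]
    have e2 : r • w h' - (r * s) • z ∈ B ⊔ F j := by
      have : r • w h' - (r * s) • z = (-r) • b + (-r) • (y - w h') := by
        rw [mul_smul, ← hby]; module
      rw [this]
      exact add_mem (Submodule.smul_mem _ _ (Submodule.mem_sup_left hb))
        (Submodule.smul_mem _ _ (Submodule.mem_sup_right hh))
    constructor
    · intro hr
      have h3 : (r * s) • z ∈ B := (hz' _).1 (Ideal.mul_mem_right _ _ hr)
      have := add_mem e2 (Submodule.mem_sup_left h3 : _ ∈ B ⊔ F j)
      rwa [sub_add_cancel] at this
    · intro hr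
      have h3 := sub_mem hr e2
      rw [sub_sub_cancel] at h3
      by_contra hrP
      exact hmin j (Nat.lt_succ_self j) ⟨r * s, fun hm => (hP.mem_or_mem hm).elim hrP hs, h3⟩
end sym
end LCF
end

section
namespace LCF

section
variable {k R L : Type*} [Field k] [CommRing R] [CommRing L] [Algebra k R] [Algebra R L] [Algebra k L]
  [IsScalarTower k R L] {f : R} [IsLocalization.Away f L]

theorem dl_comm (δ δ' : Derivation k R R) (h : ∀ r, δ (δ' r) = δ' (δ r)) (x : L) :
    dl L f δ (dl L f δ' x) = dl L f δ' (dl L f δ x) := by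
  have : ⁅dl L f δ, dl L f δ'⁆ = 0 := by
    refine der_ext_unique (R := R) (Submonoid.powers f) _ _ fun r => ?_
    rw [Derivation.commutator_apply, dl_alg, dl_alg, dl_alg, dl_alg, h, sub_self]; rfl
  have h2 := congrArg (fun d => d x) this
  simp only [Derivation.commutator_apply] at h2
  exact sub_eq_zero.1 h2

theorem dl_smul (δ : Derivation k R R) (r : R) (x : L) : dl L f δ (r • x) = δ r • x + r • dl L f δ x := by
  rw [Algebra.smul_def, Derivation.leibniz, dl_alg, smul_eq_mul, smul_eq_mul, Algebra.smul_def, Algebra.smul_def]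
  ring

theorem dl_res {L' : Type*} [CommRing L'] [Algebra R L'] [Algebra k L'] [IsScalarTower k R L'] {f' : R}
    [IsLocalization.Away f' L'] (hd : f ∣ f') (res : L →ₗ[R] L') (hres : ∀ r, res (algebraMap R L r) = algebraMap R L' r)
    (δ : Derivation k R R) (x : L) : dl L' f' δ (res x) = res (dl L f δ x) := by
  obtain ⟨⟨a, _, m, rfl⟩, hx⟩ := IsLocalization.surj (Submonoid.powers f) x
  simp only at hx
  have h1 : f ^ m • x = algebraMap R L a := by rw [Algebra.smul_def, mul_comm, hx]
  have h2 := congrArg (fun y => dl L' f' δ (res y)) h1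
  have h3 := congrArg (fun y => res (dl L f δ y)) h1
  simp only [map_smul, dl_smul, hres, dl_alg, map_add] at h2 h3
  rw [← h3] at h2
  have h4 := add_left_cancel h2
  have hu : IsUnit (algebraMap R L' (f ^ m)) := by
    refine isUnit_of_dvd_unit ((algebraMap R L').map_dvd (pow_dvd_pow_of_dvd hd m)) ?_
    exact IsLocalization.map_units L' (⟨f' ^ m, m, rfl⟩ : Submonoid.powers f')
  rw [Algebra.smul_def, Algebra.smul_def] at h4
  exact hu.mul_left_cancel h4
end

set_option maxHeartbeats 1600000 in
theorem AP_char0 {k : Type*} [Field k] [CharZero k] {n : ℕ} {ι : Type*} [DecidableEq ι] [Finite ι]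
    (f : ι → MvPowerSeries (Fin n) k) (i : ℕ) :
    (AP (MvPowerSeries (Fin n) k) (HC f (MvPowerSeries (Fin n) k) i)).Finite := by
  classical
  let R := MvPowerSeries (Fin n) k
  let L : Finset ι → Type _ := fun U => Localization.Away (gp f U)
  let l : ∀ U, R →ₗ[R] L U := fun U => Algebra.linearMap R (L U)
  haveI : ∀ U, IsLocalizedModule (.powers (gp f U)) (l U) := fun U => by
    dsimp only [l]; infer_instance
  have hM := resOf_model f l
  rw [AP_congr (cohEquiv (cmodel f R) hM (LinearEquiv.refl R R) i)]
  choose j₀ hj₀ using fun U => gen_Rf (k := k) (n := n) (L := L U) (f := gp f U)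
  let d : Fin n → ∀ U, L U →+ L U := fun a U =>
    (dl (L U) (gp f U) (MvPowerSeries.pderiv k a)).toLinearMap.toAddMonoidHom
  let D : ∀ i, Fin n → AddMonoid.End (Ch L i) := fun i a =>
    { toFun := fun s α => d a _ (s α)
      map_zero' := by funext α; exact map_zero _
      map_add' := fun s t => by funext α; exact map_add _ _ _ }
  have hDa : ∀ i a (s : Ch L i) α, D i a s α = dl (L (img α)) (gp f (img α)) (MvPowerSeries.pderiv k a) (s α) :=
    fun _ _ _ _ => rfl
  have hfin : (AP R (Ch L i ⧸ Bd (dd (resOf f l)) i)).Finite := by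
    refine AP_der_finite (fun a r => MvPowerSeries.pderiv k a r) (D i) ?_ ?_
      (κ := Fin i → ι) (fun α => Pi.single α (fi (L (img α)) (gp f (img α)) ^ j₀ (img α))) ?_ _ ?_
    · intro a b
      refine AddMonoidHom.ext fun s => ?_
      funext α
      change D i a (D i b s) α = D i b (D i a s) α
      rw [hDa, hDa, hDa, hDa]
      exact dl_comm _ _ (fun r => pderiv_pderiv _ _ _) _
    · intro a r s
      funext α
      rw [hDa, Pi.smul_apply, dl_smul]; rfl
    · intro N hN hv
      have key : ∀ α : Fin i → ι, N.comap (LinearMap.single R (fun α : Fin i → ι => L (img α)) α) = ⊤ := by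
        intro α
        refine hj₀ (img α) _ ?_ (hv α)
        intro a x hx
        have h1 := hN a _ hx
        have h2 : D i a (LinearMap.single R (fun α : Fin i → ι => L (img α)) α x) =
            LinearMap.single R (fun α : Fin i → ι => L (img α)) α (dl (L (img α)) (gp f (img α)) (MvPowerSeries.pderiv k a) x) := by
          funext β
          rw [hDa]
          by_cases hβ : β = α
          · subst hβ
            simp
          · rw [LinearMap.single_apply, LinearMap.single_apply, Pi.single_eq_of_ne hβ, Pi.single_eq_of_ne hβ, map_zero]
        rw [h2] at h1
        exact h1
      rw [eq_top_iff]
      intro s _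
      cases nonempty_fintype ι
      rw [← Finset.univ_sum_single s]
      refine sum_mem fun α _ => ?_
      have : s α ∈ N.comap (LinearMap.single R (fun α : Fin i → ι => L (img α)) α) := by rw [key]; trivial
      exact this
    · intro a x hx
      exact Bd_map (d := dd (resOf f l)) (d' := dd (resOf f l)) (fun i => D i a) (fun i s => 
        dd_nat (res := resOf f l) (res' := resOf f l) (d a) (fun U V h x => 
          dl_res (gp_dvd f h) _ (fun r => hM.comm U V h r) _ _) i s) i x hx
  refine hfin.subset ?_
  rintro P hP
  obtain ⟨h1, z, _, h2⟩ := (AP_Coh_iff _ i P).1 hP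
  exact ⟨h1, Submodule.Quotient.mk z, fun r => by
    rw [h2, ← Submodule.Quotient.mk_smul, Submodule.Quotient.mk_eq_zero]⟩
end LCF
end

section
namespace LCF

section nil
variable {R : Type*} [CommRing R] 

theorem pow_eq_of_nil {g g' : R} (h : IsNilpotent (g - g')) : ∃ N c, g' ^ N = c * g := by
  obtain ⟨N, hN⟩ := h
  refine ⟨N, ?_⟩
  have : g ∣ (g' - g) ^ N - g' ^ N := by
    have h1 := sub_dvd_pow_sub_pow (g' - g) g' N
    rw [sub_sub_cancel_left] at h1
    exact (neg_dvd.1 h1)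
  have h2 : (g' - g) ^ N = 0 := by rw [← neg_sub, neg_pow, hN, mul_zero]
  rw [h2, zero_sub, dvd_neg] at this
  obtain ⟨c, hc⟩ := this
  exact ⟨c, by rw [hc, mul_comm]⟩

theorem isLocalizedModule_of_nil {M N : Type*} [AddCommGroup M] [Module R M] [AddCommGroup N] [Module R N]
    (l : M →ₗ[R] N) {g g' : R} (h : IsNilpotent (g - g')) (hl : IsLocalizedModule (.powers g) l) :
    IsLocalizedModule (.powers g') l := by
  obtain ⟨K, c, hc⟩ := pow_eq_of_nil h
  have hcm : ∀ m, g' ^ (K * m) = c ^ m * g ^ m := fun m => by rw [pow_mul, hc, mul_pow]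
  refine ⟨?_, ?_, ?_⟩
  · rintro ⟨_, m, rfl⟩
    simp only [map_pow]
    refine IsUnit.pow _ ?_
    have hg : IsUnit (algebraMap R (Module.End R N) g) :=
      IsLocalizedModule.map_units l (⟨g, 1, pow_one g⟩ : Submonoid.powers g)
    have hn : IsNilpotent (algebraMap R (Module.End R N) (g' - g)) := by
      rw [← neg_sub]; exact (h.neg).map _
    have := hn.isUnit_add_left_of_commute hg (Algebra.commutes _ _)
    rwa [← map_add, add_sub_cancel] at this
  · intro y
    obtain ⟨⟨x, _, m, rfl⟩, hx⟩ := IsLocalizedModule.surj (.powers g) l y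
    refine ⟨⟨c ^ m • x, _, K * m, rfl⟩, ?_⟩
    rw [map_smul, ← hx]
    change g' ^ (K * m) • y = c ^ m • g ^ m • y
    rw [hcm, mul_smul]
  · intro x y hxy
    obtain ⟨⟨_, m, rfl⟩, hm⟩ := IsLocalizedModule.exists_of_eq (S := .powers g) (f := l) hxy
    refine ⟨⟨_, K * m, rfl⟩, ?_⟩
    change g' ^ (K * m) • x = g' ^ (K * m) • y
    change g ^ m • x = g ^ m • y at hm
    rw [hcm, mul_smul, mul_smul, hm]

theorem gp_nil {ι : Type*} {f f' : ι → R} (h : ∀ j, IsNilpotent (f j - f' j)) (U : Finset ι) :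
    IsNilpotent (gp f U - gp f' U) := by
  have : ∀ x, IsNilpotent x ↔ Ideal.Quotient.mk (nilradical R) x = 0 := fun x => by
    rw [Ideal.Quotient.eq_zero_iff_mem, mem_nilradical]
  rw [this, map_sub, sub_eq_zero, gp, gp, map_prod, map_prod]
  refine Finset.prod_congr rfl fun j _ => ?_
  rw [← sub_eq_zero, ← map_sub, ← this]; exact h j

theorem Model.of_nil {ι : Type*} {M : Type*} [AddCommGroup M] [Module R M] {L : Finset ι → Type*}
    [∀ U, AddCommGroup (L U)] [∀ U, Module R (L U)] {f f' : ι → R} {l : ∀ U, M →ₗ[R] L U}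
    {res : ∀ U V, U ⊆ V → L U →ₗ[R] L V} (hM : Model f l res) (h : ∀ j, IsNilpotent (f j - f' j)) :
    Model f' l res :=
  ⟨fun U => isLocalizedModule_of_nil _ (gp_nil h U) (hM.loc U), hM.comm⟩
end nil

section tr
variable {ι : Type*} [DecidableEq ι] {T R : Type*} [CommRing T] [CommRing R] [Algebra T R]

theorem AP_transfer_aux [IsNoetherianRing R] {M : Type*} [AddCommGroup M] [Module R M] [Module T M] [IsScalarTower T R M]
    {L : Finset ι → Type*} [∀ U, AddCommGroup (L U)] [∀ U, Module R (L U)]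
    (f : ι → T) {l : ∀ U, M →ₗ[R] L U} {res : ∀ U V, U ⊆ V → L U →ₗ[R] L V}
    (hM : Model (fun j => algebraMap T R (f j)) l res) (i : ℕ) (h : (AP R (Coh (dd res) i)).Finite) :
    (AP T (HC f M i)).Finite := by
  letI : ∀ U, Module T (L U) := fun U => Module.compHom _ (algebraMap T R)
  haveI : ∀ U, IsScalarTower T R (L U) := fun U => IsScalarTower.of_algebraMap_smul fun _ _ => rfl
  have hM' := Model.restrict hM
  rw [AP_congr (cohEquiv (cmodel f M) hM' (LinearEquiv.refl T M) i), AP_restrict]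
  exact AP_finite_down (R := R) h

theorem AP_transfer_down [IsNoetherianRing R] {M : Type*} [AddCommGroup M] [Module R M] [Module T M] [IsScalarTower T R M]
    (f : ι → T) (i : ℕ) (h : (AP R (HC (fun j => algebraMap T R (f j)) M i)).Finite) :
    (AP T (HC f M i)).Finite :=
  AP_transfer_aux f (cmodel (fun j => algebraMap T R (f j)) M) i h

theorem AP_lift_aux {L : Finset ι → Type*} [∀ U, AddCommGroup (L U)] [∀ U, Module R (L U)]
    {l : ∀ U, R →ₗ[R] L U} {res : ∀ U V, U ⊆ V → L U →ₗ[R] L V} {J : Type*} [Fintype J] {M' : J → Type*} [∀ j, AddCommGroup (M' j)] [∀ j, Module T (M' j)]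
    (φ : ∀ j, R →ₗ[T] M' j) (ψ : ∀ j, M' j →ₗ[T] R) (h : ∀ m, ∑ j, ψ j (φ j m) = m)
    (f' : ι → T) (f : ι → R) (hf : ∀ j, IsNilpotent (f j - algebraMap T R (f' j)))
    (hs : ∀ r : R, ∃ t, IsNilpotent (r - algebraMap T R t)) (i : ℕ) (hM : Model f l res)
    (hfin : ∀ j, (AP T (HC f' (M' j) i)).Finite) : (AP R (Coh (dd res) i)).Finite := by
  letI : ∀ U, Module T (L U) := fun U => Module.compHom _ (algebraMap T R)
  haveI : ∀ U, IsScalarTower T R (L U) := fun U => IsScalarTower.of_algebraMap_smul fun _ _ => rfl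
  have hM1 := Model.restrict (hM.of_nil hf)
  have h1 := AP_finite_of_retract hM1 (fun j => cmodel f' (M' j)) φ ψ h i hfin
  rw [AP_restrict] at h1
  refine AP_finite_up (T := T) h1 ?_
  have key : ∀ P Q : Ideal R, P.IsPrime → Q.IsPrime → P.comap (algebraMap T R) = Q.comap (algebraMap T R) → P ≤ Q := by
    intro P Q hP hQ hPQ r hr
    obtain ⟨t, ht⟩ := hs r
    have hn : ∀ P : Ideal R, P.IsPrime → r - algebraMap T R t ∈ P := fun P hP =>
      nilradical_le_prime P ht
    have h2 : t ∈ P.comap (algebraMap T R) := by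
      have := sub_mem hr (hn P hP)
      rwa [sub_sub_cancel] at this
    rw [hPQ] at h2
    have := add_mem (hn Q hQ) h2
    rwa [sub_add_cancel] at this
  exact fun P Q hP hQ hPQ => le_antisymm (key P Q hP hQ hPQ) (key Q P hQ hP hPQ.symm)

theorem AP_lift {J : Type*} [Fintype J] {M' : J → Type*} [∀ j, AddCommGroup (M' j)] [∀ j, Module T (M' j)]
    (φ : ∀ j, R →ₗ[T] M' j) (ψ : ∀ j, M' j →ₗ[T] R) (h : ∀ m, ∑ j, ψ j (φ j m) = m)
    (f' : ι → T) (f : ι → R) (hf : ∀ j, IsNilpotent (f j - algebraMap T R (f' j)))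
    (hs : ∀ r : R, ∃ t, IsNilpotent (r - algebraMap T R t)) (i : ℕ)
    (hfin : ∀ j, (AP T (HC f' (M' j) i)).Finite) : (AP R (HC f R i)).Finite :=
  AP_lift_aux φ ψ h f' f hf hs i (cmodel f R) hfin
end tr

section coef
variable {n : ℕ}

theorem coeff_mem_pow {A : Type*} [CommRing A] (I : Ideal A) (g : MvPowerSeries (Fin n) A)
    (hg : ∀ d, MvPowerSeries.coeff d g ∈ I) (m : ℕ) : ∀ d, MvPowerSeries.coeff d (g ^ m) ∈ I ^ m := by
  induction m with
  | zero => simp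
  | succ m ih =>
    intro d
    rw [pow_succ g, MvPowerSeries.coeff_mul, pow_succ]
    exact sum_mem fun x _ => Ideal.mul_mem_mul (ih _) (hg _)

theorem series_nilp {A : Type*} [CommRing A] [IsNoetherianRing A] (g : MvPowerSeries (Fin n) A)
    (hg : ∀ d, IsNilpotent (MvPowerSeries.coeff d g)) : IsNilpotent g := by
  obtain ⟨N, hN⟩ := IsNoetherianRing.isNilpotent_nilradical A
  refine ⟨N, ?_⟩
  ext d
  have := coeff_mem_pow (nilradical A) g hg N d
  rw [hN] at this
  simpa using this

variable {T : Type*} [CommRing T]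

/-- coefficientwise application of a linear map -/
noncomputable def cw {B B' : Type*} [CommRing B] [CommRing B'] [Algebra T B] [Algebra T B'] (φ : B →ₗ[T] B') :
    MvPowerSeries (Fin n) B →ₗ[MvPowerSeries (Fin n) T] MvPowerSeries (Fin n) B' where
  toFun g := fun d => φ (MvPowerSeries.coeff d g)
  map_add' a b := by
    ext d
    change φ (MvPowerSeries.coeff d (a + b)) = φ (MvPowerSeries.coeff d a) + φ (MvPowerSeries.coeff d b)
    rw [map_add, map_add]
  map_smul' r g := by
    let g' : MvPowerSeries (Fin n) B' := fun d => φ (MvPowerSeries.coeff d g)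
    have hg' : ∀ d, MvPowerSeries.coeff d g' = φ (MvPowerSeries.coeff d g) := fun _ => rfl
    ext d
    change φ (MvPowerSeries.coeff d (r • g)) = MvPowerSeries.coeff d (r • g')
    rw [Algebra.smul_def, Algebra.smul_def, MvPowerSeries.coeff_mul, MvPowerSeries.coeff_mul, map_sum]
    refine Finset.sum_congr rfl fun x _ => ?_
    rw [hg', MvPowerSeries.algebraMap_apply'', MvPowerSeries.algebraMap_apply'',
      MvPowerSeries.coeff_map, MvPowerSeries.coeff_map, ← Algebra.smul_def, map_smul, Algebra.smul_def]

theorem coeff_cw {B B' : Type*} [CommRing B] [CommRing B'] [Algebra T B] [Algebra T B'] (φ : B →ₗ[T] B')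
    (g : MvPowerSeries (Fin n) B) (d) : MvPowerSeries.coeff d (cw φ g) = φ (MvPowerSeries.coeff d g) := rfl

/-- the property we want -/
def Good (n : ℕ) (A : Type*) [CommRing A] : Prop :=
  ∀ (m : ℕ) (f : Fin m → MvPowerSeries (Fin n) A) (i : ℕ),
    (AP (MvPowerSeries (Fin n) A) (HC f (MvPowerSeries (Fin n) A) i)).Finite

theorem Good.of_retract {A : Type*} [CommRing A] [IsNoetherianRing A] [Algebra T A] {J : Type*} [Fintype J]
    {B : J → Type*} [∀ j, CommRing (B j)] [∀ j, IsNoetherianRing (B j)] [∀ j, Algebra T (B j)]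
    (φ : ∀ j, A →ₗ[T] B j) (ψ : ∀ j, B j →ₗ[T] A) (h : ∀ a, ∑ j, ψ j (φ j a) = a)
    (hs : ∀ a : A, ∃ t, IsNilpotent (a - algebraMap T A t)) (hB : ∀ j, Good n (B j)) : Good n A := by
  intro m f i
  choose lf hlf using hs
  have hs' : ∀ r : MvPowerSeries (Fin n) A, IsNilpotent (r - algebraMap (MvPowerSeries (Fin n) T) _
      (fun d => lf (MvPowerSeries.coeff d r) : MvPowerSeries (Fin n) T)) := by
    intro r
    refine series_nilp _ fun d => ?_
    rw [map_sub]
    exact hlf _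
  refine AP_lift (fun j => cw (φ j)) (fun j => cw (ψ j)) ?_
    (fun j => (fun d => lf (MvPowerSeries.coeff d (f j)) : MvPowerSeries (Fin n) T)) f (fun j => hs' _)
    (fun r => ⟨_, hs' r⟩) i ?_
  · intro g
    ext d
    rw [map_sum]
    exact h _
  · intro j
    exact AP_transfer_down (R := MvPowerSeries (Fin n) (B j)) _ i (hB j m _ i)
end coef
end LCF
end

section
namespace LCF

theorem finite_of_nilp {V A : Type*} [CommRing V] [CommRing A] [Algebra V A] (I : Ideal A) (hfg : I.FG)
    (hn : IsNilpotent I) (hs : ∀ a, ∃ v, a - algebraMap V A v ∈ I) : Module.Finite V A := by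
  have key : ∀ N : ℕ, ∃ s : Finset A, ∀ a, ∃ b ∈ Submodule.span V (s : Set A), a - b ∈ I ^ N := by
    classical
    intro N
    induction N with
    | zero => exact ⟨∅, fun a => ⟨0, zero_mem _, by simp⟩⟩
    | succ N ih =>
      obtain ⟨s, hs'⟩ := ih
      obtain ⟨t, ht⟩ := hfg.pow (n := N)
      refine ⟨s ∪ t, fun a => ?_⟩
      obtain ⟨b, hb, hab⟩ := hs' a
      have h1 : ∀ c ∈ I ^ N, ∃ b ∈ Submodule.span V (t : Set A), c - b ∈ I ^ (N+1) := by
        intro c hc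
        have hc' : c ∈ Submodule.span A (t : Set A) := by rw [← ht] at hc; exact hc
        have htN : ∀ x ∈ t, x ∈ I ^ N := fun x hx => ht ▸ Submodule.subset_span hx
        clear hc
        induction hc' using Submodule.span_induction with
        | mem x hx => exact ⟨x, Submodule.subset_span hx, by simp⟩
        | zero => exact ⟨0, zero_mem _, by simp⟩
        | add x y _ _ h1 h2 =>
          obtain ⟨b, hb, h1⟩ := h1
          obtain ⟨b', hb', h2⟩ := h2
          refine ⟨b + b', add_mem hb hb', ?_⟩
          rw [add_sub_add_comm]; exact add_mem h1 h2
        | smul r x hx h =>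
          obtain ⟨b, hb, h⟩ := h
          obtain ⟨v, hv⟩ := hs r
          refine ⟨v • b, Submodule.smul_mem _ _ hb, ?_⟩
          have hxN : x ∈ I ^ N := by rw [← ht]; exact hx
          have : r • x - v • b = (r - algebraMap V A v) * x + algebraMap V A v * (x - b) := by
            rw [smul_eq_mul, Algebra.smul_def]; ring
          rw [this]
          refine add_mem ?_ (Ideal.mul_mem_left _ _ h)
          rw [pow_succ, mul_comm (I ^ N)]
          exact Ideal.mul_mem_mul hv hxN
      obtain ⟨b', hb', h2⟩ := h1 _ hab
      refine ⟨b + b', add_mem (Submodule.span_mono (by simp) hb) (Submodule.span_mono (by simp) hb'), ?_⟩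
      rwa [← sub_sub]
  obtain ⟨N, hN⟩ := hn
  obtain ⟨s, hs'⟩ := key N
  refine ⟨⟨s, ?_⟩⟩
  rw [eq_top_iff]
  intro a _
  obtain ⟨b, hb, hab⟩ := hs' a
  rw [hN, Ideal.zero_eq_bot, Ideal.mem_bot, sub_eq_zero] at hab
  rwa [hab]

theorem fs_charZero (k : Type*) [Field k] [CharZero k] : Algebra.FormallySmooth ℤ k := by
  haveI : Algebra.FormallySmooth ℤ ℚ := Algebra.FormallySmooth.of_isLocalization (nonZeroDivisors ℤ)
  haveI : Algebra.FormallySmooth ℚ k := by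
    obtain ⟨s, hs⟩ := exists_isTranscendenceBasis ℚ k
    haveI : Algebra.IsAlgebraic (IntermediateField.adjoin ℚ (Set.range ((↑) : s → k))) k := hs.isAlgebraic_field
    exact .of_algebraicIndependent_of_isSeparable hs.1
  exact Algebra.FormallySmooth.comp ℤ ℚ k

theorem Good.char0 (n : ℕ) (A : Type*) [CommRing A] [IsArtinianRing A] [IsLocalRing A]
    [CharZero (IsLocalRing.ResidueField A)] : Good n A := by
  let k := IsLocalRing.ResidueField A
  haveI : Algebra.FormallySmooth ℤ k := fs_charZero k
  have hn : IsNilpotent (IsLocalRing.maximalIdeal A) := by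
    rw [← IsLocalRing.jacobson_eq_maximalIdeal ⊥ bot_ne_top]
    exact IsArtinianRing.isNilpotent_jacobson_bot
  let g : k →+* A := (Algebra.FormallySmooth.lift (R := ℤ) (A := k) (IsLocalRing.maximalIdeal A) hn (AlgHom.id ℤ k)).toRingHom
  have hg : ∀ x : k, IsLocalRing.residue A (g x) = x := fun x =>
    Algebra.FormallySmooth.mk_lift (R := ℤ) (A := k) (IsLocalRing.maximalIdeal A) hn (AlgHom.id ℤ k) x
  letI : Algebra k A := g.toAlgebra
  have hs : ∀ a : A, ∃ v : k, a - algebraMap k A v ∈ IsLocalRing.maximalIdeal A := by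
    intro a
    refine ⟨IsLocalRing.residue A a, ?_⟩
    rw [← IsLocalRing.residue_eq_zero_iff, map_sub]
    change _ - IsLocalRing.residue A (g _) = 0
    rw [hg, sub_self]
  haveI : Module.Finite k A := finite_of_nilp (IsLocalRing.maximalIdeal A) (IsNoetherian.noetherian _) hn hs
  let b := Module.finBasis k A
  refine Good.of_retract (T := k) (B := fun _ => k) (fun j => b.coord j)
    (fun j => LinearMap.toSpanSingleton k A (b j)) (fun a => by simpa using b.sum_repr a) ?_ ?_
  · intro a
    obtain ⟨v, hv⟩ := hs a
    refine ⟨v, ?_⟩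
    obtain ⟨N, hN⟩ := hn
    refine ⟨N, ?_⟩
    have := Ideal.pow_mem_pow hv N
    rwa [hN] at this
  · intro _ m f i
    exact AP_char0 f i

theorem Good.of_local (n : ℕ) (A : Type*) [CommRing A] [IsArtinianRing A]
    (h : ∀ I : MaximalSpectrum A, Good n (Localization.AtPrime I.asIdeal)) : Good n A := by
  classical
  haveI : Fintype (MaximalSpectrum A) := Fintype.ofFinite _
  let e : A ≃ₐ[A] (∀ I : MaximalSpectrum A, Localization.AtPrime I.asIdeal) := MaximalSpectrum.toPiLocalizationEquiv A
  haveI : ∀ I : MaximalSpectrum A, IsNoetherianRing (Localization.AtPrime I.asIdeal) := fun I =>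
    IsLocalization.isNoetherianRing I.asIdeal.primeCompl _ inferInstance
  refine Good.of_retract (T := A) (B := fun I : MaximalSpectrum A => Localization.AtPrime I.asIdeal)
    (fun I => (LinearMap.proj I).comp e.toLinearMap)
    (fun I => e.symm.toLinearMap.comp (LinearMap.single A (fun I : MaximalSpectrum A => Localization.AtPrime I.asIdeal) I)) ?_ (fun a => ⟨a, by simp⟩) h
  intro a
  change ∑ I, e.symm (Pi.single I (e a I)) = a
  rw [← map_sum, Finset.univ_sum_single, AlgEquiv.symm_apply_apply]
end LCF
end

section
namespace LCF
open WittVector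

theorem witt_lift (p : ℕ) [hp : Fact p.Prime] {A Ω : Type*} [CommRing A] [Field Ω] [CharP Ω p] [PerfectRing Ω p]
    (θ : A →+* Ω) (hθ : Function.Surjective θ) (N : ℕ) (hN : RingHom.ker θ ^ (N+1) = ⊥) :
    ∃ g : WittVector p Ω →+* A, ∀ w, θ (g w) = w.coeff 0 := by
  have hle : RingHom.ker (WittVector.map (p := p) θ) ≤ RingHom.ker (WittVector.ghostComponent (p := p) (R := A) N) := by
    intro x hx
    rw [RingHom.mem_ker] at hx ⊢
    have hx' : ∀ i, x.coeff i ∈ RingHom.ker θ := by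
      intro i
      have := congrArg (fun y => WittVector.coeff y i) hx
      simpa [WittVector.map_coeff] using this
    have hpm : (p : A) ∈ RingHom.ker θ := by
      rw [RingHom.mem_ker, map_natCast, CharP.cast_eq_zero]
    rw [WittVector.ghostComponent_apply, aeval_wittPolynomial]
    refine Finset.sum_eq_zero fun i hi => ?_
    rw [← Ideal.mem_bot, ← hN]
    have h1 := Ideal.mul_mem_mul (Ideal.pow_mem_pow hpm i) (Ideal.pow_mem_pow (hx' i) (p ^ (N - i)))
    rw [← pow_add] at h1
    refine Ideal.pow_le_pow_right ?_ h1
    have := Nat.lt_pow_self (n := N - i) hp.out.one_lt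
    have := Finset.mem_range.1 hi
    omega
  let h : WittVector p Ω →+* A := RingHom.liftOfSurjective (WittVector.map θ)
    (WittVector.map_surjective _ hθ) ⟨WittVector.ghostComponent N, hle⟩
  have hh : ∀ x, h (WittVector.map θ x) = WittVector.ghostComponent N x := fun x =>
    RingHom.liftOfSurjective_comp_apply ..
  have hh2 : ∀ w, θ (h w) = (w.coeff 0) ^ (p ^ N) := by
    intro w
    obtain ⟨x, rfl⟩ := WittVector.map_surjective (p := p) _ hθ w
    rw [hh, WittVector.ghostComponent_apply, aeval_wittPolynomial, map_sum, Finset.sum_eq_single 0]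
    · simp [WittVector.map_coeff]
    · intro i _ hi
      simp [hi]
    · simp
  refine ⟨h.comp (WittVector.map (iterateFrobeniusEquiv Ω p N).symm.toRingHom), fun w => ?_⟩
  rw [RingHom.comp_apply, hh2, WittVector.map_coeff]
  have := (iterateFrobeniusEquiv Ω p N).apply_symm_apply (w.coeff 0)
  rwa [iterateFrobeniusEquiv_def] at this

theorem Good.witt (n p : ℕ) [hp : Fact p.Prime] {Ω : Type*} [Field Ω] [CharP Ω p] [PerfectRing Ω p] (k : ℕ) :
    Good n (WittVector p Ω ⧸ (Ideal.span {(p : WittVector p Ω) ^ k})) := by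
  let I : Ideal (WittVector p Ω) := Ideal.span {(p : WittVector p Ω) ^ k}
  let F := WittVector.frobeniusEquiv p Ω
  have hI : I = I.map (F : WittVector p Ω →+* WittVector p Ω) := by
    rw [Ideal.map_span, Set.image_singleton, map_pow, map_natCast]
  let σ : WittVector p Ω ⧸ I ≃+* WittVector p Ω ⧸ I := Ideal.quotientEquiv I I F hI
  intro m f i
  refine AP_frob_series p σ (N := k) ?_ ?_ f i
  · change (p : WittVector p Ω ⧸ I) ^ k = 0
    rw [← map_natCast (Ideal.Quotient.mk I), ← map_pow, Ideal.Quotient.eq_zero_iff_mem]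
    exact Ideal.mem_span_singleton_self _
  · intro b
    obtain ⟨b, rfl⟩ := Ideal.Quotient.mk_surjective b
    have : F b - b ^ p ∈ Ideal.span {(p : WittVector p Ω)} := by
      rw [WittVector.mem_span_p_iff_coeff_zero_eq_zero]
      change WittVector.constantCoeff (F b - b ^ p) = (0 : Ω)
      rw [map_sub, map_pow, sub_eq_zero]
      change WittVector.coeff (WittVector.frobenius b) 0 = WittVector.coeff b 0 ^ p
      rw [WittVector.coeff_frobenius_charP]
    obtain ⟨c, hc⟩ := Ideal.mem_span_singleton.1 this
    refine ⟨Ideal.Quotient.mk I c, ?_⟩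
    change Ideal.Quotient.mk I (F b) = _
    rw [sub_eq_iff_eq_add.1 hc, map_add, map_mul, map_pow, map_natCast, add_comm]

theorem Good.perfect (n p : ℕ) [hp : Fact p.Prime] {A Ω : Type*} [CommRing A] [IsNoetherianRing A] [Field Ω] [CharP Ω p] [PerfectRing Ω p]
    (θ : A →+* Ω) (hθ : Function.Surjective θ) (hN : IsNilpotent (RingHom.ker θ)) : Good n A := by
  classical
  obtain ⟨N, hN'⟩ := id hN
  have hN1 : RingHom.ker θ ^ (N+1) = ⊥ := by rw [pow_succ, hN']; simp
  obtain ⟨g, hg⟩ := witt_lift p θ hθ N hN1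
  letI : Algebra (WittVector p Ω) A := g.toAlgebra
  have hs : ∀ a : A, ∃ v : WittVector p Ω, a - algebraMap (WittVector p Ω) A v ∈ RingHom.ker θ := by
    intro a
    refine ⟨WittVector.teichmuller p (θ a), ?_⟩
    rw [RingHom.mem_ker, map_sub]
    change _ - θ (g _) = 0
    rw [hg, WittVector.teichmuller_coeff_zero, sub_self]
  haveI : Module.Finite (WittVector p Ω) A := finite_of_nilp (RingHom.ker θ) (IsNoetherian.noetherian _) hN hs
  have hpm : (p : A) ∈ RingHom.ker θ := by
      rw [RingHom.mem_ker, map_natCast, CharP.cast_eq_zero]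
  have hp0 : (p : A) ^ N = 0 := by
    have := Ideal.pow_mem_pow hpm N
    rwa [hN'] at this
  have htor : Module.IsTorsion' A (Submonoid.powers (p : WittVector p Ω)) := by
    intro x
    refine ⟨⟨(p : WittVector p Ω) ^ N, N, rfl⟩, ?_⟩
    change (p : WittVector p Ω) ^ N • x = 0
    rw [Algebra.smul_def, map_pow, map_natCast, hp0, zero_mul]
  obtain ⟨d, k, ⟨e⟩⟩ := Module.torsion_by_prime_power_decomposition (WittVector.irreducible p) htor
  refine Good.of_retract (T := WittVector p Ω)
    (B := fun j : Fin d => WittVector p Ω ⧸ (Ideal.span {(p : WittVector p Ω) ^ (k j)}))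
    (fun j => (DirectSum.component (WittVector p Ω) (Fin d) (fun j => WittVector p Ω ⧸ (Ideal.span {(p : WittVector p Ω) ^ (k j)})) j).comp e.toLinearMap)
    (fun j => e.symm.toLinearMap.comp (DirectSum.lof (WittVector p Ω) (Fin d) (fun j => WittVector p Ω ⧸ (Ideal.span {(p : WittVector p Ω) ^ (k j)})) j)) ?_ ?_ ?_
  · intro a
    change ∑ j, e.symm (DirectSum.lof _ _ _ j (e a j)) = a
    rw [← map_sum, LinearEquiv.symm_apply_eq]
    exact DirectSum.sum_univ_of _
  · intro a
    obtain ⟨v, hv⟩ := hs a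
    refine ⟨v, N, ?_⟩
    have := Ideal.pow_mem_pow hv N
    rwa [hN'] at this
  · intro j
    exact Good.witt n p (k j)
end LCF
end

section
namespace LCF

/-- nonnegative rationals with `p`-power denominators -/
def Ex (p : ℕ) : AddSubmonoid ℚ where
  carrier := {q | ∃ j n : ℕ, q * (p : ℚ) ^ j = n}
  zero_mem' := ⟨0, 0, by simp⟩
  add_mem' := by
    rintro a b ⟨j, n, h⟩ ⟨i, m, h'⟩
    refine ⟨j + i, n * p ^ i + m * p ^ j, ?_⟩
    push_cast
    rw [← h, ← h']; ring

theorem Ex.nonneg {p : ℕ} [hp : Fact p.Prime] (e : Ex p) : (0 : ℚ) ≤ e := by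
  obtain ⟨j, n, h⟩ := e.2
  have h0 : (0 : ℚ) < (p : ℚ) ^ j := by have := hp.out.pos; positivity
  by_contra hlt
  push Not at hlt
  have h2 := mul_neg_of_neg_of_pos hlt h0
  rw [h] at h2
  exact absurd (Nat.cast_nonneg (α := ℚ) n) (not_le.2 h2)

theorem Ex.nat_mem (p n : ℕ) : (n : ℚ) ∈ Ex p := ⟨0, n, by simp⟩

section
variable {p : ℕ} [hp : Fact p.Prime]

/-- lift of exponent to larger denominators -/
theorem Ex.lift (e : Ex p) {j n : ℕ} (h : (e : ℚ) * (p : ℚ) ^ j = n) (i : ℕ) :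
    (e : ℚ) * (p : ℚ) ^ (j + i) = (n * p ^ i : ℕ) := by
  push_cast
  rw [pow_add, ← mul_assoc, h]

theorem Ex.common (s : Finset (Ex p)) : ∃ j, ∀ e ∈ s, ∃ n : ℕ, (e : ℚ) * (p : ℚ) ^ j = n := by
  classical
  induction s using Finset.induction_on with
  | empty => exact ⟨0, by simp⟩
  | insert a s _ ih =>
    obtain ⟨j, hj⟩ := ih
    obtain ⟨i, n, hn⟩ := a.2
    refine ⟨i + j, fun e he => ?_⟩
    rcases Finset.mem_insert.1 he with rfl | he
    · exact ⟨_, Ex.lift _ hn j⟩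
    · obtain ⟨m, hm⟩ := hj e he
      rw [add_comm]
      exact ⟨_, Ex.lift _ hm i⟩

variable {Ω : Type*} [Field Ω] [CharP Ω p] [PerfectRing Ω p]

variable (p) in
noncomputable def rt (j : ℕ) : Ω ≃+* Ω := (iterateFrobeniusEquiv Ω p j).symm

theorem rt_pow (j : ℕ) (x : Ω) : rt p j x ^ p ^ j = x := by
  have := (iterateFrobeniusEquiv Ω p j).apply_symm_apply x
  rwa [iterateFrobeniusEquiv_def] at this

theorem pow_pj_inj (j : ℕ) {x y : Ω} (h : x ^ p ^ j = y ^ p ^ j) : x = y :=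
  (iterateFrobeniusEquiv Ω p j).injective h

theorem rt_add_pow (j i : ℕ) (x : Ω) : rt p (j + i) x ^ p ^ i = rt p j x := by
  apply pow_pj_inj (p := p) j
  rw [← pow_mul, ← pow_add, add_comm i j, rt_pow, rt_pow]

variable (p) in
noncomputable def pw (x : Ω) (e : Ex p) : Ω := rt p e.2.choose x ^ e.2.choose_spec.choose

theorem pw_eq (x : Ω) (e : Ex p) {j n : ℕ} (h : (e : ℚ) * (p : ℚ) ^ j = n) : pw p x e = rt p j x ^ n := by
  have h' := e.2.choose_spec.choose_spec
  unfold pw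
  set i := e.2.choose
  set m := e.2.choose_spec.choose
  have h1 := Ex.lift e h i
  have h2 := Ex.lift e h' j
  rw [add_comm i j, h1] at h2
  have h3 : n * p ^ i = m * p ^ j := by exact_mod_cast h2
  rw [← rt_add_pow j i, ← pow_mul, mul_comm (p ^ i), h3, mul_comm m, pow_mul, add_comm j i, rt_add_pow i j]

theorem pw_zero (x : Ω) : pw p x 0 = 1 := by
  rw [pw_eq x 0 (j := 0) (n := 0) (by simp), pow_zero]

theorem pw_add (x : Ω) (e f : Ex p) : pw p x (e + f) = pw p x e * pw p x f := by
  obtain ⟨j, hj⟩ := Ex.common ({e, f} : Finset (Ex p))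
  obtain ⟨n, hn⟩ := hj e (by simp)
  obtain ⟨m, hm⟩ := hj f (by simp)
  have : ((e + f : Ex p) : ℚ) * (p : ℚ) ^ j = (n + m : ℕ) := by
    push_cast
    rw [add_mul, hn, hm]
  rw [pw_eq x e hn, pw_eq x f hm, pw_eq x _ this, pow_add]

theorem pw_nat (x : Ω) (n : ℕ) : pw p x ⟨n, Ex.nat_mem p n⟩ = x ^ n := by
  rw [pw_eq x _ (j := 0) (n := n) (by simp)]
  have := rt_pow (p := p) 0 x
  rw [pow_zero, pow_one] at this
  rw [this]

theorem rt_pw (x : Ω) (e : Ex p) : ∃ f : Ex p, rt p 1 (pw p x e) = pw p x f := by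
  obtain ⟨j, n, h⟩ := e.2
  have hp0 : (p : ℚ) ≠ 0 := by exact_mod_cast hp.out.ne_zero
  have h2 : ((e : ℚ) / p) * (p : ℚ) ^ (j + 1) = n := by
    rw [← h, pow_succ]; field_simp
  refine ⟨⟨(e : ℚ) / p, j + 1, n, h2⟩, ?_⟩
  rw [pw_eq x ⟨(e : ℚ) / p, j + 1, n, h2⟩ h2, pw_eq x e h, map_pow]
  congr 1
  apply pow_pj_inj (p := p) 1
  rw [rt_pow, rt_add_pow j 1]

variable {k : Type*} [Field k] [Algebra k Ω]

variable (p Ω) in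
noncomputable def mono (γ : k →₀ Ex p) : Ω := γ.prod fun c e => pw p (algebraMap k Ω c) e

theorem mono_zero : mono p Ω (0 : k →₀ Ex p) = 1 := Finsupp.prod_zero_index

theorem mono_add (γ δ : k →₀ Ex p) : mono p Ω (γ + δ) = mono p Ω γ * mono p Ω δ := by
  classical
  exact Finsupp.prod_add_index' (fun _ => pw_zero _) (fun _ _ _ => pw_add _ _ _)

theorem mono_single (c : k) (e : Ex p) : mono p Ω (Finsupp.single c e) = pw p (algebraMap k Ω c) e :=
  Finsupp.prod_single_index (pw_zero _)

/-- reduced exponents supported in `B` -/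
def Red (p : ℕ) {k : Type*} (B : Set k) : Set (k →₀ Ex p) :=
  {γ | (∀ c ∉ B, γ c = 0) ∧ ∀ c, ((γ c : Ex p) : ℚ) < 1}

variable (p Ω) in
def gens (B : Set k) : Set Ω := {y | ∃ b ∈ B, ∃ e : Ex p, y = pw p (algebraMap k Ω b) e}

theorem pbmono_mem (B : Set k) (γ : k →₀ Ex p) (h : ∀ c ∉ B, γ c = 0) :
    mono p Ω γ ∈ IntermediateField.adjoin k (gens p Ω B) := by
  refine prod_mem fun c hc => ?_
  refine IntermediateField.subset_adjoin _ _ ⟨c, ?_, γ c, rfl⟩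
  by_contra h'
  exact (Finsupp.mem_support_iff.1 hc) (h c h')

theorem indep_pw (K : IntermediateField k Ω) (hpi : ∀ y : Ω, ∃ (j : ℕ) (c : k), y ^ p ^ j = algebraMap k Ω c)
    (x : Ω) (hxK : x ∈ K) (hx : rt p 1 x ∉ K) : LinearIndependent K (fun e : {e : Ex p // (e : ℚ) < 1} => pw p x e.1) := by
  classical
  haveI : CharP K p := ((algebraMap K Ω).charP_iff (algebraMap K Ω).injective p).2 inferInstance
  haveI : ExpChar K p := ExpChar.prime hp.out
  haveI : IsPurelyInseparable K Ω := by
    rw [isPurelyInseparable_iff_pow_mem K p]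
    intro y
    obtain ⟨j, c, h⟩ := hpi y
    exact ⟨j, algebraMap k K c, by rw [h]; rfl⟩
  rw [linearIndependent_iff']
  intro s g hg e he
  obtain ⟨j, hj⟩ := Ex.common (s.image Subtype.val)
  have hj' : ∀ e : {e : Ex p // (e : ℚ) < 1}, e ∈ s → ∃ n : ℕ, (e.1 : ℚ) * (p : ℚ) ^ j = n := fun e he =>
    hj e.1 (Finset.mem_image_of_mem _ he)
  choose! nn hnn using hj'
  have hp0 : (0 : ℚ) < (p : ℚ) ^ j := by have := hp.out.pos; positivity
  have hlt : ∀ e ∈ s, nn e < p ^ j := by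
    intro e he
    have : (nn e : ℚ) < (p ^ j : ℕ) := by
      rw [← hnn e he]
      push_cast
      nlinarith [e.2]
    exact_mod_cast this
  have hinj : ∀ e ∈ s, ∀ f ∈ s, nn e = nn f → e = f := by
    intro e he f hf h
    have h1 := hnn e he
    rw [h, ← hnn f hf] at h1
    exact Subtype.ext (Subtype.ext (mul_right_cancel₀ hp0.ne' h1))
  let F : Polynomial K := ∑ e ∈ s, Polynomial.monomial (nn e) (g e)
  have hF : Polynomial.aeval (rt p j x) F = 0 := by
    rw [← hg, map_sum]
    refine Finset.sum_congr rfl fun e he => ?_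
    rw [Polynomial.aeval_monomial, pw_eq x e.1 (hnn e he), Algebra.smul_def]
  have hF0 : F = 0 := by
    by_contra hF0
    obtain ⟨m, y, hmy⟩ := IsPurelyInseparable.minpoly_eq_X_pow_sub_C K p (rt p j x)
    have hdeg : (minpoly K (rt p j x)).natDegree ≤ F.natDegree :=
      Polynomial.natDegree_le_natDegree (minpoly.degree_le_of_ne_zero K _ hF0 hF)
    have hFd : F.natDegree < p ^ j := by
      refine (Polynomial.natDegree_sum_le _ _).trans_lt ?_
      refine (Finset.fold_max_lt _).2 ⟨by have := hp.out.pos; positivity, fun e he => ?_⟩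
      exact (Polynomial.natDegree_monomial_le _).trans_lt (hlt e he)
    rw [hmy, Polynomial.natDegree_X_pow_sub_C] at hdeg
    have hmj : m < j := (Nat.pow_lt_pow_iff_right hp.out.one_lt).1 (hdeg.trans_lt hFd)
    have hy : rt p j x ^ p ^ m = algebraMap K Ω y := by
      have := minpoly.aeval K (rt p j x)
      rw [hmy] at this
      simpa [sub_eq_zero] using this
    apply hx
    obtain ⟨d, rfl⟩ := Nat.exists_eq_add_of_lt hmj
    have : rt p 1 x = algebraMap K Ω y ^ p ^ d := by
      rw [← hy, ← pow_mul, ← pow_add, show m + d + 1 = 1 + (m + d) by ring, rt_add_pow]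
    rw [this]
    exact pow_mem y.2 _
  have : F.coeff (nn e) = g e := by
    rw [Polynomial.finset_sum_coeff, Finset.sum_eq_single e]
    · simp
    · intro f hf hne
      rw [Polynomial.coeff_monomial, if_neg]
      intro h
      exact hne (hinj f hf e he h)
    · exact fun h => absurd he h
  rw [← this, hF0, Polynomial.coeff_zero]

theorem indep_insert (hpi : ∀ y : Ω, ∃ (j : ℕ) (c : k), y ^ p ^ j = algebraMap k Ω c) (B : Set k)
    (hB : LinearIndepOn k (mono p Ω) (Red p B)) (c : k)
    (hc : rt p 1 (algebraMap k Ω c) ∉ IntermediateField.adjoin k (gens p Ω B)) :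
    LinearIndepOn k (mono p Ω) (Red p (insert c B)) := by
  classical
  let K := IntermediateField.adjoin k (gens p Ω B)
  have h1 : LinearIndependent k (fun γ : Red p B => (⟨mono p Ω γ.1, pbmono_mem B _ γ.2.1⟩ : K)) := by
    refine LinearIndependent.of_comp (K.val.toLinearMap) ?_
    exact hB
  have h2 := indep_pw K hpi (algebraMap k Ω c) (K.algebraMap_mem c) hc
  have h3 := linearIndependent_smul h1 h2
  have hmem : ∀ γ : Red p (insert c B), γ.1.erase c ∈ Red p B := by
    intro γ
    refine ⟨fun d hd => ?_, fun d => ?_⟩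
    · by_cases hdc : d = c
      · rw [hdc, Finsupp.erase_same]
      · rw [Finsupp.erase_ne hdc]
        exact γ.2.1 d (by simp [hd, hdc])
    · by_cases hdc : d = c
      · rw [hdc, Finsupp.erase_same]; simp
      · rw [Finsupp.erase_ne hdc]
        exact γ.2.2 d
  have h4 := h3.comp (fun γ : Red p (insert c B) => ((⟨γ.1.erase c, hmem γ⟩ : Red p B), (⟨γ.1 c, γ.2.2 c⟩ : {e : Ex p // (e : ℚ) < 1}))) ?_
  · have h5 : (fun γ : Red p (insert c B) => mono p Ω γ.1) = fun γ : Red p (insert c B) =>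
        mono p Ω (γ.1.erase c) * pw p (algebraMap k Ω c) (γ.1 c) := by
      funext γ
      rw [← mono_single, ← mono_add, Finsupp.erase_add_single]
    change LinearIndependent k (fun γ : Red p (insert c B) => mono p Ω γ.1)
    rw [h5]
    exact h4
  · intro γ δ h
    rw [Prod.mk.injEq, Subtype.mk.injEq, Subtype.mk.injEq] at h
    apply Subtype.ext
    rw [← Finsupp.single_add_erase c γ.1, ← Finsupp.single_add_erase c δ.1, h.1, h.2]

theorem exists_pbasis (hpi : ∀ y : Ω, ∃ (j : ℕ) (c : k), y ^ p ^ j = algebraMap k Ω c) :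
    ∃ B : Set k, LinearIndepOn k (mono p Ω) (Red p B) ∧ Algebra.adjoin k (gens p Ω B) = ⊤ := by
  classical
  obtain ⟨B, -, hB⟩ := zorn_subset_nonempty {B : Set k | LinearIndepOn k (mono p Ω) (Red p B)} (by
    intro C hC hch hne
    refine ⟨⋃₀ C, ?_, fun s hs => Set.subset_sUnion_of_mem hs⟩
    have h1 : LinearIndepOn k (mono p Ω) (⋃ B ∈ C, Red p B) := by
      refine linearIndepOn_biUnion_of_directed ?_ (fun B hB => hC hB)
      intro B hB B' hB'
      have hmono : ∀ {S T : Set k}, S ⊆ T → Red p S ⊆ Red p T := fun hST γ hγ =>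
        ⟨fun c hc => hγ.1 c (fun h => hc (hST h)), hγ.2⟩
      rcases hch.total hB hB' with h | h
      · exact ⟨B', hB', hmono h, subset_rfl⟩
      · exact ⟨B, hB, subset_rfl, hmono h⟩
    refine LinearIndepOn.mono h1 ?_
    intro γ hγ
    have hs : (γ.support : Set k) ⊆ ⋃₀ C := by
      intro c hc
      by_contra h
      exact (Finsupp.mem_support_iff.1 hc) (hγ.1 c h)
    obtain ⟨B, hB, hsB⟩ := hch.directedOn.exists_mem_subset_of_finite_of_subset_sUnion hne γ.support.finite_toSet hs
    refine Set.mem_biUnion hB ⟨fun c hc => ?_, hγ.2⟩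
    by_contra h
    exact hc (hsB (Finsupp.mem_support_iff.2 h))) ∅ (by
    have h0 : Red p (∅ : Set k) ⊆ {0} := by
      intro γ hγ
      exact Finsupp.ext fun c => hγ.1 c (by simp)
    have h1 : LinearIndepOn k (mono p Ω) ({0} : Set (k →₀ Ex p)) := by
      rw [linearIndepOn_singleton_iff, mono_zero]
      exact one_ne_zero
    exact LinearIndepOn.mono h1 h0)
  refine ⟨B, hB.1, ?_⟩
  have halg : ∀ x ∈ gens p Ω B, IsAlgebraic k x := by
    intro x _
    obtain ⟨j, c, h⟩ := hpi x
    refine IsAlgebraic.of_pow (n := p ^ j) (by have := hp.out.pos; positivity) ?_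
    rw [h]
    exact isAlgebraic_algebraMap c
  have hadj := IntermediateField.adjoin_toSubalgebra_of_isAlgebraic halg
  have hmemiff : ∀ y, y ∈ IntermediateField.adjoin k (gens p Ω B) ↔ y ∈ Algebra.adjoin k (gens p Ω B) := by
    intro y
    rw [← hadj]; rfl
  have hroot : ∀ c : k, rt p 1 (algebraMap k Ω c) ∈ Algebra.adjoin k (gens p Ω B) := by
    intro c
    rw [← hmemiff]
    by_contra hc
    have hi := indep_insert hpi B hB.1 c hc
    have hcB : c ∈ B := hB.2 hi (Set.subset_insert _ _) (Set.mem_insert _ _)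
    apply hc
    refine IntermediateField.subset_adjoin _ _ ⟨c, hcB, ?_⟩
    obtain ⟨f, hf⟩ := rt_pw (algebraMap k Ω c) (⟨(1 : ℕ), Ex.nat_mem p 1⟩ : Ex p)
    rw [pw_nat, pow_one] at hf
    exact ⟨f, hf⟩
  have hrt : ∀ y ∈ Algebra.adjoin k (gens p Ω B), rt p 1 y ∈ Algebra.adjoin k (gens p Ω B) := by
    intro y hy
    induction hy using Algebra.adjoin_induction with
    | mem x hx =>
      obtain ⟨b, hb, e, rfl⟩ := hx
      obtain ⟨f, hf⟩ := rt_pw (algebraMap k Ω b) e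
      exact Algebra.subset_adjoin ⟨b, hb, f, hf⟩
    | algebraMap c => exact hroot c
    | add x y _ _ hx hy => rw [map_add]; exact add_mem hx hy
    | mul x y _ _ hx hy => rw [map_mul]; exact mul_mem hx hy
  have hall : ∀ (j : ℕ) (y : Ω), y ^ p ^ j ∈ Algebra.adjoin k (gens p Ω B) → y ∈ Algebra.adjoin k (gens p Ω B) := by
    intro j
    induction j with
    | zero => intro y hy; simpa using hy
    | succ j ih =>
      intro y hy
      apply ih
      have := hrt _ hy
      have h2 : rt p 1 (y ^ p ^ (j+1)) = y ^ p ^ j := by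
        apply pow_pj_inj (p := p) 1
        rw [rt_pow, ← pow_mul, ← pow_add]
      rwa [h2] at this
  rw [eq_top_iff]
  intro y _
  obtain ⟨j, c, h⟩ := hpi y
  apply hall j
  rw [h]
  exact Subalgebra.algebraMap_mem _ c
end
end LCF
end

section
namespace LCF
section
variable {p : ℕ} [hp : Fact p.Prime]

def Ex.one (p : ℕ) : Ex p := ⟨(1 : ℕ), Ex.nat_mem p 1⟩

theorem Ex.one_val : ((Ex.one p : Ex p) : ℚ) = 1 := Nat.cast_one

theorem Ex.pred (e : Ex p) (h : (1 : ℚ) ≤ e) : ∃ f : Ex p, e = f + Ex.one p := by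
  obtain ⟨j, n, hn⟩ := e.2
  have h0 : (0 : ℚ) < (p : ℚ) ^ j := by have := hp.out.pos; positivity
  have hle : p ^ j ≤ n := by
    have : ((p ^ j : ℕ) : ℚ) ≤ n := by
      push_cast
      rw [← hn]; nlinarith
    exact_mod_cast this
  refine ⟨⟨(e : ℚ) - 1, j, n - p ^ j, ?_⟩, ?_⟩
  · push_cast [hle]
    rw [sub_mul, hn, one_mul]
  · apply Subtype.ext
    push_cast
    rw [Ex.one_val]; ring

variable {k : Type*}

/-- integer parts of the exponents -/
noncomputable def flo (γ : k →₀ Ex p) : k →₀ ℕ := γ.mapRange (fun e : Ex p => ⌊(e : ℚ)⌋₊) (by simp)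

theorem flo_add (γ : k →₀ Ex p) (b : k) :
    flo (γ + Finsupp.single b (Ex.one p)) = flo γ + Finsupp.single b 1 := by
  classical
  ext c
  simp only [flo, Finsupp.mapRange_apply, Finsupp.add_apply, Finsupp.single_apply]
  split_ifs with h
  · push_cast
    rw [Ex.one_val, Nat.floor_add_one (Ex.nonneg _)]
  · simp

def IsInt (γ : k →₀ Ex p) : Prop := ∀ c, ∃ m : ℕ, ((γ c : Ex p) : ℚ) = m

theorem isInt_add (γ : k →₀ Ex p) (b : k) : IsInt (γ + Finsupp.single b (Ex.one p)) ↔ IsInt γ := by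
  classical
  refine forall_congr' fun c => ?_
  simp only [Finsupp.add_apply, Finsupp.single_apply]
  split_ifs with h
  · push_cast
    rw [Ex.one_val]
    constructor
    · rintro ⟨m, hm⟩
      have h1 : (1 : ℚ) ≤ m := by rw [← hm]; linarith [Ex.nonneg (γ c)]
      have h2 : 1 ≤ m := by exact_mod_cast h1
      exact ⟨m - 1, by push_cast [h2]; linarith⟩
    · rintro ⟨m, hm⟩
      exact ⟨m + 1, by push_cast; rw [hm]⟩
  · simp

def SB (p : ℕ) (B : Set k) : AddSubmonoid (k →₀ Ex p) where
  carrier := {γ | ∀ c ∉ B, γ c = 0}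
  zero_mem' := fun _ _ => rfl
  add_mem' := fun {a b} ha hb c hc => by rw [Finsupp.add_apply, ha c hc, hb c hc, add_zero]

theorem single_mem_SB {B : Set k} {b : k} (hb : b ∈ B) (e : Ex p) : Finsupp.single b e ∈ SB p B := by
  classical
  intro c hc
  rw [Finsupp.single_apply, if_neg]
  rintro rfl
  exact hc hb

variable {A : Type*} [CommRing A] (s : k → A) (B : Set k)

noncomputable def uu (γ : k →₀ Ex p) : A :=
  open Classical in if IsInt γ then (flo γ).prod (fun c m => s c ^ m) else 0

theorem uu_add (γ : k →₀ Ex p) (b : k) : uu s (γ + Finsupp.single b (Ex.one p)) = s b * uu s γ := by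
  classical
  unfold uu
  rw [isInt_add]
  split_ifs with h
  · have h1 : (flo γ + Finsupp.single b 1).prod (fun c m => s c ^ m)
        = (flo γ).prod (fun c m => s c ^ m) * (Finsupp.single b 1).prod (fun c m => s c ^ m) :=
      Finsupp.prod_add_index' (fun _ => pow_zero _) (fun _ _ _ => pow_add _ _ _)
    have h2 : (Finsupp.single b 1).prod (fun c m => s c ^ m) = s b ^ 1 :=
      Finsupp.prod_single_index (pow_zero _)
    rw [flo_add, h1, h2, pow_one, mul_comm]
  · rw [mul_zero]

theorem uu_zero : uu s (0 : k →₀ Ex p) = 1 := by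
  classical
  unfold uu
  rw [if_pos]
  · simp [flo]
  · intro c; exact ⟨0, by simp⟩

variable (p) in
noncomputable def pbJJ : Ideal (AddMonoidAlgebra A (SB p B)) :=
  Ideal.span {x | ∃ (b : k) (hb : b ∈ B), x = AddMonoidAlgebra.single ⟨Finsupp.single b (Ex.one p), single_mem_SB hb _⟩ 1
    - algebraMap A _ (s b)}

noncomputable def pbLL : AddMonoidAlgebra A (SB p B) →ₗ[A] A :=
  (Finsupp.linearCombination A (fun γ : SB p B => uu s γ.1)).comp
    (AddMonoidAlgebra.coeffLinearEquiv A).toLinearMap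

theorem pbLL_single (γ : SB p B) (a : A) : pbLL s B (AddMonoidAlgebra.single γ a) = a * uu s γ.1 := by
  change Finsupp.linearCombination A (fun γ : SB p B => uu s γ.1) (Finsupp.single γ a) = _
  rw [Finsupp.linearCombination_single, smul_eq_mul]

theorem single_mul_gen (γ : SB p B) (a : A) (b : k) (hb : b ∈ B) :
    AddMonoidAlgebra.single γ a * (AddMonoidAlgebra.single ⟨Finsupp.single b (Ex.one p), single_mem_SB hb _⟩ 1
    - algebraMap A (AddMonoidAlgebra A (SB p B)) (s b)) =
      AddMonoidAlgebra.single (γ + ⟨Finsupp.single b (Ex.one p), single_mem_SB hb _⟩) a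
        - AddMonoidAlgebra.single γ (a * s b) := by
  rw [mul_sub, AddMonoidAlgebra.single_mul_single, mul_one]
  congr 1
  change _ * AddMonoidAlgebra.single 0 (s b) = _
  rw [AddMonoidAlgebra.single_mul_single, add_zero]

theorem pbLL_JJ : ∀ x ∈ pbJJ p s B, pbLL s B x = 0 := by
  have key : ∀ x ∈ pbJJ p s B, ∀ r, pbLL s B (r * x) = 0 := by
    intro x hx
    induction hx using Submodule.span_induction with
    | zero => intro r; rw [mul_zero]; exact map_zero _
    | add x y _ _ hx hy => intro r; rw [mul_add, map_add, hx, hy, add_zero]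
    | mem x hx =>
      obtain ⟨b, hb, rfl⟩ := hx
      intro r
      induction r using AddMonoidAlgebra.induction_linear with
      | zero => rw [zero_mul]; exact map_zero _
      | add x y hx hy => rw [add_mul, map_add, hx, hy, add_zero]
      | single γ a =>
        rw [single_mul_gen s B γ a b hb, map_sub, pbLL_single, pbLL_single]
        change a * uu s (γ.1 + Finsupp.single b (Ex.one p)) - _ = 0
        rw [uu_add]; ring
    | smul t x _ hx => intro r; rw [smul_eq_mul, ← mul_assoc]; exact hx _
  intro x hx
  simpa using key x hx 1

variable (p) in
abbrev AQ := AddMonoidAlgebra A (SB p B) ⧸ pbJJ p s B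

noncomputable def rho : AQ p s B →ₗ[A] A :=
  Submodule.liftQ ((pbJJ p s B).restrictScalars A) (pbLL s B) (fun x hx => pbLL_JJ s B x hx)

theorem rho_one : rho s B (1 : AQ p s B) = 1 := by
  change pbLL s B (AddMonoidAlgebra.single 0 1) = 1
  rw [pbLL_single]
  change 1 * uu s (0 : k →₀ Ex p) = 1
  rw [uu_zero, mul_one]

variable (p) in
noncomputable def pbXX (γ : SB p B) : AQ p s B := Ideal.Quotient.mk _ (AddMonoidAlgebra.single γ 1)

theorem pbXX_add (γ : SB p B) (b : k) (hb : b ∈ B) :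
    pbXX p s B (γ + ⟨Finsupp.single b (Ex.one p), single_mem_SB hb _⟩) = s b • pbXX p s B γ := by
  change _ = Ideal.Quotient.mk _ (s b • AddMonoidAlgebra.single γ 1)
  unfold pbXX
  rw [AddMonoidAlgebra.smul_single, smul_eq_mul, mul_one, Ideal.Quotient.eq]
  have h1 := single_mul_gen s B γ 1 b hb
  rw [one_mul] at h1
  rw [← h1]
  exact Ideal.mul_mem_left _ _ (Ideal.subset_span ⟨b, hb, rfl⟩)

theorem pbXX_span (γ : SB p B) : pbXX p s B γ ∈ Submodule.span A (Set.range fun δ : {δ : SB p B // δ.1 ∈ Red p B} => pbXX p s B δ.1) := by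
  classical
  induction hN : (flo γ.1).degree generalizing γ with
  | zero =>
    refine Submodule.subset_span ⟨⟨γ, γ.2, fun c => ?_⟩, rfl⟩
    have h1 : flo γ.1 = 0 := (Finsupp.degree_eq_zero_iff _).1 hN
    have h2 := DFunLike.congr_fun h1 c
    simpa [flo, Nat.floor_eq_zero] using h2
  | succ N ih =>
    have h0 : flo γ.1 ≠ 0 := by intro h; rw [h] at hN; simp at hN
    obtain ⟨b, hb⟩ := Finsupp.ne_iff.1 h0
    have hb1 : (1 : ℚ) ≤ (γ.1 b : Ex p) := by
      by_contra hlt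
      apply hb
      simpa [flo, Nat.floor_eq_zero] using hlt
    have hbB : b ∈ B := by
      by_contra h
      rw [γ.2 b h] at hb1
      norm_num at hb1
    obtain ⟨f, hf⟩ := Ex.pred _ hb1
    let δ : SB p B := ⟨γ.1.erase b + Finsupp.single b f, (SB p B).add_mem (fun c hc => by
      by_cases h : c = b
      · rw [h, Finsupp.erase_same]
      · rw [Finsupp.erase_ne h]; exact γ.2 c hc) (single_mem_SB hbB f)⟩
    have hδ : γ = δ + ⟨Finsupp.single b (Ex.one p), single_mem_SB hbB _⟩ := by
      apply Subtype.ext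
      change γ.1 = γ.1.erase b + Finsupp.single b f + Finsupp.single b (Ex.one p)
      rw [add_assoc, ← Finsupp.single_add, ← hf, Finsupp.erase_add_single]
    rw [hδ, pbXX_add s B δ b hbB]
    refine Submodule.smul_mem _ _ (ih δ ?_)
    have h1 : flo γ.1 = flo δ.1 + Finsupp.single b 1 := by
      rw [← flo_add]; exact congrArg (fun x : SB p B => flo x.1) hδ
    rw [h1, map_add, Finsupp.degree_single] at hN
    omega

theorem pbXX_top : Submodule.span A (Set.range fun δ : {δ : SB p B // δ.1 ∈ Red p B} => pbXX p s B δ.1) = ⊤ := by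
  rw [eq_top_iff]
  rintro x -
  obtain ⟨x, rfl⟩ := Ideal.Quotient.mk_surjective x
  induction x using AddMonoidAlgebra.induction_linear with
  | zero => rw [map_zero]; exact zero_mem _
  | add x y hx hy => rw [map_add]; exact add_mem hx hy
  | single γ a =>
    have : Ideal.Quotient.mk (pbJJ p s B) (AddMonoidAlgebra.single γ a) = a • pbXX p s B γ := by
      change _ = Ideal.Quotient.mk _ (a • AddMonoidAlgebra.single γ 1)
      rw [AddMonoidAlgebra.smul_single, smul_eq_mul, mul_one]
    rw [this]
    exact Submodule.smul_mem _ _ (pbXX_span s B γ)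

end
end LCF
end

section
namespace LCF
theorem ker_of_span {A Q k Ω J : Type*} [CommRing A] [CommRing Q] [Algebra A Q] [Field k] [Field Ω] [Algebra k Ω] [Algebra A k]
    (θ : Q →+* Ω) (X : J → Q) (w : J → Ω) (hX : Submodule.span A (Set.range X) = ⊤) (hw : LinearIndependent k w)
    (hXw : ∀ i, θ (X i) = w i) (hθ : ∀ a, θ (algebraMap A Q a) = algebraMap k Ω (algebraMap A k a)) :
    RingHom.ker θ = (RingHom.ker (algebraMap A k)).map (algebraMap A Q) := by
  apply le_antisymm
  · intro x hx
    rw [RingHom.mem_ker] at hx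
    have hx' : x ∈ Submodule.span A (Set.range X) := by
      rw [hX]; trivial
    obtain ⟨c, rfl⟩ := Finsupp.mem_span_range_iff_exists_finsupp.1 hx'
    have hsm : ∀ (a : A) (i : J), θ (a • X i) = algebraMap A k a • w i := by
      intro a i
      rw [Algebra.smul_def, map_mul, hθ, hXw, Algebra.smul_def]
    rw [Finsupp.sum, map_sum] at hx
    rw [linearIndependent_iff'] at hw
    have h3 := hw c.support (fun i => algebraMap A k (c i)) (by
      rw [← hx]
      exact Finset.sum_congr rfl fun i _ => (hsm _ _).symm)
    refine sum_mem fun i hi => ?_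
    change c i • X i ∈ _
    rw [Algebra.smul_def]
    exact Ideal.mul_mem_right _ _ (Ideal.mem_map_of_mem _ (h3 i hi))
  · rw [Ideal.map_le_iff_le_comap]
    intro a ha
    rw [Ideal.mem_comap, RingHom.mem_ker, hθ, (RingHom.mem_ker).1 ha, map_zero]

section
variable {p : ℕ} [hp : Fact p.Prime] {k : Type*} {A : Type*} [CommRing A] (s : k → A) (B : Set k)
variable {Ω : Type*} [Field Ω] [CharP Ω p] [PerfectRing Ω p] [Field k] [Algebra k Ω] [Algebra A k] [Algebra A Ω]
  [IsScalarTower A k Ω]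

variable (p Ω) in
noncomputable def monoHom : Multiplicative (SB p B) →* Ω where
  toFun γ := mono p Ω γ.toAdd.1
  map_one' := mono_zero
  map_mul' x y := mono_add _ _

variable (p Ω) in
noncomputable def theta0 : AddMonoidAlgebra A (SB p B) →ₐ[A] Ω := AddMonoidAlgebra.lift A Ω _ (monoHom p B Ω)

theorem theta0_single (γ : SB p B) (a : A) :
    theta0 p B Ω (AddMonoidAlgebra.single γ a) = a • mono p Ω γ.1 :=
  AddMonoidAlgebra.lift_single _ _ _

variable (p Ω) in
noncomputable def theta (hs : ∀ c, algebraMap A k (s c) = c) : AQ p s B →+* Ω :=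
  Ideal.Quotient.lift (pbJJ p s B) (theta0 (A := A) p B Ω).toRingHom (by
    intro x hx
    have : pbJJ p s B ≤ RingHom.ker (theta0 (A := A) p B Ω).toRingHom := by
      refine Ideal.span_le.2 ?_
      rintro x ⟨b, hb, rfl⟩
      rw [SetLike.mem_coe, RingHom.mem_ker]
      change theta0 p B Ω (_ - _) = 0
      rw [map_sub, AlgHom.commutes, theta0_single, one_smul]
      change mono p Ω (Finsupp.single b (Ex.one p)) - _ = 0
      rw [mono_single, IsScalarTower.algebraMap_apply A k Ω, hs, sub_eq_zero]
      exact (pw_nat _ 1).trans (pow_one _)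
    exact this hx)

theorem theta_mk (hs : ∀ c, algebraMap A k (s c) = c) (x) :
    theta p s B Ω hs (Ideal.Quotient.mk _ x) = theta0 p B Ω x := rfl

variable (p) in
noncomputable abbrev aqm : A →+* AQ p s B := (Ideal.Quotient.mk (pbJJ p s B)).comp (algebraMap A (AddMonoidAlgebra A (SB p B)))

theorem aqm_smul (a : A) (x : AQ p s B) : a • x = aqm p s B a * x := Algebra.smul_def a x

theorem theta_algebraMap (hs : ∀ c, algebraMap A k (s c) = c) (a : A) :
    theta p s B Ω hs (aqm p s B a) = algebraMap A Ω a := (theta0 p B Ω).commutes a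

theorem theta_surj (hs : ∀ c, algebraMap A k (s c) = c) (hB : Algebra.adjoin k (gens p Ω B) = ⊤) :
    Function.Surjective (theta p s B Ω hs) := by
  intro y
  have hy : y ∈ Algebra.adjoin k (gens p Ω B) := by rw [hB]; trivial
  induction hy using Algebra.adjoin_induction with
  | mem x hx =>
    obtain ⟨b, hb, e, rfl⟩ := hx
    refine ⟨Ideal.Quotient.mk _ (AddMonoidAlgebra.single ⟨Finsupp.single b e, single_mem_SB hb e⟩ 1), ?_⟩
    rw [theta_mk, theta0_single, one_smul, mono_single]
  | algebraMap c =>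
    refine ⟨aqm p s B (s c), ?_⟩
    rw [theta_algebraMap, IsScalarTower.algebraMap_apply A k Ω, hs]
  | add x y _ _ hx hy =>
    obtain ⟨a, rfl⟩ := hx
    obtain ⟨b, rfl⟩ := hy
    exact ⟨a + b, map_add _ _ _⟩
  | mul x y _ _ hx hy =>
    obtain ⟨a, rfl⟩ := hx
    obtain ⟨b, rfl⟩ := hy
    exact ⟨a * b, map_mul _ _ _⟩

theorem theta_ker (hs : ∀ c, algebraMap A k (s c) = c) (hB : LinearIndepOn k (mono p Ω) (Red p B)) :
    RingHom.ker (theta p s B Ω hs) = (RingHom.ker (algebraMap A k)).map (Algebra.ofId A (AQ p s B) : A →+* AQ p s B) := by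
  have h2 : LinearIndependent k (fun δ : {δ : SB p B // δ.1 ∈ Red p B} => mono p Ω δ.1.1) :=
    LinearIndependent.comp hB (fun δ : {δ : SB p B // δ.1 ∈ Red p B} => (⟨δ.1.1, δ.2⟩ : Red p B))
      (fun a b h => Subtype.ext (Subtype.ext (congrArg (fun x : Red p B => x.1) h)))
  refine ker_of_span (Q := AQ p s B) (theta p s B Ω hs) (fun δ : {δ : SB p B // δ.1 ∈ Red p B} => pbXX p s B δ.1) _ (pbXX_top s B) h2 ?_ ?_
  · intro i
    unfold pbXX
    rw [theta_mk, theta0_single, one_smul]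
  · intro a
    rw [← IsScalarTower.algebraMap_apply A k Ω]
    exact theta_algebraMap s B hs a
end

theorem noeth_of_nilp_max {A Ω : Type*} [CommRing A] [Field Ω] (θ : A →+* Ω) (hθ : Function.Surjective θ)
    (hN : IsNilpotent (RingHom.ker θ)) (hfg : (RingHom.ker θ).FG) : IsNoetherianRing A := by
  refine IsNoetherianRing.of_prime fun P hP => ?_
  haveI : (RingHom.ker θ).IsMaximal := RingHom.ker_isMaximal_of_surjective θ hθ
  obtain ⟨N, hN⟩ := hN
  have hle : RingHom.ker θ ≤ P := by
    refine hP.le_of_pow_le (n := N) ?_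
    rw [hN]; exact bot_le
  rwa [← Ideal.IsMaximal.eq_of_le inferInstance hP.ne_top hle]

theorem Good.of_theta (n p : ℕ) [hp : Fact p.Prime] {A : Type*} {Q : Type*} {Ω : Type*} [CommRing A] [IsArtinianRing A] [CommRing Q]
    [Algebra A Q] [Field Ω] [CharP Ω p] [PerfectRing Ω p] (θ : Q →+* Ω) (hsur : Function.Surjective θ) (m : Ideal A)
    (hn : IsNilpotent m) (hm : m.FG) (hker : RingHom.ker θ = m.map (algebraMap A Q)) (r : Q →ₗ[A] A) (hr : r 1 = 1) :
    Good n A := by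
  have hn' : IsNilpotent (RingHom.ker θ) := by
    obtain ⟨N, hN⟩ := hn
    refine ⟨N, ?_⟩
    rw [hker, ← Ideal.map_pow, hN]
    exact Ideal.map_bot
  have hfg : (RingHom.ker θ).FG := by
    rw [hker]
    exact Ideal.FG.map hm _
  haveI : IsNoetherianRing Q := noeth_of_nilp_max _ hsur hn' hfg
  have hgood : Good n Q := Good.perfect n p _ hsur hn'
  refine Good.of_retract (T := A) (J := Unit) (B := fun _ => Q)
    (fun _ => Algebra.linearMap A Q) (fun _ => r) ?_ (fun a => ⟨a, by simp⟩) (fun _ => hgood)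
  intro a
  rw [Fintype.sum_unique, Algebra.linearMap_apply, Algebra.algebraMap_eq_smul_one, map_smul, hr, smul_eq_mul, mul_one]

theorem Good.charp (n p : ℕ) [hp : Fact p.Prime] (A : Type*) [CommRing A] [IsArtinianRing A] [IsLocalRing A]
    [CharP (IsLocalRing.ResidueField A) p] : Good n A := by
  let k := IsLocalRing.ResidueField A
  let Ω := PerfectClosure k p
  letI : Algebra k Ω := (PerfectClosure.of k p).toAlgebra
  letI : Algebra A Ω := ((algebraMap k Ω).comp (algebraMap A k)).toAlgebra
  haveI : IsScalarTower A k Ω := IsScalarTower.of_algebraMap_eq fun _ => rfl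
  have hpi : ∀ y : Ω, ∃ (j : ℕ) (c : k), y ^ p ^ j = algebraMap k Ω c := by
    intro y
    obtain ⟨⟨j, c⟩, rfl⟩ := PerfectClosure.mk_surjective k p y
    refine ⟨j, c, ?_⟩
    rw [← iterate_frobenius, PerfectClosure.iterate_frobenius_mk]
    rfl
  obtain ⟨B, hB1, hB2⟩ := exists_pbasis (p := p) (Ω := Ω) hpi
  have hsurj : Function.Surjective (algebraMap A k) := IsLocalRing.residue_surjective
  choose s hs using hsurj
  have hker := theta_ker s B hs hB1
  have hsur := theta_surj s B hs hB2
  have hm : RingHom.ker (algebraMap A k) = IsLocalRing.maximalIdeal A := IsLocalRing.ker_residue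
  have hn : IsNilpotent (IsLocalRing.maximalIdeal A) := by
    rw [← IsLocalRing.jacobson_eq_maximalIdeal ⊥ bot_ne_top]
    exact IsArtinianRing.isNilpotent_jacobson_bot
  exact Good.of_theta (Q := AQ p s B) n p (theta p s B Ω hs) hsur _ hn (IsNoetherian.noetherian _) (by rw [hker, hm]; rfl) (rho s B) (rho_one s B)

theorem Good.localArtinian (n : ℕ) (A : Type*) [CommRing A] [IsArtinianRing A] [IsLocalRing A] : Good n A := by
  obtain ⟨p, hp⟩ := CharP.exists (IsLocalRing.ResidueField A)
  rcases CharP.char_is_prime_or_zero (IsLocalRing.ResidueField A) p with h | rfl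
  · haveI : Fact p.Prime := ⟨h⟩
    exact Good.charp n p A
  · haveI : CharZero (IsLocalRing.ResidueField A) := CharP.charP_to_charZero _
    exact Good.char0 n A

theorem Good.artinian (n : ℕ) (A : Type*) [CommRing A] [IsArtinianRing A] : Good n A := by
  refine Good.of_local n A fun I => ?_
  haveI : IsArtinianRing (Localization.AtPrime I.asIdeal) :=
    inferInstance
  exact Good.localArtinian n _
end LCF
end

/-!
STATEMENT 1: Let `A` be a commutative Noetherian ring of Krull dimension zero and let
`R = A[[x_1,...,x_n]]` be a formal power series ring over `A`.  Then for every ideal `I`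
of `R` and every `i ≥ 0`, the set of associated primes `Ass_R H^i_I(R)` is finite.
-/

universe u

open CategoryTheory

theorem associatedPrimes_localCohomology_finite_of_dim_zero_powerSeries
    (A : Type u) [CommRing A] [IsNoetherianRing A] (hA : ringKrullDim A = 0)
    (n : ℕ) (I : Ideal (MvPowerSeries (Fin n) A)) (i : ℕ) :
    (associatedPrimes (MvPowerSeries (Fin n) A)
      ((localCohomology I i).obj (ModuleCat.of _ (MvPowerSeries (Fin n) A)))).Finite := by
  haveI : IsArtinianRing A := by
    rw [isArtinianRing_iff_krullDimLE_zero, Ring.KrullDimLE, Order.krullDimLE_iff, ← ringKrullDim, hA]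
    exact le_refl _
  haveI : IsNoetherianRing (MvPowerSeries (Fin n) A) := inferInstance
  obtain ⟨m, f, hf⟩ := Submodule.fg_iff_exists_fin_generating_family.1 (IsNoetherian.noetherian I)
  have hf' : I = Ideal.span (Set.range f) := hf.symm
  subst hf'
  rw [LCF.associatedPrimes_eq_AP]
  exact (LCF.Good.artinian n A m f i).subset (LCF.AP_lc f i _)
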